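/- (Nesterenko) Let E_2, E_4, E_6 be the classical Eisenstein series of weights 2, 4, 6 for SL_2(ℤ), normalized so that lim_{Im(z)→∞} E_{2i}(z) = 1. Let z be a complex number with Im(z) > 0. Then at least three of the four complex numbers e^{2πiz}, E_2(z), E_4(z), E_6(z) are algebraically independent over ℚ; equivalently, the transcendence degree over ℚ of ℚ(e^{2πiz}, E_2(z), E_4(z), E_6(z)) is at least 3. -/

import Mathlib

open Complex

/-- The normalised Eisenstein series of weight `2`:
`E₂(z) = 1 − 24 ∑_{n≥1} σ₁(n) qⁿ`, `q = e^{2πiz}`. -/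
noncomputable def eisE2 (z : ℂ) : ℂ :=
  1 - 24 * ∑' n : ℕ,
    (∑ d ∈ Nat.divisors (n + 1), (d : ℂ) ^ 1) * Complex.exp (2 * Real.pi * I * z) ^ (n + 1)

/-- The normalised Eisenstein series of weight `4`:
`E₄(z) = 1 + 240 ∑_{n≥1} σ₃(n) qⁿ`, `q = e^{2πiz}`. -/
noncomputable def eisE4 (z : ℂ) : ℂ :=
  1 + 240 * ∑' n : ℕ,
    (∑ d ∈ Nat.divisors (n + 1), (d : ℂ) ^ 3) * Complex.exp (2 * Real.pi * I * z) ^ (n + 1)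

/-- The normalised Eisenstein series of weight `6`:
`E₆(z) = 1 − 504 ∑_{n≥1} σ₅(n) qⁿ`, `q = e^{2πiz}`. -/
noncomputable def eisE6 (z : ℂ) : ℂ :=
  1 - 504 * ∑' n : ℕ,
    (∑ d ∈ Nat.divisors (n + 1), (d : ℂ) ^ 5) * Complex.exp (2 * Real.pi * I * z) ^ (n + 1)

open Complex
namespace Nes

/-! ### Sup norms of polynomials on polydiscs, Gelfond inequality -/

theorem mahler_le_of_bound (p : Polynomial ℂ) (K : ℝ) (hK : 0 < K)
    (h : ∀ z : ℂ, ‖z‖ = 1 → ‖p.eval z‖ ≤ K) : p.mahlerMeasure ≤ K := by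
  by_cases hp : p = 0
  · simp [hp, hK.le]
  have hC : (Polynomial.C ((K:ℂ)⁻¹)) ≠ 0 := by simp [hK.ne']
  have h2 : (Polynomial.C ((K:ℂ)⁻¹) * p).logMahlerMeasure ≤ 0 := by
    rw [Polynomial.logMahlerMeasure_def]
    apply Real.circleAverage_mono_on_of_le_circle
    · exact Polynomial.intervalIntegrable_mahlerMeasure _
    · intro x hx
      have hx' : ‖x‖ = 1 := by simpa using hx
      apply Real.log_nonpos (norm_nonneg _)
      have := h x hx'
      simp only [Polynomial.eval_mul, Polynomial.eval_C, norm_mul, norm_inv, Complex.norm_real,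
        Real.norm_eq_abs, abs_of_pos hK]
      rw [inv_mul_le_iff₀ hK]; linarith
  rw [Polynomial.logMahlerMeasure_eq_log_MahlerMeasure, Polynomial.mahlerMeasure_mul,
    Polynomial.mahlerMeasure_const] at h2
  have hpos : 0 < p.mahlerMeasure := Polynomial.mahlerMeasure_pos_of_ne_zero hp
  have h3 : 0 < ‖(K:ℂ)⁻¹‖ * p.mahlerMeasure := by
    apply mul_pos _ hpos; simp [hK.ne']
  have h4 := (Real.log_nonpos_iff h3.le).mp h2
  simp only [norm_inv, Complex.norm_real, Real.norm_eq_abs, abs_of_pos hK] at h4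
  rw [inv_mul_le_iff₀ hK] at h4; linarith

theorem exists_mahler_le (p : Polynomial ℂ) : ∃ z : ℂ, ‖z‖ = 1 ∧ p.mahlerMeasure ≤ ‖p.eval z‖ := by
  by_contra! h
  have hc : IsCompact (Metric.sphere (0:ℂ) 1) := isCompact_sphere 0 1
  obtain ⟨z0, hz0, hmax⟩ := hc.exists_isMaxOn ⟨1, by simp⟩
    (f := fun z => ‖p.eval z‖) (by fun_prop)
  have h0 : ‖z0‖ = 1 := by simpa using hz0
  have h1 := h z0 h0
  have := mahler_le_of_bound p ((‖p.eval z0‖ + p.mahlerMeasure) / 2)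
    (by linarith [norm_nonneg (p.eval z0)]) (by
      intro z hz
      have h3 : ‖p.eval z‖ ≤ ‖p.eval z0‖ := hmax (by simpa using hz)
      linarith)
  linarith

theorem norm_eval_le_mahler (p : Polynomial ℂ) (z : ℂ) (hz : ‖z‖ ≤ 1) :
    ‖p.eval z‖ ≤ 2 ^ p.natDegree * p.mahlerMeasure := by
  rw [Polynomial.mahlerMeasure_eq_leadingCoeff_mul_prod_roots]
  have hs : p.Splits := IsAlgClosed.splits p
  rw [hs.eval_eq_prod_roots]
  rw [norm_mul]
  have h1 : ‖(p.roots.map (fun a => z - a)).prod‖ ≤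
      2 ^ p.natDegree * (p.roots.map (fun a ↦ max 1 ‖a‖)).prod := by
    have hcard : p.natDegree = Multiset.card p.roots := hs.natDegree_eq_card_roots
    rw [hcard]
    generalize p.roots = s
    induction s using Multiset.induction_on with
    | empty => simp
    | cons a s ih =>
      simp only [Multiset.map_cons, Multiset.prod_cons, Multiset.card_cons, norm_mul]
      have : ‖z - a‖ ≤ 2 * max 1 ‖a‖ := by
        have := norm_sub_le z a
        have h1 := le_max_left 1 ‖a‖
        have h2 := le_max_right 1 ‖a‖
        linarith
      calc _ ≤ (2 * max 1 ‖a‖) * _ := mul_le_mul this ih (norm_nonneg _) (by positivity)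
        _ = _ := by ring
  calc _ ≤ ‖p.leadingCoeff‖ * _ := mul_le_mul_of_nonneg_left h1 (norm_nonneg _)
    _ = _ := by ring

theorem prod_mahler {J : Type*} (s : Finset J) (p : J → Polynomial ℂ) :
    (∏ j ∈ s, p j).mahlerMeasure = ∏ j ∈ s, (p j).mahlerMeasure := by
  classical
  induction s using Finset.induction_on with
  | empty => simp
  | insert a s ha ih => rw [Finset.prod_insert ha, Finset.prod_insert ha, Polynomial.mahlerMeasure_mul, ih]

theorem gelfond_one {J : Type*} (s : Finset J) (p : J → Polynomial ℂ) (d : J → ℕ)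
    (hd : ∀ j ∈ s, (p j).natDegree ≤ d j) (R : ℝ) (hR : 0 < R) (x : J → ℂ)
    (hx : ∀ j ∈ s, ‖x j‖ ≤ R) :
    ∃ z : ℂ, ‖z‖ ≤ R ∧ ∏ j ∈ s, ‖(p j).eval (x j)‖ ≤ 2 ^ (∑ j ∈ s, d j) * ∏ j ∈ s, ‖(p j).eval z‖ := by
  have hRc : (R:ℂ) ≠ 0 := by exact_mod_cast hR.ne'
  set q : J → Polynomial ℂ := fun j => (p j).comp (Polynomial.C (R:ℂ) * Polynomial.X) with hq
  have hqd : ∀ j ∈ s, (q j).natDegree ≤ d j := by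
    intro j hj
    refine le_trans (Polynomial.natDegree_comp_le) ?_
    have : (Polynomial.C (R:ℂ) * Polynomial.X).natDegree ≤ 1 :=
      (Polynomial.natDegree_C_mul_le _ _).trans (by simp)
    calc _ ≤ (p j).natDegree * 1 := Nat.mul_le_mul_left _ this
      _ ≤ _ := by simpa using hd j hj
  obtain ⟨z, hz, hM⟩ := exists_mahler_le (∏ j ∈ s, q j)
  refine ⟨R * z, by simp [hz, abs_of_pos hR], ?_⟩
  rw [prod_mahler, Polynomial.eval_prod, norm_prod] at hM
  have hev : ∀ j w, (q j).eval w = (p j).eval (R * w) := by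
    intro j w; simp [hq]
  simp only [hev] at hM
  calc ∏ j ∈ s, ‖(p j).eval (x j)‖ ≤ ∏ j ∈ s, (2 ^ (d j) * (q j).mahlerMeasure) := by
        apply Finset.prod_le_prod (fun _ _ => norm_nonneg _)
        intro j hj
        have h1 : (p j).eval (x j) = (q j).eval ((R:ℂ)⁻¹ * x j) := by
          rw [hev, mul_inv_cancel_left₀ hRc]
        rw [h1]
        refine (norm_eval_le_mahler _ _ ?_).trans ?_
        · simp only [norm_mul, norm_inv, Complex.norm_real, Real.norm_eq_abs, abs_of_pos hR]
          rw [inv_mul_le_iff₀ hR]; linarith [hx j hj]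
        · apply mul_le_mul_of_nonneg_right _ (Polynomial.mahlerMeasure_nonneg _)
          exact pow_le_pow_right₀ (by norm_num) (hqd j hj)
    _ = 2 ^ (∑ j ∈ s, d j) * ∏ j ∈ s, (q j).mahlerMeasure := by
        rw [Finset.prod_mul_distrib, Finset.prod_pow_eq_pow_sum]
    _ ≤ _ := mul_le_mul_of_nonneg_left hM (by positivity)

/-- restriction of a polynomial to a line parallel to a coordinate axis -/
noncomputable def lineRes {n : Type*} [DecidableEq n] (f : MvPolynomial n ℂ) (p : n → ℂ) (k : n) :
    Polynomial ℂ :=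
  MvPolynomial.aeval (fun i => if i = k then Polynomial.X else Polynomial.C (p i)) f

theorem lineRes_eval {n : Type*} [DecidableEq n] (f : MvPolynomial n ℂ) (p : n → ℂ) (k : n) (t : ℂ) :
    (lineRes f p k).eval t = MvPolynomial.eval (Function.update p k t) f := by
  unfold lineRes
  have h := MvPolynomial.comp_aeval (R := ℂ)
    (fun i => if i = k then Polynomial.X else Polynomial.C (p i)) (Polynomial.aeval (R := ℂ) t)
  have h2 := congrArg (fun g => g f) h
  simp only [AlgHom.comp_apply] at h2
  rw [Polynomial.coe_aeval_eq_eval] at h2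
  rw [h2, MvPolynomial.aeval_eq_eval]
  congr 2
  funext i
  by_cases hi : i = k
  · subst hi; simp
  · simp [hi]

theorem lineRes_natDegree {n : Type*} [DecidableEq n] (f : MvPolynomial n ℂ) (p : n → ℂ) (k : n) (d : ℕ)
    (hd : f.totalDegree ≤ d) : (lineRes f p k).natDegree ≤ d := by
  have := MvPolynomial.aeval_natDegree_le (F := f) (m := d) (n := 1) hd
    (fun i => if i = k then Polynomial.X else Polynomial.C (p i)) (by
      intro i; split_ifs <;> simp)
  simpa [lineRes] using this

/-- Gelfond inequality on polydiscs. -/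
theorem gelfond {n : Type*} [Fintype n] {J : Type*} (s : Finset J) (f : J → MvPolynomial n ℂ)
    (d : J → ℕ) (hd : ∀ j ∈ s, (f j).totalDegree ≤ d j) (R : ℝ) (hR : 0 < R) (p : J → n → ℂ)
    (hp : ∀ j ∈ s, ∀ k, ‖p j k‖ ≤ R) :
    ∃ z : n → ℂ, (∀ k, ‖z k‖ ≤ R) ∧ ∏ j ∈ s, ‖MvPolynomial.eval (p j) (f j)‖ ≤
      2 ^ (Fintype.card n * ∑ j ∈ s, d j) * ∏ j ∈ s, ‖MvPolynomial.eval z (f j)‖ := by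
  classical
  have key : ∀ t : Finset n, ∃ z : n → ℂ, (∀ k, ‖z k‖ ≤ R) ∧ ∏ j ∈ s, ‖MvPolynomial.eval (p j) (f j)‖ ≤
      2 ^ (t.card * ∑ j ∈ s, d j) * ∏ j ∈ s, ‖MvPolynomial.eval (t.piecewise z (p j)) (f j)‖ := by
    intro t
    induction t using Finset.induction_on with
    | empty => exact ⟨0, by simp [hR.le], by simp⟩
    | insert a t ha ih =>
      obtain ⟨z, hz, h⟩ := ih
      obtain ⟨w, hw, h1⟩ := gelfond_one s (fun j => lineRes (f j) (t.piecewise z (p j)) a) d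
        (fun j hj => lineRes_natDegree _ _ _ _ (hd j hj)) R hR (fun j => p j a) (fun j hj => hp j hj a)
      refine ⟨Function.update z a w, ?_, ?_⟩
      · intro k
        by_cases hk : k = a
        · subst hk; simpa using hw
        · simpa [hk] using hz k
      · simp only [lineRes_eval] at h1
        have e1 : ∀ j, Function.update (t.piecewise z (p j)) a (p j a) = t.piecewise z (p j) := by
          intro j
          funext i
          by_cases hi : i = a
          · subst hi; simp [ha]
          · simp [hi]
        have e2 : ∀ j, Function.update (t.piecewise z (p j)) a w =
            (insert a t).piecewise (Function.update z a w) (p j) := by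
          intro j
          funext i
          by_cases hi : i = a
          · subst hi; simp
          · by_cases hit : i ∈ t <;> simp [hi, hit, Finset.piecewise]
        simp only [e1, e2] at h1
        refine h.trans ?_
        rw [Finset.card_insert_of_notMem ha, add_mul, one_mul, pow_add, mul_assoc]
        exact mul_le_mul_of_nonneg_left h1 (by positivity)
  obtain ⟨z, hz, h⟩ := key Finset.univ
  exact ⟨z, hz, by simpa using h⟩

end Nes

open Complex
namespace Nes

/-- the closed polydisc -/
def pdisc (n : Type*) (R : ℝ) : Set (n → ℂ) := {z | ∀ k, ‖z k‖ ≤ R}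

theorem pdisc_compact (n : Type*) [Fintype n] (R : ℝ) : IsCompact (pdisc n R) := by
  have : pdisc n R = Set.pi Set.univ (fun _ : n => Metric.closedBall (0:ℂ) R) := by
    ext z; simp [pdisc]
  rw [this]
  exact isCompact_univ_pi (fun _ => isCompact_closedBall _ _)

/-- sup norm on the polydisc -/
noncomputable def pn {n : Type*} (R : ℝ) (F : MvPolynomial n ℂ) : ℝ :=
  sSup ((fun z => ‖MvPolynomial.eval z F‖) '' pdisc n R)

theorem continuous_eval_mv {n : Type*} (F : MvPolynomial n ℂ) :
    Continuous (fun z : n → ℂ => MvPolynomial.eval z F) := MvPolynomial.continuous_eval F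

theorem le_pn {n : Type*} [Fintype n] {R : ℝ} (F : MvPolynomial n ℂ) {z : n → ℂ}
    (hz : ∀ k, ‖z k‖ ≤ R) : ‖MvPolynomial.eval z F‖ ≤ pn R F := by
  apply le_csSup
  · exact ((pdisc_compact n R).image (continuous_eval_mv F).norm).bddAbove
  · exact ⟨z, hz, rfl⟩

theorem pn_le {n : Type*} {R : ℝ} (hR : 0 ≤ R) (F : MvPolynomial n ℂ) {K : ℝ}
    (h : ∀ z : n → ℂ, (∀ k, ‖z k‖ ≤ R) → ‖MvPolynomial.eval z F‖ ≤ K) : pn R F ≤ K := by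
  apply csSup_le
  · exact ⟨_, 0, by simp [pdisc, hR], rfl⟩
  · rintro _ ⟨z, hz, rfl⟩
    exact h z hz

theorem exists_pn {n : Type*} [Fintype n] {R : ℝ} (hR : 0 ≤ R) (F : MvPolynomial n ℂ) :
    ∃ z : n → ℂ, (∀ k, ‖z k‖ ≤ R) ∧ ‖MvPolynomial.eval z F‖ = pn R F := by
  obtain ⟨z, hz, h⟩ := (pdisc_compact n R).exists_sSup_image_eq (f := fun z => ‖MvPolynomial.eval z F‖)
    ⟨0, by simp [pdisc, hR]⟩ (continuous_eval_mv F).norm.continuousOn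
  exact ⟨z, hz, h.symm⟩

theorem pn_nonneg {n : Type*} [Fintype n] {R : ℝ} (hR : 0 ≤ R) (F : MvPolynomial n ℂ) : 0 ≤ pn R F := by
  obtain ⟨z, _, h⟩ := exists_pn hR F
  rw [← h]; exact norm_nonneg _

theorem pn_mono {n : Type*} [Fintype n] {R R' : ℝ} (hR : 0 ≤ R) (h : R ≤ R') (F : MvPolynomial n ℂ) :
    pn R F ≤ pn R' F :=
  pn_le hR F (fun _ hz => le_pn F (fun k => (hz k).trans h))

theorem prod_pn_le {n : Type*} [Fintype n] {J : Type*} (s : Finset J) (f : J → MvPolynomial n ℂ)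
    (d : J → ℕ) (hd : ∀ j ∈ s, (f j).totalDegree ≤ d j) (R : ℝ) (hR : 0 < R) :
    ∏ j ∈ s, pn R (f j) ≤ 2 ^ (Fintype.card n * ∑ j ∈ s, d j) * pn R (∏ j ∈ s, f j) := by
  choose p hp hp' using fun j => exists_pn hR.le (f j)
  obtain ⟨z, hz, h⟩ := gelfond s f d hd R hR p (fun j _ => hp j)
  simp only [hp'] at h
  refine h.trans (mul_le_mul_of_nonneg_left ?_ (by positivity))
  rw [← norm_prod, ← map_prod]
  exact le_pn _ hz

theorem optionEquivLeft_eval {α : Type*} (F : MvPolynomial (Option α) ℤ) (z : α → ℂ) (t : ℂ) :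
    (((MvPolynomial.optionEquivLeft ℤ α) F).map (MvPolynomial.aeval z : MvPolynomial α ℤ →ₐ[ℤ] ℂ).toRingHom).eval t
      = MvPolynomial.aeval (fun o : Option α => o.elim t z) F := by
  induction F using MvPolynomial.induction_on with
  | C a => simp
  | add p q hp hq => simp [Polynomial.map_add, Polynomial.eval_add] at hp hq ⊢; rw [hp, hq]
  | mul_X p i hp =>
    rw [map_mul, Polynomial.map_mul, Polynomial.eval_mul, map_mul, hp]
    congr 1
    cases i <;> simp

theorem exists_one_le_norm {n : Type*} [Fintype n] (F : MvPolynomial n ℤ) (hF : F ≠ 0) :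
    ∃ z : n → ℂ, (∀ k, ‖z k‖ ≤ 1) ∧ 1 ≤ ‖MvPolynomial.aeval z F‖ := by
  revert F
  refine Fintype.induction_empty_option (P := fun n _ => ∀ (F : MvPolynomial n ℤ) (hF : F ≠ 0),
    ∃ z : n → ℂ, (∀ k, ‖z k‖ ≤ 1) ∧ 1 ≤ ‖MvPolynomial.aeval z F‖) ?_ ?_ ?_ n
  · intro α β _ e ih F hF
    obtain ⟨z, hz, h⟩ := ih (MvPolynomial.rename e.symm F)
      (fun h => hF (MvPolynomial.rename_injective _ e.symm.injective (by simpa using h)))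
    refine ⟨z ∘ e.symm, fun k => hz _, ?_⟩
    rwa [MvPolynomial.aeval_rename] at h
  · intro F hF
    refine ⟨fun i => i.elim, fun k => k.elim, ?_⟩
    obtain ⟨c, rfl⟩ := MvPolynomial.C_surjective (R := ℤ) PEmpty F
    have hc : c ≠ 0 := by rintro rfl; simp at hF
    rw [MvPolynomial.aeval_C, algebraMap_int_eq, eq_intCast, Complex.norm_intCast]
    exact_mod_cast Int.one_le_abs hc
  · intro α _ ih F hF
    set P := (MvPolynomial.optionEquivLeft ℤ α) F with hP
    have hP0 : P ≠ 0 := by simpa [hP] using hF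
    obtain ⟨z, hz, h⟩ := ih P.leadingCoeff (by simpa using hP0)
    set Q := P.map (MvPolynomial.aeval z : MvPolynomial α ℤ →ₐ[ℤ] ℂ).toRingHom with hQ
    have hl : Q.leadingCoeff = MvPolynomial.aeval z P.leadingCoeff := by
      rw [hQ, Polynomial.leadingCoeff_map_of_leadingCoeff_ne_zero]
      · rfl
      · intro h0
        have h0' : (MvPolynomial.aeval z) P.leadingCoeff = (0:ℂ) := h0
        rw [h0'] at h; simp at h; linarith
    obtain ⟨t, ht, h2⟩ := exists_mahler_le Q
    refine ⟨fun o => o.elim t z, ?_, ?_⟩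
    · rintro (_ | k)
      · simp [ht]
      · simpa using hz k
    · rw [← optionEquivLeft_eval]
      calc 1 ≤ ‖Q.leadingCoeff‖ := by rw [hl]; exact h
        _ ≤ _ := Polynomial.leadingCoeff_le_mahlerMeasure Q
        _ ≤ _ := h2

/-- the complexification of an integer polynomial -/
noncomputable abbrev cx {n : Type*} (F : MvPolynomial n ℤ) : MvPolynomial n ℂ :=
  MvPolynomial.map (Int.castRingHom ℂ) F

theorem eval_cx {n : Type*} (F : MvPolynomial n ℤ) (z : n → ℂ) :
    MvPolynomial.eval z (cx F) = MvPolynomial.aeval z F := by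
  rw [MvPolynomial.eval_map, MvPolynomial.aeval_def]; rfl

theorem totalDegree_cx_le {n : Type*} (F : MvPolynomial n ℤ) : (cx F).totalDegree ≤ F.totalDegree :=
  Finset.sup_mono (MvPolynomial.support_map_subset _ _)

theorem coeff_aeval_scale {n : Type*} (F : MvPolynomial n ℤ) (z : n → ℂ) (D : ℕ) :
    (MvPolynomial.aeval (fun i => Polynomial.C (z i) * Polynomial.X) F : Polynomial ℂ).coeff D =
      MvPolynomial.aeval z (MvPolynomial.homogeneousComponent D F) := by
  induction F using MvPolynomial.induction_on' with
  | add p q hp hq => simp [hp, hq]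
  | monomial s c =>
    rw [MvPolynomial.aeval_monomial]
    have h1 : (s.prod fun i k => (Polynomial.C (z i) * Polynomial.X : Polynomial ℂ) ^ k) =
        Polynomial.C (s.prod fun i k => z i ^ k) * Polynomial.X ^ s.degree := by
      simp only [mul_pow, Finsupp.prod_mul, map_finsuppProd, map_pow]
      congr 1
      simp [Finsupp.prod, Finset.prod_pow_eq_pow_sum, Finsupp.degree_apply]
    rw [h1]
    by_cases hD : s.degree = D
    · have h2 : MvPolynomial.homogeneousComponent D (MvPolynomial.monomial s c) = MvPolynomial.monomial s c := by
        apply (MvPolynomial.homogeneousComponent_of_mem _).trans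
        · rw [if_pos rfl]
        · exact (MvPolynomial.mem_homogeneousSubmodule _ _).mpr (MvPolynomial.isHomogeneous_monomial _ hD)
      rw [h2, MvPolynomial.aeval_monomial, ← hD]
      simp
    · have h2 : MvPolynomial.homogeneousComponent D (MvPolynomial.monomial s c) = 0 := by
        apply (MvPolynomial.homogeneousComponent_of_mem (n := s.degree) _).trans
        · rw [if_neg (Ne.symm hD)]
        · exact (MvPolynomial.mem_homogeneousSubmodule _ _).mpr (MvPolynomial.isHomogeneous_monomial _ rfl)
      rw [h2]
      simp [Polynomial.coeff_X_pow, Ne.symm hD]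

theorem pow_le_pn {n : Type*} [Fintype n] (F : MvPolynomial n ℤ) (hF : F ≠ 0) (R : ℝ) (hR : 0 < R) :
    R ^ F.totalDegree ≤ pn R (cx F) := by
  obtain ⟨D, hD⟩ : ∃ D, D = F.totalDegree := ⟨_, rfl⟩
  rw [← hD]
  have hh : MvPolynomial.homogeneousComponent D F ≠ 0 := by
    intro h0
    have := MvPolynomial.coeff_homogeneousComponent (R := ℤ) D F
    obtain ⟨s, hs, hsD⟩ : ∃ s ∈ F.support, s.degree = D := by
      obtain ⟨s, hs, h⟩ := Finset.exists_mem_eq_sup F.support (by simpa using hF) (fun s => s.degree)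
      refine ⟨s, hs, ?_⟩
      rw [← h, hD]
      rfl
    have h1 := MvPolynomial.coeff_homogeneousComponent D F s
    rw [if_pos hsD, h0, MvPolynomial.coeff_zero] at h1
    exact MvPolynomial.mem_support_iff.mp hs h1.symm
  obtain ⟨z, hz, h⟩ := exists_one_le_norm _ hh
  set P : Polynomial ℂ := MvPolynomial.aeval (fun i => Polynomial.C (z i) * Polynomial.X) F with hP
  have hdeg : P.natDegree ≤ D := by
    have hx : ∀ i, (Polynomial.C (z i) * Polynomial.X : Polynomial ℂ).natDegree ≤ 1 := fun i => by
      refine (Polynomial.natDegree_C_mul_le _ _).trans ?_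
      simp
    have := MvPolynomial.aeval_natDegree_le (cx F) (m := D) ((totalDegree_cx_le F).trans hD.ge)
      (fun i => Polynomial.C (z i) * Polynomial.X) hx
    rw [mul_one] at this
    have e : MvPolynomial.aeval (fun i => Polynomial.C (z i) * Polynomial.X) (cx F) = P :=
      MvPolynomial.aeval_map_algebraMap (A := ℂ) (B := Polynomial ℂ)
        (fun i => Polynomial.C (z i) * Polynomial.X) F
    rw [← e]
    exact this
  have hco : P.coeff D = MvPolynomial.aeval z (MvPolynomial.homogeneousComponent D F) := by
    exact coeff_aeval_scale F z D
  have h : 1 ≤ ‖P.coeff D‖ := hco ▸ h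
  have hnd : P.natDegree = D := by
    apply le_antisymm hdeg
    apply Polynomial.le_natDegree_of_ne_zero
    intro h0
    rw [h0] at h; simp at h; linarith
  have hl : P.leadingCoeff = P.coeff D := by
    rw [Polynomial.leadingCoeff, hnd]
  have hRc : (R:ℂ) ≠ 0 := by exact_mod_cast hR.ne'
  obtain ⟨t, ht, h2⟩ := exists_mahler_le (P.comp (Polynomial.C (R:ℂ) * Polynomial.X))
  have h3 := (Polynomial.leadingCoeff_le_mahlerMeasure _).trans h2
  rw [Polynomial.leadingCoeff_comp (by rw [Polynomial.natDegree_C_mul_X _ hRc]; norm_num), hl, hnd] at h3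
  have h4 : P.eval (R * t) = MvPolynomial.eval (fun i => z i * (R * t)) (cx F) := by
    rw [eval_cx, hP, ← Polynomial.coe_aeval_eq_eval]
    have h := MvPolynomial.comp_aeval (R := ℤ)
      (fun i => Polynomial.C (z i) * Polynomial.X) ((Polynomial.aeval (R := ℂ) (R * t)).restrictScalars ℤ)
    have h2 := congrArg (fun g => g F) h
    simp only [AlgHom.comp_apply] at h2
    rw [AlgHom.restrictScalars_apply] at h2
    rw [h2]
    simp
  have h5 : R ^ D ≤ ‖P.eval (R * t)‖ := by
    simp only [Polynomial.leadingCoeff_C_mul_X, norm_mul, norm_pow, Complex.norm_real, Real.norm_eq_abs, abs_of_pos hR,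
      Polynomial.eval_comp, Polynomial.eval_mul, Polynomial.eval_C, Polynomial.eval_X] at h3
    have : (0:ℝ) < R ^ D := by positivity
    nlinarith
  refine h5.trans ?_
  rw [h4]
  apply le_pn
  intro k
  simp only [norm_mul, ht, Complex.norm_real, Real.norm_eq_abs, abs_of_pos hR, mul_one]
  nlinarith [hz k]

end Nes

open Complex
namespace Nes

/-! ### Valuation rings -/

theorem exists_valuation_center {R K : Type*} [CommRing R] [IsDomain R] [Field K] (f : R →+* K)
    (hf : Function.Injective f) (P : Ideal R) [hP : P.IsPrime] :
    ∃ V : ValuationSubring K, (∀ r, f r ∈ V) ∧ ∀ r, V.valuation (f r) < 1 ↔ r ∈ P := by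
  have hu : ∀ s : P.primeCompl, IsUnit (f s) := by
    intro s
    apply IsUnit.mk0
    intro h
    apply s.2
    rw [(map_eq_zero_iff f hf).mp h]
    exact P.zero_mem
  let g : Localization.AtPrime P →+* K := IsLocalization.lift (M := P.primeCompl) hu
  obtain ⟨V, hV, hloc⟩ := IsLocalRing.exists_factor_valuationRing g
  have hg : ∀ r, g (algebraMap R _ r) = f r := fun r => IsLocalization.lift_eq hu r
  refine ⟨V, fun r => ?_, fun r => ?_⟩
  · rw [← hg]; exact hV _
  · have h1 : V.valuation (f r) < 1 ↔ ¬ IsUnit (g.codRestrict V.toSubring hV (algebraMap R _ r)) := by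
      have h2 := V.valuation_lt_one_iff (g.codRestrict V.toSubring hV (algebraMap R _ r))
      have h3 : ((g.codRestrict V.toSubring hV (algebraMap R _ r) : V) : K) = f r := hg r
      rw [h3] at h2
      rw [← h2, IsLocalRing.mem_maximalIdeal, mem_nonunits_iff]
    rw [h1, isUnit_map_iff, IsLocalization.AtPrime.isUnit_to_map_iff _ P]
    simp [Ideal.primeCompl]

theorem isIntegralElem_of_valuation {R K : Type*} [CommRing R] [Field K] (f : R →+* K) (x : K)
    (h : ∀ V : ValuationSubring K, (∀ r, f r ∈ V) → x ∈ V) : f.IsIntegralElem x := by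
  have h1 : x ∈ (⨅ V : {V : ValuationSubring K // (f.range : Set K) ⊆ V.toSubring}, V.1.toSubring) := by
    rw [Subring.mem_iInf]
    rintro ⟨V, hV⟩
    exact h V (fun r => hV ⟨r, rfl⟩)
  rw [iInf_valuationSubring_superset] at h1
  have h2 : IsIntegral (Subring.closure (f.range : Set K)) x := h1
  have e : Subring.closure (f.range : Set K) = f.range := Subring.closure_eq _
  rw [e] at h2
  have h3 : IsIntegral f.range x := h2
  obtain ⟨p, hp, hpx⟩ := h3
  have hs : Function.Surjective (f.rangeRestrict) := f.rangeRestrict_surjective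
  obtain ⟨p', hp', -, hm⟩ := Polynomial.lifts_and_natDegree_eq_and_monic
    ((Polynomial.mem_lifts p).mpr (Polynomial.map_surjective _ hs p)) hp
  refine ⟨p', hm, ?_⟩
  rw [← hp', Polynomial.eval₂_map] at hpx
  exact hpx

theorem valuation_int_le {K : Type*} [Field K] (V : ValuationSubring K) (n : ℤ) :
    V.valuation (n : K) ≤ 1 := (V.valuation_le_one_iff _).mpr (intCast_mem V n)

/-- Gauss lemma for products of linear forms. -/
theorem gauss_aux {K : Type*} [Field K] (V : ValuationSubring K) {μ : Type*} [Fintype μ]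
    {J : Type*} [Fintype J] (w : J → μ → K) (a : K)
    (h : ∀ s, MvPolynomial.coeff s (MvPolynomial.C a * ∏ j, (MvPolynomial.X none +
      ∑ k, MvPolynomial.C (w j k) * MvPolynomial.X (some k)) : MvPolynomial (Option μ) K) ∈ V) :
    ∃ c : J → K, (∀ j, 1 ≤ V.valuation (c j)) ∧ (∀ j k, V.valuation (w j k) ≤ V.valuation (c j)) ∧
      V.valuation (a * ∏ j, c j) ≤ 1 := by
  classical
  let v : J → Option μ → K := fun j o => o.elim 1 (w j)
  have hmax : ∀ j, ∃ o, ∀ o', V.valuation (v j o') ≤ V.valuation (v j o) := fun j =>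
    Finite.exists_max (fun o => V.valuation (v j o))
  choose o ho using hmax
  let c : J → K := fun j => v j (o j)
  have hc1 : ∀ j, 1 ≤ V.valuation (c j) := by
    intro j
    have := ho j none
    simpa [v] using this
  have hc0 : ∀ j, c j ≠ 0 := by
    intro j h0
    have := hc1 j
    rw [h0, map_zero] at this
    exact absurd this (by simp)
  have hd : ∀ j p, v j p / c j ∈ V := by
    intro j p
    rw [← V.valuation_le_one_iff, map_div₀]
    exact div_le_one_of_le₀ (ho j p) zero_le
  let l : J → MvPolynomial (Option μ) V := fun j => ∑ p, MvPolynomial.C ⟨v j p / c j, hd j p⟩ * MvPolynomial.X p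
  have hl : ∀ j, MvPolynomial.map (IsLocalRing.residue V) (l j) ≠ 0 := by
    intro j h0
    have := congrArg (MvPolynomial.eval (Pi.single (o j) 1)) h0
    simp only [l, map_sum, map_mul, MvPolynomial.map_C, MvPolynomial.map_X, MvPolynomial.eval_C,
      MvPolynomial.eval_X, Pi.single_apply, map_zero, mul_ite, mul_one, mul_zero,
      Finset.sum_ite_eq', Finset.mem_univ, if_true] at this
    have e : (⟨v j (o j) / c j, hd j (o j)⟩ : V) = 1 := Subtype.ext (div_self (hc0 j))
    rw [e] at this
    simp at this
  have hprod : MvPolynomial.map (IsLocalRing.residue V) (∏ j, l j) ≠ 0 := by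
    rw [map_prod]
    exact Finset.prod_ne_zero_iff.mpr (fun j _ => hl j)
  obtain ⟨s, hs⟩ := MvPolynomial.ne_zero_iff.mp hprod
  rw [MvPolynomial.coeff_map] at hs
  have hunit : V.valuation ((MvPolynomial.coeff s (∏ j, l j) : V) : K) = 1 := by
    apply (V.valuation_eq_one_iff _).mp
    by_contra hn
    exact hs ((IsLocalRing.residue_eq_zero_iff _).mpr hn)
  have hmap : MvPolynomial.C a * ∏ j, (MvPolynomial.X none +
      ∑ k, MvPolynomial.C (w j k) * MvPolynomial.X (some k)) =
      MvPolynomial.C (a * ∏ j, c j) * MvPolynomial.map V.subtype (∏ j, l j) := by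
    rw [MvPolynomial.C_mul, mul_assoc, map_prod, map_prod, ← Finset.prod_mul_distrib]
    congr 1
    refine Finset.prod_congr rfl (fun j _ => ?_)
    simp only [l, map_sum, map_mul, MvPolynomial.map_C, MvPolynomial.map_X, Finset.mul_sum]
    simp only [← mul_assoc, ← MvPolynomial.C_mul]
    rw [Fintype.sum_option]
    have e : ∀ p, c j * V.subtype ⟨v j p / c j, hd j p⟩ = v j p := by
      intro p
      show c j * (v j p / c j) = v j p
      field_simp [hc0 j]
    simp only [e]
    simp [v]
  have hac : V.valuation (a * ∏ j, c j) ≤ 1 := by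
    have h1 := h s
    rw [hmap, MvPolynomial.coeff_C_mul, MvPolynomial.coeff_map, ← V.valuation_le_one_iff, map_mul] at h1
    have h2 : V.valuation (V.subtype (MvPolynomial.coeff s (∏ j, l j))) = 1 := hunit
    rw [h2, mul_one] at h1
    exact h1
  exact ⟨c, hc1, fun j k => ho j (some k), hac⟩

theorem gauss_linear {K : Type*} [Field K] (V : ValuationSubring K) {μ : Type*} [Fintype μ]
    {J : Type*} [Fintype J] (w : J → μ → K) (a : K)
    (h : ∀ s, MvPolynomial.coeff s (MvPolynomial.C a * ∏ j, (MvPolynomial.X none +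
      ∑ k, MvPolynomial.C (w j k) * MvPolynomial.X (some k)) : MvPolynomial (Option μ) K) ∈ V)
    (B : MvPolynomial μ ℤ) (b : ℕ) (hb : B.totalDegree ≤ b) :
    a ^ b * ∏ j, MvPolynomial.aeval (w j) B ∈ V := by
  obtain ⟨c, hc1, ho, hac⟩ := gauss_aux V w a h
  have hB : ∀ j, V.valuation (MvPolynomial.aeval (w j) B) ≤ V.valuation (c j) ^ b := by
    intro j
    rw [MvPolynomial.aeval_def, MvPolynomial.eval₂_eq]
    apply Valuation.map_sum_le
    intro α hα
    rw [map_mul, map_prod]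
    have h1 : V.valuation ((algebraMap ℤ K) (MvPolynomial.coeff α B)) ≤ 1 := by
      simp only [algebraMap_int_eq, eq_intCast]; exact valuation_int_le V (MvPolynomial.coeff α B)
    have h2 : ∏ i ∈ α.support, V.valuation (w j i ^ α i) ≤ V.valuation (c j) ^ (∑ i ∈ α.support, α i) := by
      rw [← Finset.prod_pow_eq_pow_sum]
      apply Finset.prod_le_prod' 
      intro i _
      rw [map_pow]
      exact pow_le_pow_left' (ho j i) _
    calc _ ≤ 1 * V.valuation (c j) ^ (∑ i ∈ α.support, α i) := mul_le_mul' h1 h2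
      _ ≤ _ := by
        rw [one_mul]
        apply pow_le_pow_right' (hc1 j)
        exact (MvPolynomial.le_totalDegree hα).trans hb
  rw [← V.valuation_le_one_iff, map_mul, map_pow, map_prod]
  calc _ ≤ V.valuation a ^ b * ∏ j, V.valuation (c j) ^ b :=
        mul_le_mul' le_rfl (Finset.prod_le_prod' fun j _ => hB j)
    _ = (V.valuation (a * ∏ j, c j)) ^ b := by
        rw [map_mul, map_prod, mul_pow, Finset.prod_pow]
    _ ≤ 1 := pow_le_one' hac b

theorem gauss_mem {K : Type*} [Field K] (V : ValuationSubring K) {μ : Type*} [Fintype μ]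
    {J : Type*} [Fintype J] (w : J → μ → K) (a : K)
    (h : ∀ s, MvPolynomial.coeff s (MvPolynomial.C a * ∏ j, (MvPolynomial.X none +
      ∑ k, MvPolynomial.C (w j k) * MvPolynomial.X (some k)) : MvPolynomial (Option μ) K) ∈ V)
    (ha : V.valuation a = 1) (j : J) (k : μ) : w j k ∈ V := by
  classical
  obtain ⟨c, hc1, ho, hac⟩ := gauss_aux V w a h
  rw [map_mul, ha, one_mul, map_prod] at hac
  rw [← V.valuation_le_one_iff]
  refine (ho j k).trans (le_trans ?_ hac)
  exact Finset.single_le_prod' (f := fun j => V.valuation (c j)) (fun i _ => hc1 i) (Finset.mem_univ j)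

end Nes

open Complex
namespace Nes

/-! ### Splitting of Chow forms into linear factors -/

noncomputable def lf {Ω : Type*} [CommRing Ω] {μ : Type*} [Fintype μ] (w : μ → Ω) :
    MvPolynomial (Option μ) Ω :=
  MvPolynomial.X none + ∑ k, MvPolynomial.C (w k) * MvPolynomial.X (some k)

noncomputable def lin {Ω : Type*} [CommRing Ω] {μ : Type*} [Fintype μ] (w : μ → Ω) :
    Option μ → MvPolynomial μ Ω :=
  fun o => o.elim (-∑ k, MvPolynomial.C (w k) * MvPolynomial.X k) MvPolynomial.X

theorem aeval_lin_lf {Ω : Type*} [CommRing Ω] {μ : Type*} [Fintype μ] (w : μ → Ω) :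
    MvPolynomial.aeval (lin w) (lf w) = 0 := by
  simp [lin, lf, MvPolynomial.algebraMap_eq]

theorem aeval_lin_eq {Ω : Type*} [CommRing Ω] {μ : Type*} [Fintype μ] (w : μ → Ω)
    (Φ : MvPolynomial (Option μ) Ω) :
    MvPolynomial.aeval (lin w) Φ = (MvPolynomial.optionEquivLeft Ω μ Φ).eval (lin w none) := by
  induction Φ using MvPolynomial.induction_on with
  | C a => simp [MvPolynomial.optionEquivLeft_C, MvPolynomial.algebraMap_eq]
  | add p q hp hq => simp only [map_add, hp, hq, Polynomial.eval_add]
  | mul_X p i hp =>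
    simp only [map_mul, hp, Polynomial.eval_mul, MvPolynomial.aeval_X]
    cases i with
    | none => simp
    | some k => simp [lin]

theorem prod_lf_dvd {Ω : Type*} [Field Ω] {μ : Type*} [Fintype μ] {J : Type*}
    (s : Finset J) (w : J → μ → Ω) (hw : ∀ i ∈ s, ∀ j ∈ s, w i = w j → i = j)
    (Φ : MvPolynomial (Option μ) Ω) (h : ∀ j ∈ s, MvPolynomial.aeval (lin (w j)) Φ = 0) :
    ∏ j ∈ s, lf (w j) ∣ Φ := by
  classical
  rw [← map_dvd_iff (MvPolynomial.optionEquivLeft Ω μ), map_prod]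
  have e : ∀ j, MvPolynomial.optionEquivLeft Ω μ (lf (w j)) = Polynomial.X - Polynomial.C (lin (w j) none) := by
    intro j
    simp [lf, lin, MvPolynomial.optionEquivLeft_C]
  simp only [e]
  induction s using Finset.induction_on with
  | empty => simp
  | insert i s hi ih =>
    have ih' := ih (fun a ha b hb => hw a (Finset.mem_insert_of_mem ha) b (Finset.mem_insert_of_mem hb))
      (fun j hj => h j (Finset.mem_insert_of_mem hj))
    rw [Finset.prod_insert hi]
    obtain ⟨G, hG⟩ := ih'
    have h1 := h i (Finset.mem_insert_self _ _)
    rw [aeval_lin_eq, hG, Polynomial.eval_mul, Polynomial.eval_prod, mul_eq_zero] at h1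
    rcases h1 with h1 | h1
    · exfalso
      rw [Finset.prod_eq_zero_iff] at h1
      obtain ⟨j, hj, h1⟩ := h1
      simp only [Polynomial.eval_sub, Polynomial.eval_X, Polynomial.eval_C, sub_eq_zero] at h1
      have : w i = w j := by
        funext k
        have := congrArg (MvPolynomial.eval (Pi.single k 1)) h1
        simpa [lin, Pi.single_apply] using this
      exact hi (hw i (Finset.mem_insert_self _ _) j (Finset.mem_insert_of_mem hj) this ▸ hj)
    · rw [← Polynomial.IsRoot.def, ← Polynomial.dvd_iff_isRoot] at h1
      rw [hG, mul_comm (Polynomial.X - _)]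
      exact mul_dvd_mul_left _ h1

theorem map_lf {A B : Type*} [CommRing A] [CommRing B] {μ : Type*} [Fintype μ] (f : A →+* B) (w : μ → A) :
    MvPolynomial.map f (lf w) = lf (fun k => f (w k)) := by
  simp [lf]

/-- The generic norm form. -/
theorem chow_norm {L M : Type} [Field L] [CharZero L] [Field M] [Algebra L M] [FiniteDimensional L M]
    {μ : Type*} [Fintype μ] (y : μ → M) :
    ∃ Ch : MvPolynomial (Option μ) L, ∀ (Ω : Type) [Field Ω] [IsAlgClosed Ω] [Algebra L Ω],
      MvPolynomial.map (algebraMap L Ω) Ch = ∏ σ : M →ₐ[L] Ω, lf (fun k => σ (y k)) := by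
  classical
  let b := Module.finBasis L M
  let A : Matrix (Fin (Module.finrank L M)) (Fin (Module.finrank L M)) (MvPolynomial (Option μ) L) :=
    (MvPolynomial.X none : MvPolynomial (Option μ) L) • 1 + ∑ k, (MvPolynomial.X (some k) : MvPolynomial (Option μ) L) •
      (Algebra.leftMulMatrix b (y k)).map (MvPolynomial.C (σ := Option μ))
  refine ⟨A.det, ?_⟩
  intro Ω _ _ _
  have hinf : Set.Infinite (Set.range (algebraMap L Ω)) := Set.infinite_range_of_injective (algebraMap L Ω).injective
  apply MvPolynomial.funext_set (fun _ => Set.range (algebraMap L Ω)) (fun _ => hinf)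
  intro x hx
  have hx' : ∀ o, ∃ u : L, algebraMap L Ω u = x o := fun o => hx o (Set.mem_univ o)
  choose u hu using hx'
  have e1 : MvPolynomial.eval u A.det = Algebra.norm L (algebraMap L M (u none) + ∑ k, u (some k) • y k) := by
    rw [Algebra.norm_eq_matrix_det b, RingHom.map_det]
    congr 1
    have e0 : Algebra.leftMulMatrix b (algebraMap L M (u none) + ∑ k, u (some k) • y k) =
        algebraMap L _ (u none) + ∑ k, u (some k) • Algebra.leftMulMatrix b (y k) := by
      rw [map_add, map_sum, AlgHom.commutes]
      congr 1
      exact Finset.sum_congr rfl fun k _ => map_smul _ _ _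
    rw [e0]
    ext i j
    simp only [A, RingHom.mapMatrix_apply, Matrix.map_apply, Matrix.add_apply, Matrix.sum_apply, Matrix.smul_apply, map_add, map_sum,
      smul_eq_mul, map_mul, MvPolynomial.eval_X, MvPolynomial.eval_C, Matrix.algebraMap_matrix_apply, Matrix.one_apply]
    congr 1
    split_ifs <;> simp
  have hxu : x = fun o => algebraMap L Ω (u o) := funext fun o => (hu o).symm
  rw [hxu, MvPolynomial.eval_map]
  have e2 : MvPolynomial.eval₂ (algebraMap L Ω) (fun o => algebraMap L Ω (u o)) A.det = algebraMap L Ω (MvPolynomial.eval u A.det) := by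
    simp only [MvPolynomial.eval, MvPolynomial.coe_eval₂Hom]
    rw [MvPolynomial.eval₂_comp_left, RingHom.comp_id]; rfl
  rw [e2, e1, Algebra.norm_eq_prod_embeddings L Ω, map_prod]
  refine Finset.prod_congr rfl fun σ _ => ?_
  simp [lf, Algebra.smul_def, mul_comm]

end Nes

open Complex
namespace Nes

theorem aeval_lin_map {A B : Type*} [CommRing A] [CommRing B] {μ : Type*} [Fintype μ] (f : A →+* B)
    (w : μ → A) (Φ : MvPolynomial (Option μ) A) :
    MvPolynomial.aeval (lin (fun k => f (w k))) (MvPolynomial.map f Φ) =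
      MvPolynomial.map f (MvPolynomial.aeval (lin w) Φ) := by
  induction Φ using MvPolynomial.induction_on with
  | C a => simp [MvPolynomial.algebraMap_eq]
  | add p q hp hq => simp only [map_add, hp, hq]
  | mul_X p i hp =>
    simp only [map_mul, hp, MvPolynomial.aeval_X, MvPolynomial.map_X]
    cases i with
    | none => simp [lin]
    | some k => simp [lin]

def e0 {μ : Type*} {A : Type*} [Zero A] [One A] : Option μ → A := fun o => o.elim 1 (fun _ => 0)

theorem eval_e0_lf {Ω : Type*} [CommRing Ω] {μ : Type*} [Fintype μ] (w : μ → Ω) :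
    MvPolynomial.eval e0 (lf w) = 1 := by
  simp [lf, e0]

theorem lf_ne_zero {Ω : Type*} [CommRing Ω] [Nontrivial Ω] {μ : Type*} [Fintype μ] (w : μ → Ω) :
    lf w ≠ 0 := by
  intro h
  have := eval_e0_lf w
  rw [h] at this
  simp at this

section split
set_option linter.unusedSectionVars false
variable {R L M : Type} [CommRing R] [IsDomain R] [Field L] [CharZero L] [Algebra R L]
  [IsFractionRing R L] [Field M] [Algebra L M] [FiniteDimensional L M] {μ : Type} [Fintype μ] (y : μ → M)
  (F : MvPolynomial (Option μ) R)

/-- the ideal of the generic point is generated by `F` -/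
def Gen : Prop := ∀ Φ : MvPolynomial (Option μ) R,
  MvPolynomial.aeval (lin y) (MvPolynomial.map ((algebraMap L M).comp (algebraMap R L)) Φ) = 0 ↔ F ∣ Φ

/-- `y` generates -/
def Sep (L : Type) {M : Type} [Field L] [Field M] [Algebra L M] {μ : Type} (y : μ → M) : Prop :=
  ∀ (Ω : Type) [Field Ω] [Algebra L Ω] (σ τ : M →ₐ[L] Ω), (∀ k, σ (y k) = τ (y k)) → σ = τ

theorem chow_vanish (Ch : MvPolynomial (Option μ) L) (h : ∀ (Ω : Type) [Field Ω] [IsAlgClosed Ω] [Algebra L Ω],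
      MvPolynomial.map (algebraMap L Ω) Ch = ∏ σ : M →ₐ[L] Ω, lf (fun k => σ (y k))) :
    MvPolynomial.aeval (lin y) (MvPolynomial.map (algebraMap L M) Ch) = 0 := by
  have h1 := h (AlgebraicClosure M)
  apply MvPolynomial.map_injective (algebraMap M (AlgebraicClosure M)) (algebraMap M (AlgebraicClosure M)).injective
  rw [← aeval_lin_map, MvPolynomial.map_map, ← IsScalarTower.algebraMap_eq, h1, map_prod, map_zero]
  exact Finset.prod_eq_zero (Finset.mem_univ (IsScalarTower.toAlgHom L M (AlgebraicClosure M)))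
    (aeval_lin_lf _)

theorem split_form (hF : Gen (L := L) y F) (hgen : Sep L y)
    (Ω : Type) [Field Ω] [IsAlgClosed Ω] [Algebra L Ω] :
    MvPolynomial.eval e0 F ≠ 0 ∧ MvPolynomial.map ((algebraMap L Ω).comp (algebraMap R L)) F =
      MvPolynomial.C (algebraMap L Ω (algebraMap R L (MvPolynomial.eval e0 F))) *
        ∏ σ : M →ₐ[L] Ω, lf (fun k => σ (y k)) := by
  classical
  obtain ⟨Ch, hCh⟩ := chow_norm (L := L) y
  have hv := chow_vanish y Ch hCh
  let _ : Algebra (MvPolynomial (Option μ) R) (MvPolynomial (Option μ) L) := MvPolynomial.algebraMvPolynomial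
  obtain ⟨⟨G, d⟩, hd⟩ := IsLocalization.surj (M := (nonZeroDivisors R).map (MvPolynomial.C (σ := Option μ)))
    (S := MvPolynomial (Option μ) L) Ch
  obtain ⟨r, hr, hrd⟩ := d.2
  simp only at hd
  rw [← hrd] at hd
  have hd' : Ch * MvPolynomial.C (algebraMap R L r) = MvPolynomial.map (algebraMap R L) G := by
    rw [← MvPolynomial.map_C]; exact hd
  have hr0 : algebraMap L Ω (algebraMap R L r) ≠ 0 := by
    have : r ≠ 0 := nonZeroDivisors.ne_zero hr
    simpa using this
  have hG : F ∣ G := by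
    rw [← hF, ← MvPolynomial.map_map, ← hd', map_mul, map_mul, hv, zero_mul]
  obtain ⟨H, hH⟩ := hG
  have hdvd : ∏ σ : M →ₐ[L] Ω, lf (fun k => σ (y k)) ∣
      MvPolynomial.map ((algebraMap L Ω).comp (algebraMap R L)) F := by
    apply prod_lf_dvd Finset.univ (fun (σ : M →ₐ[L] Ω) k => σ (y k))
    · intro σ _ τ _ h
      exact hgen Ω σ τ (fun k => congrFun h k)
    · intro σ _
      have h1 := (hF F).mpr dvd_rfl
      have h2 := congrArg (MvPolynomial.map (σ : M →+* Ω)) h1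
      rw [← aeval_lin_map, MvPolynomial.map_map, map_zero] at h2
      have h3 : (σ : M →+* Ω).comp ((algebraMap L M).comp (algebraMap R L)) = (algebraMap L Ω).comp (algebraMap R L) := by
        ext x; simp
      rw [h3] at h2
      exact h2
  obtain ⟨K, hK⟩ := hdvd
  have hprod0 : ∏ σ : M →ₐ[L] Ω, lf (fun k => σ (y k)) ≠ 0 :=
    Finset.prod_ne_zero_iff.mpr fun σ _ => lf_ne_zero _
  have h3 : K * MvPolynomial.map ((algebraMap L Ω).comp (algebraMap R L)) H =
      MvPolynomial.C (algebraMap L Ω (algebraMap R L r)) := by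
    apply mul_left_cancel₀ hprod0
    rw [← mul_assoc, ← hK, ← map_mul, ← hH, ← MvPolynomial.map_map, ← hd', map_mul, hCh Ω, MvPolynomial.map_C]
  have hKu : IsUnit K := by
    apply isUnit_of_mul_isUnit_left (y := MvPolynomial.map ((algebraMap L Ω).comp (algebraMap R L)) H)
    rw [h3]
    exact (IsUnit.mk0 _ hr0).map MvPolynomial.C
  obtain ⟨k, hk, hKk⟩ := MvPolynomial.isUnit_iff_eq_C_of_isReduced.mp hKu
  have h4 : algebraMap L Ω (algebraMap R L (MvPolynomial.eval e0 F)) = k := by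
    have := congrArg (MvPolynomial.eval e0) hK
    rw [map_mul, map_prod, Finset.prod_congr rfl (fun σ _ => eval_e0_lf _), Finset.prod_const_one, one_mul,
      hKk, MvPolynomial.eval_C] at this
    rw [← this]
    have h5 := MvPolynomial.map_eval ((algebraMap L Ω).comp (algebraMap R L)) (e0 : Option μ → R) F
    rw [RingHom.comp_apply] at h5
    rw [h5]
    congr 1
    congr 1
    funext o
    cases o <;> simp [e0]
  refine ⟨fun h0 => ?_, ?_⟩
  · rw [h0, map_zero, map_zero] at h4
    exact hk.ne_zero h4.symm
  · rw [hK, hKk, h4, mul_comm]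

theorem exists_normElt [IsIntegrallyClosed R] (hF : Gen (L := L) y F) (hgen : Sep L y)
    (B : MvPolynomial μ ℤ) (b : ℕ) (hb : B.totalDegree ≤ b) :
    ∃ N : R, algebraMap R L N = algebraMap R L (MvPolynomial.eval e0 F) ^ b *
      Algebra.norm L (MvPolynomial.aeval y B) := by
  classical
  let Ω := AlgebraicClosure L
  obtain ⟨ha, hs⟩ := split_form y F hF hgen Ω
  have hN : ∀ σ : M →ₐ[L] Ω, σ (MvPolynomial.aeval y B) = MvPolynomial.aeval (fun k => σ (y k)) B := by
    intro σ
    rw [MvPolynomial.aeval_def, MvPolynomial.aeval_def]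
    rw [← RingHom.coe_coe, MvPolynomial.eval₂_comp_left]
    congr 1
    exact RingHom.ext_int _ _
  set x : L := algebraMap R L (MvPolynomial.eval e0 F) ^ b * Algebra.norm L (MvPolynomial.aeval y B) with hx
  have h1 : algebraMap L Ω x = (algebraMap L Ω (algebraMap R L (MvPolynomial.eval e0 F))) ^ b *
      ∏ σ : M →ₐ[L] Ω, MvPolynomial.aeval (fun k => σ (y k)) B := by
    rw [hx, map_mul, map_pow, Algebra.norm_eq_prod_embeddings L Ω]
    simp only [hN]
  have h2 : ((algebraMap L Ω).comp (algebraMap R L)).IsIntegralElem (algebraMap L Ω x) := by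
    apply isIntegralElem_of_valuation
    intro V hV
    rw [h1]
    apply gauss_linear V (fun (σ : M →ₐ[L] Ω) k => σ (y k)) _ _ B b hb
    intro s
    change MvPolynomial.coeff s (MvPolynomial.C _ * ∏ σ : M →ₐ[L] Ω, lf (fun k => σ (y k))) ∈ V
    rw [← hs, MvPolynomial.coeff_map]
    exact hV _
  have h3 : IsIntegral R x := by
    obtain ⟨p, hp, hpx⟩ := h2
    refine ⟨p, hp, ?_⟩
    rw [← Polynomial.hom_eval₂] at hpx
    exact (map_eq_zero _).mp hpx
  exact IsIntegrallyClosed.isIntegral_iff.mp h3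

/-- Specialisation at a prime dividing the norm. -/
theorem exists_special [IsIntegrallyClosed R] (hF : Gen (L := L) y F) (hgen : Sep L y)
    (B : MvPolynomial μ ℤ) (b : ℕ) (N : R)
    (hN : algebraMap R L N = algebraMap R L (MvPolynomial.eval e0 F) ^ b *
      Algebra.norm L (MvPolynomial.aeval y B)) (S : R) (hS : Prime S) (hSN : S ∣ N)
    (hSa : ¬ S ∣ MvPolynomial.eval e0 F) :
    ∃ (κ : Type) (_ : Field κ) (π : R →+* κ) (y' : μ → κ), (∀ r, π r = 0 ↔ S ∣ r) ∧
      (∀ Q : MvPolynomial μ R, MvPolynomial.eval₂ ((algebraMap L M).comp (algebraMap R L)) y Q = 0 →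
        MvPolynomial.eval₂ π y' Q = 0) ∧ MvPolynomial.aeval y' B = 0 := by
  classical
  let Ω := AlgebraicClosure L
  obtain ⟨ha, hs⟩ := split_form y F hF hgen Ω
  let f : R →+* Ω := (algebraMap L Ω).comp (algebraMap R L)
  have hf : Function.Injective f := (algebraMap L Ω).injective.comp (IsFractionRing.injective R L)
  have hP : (Ideal.span {S}).IsPrime := (Ideal.span_singleton_prime hS.ne_zero).mpr hS
  obtain ⟨V, hV, hVS⟩ := exists_valuation_center f hf (Ideal.span {S})
  simp only [Ideal.mem_span_singleton] at hVS
  have hva : V.valuation (f (MvPolynomial.eval e0 F)) = 1 := by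
    apply le_antisymm
    · rw [V.valuation_le_one_iff]; exact hV _
    · by_contra h; exact hSa ((hVS _).mp (not_le.mp h))
  have hmem : ∀ (σ : M →ₐ[L] Ω) k, σ (y k) ∈ V := by
    intro σ k
    apply gauss_mem V (fun (σ : M →ₐ[L] Ω) k => σ (y k)) (f (MvPolynomial.eval e0 F)) _ hva σ k
    intro s
    change MvPolynomial.coeff s (MvPolynomial.C (algebraMap L Ω (algebraMap R L (MvPolynomial.eval e0 F))) *
      ∏ σ : M →ₐ[L] Ω, lf (fun k => σ (y k))) ∈ V
    rw [← hs, MvPolynomial.coeff_map]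
    exact hV _
  have hvN : V.valuation (∏ σ : M →ₐ[L] Ω, σ (MvPolynomial.aeval y B)) < 1 := by
    have h1 := (hVS N).mpr hSN
    have h2 : f N = f (MvPolynomial.eval e0 F) ^ b * ∏ σ : M →ₐ[L] Ω, σ (MvPolynomial.aeval y B) := by
      simp only [f, RingHom.comp_apply]
      rw [hN, map_mul, map_pow, Algebra.norm_eq_prod_embeddings L Ω]
    rw [h2, map_mul, map_pow, hva, one_pow, one_mul] at h1
    exact h1
  have hex : ∃ σ : M →ₐ[L] Ω, V.valuation (σ (MvPolynomial.aeval y B)) < 1 := by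
    by_contra hcon
    push Not at hcon
    rw [map_prod] at hvN
    exact absurd (Finset.one_le_prod' (fun σ (_ : σ ∈ Finset.univ) => hcon σ)) (not_le.mpr hvN)
  obtain ⟨σ, hσ⟩ := hex
  let yV : μ → V := fun k => ⟨σ (y k), hmem σ k⟩
  let fV : R →+* V := f.codRestrict V.toSubring hV
  have key : ∀ Q : MvPolynomial μ R, ((MvPolynomial.eval₂ fV yV Q : V) : Ω) =
      σ (MvPolynomial.eval₂ ((algebraMap L M).comp (algebraMap R L)) y Q) := by
    intro Q
    have h1 := MvPolynomial.eval₂_comp_left V.subtype fV yV Q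
    have h2 := MvPolynomial.eval₂_comp_left (σ : M →+* Ω) ((algebraMap L M).comp (algebraMap R L)) y Q
    refine h1.trans (Eq.trans ?_ h2.symm)
    congr 1
    ext r
    simp [fV, f]
  refine ⟨IsLocalRing.ResidueField V, inferInstance, (IsLocalRing.residue V).comp fV,
    fun k => IsLocalRing.residue V (yV k), ?_, ?_, ?_⟩
  · intro r
    rw [← hVS r, RingHom.comp_apply, IsLocalRing.residue_eq_zero_iff]
    exact V.valuation_lt_one_iff (fV r)
  · intro Q hQ
    have h1 := MvPolynomial.eval₂_comp_left (IsLocalRing.residue V) fV yV Q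
    refine h1.symm.trans ?_
    have h2 : (MvPolynomial.eval₂ fV yV Q : V) = 0 := by
      apply Subtype.ext
      rw [key, hQ, map_zero]; rfl
    rw [h2, map_zero]
  · refine Eq.trans (b := IsLocalRing.residue V (MvPolynomial.aeval yV B)) ?_ ?_
    · rw [MvPolynomial.aeval_def, MvPolynomial.aeval_def, MvPolynomial.eval₂_comp_left]
      congr 1
    rw [IsLocalRing.residue_eq_zero_iff]
    apply (V.valuation_lt_one_iff _).mpr
    have h3 : ((MvPolynomial.aeval yV B : V) : Ω) = σ (MvPolynomial.aeval y B) := by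
      have h1 := MvPolynomial.eval₂_comp_left V.subtype (algebraMap ℤ V) yV B
      have h2 := MvPolynomial.eval₂_comp_left (σ : M →+* Ω) (algebraMap ℤ M) y B
      refine h1.trans (Eq.trans ?_ h2.symm)
      congr 1
      exact RingHom.ext_int _ _
    rw [h3]; exact hσ

end split
end Nes

open Complex
namespace Nes

/-! ### Concrete Chow forms -/

abbrev PP (μ ι : Type) := MvPolynomial (ι × Option μ) ℤ

section chow
set_option linter.unusedSectionVars false
variable {μ : Type} [Fintype μ]

noncomputable def subU (μ ι : Type) [Fintype μ] : PP μ ι →+* MvPolynomial (ι × μ) (MvPolynomial μ ℤ) :=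
  MvPolynomial.eval₂Hom (Int.castRingHom _) (fun p => p.2.elim
    (-∑ k, MvPolynomial.C (MvPolynomial.X k) * MvPolynomial.X (p.1, k)) (fun k => MvPolynomial.X (p.1, k)))

noncomputable def sub {κ : Type} [CommRing κ] (ι : Type) (y : μ → κ) : PP μ ι →+* MvPolynomial (ι × μ) κ :=
  (MvPolynomial.map (MvPolynomial.aeval y : MvPolynomial μ ℤ →ₐ[ℤ] κ).toRingHom).comp (subU μ ι)

theorem sub_none {κ : Type} [CommRing κ] {ι : Type} (y : μ → κ) (i : ι) :
    sub ι y (MvPolynomial.X (i, none)) = -∑ k, MvPolynomial.C (y k) * MvPolynomial.X (i, k) := by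
  simp [sub, subU]

theorem sub_some {κ : Type} [CommRing κ] {ι : Type} (y : μ → κ) (i : ι) (k : μ) :
    sub ι y (MvPolynomial.X (i, some k)) = MvPolynomial.X (i, k) := by
  simp [sub, subU]

def IsChow {κ : Type} [CommRing κ] {ι : Type} (F : PP μ ι) (y : μ → κ) : Prop :=
  ∀ Φ, sub ι y Φ = 0 ↔ F ∣ Φ

def Free {κ : Type} [CommRing κ] (ι : Type) (y : μ → κ) : Prop :=
  ∀ Φ : PP μ ι, sub ι y Φ = 0 → Φ = 0

def spEquiv (ι ν : Type) : Option ι × ν ≃ ν ⊕ (ι × ν) where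
  toFun p := p.1.elim (Sum.inl p.2) (fun i => Sum.inr (i, p.2))
  invFun := Sum.elim (fun o => (none, o)) (fun q => (some q.1, q.2))
  left_inv := by rintro ⟨_ | i, o⟩ <;> rfl
  right_inv := by rintro (o | ⟨i, o⟩) <;> rfl

noncomputable def spl (A : Type) [CommRing A] (ι ν : Type) :
    MvPolynomial (Option ι × ν) A ≃ₐ[A] MvPolynomial ν (MvPolynomial (ι × ν) A) :=
  (MvPolynomial.renameEquiv A (spEquiv ι ν)).trans (MvPolynomial.sumAlgEquiv A ν (ι × ν))

@[simp] theorem spl_none (A : Type) [CommRing A] (ι ν : Type) (o : ν) :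
    spl A ι ν (MvPolynomial.X (none, o)) = MvPolynomial.X o := by
  simp [spl, spEquiv]

@[simp] theorem spl_some (A : Type) [CommRing A] (ι ν : Type) (i : ι) (o : ν) :
    spl A ι ν (MvPolynomial.X (some i, o)) = MvPolynomial.C (MvPolynomial.X (i, o)) := by
  simp [spl, spEquiv]

@[simp] theorem spl_C (A : Type) [CommRing A] (ι ν : Type) (a : A) :
    spl A ι ν (MvPolynomial.C a) = MvPolynomial.C (MvPolynomial.C a) := by
  simp [spl]

/-- The key compatibility: substitution in all groups = substitution in the main group after
substituting in the other ones. -/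
theorem spl_sub {κ : Type} [CommRing κ] {ι : Type} (y : μ → κ) (Φ : PP μ (Option ι)) :
    spl κ ι μ (sub (Option ι) y Φ) =
      MvPolynomial.aeval (lin (fun k => (MvPolynomial.C (y k) : MvPolynomial (ι × μ) κ)))
        (MvPolynomial.map (sub ι y) (spl ℤ ι (Option μ) Φ)) := by
  induction Φ using MvPolynomial.induction_on with
  | C a => simp
  | add p q hp hq => simp only [map_add, hp, hq]
  | mul_X p i hp =>
    have hX : spl κ ι μ (sub (Option ι) y (MvPolynomial.X i)) =
      MvPolynomial.aeval (lin (fun k => (MvPolynomial.C (y k) : MvPolynomial (ι × μ) κ)))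
        (MvPolynomial.map (sub ι y) (spl ℤ ι (Option μ) (MvPolynomial.X i))) := by
      rcases i with ⟨_ | i, _ | k⟩
      · rw [sub_none, spl_none, MvPolynomial.map_X, MvPolynomial.aeval_X, map_neg, map_sum]
        simp only [map_mul, spl_none, spl_C]; rfl
      · rw [sub_some, spl_none, spl_none, MvPolynomial.map_X, MvPolynomial.aeval_X]; rfl
      · rw [sub_none, spl_some, MvPolynomial.map_C, sub_none, MvPolynomial.aeval_C, map_neg, map_sum,
          MvPolynomial.algebraMap_eq, map_neg, map_sum]
        simp only [map_mul, spl_some, spl_C]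
      · rw [sub_some, spl_some, spl_some, MvPolynomial.map_C, sub_some, MvPolynomial.aeval_C]; rfl
    rw [map_mul, map_mul, map_mul, map_mul, map_mul, hp, hX]

theorem sub_eq_zero_iff {κ : Type} [CommRing κ] {ι : Type} (y : μ → κ) (Φ : PP μ (Option ι)) :
    sub (Option ι) y Φ = 0 ↔ MvPolynomial.aeval (lin (fun k => (MvPolynomial.C (y k) : MvPolynomial (ι × μ) κ)))
        (MvPolynomial.map (sub ι y) (spl ℤ ι (Option μ) Φ)) = 0 := by
  rw [← spl_sub, map_eq_zero_iff _ (spl κ ι μ).injective]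

end chow
end Nes

open Complex
namespace Nes

theorem ker_principal {A K : Type} [CommRing A] [IsDomain A] [UniqueFactorizationMonoid A] [Field K]
    (f : A →+* K) (hf : Function.Injective f) (θ : K) (p : Polynomial A) (hp : p ≠ 0)
    (hpθ : p.eval₂ f θ = 0) :
    ∃ F : Polynomial A, Prime F ∧ ∀ Ψ : Polynomial A, Ψ.eval₂ f θ = 0 ↔ F ∣ Ψ := by
  have : (RingHom.ker (Polynomial.eval₂RingHom f θ)).IsPrime := RingHom.ker_isPrime _
  obtain ⟨F, hF, hFp⟩ := Ideal.IsPrime.exists_mem_prime_of_ne_bot this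
    (by
      intro h
      have h1 : p ∈ RingHom.ker (Polynomial.eval₂RingHom f θ) := by
        rw [RingHom.mem_ker]; exact hpθ
      rw [h] at h1
      exact hp h1)
  have hF' : F.eval₂ f θ = 0 := hF
  refine ⟨F, hFp, fun Ψ => ⟨fun h => ?_, ?_⟩⟩
  · have hdeg : F.natDegree ≠ 0 := by
      intro h0
      rw [Polynomial.eq_C_of_natDegree_eq_zero h0, Polynomial.eval₂_C] at hF'
      have h1 : F.coeff 0 = 0 := hf (by rw [hF', map_zero])
      apply hFp.ne_zero
      rw [Polynomial.eq_C_of_natDegree_eq_zero h0, h1, map_zero]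
    have hprim := hFp.irreducible.isPrimitive hdeg
    let L := FractionRing A
    have hirr := (Polynomial.IsPrimitive.irreducible_iff_irreducible_map_fraction_map (K := L) hprim).mp hFp.irreducible
    apply Polynomial.IsPrimitive.dvd_of_fraction_map_dvd_fraction_map (K := L) hprim
    let g : L →+* K := IsFractionRing.lift hf
    have hg : g.comp (algebraMap A L) = f := by
      ext a; exact IsFractionRing.lift_algebraMap hf a
    by_contra hnd
    have hcop := (EuclideanDomain.dvd_or_coprime _ (Ψ.map (algebraMap A L)) hirr).resolve_left hnd
    obtain ⟨a, b, hab⟩ := hcop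
    have h2 := congrArg (Polynomial.eval₂ g θ) hab
    rw [Polynomial.eval₂_add, Polynomial.eval₂_mul, Polynomial.eval₂_mul, Polynomial.eval₂_map, Polynomial.eval₂_map,
      hg, hF', h] at h2
    simp at h2
  · rintro ⟨G, rfl⟩
    rw [Polynomial.eval₂_mul, hF', zero_mul]

section chow
set_option linter.unusedSectionVars false
variable {μ : Type} [Fintype μ]

theorem aeval_lin_eval₂ {A D : Type*} [CommRing A] [CommRing D] (f : A →+* D) (w : μ → D)
    (Ψ : MvPolynomial (Option μ) A) :
    MvPolynomial.aeval (lin w) (MvPolynomial.map f Ψ) =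
      (MvPolynomial.optionEquivLeft A μ Ψ).eval₂ (MvPolynomial.map f) (lin w none) := by
  induction Ψ using MvPolynomial.induction_on with
  | C a => simp [MvPolynomial.optionEquivLeft_C, MvPolynomial.algebraMap_eq]
  | add p q hp hq => simp only [map_add, hp, hq, Polynomial.eval₂_add]
  | mul_X p i hp =>
    simp only [map_mul, hp, Polynomial.eval₂_mul, MvPolynomial.aeval_X, MvPolynomial.map_X]
    cases i with
    | none => simp
    | some k => simp [lin]

theorem exists_chow {κ : Type} [Field κ] {ι : Type} [Finite ι] (y : μ → κ) (h0 : Free ι y)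
    (h1 : ¬ Free (Option ι) y) : ∃ F : PP μ (Option ι), Prime F ∧ IsChow F y := by
  unfold Free at h1
  push Not at h1
  obtain ⟨Φ, hΦ, hΦ0⟩ := h1
  let D := MvPolynomial μ (MvPolynomial (ι × μ) κ)
  let K := FractionRing D
  have hinj : Function.Injective (sub ι y) := (injective_iff_map_eq_zero _).mpr h0
  let f : MvPolynomial μ (PP μ ι) →+* K := (algebraMap D K).comp (MvPolynomial.map (sub ι y))
  have hf : Function.Injective f := (IsFractionRing.injective D K).comp (MvPolynomial.map_injective _ hinj)
  let w : μ → MvPolynomial (ι × μ) κ := fun k => MvPolynomial.C (y k)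
  let e : PP μ (Option ι) ≃+* Polynomial (MvPolynomial μ (PP μ ι)) :=
    (spl ℤ ι (Option μ)).toRingEquiv.trans (MvPolynomial.optionEquivLeft (PP μ ι) μ).toRingEquiv
  have key : ∀ Ψ, sub (Option ι) y Ψ = 0 ↔ (e Ψ).eval₂ f (algebraMap D K (lin w none)) = 0 := by
    intro Ψ
    rw [sub_eq_zero_iff, aeval_lin_eval₂, ← map_eq_zero_iff (algebraMap D K) (IsFractionRing.injective D K),
      Polynomial.hom_eval₂]
    rfl
  obtain ⟨F, hF, hFp⟩ := ker_principal f hf (algebraMap D K (lin w none)) (e Φ)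
    (by simpa using hΦ0) ((key Φ).mp hΦ)
  refine ⟨e.symm F, (MulEquiv.prime_iff e.symm).mpr hF, fun Ψ => ?_⟩
  rw [key, hFp]
  constructor
  · intro h
    simpa using map_dvd e.symm h
  · intro h
    simpa using map_dvd e h

theorem sub_rename {κ : Type} [CommRing κ] {ι ι' : Type} (f : ι → ι') (y : μ → κ) (Φ : PP μ ι) :
    sub ι' y (MvPolynomial.rename (Prod.map f id) Φ) = MvPolynomial.rename (Prod.map f id) (sub ι y Φ) := by
  induction Φ using MvPolynomial.induction_on with
  | C a => simp
  | add p q hp hq => simp only [map_add, hp, hq]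
  | mul_X p i hp =>
    simp only [map_mul, hp, MvPolynomial.rename_X]
    congr 1
    rcases i with ⟨i, _ | k⟩
    · simp [sub_none]
    · simp [sub_some]

theorem free_of_chow {κ : Type} [CommRing κ] {ι : Type} (F : PP μ (Option ι)) (y : μ → κ)
    (hF : IsChow F y) (hc : ∀ n, F ≠ MvPolynomial.C n) : Free ι y := by
  classical
  intro Φ hΦ
  by_contra hΦ0
  have hdeg : ∀ p, MvPolynomial.degreeOf p F = 0 := by
    rintro ⟨i, o⟩
    let f : ι → Option ι := fun j => Equiv.swap none i (some j)
    have hf : Function.Injective f := (Equiv.injective _).comp (Option.some_injective _)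
    have hne : ∀ j, f j ≠ i := by
      intro j hj
      have : Equiv.swap none i (some j) = Equiv.swap none i none := by
        rw [Equiv.swap_apply_left]; exact hj
      exact absurd ((Equiv.injective _) this) (by simp)
    have hf' : Function.Injective (Prod.map f (id : Option μ → Option μ)) := hf.prodMap Function.injective_id
    have h1 : F ∣ MvPolynomial.rename (Prod.map f id) Φ := by
      rw [← hF, sub_rename, hΦ, map_zero]
    obtain ⟨G, hG⟩ := h1
    have h2 : MvPolynomial.rename (Prod.map f id) Φ ≠ 0 := by
      intro h; exact hΦ0 (MvPolynomial.rename_injective _ hf' (by rw [h, map_zero]))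
    have h3 : MvPolynomial.degreeOf (i, o) (MvPolynomial.rename (Prod.map f id) Φ) = 0 := by
      rw [← Nat.le_zero, MvPolynomial.degreeOf_le_iff]
      intro m hm
      rw [MvPolynomial.support_rename_of_injective hf'] at hm
      obtain ⟨m', -, rfl⟩ := Finset.mem_image.mp hm
      rw [Nat.le_zero]
      apply Finsupp.mapDomain_of_notMem_range
      rintro ⟨⟨j, o'⟩, hj⟩
      exact hne j (congrArg Prod.fst hj)
    rw [hG] at h2 h3
    rw [MvPolynomial.degreeOf_mul_eq (left_ne_zero_of_mul h2) (right_ne_zero_of_mul h2)] at h3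
    omega
  apply hc (MvPolynomial.coeff 0 F)
  ext m
  rw [MvPolynomial.coeff_C]
  split_ifs with h
  · rw [h]
  · by_contra hm
    apply h
    ext p
    have := MvPolynomial.degreeOf_le_iff.mp (hdeg p).le m (MvPolynomial.mem_support_iff.mpr hm)
    simp only [Finsupp.coe_zero, Pi.zero_apply]; omega

end chow
end Nes

open Complex
namespace Nes
section chow
set_option linter.unusedSectionVars false
variable {μ : Type} [Fintype μ]

/-- shear of the groups of variables -/
noncomputable def shear (A : Type) [CommRing A] {ι ν : Type} (c : ι → ℤ) :
    MvPolynomial (Option ι × ν) A →ₐ[A] MvPolynomial (Option ι × ν) A :=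
  MvPolynomial.aeval (fun p => MvPolynomial.X p + p.1.elim 0 (fun i => (c i : MvPolynomial (Option ι × ν) A) *
    MvPolynomial.X (none, p.2)))

theorem shear_X (A : Type) [CommRing A] {ι ν : Type} (c : ι → ℤ) (p : Option ι × ν) :
    shear A c (MvPolynomial.X p) = MvPolynomial.X p + p.1.elim 0 (fun i => (c i : MvPolynomial (Option ι × ν) A) *
    MvPolynomial.X (none, p.2)) := by
  simp [shear]

theorem shear_neg (A : Type) [CommRing A] {ι ν : Type} (c : ι → ℤ) (Φ : MvPolynomial (Option ι × ν) A) :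
    shear A c (shear A (-c) Φ) = Φ := by
  induction Φ using MvPolynomial.induction_on with
  | C a => simp [shear, MvPolynomial.algebraMap_eq]
  | add p q hp hq => simp only [map_add, hp, hq]
  | mul_X p i hp =>
    rw [map_mul, map_mul, hp, shear_X]
    rcases i with ⟨_ | i, o⟩
    · simp [shear_X]
    · simp [shear_X]

theorem sub_shear {κ : Type} [CommRing κ] {ι : Type} (c : ι → ℤ) (y : μ → κ) (Φ : PP μ (Option ι)) :
    sub (Option ι) y (shear ℤ c Φ) = shear κ c (sub (Option ι) y Φ) := by
  induction Φ using MvPolynomial.induction_on with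
  | C a => simp [shear]
  | add p q hp hq => simp only [map_add, hp, hq]
  | mul_X p i hp =>
    have hX : sub (Option ι) y (shear ℤ c (MvPolynomial.X i)) = shear κ c (sub (Option ι) y (MvPolynomial.X i)) := by
      rcases i with ⟨_ | i, _ | k⟩
      · rw [shear_X, sub_none]
        simp [sub_none, shear_X, MvPolynomial.algHom_C, MvPolynomial.algebraMap_eq]
      · rw [shear_X, sub_some]
        simp [sub_some, shear_X]
      · rw [shear_X, sub_none]
        simp only [Option.elim_some, map_add, map_mul, map_neg, map_sum, sub_none, shear_X, MvPolynomial.algHom_C,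
          MvPolynomial.algebraMap_eq, mul_add, Finset.sum_add_distrib, map_intCast, mul_neg, neg_add]
        congr 2
        rw [Finset.mul_sum]
        exact Finset.sum_congr rfl fun k _ => by ring
      · rw [shear_X, sub_some]
        simp [sub_some, shear_X]
    rw [map_mul, map_mul, map_mul, map_mul, hp, hX]

/-- leading coefficient of a Chow form -/
noncomputable def lead {ι : Type} (F : PP μ (Option ι)) : PP μ ι :=
  MvPolynomial.eval e0 (spl ℤ ι (Option μ) F)

def ext0 {ι : Type} (v : Option μ → ℂ) (u : ι × Option μ → ℂ) : Option ι × Option μ → ℂ :=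
  fun p => p.1.elim (v p.2) (fun i => u (i, p.2))

theorem aeval_ext0 {ι : Type} (v : Option μ → ℂ) (u : ι × Option μ → ℂ) (F : PP μ (Option ι)) :
    MvPolynomial.aeval (ext0 v u) F =
      MvPolynomial.eval₂ (MvPolynomial.aeval u : PP μ ι →ₐ[ℤ] ℂ).toRingHom v (spl ℤ ι (Option μ) F) := by
  induction F using MvPolynomial.induction_on with
  | C a => rw [spl_C, MvPolynomial.eval₂_C]; simp
  | add p q hp hq => simp only [map_add, hp, hq, MvPolynomial.eval₂_add]
  | mul_X p i hp =>
    rw [map_mul, map_mul, MvPolynomial.eval₂_mul, hp]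
    rcases i with ⟨_ | i, o⟩
    · simp [ext0]
    · simp [ext0]

theorem aeval_lead {ι : Type} (u : ι × Option μ → ℂ) (F : PP μ (Option ι)) :
    MvPolynomial.aeval u (lead F) = MvPolynomial.aeval (ext0 e0 u) F := by
  rw [aeval_ext0, lead]
  have h := MvPolynomial.eval₂_comp_left (MvPolynomial.aeval u : PP μ ι →ₐ[ℤ] ℂ).toRingHom (RingHom.id _) e0
    (spl ℤ ι (Option μ) F)
  rw [RingHom.comp_id] at h
  have e : ((MvPolynomial.aeval u : PP μ ι →ₐ[ℤ] ℂ).toRingHom : PP μ ι → ℂ) ∘ (e0 : Option μ → PP μ ι) = e0 := by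
    funext o; cases o <;> simp [e0]
  rw [e] at h
  rw [← h]; rfl

theorem lead_shift {κ : Type} [CommRing κ] {ι : Type} [Finite ι] (F : PP μ (Option ι)) (y : μ → κ)
    (hF : IsChow F y) (hF0 : F ≠ 0) (c : ι → ℤ) :
    ∃ ε : ℂ, ε ^ 2 = 1 ∧ ∀ u : ι × Option μ → ℂ,
      MvPolynomial.aeval (fun p : ι × Option μ => u p + p.2.elim (c p.1 : ℂ) 0) (lead F) =
        ε * MvPolynomial.aeval u (lead F) := by
  have hdiv : ∀ c : ι → ℤ, F ∣ shear ℤ c F := by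
    intro c
    rw [← hF, sub_shear, (hF F).mpr dvd_rfl, map_zero]
  obtain ⟨G, hG⟩ := hdiv c
  obtain ⟨H, hH⟩ := hdiv (-c)
  have h1 : F * (G * shear ℤ c H) = F * 1 := by
    have := shear_neg ℤ c F
    rw [hH, map_mul, hG] at this
    rw [mul_one, ← mul_assoc]; exact this
  have h2 := mul_left_cancel₀ hF0 h1
  have h3 : IsUnit G := IsUnit.of_mul_eq_one _ h2
  obtain ⟨r, hr, hGr⟩ := MvPolynomial.isUnit_iff_eq_C_of_isReduced.mp h3
  refine ⟨(r : ℂ), ?_, ?_⟩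
  · rcases Int.isUnit_iff.mp hr with h | h <;> simp [h]
  · intro u
    rw [aeval_lead, aeval_lead]
    have h4 : MvPolynomial.aeval (ext0 e0 u) (shear ℤ c F) = MvPolynomial.aeval (ext0 e0
        (fun p : ι × Option μ => u p + p.2.elim (c p.1 : ℂ) 0)) F := by
      rw [shear, ← AlgHom.comp_apply]
      congr 1
      ext p
      rcases p with ⟨_ | i, _ | o⟩ <;> simp [ext0, e0]
    rw [← h4, hG, map_mul, hGr]
    simp [mul_comm]

theorem lead_const {κ : Type} [CommRing κ] {ι : Type} [Finite ι] (F : PP μ (Option ι)) (y : μ → κ)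
    (hF : IsChow F y) (hF0 : F ≠ 0) (u u' : ι × Option μ → ℂ) (h : ∀ i k, u (i, some k) = u' (i, some k)) :
    MvPolynomial.aeval u (lead F) = MvPolynomial.aeval u' (lead F) := by
  let Ψ : MvPolynomial ι ℂ := MvPolynomial.aeval (fun p : ι × Option μ => MvPolynomial.C (u p) +
    p.2.elim (MvPolynomial.X p.1) 0) (lead F)
  have hΨ : ∀ x : ι → ℂ, MvPolynomial.eval x Ψ =
      MvPolynomial.aeval (fun p : ι × Option μ => u p + p.2.elim (x p.1) 0) (lead F) := by
    intro x
    have h1 := MvPolynomial.eval₂_comp_left (MvPolynomial.eval x) (algebraMap ℤ (MvPolynomial ι ℂ))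
      (fun p : ι × Option μ => MvPolynomial.C (u p) + p.2.elim (MvPolynomial.X p.1) 0) (lead F)
    refine h1.trans ?_
    rw [MvPolynomial.aeval_def]
    congr 1
    · exact RingHom.ext_int _ _
    · funext p
      rcases p with ⟨i, _ | o⟩ <;> simp
  have hconst : Ψ = MvPolynomial.C (MvPolynomial.aeval u (lead F)) := by
    apply MvPolynomial.funext_set (fun _ => Set.range (fun n : ℤ => (2 * n : ℂ)))
      (fun _ => Set.infinite_range_of_injective (fun a b hab => by simpa using hab))
    intro x hx
    have hx' : ∀ i, ∃ n : ℤ, (2 * n : ℂ) = x i := fun i => hx i (Set.mem_univ i)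
    choose c hc using hx'
    obtain ⟨ε, hε, hs⟩ := lead_shift F y hF hF0 c
    rw [hΨ, MvPolynomial.eval_C]
    have h1 := hs (fun p : ι × Option μ => u p + p.2.elim (c p.1 : ℂ) 0)
    rw [hs u, ← mul_assoc, ← pow_two, hε, one_mul] at h1
    rw [← h1]
    congr 2
    funext p
    rcases p with ⟨i, _ | o⟩
    · simp [← hc]; ring
    · simp
  have h2 := hΨ (fun i => u' (i, none) - u (i, none))
  rw [hconst, MvPolynomial.eval_C] at h2
  rw [h2]
  congr 2
  funext p
  rcases p with ⟨i, _ | o⟩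
  · simp
  · simp [h]

end chow
end Nes

open Complex
namespace Nes
section chow
set_option linter.unusedSectionVars false
variable {μ : Type} [Fintype μ]

theorem alg_of_form {R L E : Type} [CommRing R] [IsDomain R] [CharZero R] [Field L] [Algebra R L]
    [IsFractionRing R L] [Field E] [Algebra L E] (w : μ → E) (F : MvPolynomial (Option μ) R) (hF0 : F ≠ 0)
    (hF : MvPolynomial.aeval (lin w) (MvPolynomial.map ((algebraMap L E).comp (algebraMap R L)) F) = 0)
    (k : μ) : IsAlgebraic L (w k) := by
  classical
  let f : R →+* E := (algebraMap L E).comp (algebraMap R L)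
  have hinf : Infinite R := Infinite.of_injective (Nat.cast : ℕ → R) Nat.cast_injective
  let p := MvPolynomial.optionEquivLeft R μ F
  have hp0 : p ≠ 0 := by simpa [p] using hF0
  let l := p.leadingCoeff
  have hl : l ≠ 0 := by simpa [l] using hp0
  have key : ∀ n : μ → R, MvPolynomial.eval n l ≠ 0 → IsAlgebraic L (-∑ k, w k * f (n k)) := by
    intro n hn
    have h1 := hF
    rw [aeval_lin_eval₂] at h1
    have h2 := congrArg (MvPolynomial.eval (fun k => f (n k))) h1
    rw [Polynomial.hom_eval₂, map_zero] at h2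
    have h3 : (MvPolynomial.eval (fun k => f (n k))).comp (MvPolynomial.map f) = f.comp (MvPolynomial.eval n) := by
      ext x <;> simp
    rw [h3] at h2
    have h4 : MvPolynomial.eval (fun k => f (n k)) (lin w none) = -∑ k, w k * f (n k) := by simp [lin]
    rw [h4] at h2
    refine ⟨(p.map (MvPolynomial.eval n)).map (algebraMap R L), ?_, ?_⟩
    · rw [Ne, Polynomial.map_eq_zero_iff (IsFractionRing.injective R L)]
      intro h
      apply hn
      have := congrArg (fun q => Polynomial.coeff q p.natDegree) h
      simpa using this
    · rw [Polynomial.map_map, Polynomial.aeval_def, Polynomial.eval₂_map]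
      exact h2
  obtain ⟨n, hn⟩ : ∃ n, MvPolynomial.eval n l ≠ 0 := by
    by_contra h
    push Not at h
    exact hl (MvPolynomial.funext (fun n => by rw [h n, map_zero]))
  let q : Polynomial R := MvPolynomial.aeval (fun j => Polynomial.C (n j) + if j = k then Polynomial.X else 0) l
  have hq : ∀ t, q.eval t = MvPolynomial.eval (fun j => n j + if j = k then t else 0) l := by
    intro t
    have h1 := MvPolynomial.eval₂_comp_left (Polynomial.evalRingHom t) (algebraMap R (Polynomial R))
      (fun j => Polynomial.C (n j) + if j = k then Polynomial.X else 0) l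
    refine h1.trans ?_
    have e1 : (Polynomial.evalRingHom t).comp (algebraMap R (Polynomial R)) = RingHom.id R := by
      ext x; simp
    rw [e1]
    congr 1
    funext j
    simp only [Function.comp]
    split_ifs <;> simp
  obtain ⟨t, ht⟩ : ∃ t, (Polynomial.X * q).eval t ≠ 0 := by
    by_contra h
    push Not at h
    have h1 : Polynomial.X * q = 0 := Polynomial.funext (fun t => by rw [h t]; simp)
    rcases mul_eq_zero.mp h1 with h2 | h2
    · exact Polynomial.X_ne_zero h2
    · have := hq 0
      rw [h2] at this
      simp at this
      exact hn this.symm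
  rw [Polynomial.eval_mul, Polynomial.eval_X] at ht
  have ht0 : t ≠ 0 := left_ne_zero_of_mul ht
  have ht1 := right_ne_zero_of_mul ht
  rw [hq] at ht1
  have a1 := key n hn
  have a2 := key _ ht1
  have a3 := a1.sub a2
  have e : -∑ j, w j * f (n j) - -∑ j, w j * f (n j + if j = k then t else 0) = w k * f t := by
    rw [neg_sub_neg, ← Finset.sum_sub_distrib]
    rw [Finset.sum_eq_single k]
    · simp; ring
    · intro j _ hj
      simp [hj]
    · simp
  rw [e] at a3
  have hft : f t ≠ 0 := by simpa [f] using ht0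
  have a4 : IsAlgebraic L (f t) := isAlgebraic_algebraMap (algebraMap R L t)
  have := a3.mul a4.inv
  rwa [mul_assoc, mul_inv_cancel₀ hft, mul_one] at this

theorem split_setup {R D L E : Type} [CommRing R] [IsDomain R] [CharZero R] [CommRing D] [IsDomain D]
    [Field L] [Field E] [Algebra R L] [IsFractionRing R L] [Algebra D E] [IsFractionRing D E]
    (f0 : R →+* D) (hf0 : Function.Injective f0) (w0 : μ → D) (G : MvPolynomial (Option μ) R) (hG0 : G ≠ 0)
    (hG : ∀ Φ : MvPolynomial (Option μ) R, MvPolynomial.aeval (lin w0) (MvPolynomial.map f0 Φ) = 0 ↔ G ∣ Φ) :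
    ∃ (M : Type) (_ : Field M) (_ : Algebra L M)
      (_ : FiniteDimensional L M) (yM : μ → M), Sep L yM ∧ Gen (L := L) yM G ∧
      ∀ Q : MvPolynomial μ R, MvPolynomial.eval₂ ((algebraMap L M).comp (algebraMap R L)) yM Q = 0 ↔
        MvPolynomial.eval₂ f0 w0 Q = 0 := by
  classical
  have hDE : Function.Injective (algebraMap D E) := IsFractionRing.injective D E
  let f : R →+* E := (algebraMap D E).comp f0
  have hf : Function.Injective f := hDE.comp hf0
  let _ : Algebra L E := (IsFractionRing.lift hf : L →+* E).toAlgebra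
  have hfE : (algebraMap L E).comp (algebraMap R L) = f :=
    RingHom.ext fun a => IsFractionRing.lift_algebraMap hf a
  let w : μ → E := fun k => algebraMap D E (w0 k)
  have hGE : ∀ Φ : MvPolynomial (Option μ) R, MvPolynomial.aeval (lin w) (MvPolynomial.map f Φ) = 0 ↔ G ∣ Φ := by
    intro Φ
    rw [← hG, ← map_eq_zero_iff (MvPolynomial.map (algebraMap D E)) (MvPolynomial.map_injective _ hDE),
      ← aeval_lin_map, MvPolynomial.map_map]
  have halg : ∀ k, IsAlgebraic L (w k) := by
    intro k
    apply alg_of_form (R := R) w G hG0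
    rw [hfE, hGE]
  let M := IntermediateField.adjoin L (Set.range w)
  have hfd : FiniteDimensional L M := IntermediateField.finiteDimensional_adjoin (by
    rintro _ ⟨k, rfl⟩; exact (halg k).isIntegral)
  let yM : μ → M := fun k => ⟨w k, IntermediateField.subset_adjoin L _ ⟨k, rfl⟩⟩
  have hsep : Sep L yM := by
    intro Ω _ _ σ τ h
    apply IntermediateField.algHom_ext_of_eq_adjoin L (rfl : M = IntermediateField.adjoin L (Set.range w))
    rintro _ ⟨k, rfl⟩
    exact h k
  refine ⟨M, inferInstance, inferInstance, hfd, yM, hsep, ?_, ?_⟩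
  · intro Φ
    rw [← hGE, ← map_eq_zero_iff (MvPolynomial.map (algebraMap M E)) (MvPolynomial.map_injective _ (algebraMap M E).injective),
      ← aeval_lin_map, MvPolynomial.map_map, ← hfE]
    rfl
  · intro Q
    rw [← map_eq_zero_iff (algebraMap M E) (algebraMap M E).injective, ← map_eq_zero_iff _ hDE]
    have h1 := MvPolynomial.eval₂_comp_left (algebraMap M E) ((algebraMap L M).comp (algebraMap R L)) yM Q
    have h2 := MvPolynomial.eval₂_comp_left (algebraMap D E) f0 w0 Q
    rw [h1, h2]
    change _ ↔ MvPolynomial.eval₂ f _ Q = 0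
    rw [← hfE]
    rfl

theorem exists_q {R L M : Type} [CommRing R] [IsDomain R] [Field L] [Field M] [Algebra R L] [IsFractionRing R L]
    [Algebra L M] [FiniteDimensional L M] (x : M) (hx : x ≠ 0) :
    ∃ q : Polynomial R, q.coeff 0 ≠ 0 ∧ q.eval₂ ((algebraMap L M).comp (algebraMap R L)) x = 0 := by
  let _ : Algebra R M := ((algebraMap L M).comp (algebraMap R L)).toAlgebra
  have : IsScalarTower R L M := IsScalarTower.of_algebraMap_eq (fun _ => rfl)
  have hal : IsAlgebraic R x :=
    (IsFractionRing.isAlgebraic_iff R L M).mpr (Algebra.IsAlgebraic.isAlgebraic _)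
  exact hal.exists_nonzero_coeff_and_aeval_eq_zero (mem_nonZeroDivisors_of_ne_zero hx)

theorem embed_part {R L M Ω : Type} [Field Ω] [IsAlgClosed Ω] [CommRing R] [IsDomain R] [IsIntegrallyClosed R] [Field L] [CharZero L] [Field M] [Algebra R L]
    [IsFractionRing R L] [Algebra L M] [FiniteDimensional L M] (yM : μ → M) (G : MvPolynomial (Option μ) R)
    (hgen : Gen (L := L) yM G) (hsep : Sep L yM) (φ : R →+* Ω) (hφ : Function.Injective φ) :
    ∃ (J : Type) (_ : Fintype J) (Y : J → μ → Ω),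
        MvPolynomial.map φ G = MvPolynomial.C (φ (MvPolynomial.eval e0 G)) * ∏ j, lf (Y j) ∧
        (∀ j (B : MvPolynomial μ ℤ), MvPolynomial.aeval yM B = 0 → MvPolynomial.aeval (Y j) B = 0) ∧
        ∀ (B : MvPolynomial μ ℤ) (b : ℕ) (N : R), algebraMap R L N = algebraMap R L (MvPolynomial.eval e0 G) ^ b *
          Algebra.norm L (MvPolynomial.aeval yM B) →
          φ N = φ (MvPolynomial.eval e0 G) ^ b * ∏ j, MvPolynomial.aeval (Y j) B := by
  classical
  let _ : Algebra L Ω := (IsFractionRing.lift hφ : L →+* Ω).toAlgebra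
  have hφE : (algebraMap L Ω).comp (algebraMap R L) = φ :=
    RingHom.ext fun a => IsFractionRing.lift_algebraMap hφ a
  have hφE' : ∀ r, algebraMap L Ω (algebraMap R L r) = φ r := fun r => IsFractionRing.lift_algebraMap hφ r
  have hσ : ∀ (σ : M →ₐ[L] Ω) (B : MvPolynomial μ ℤ), MvPolynomial.aeval (fun k => σ (yM k)) B =
      σ (MvPolynomial.aeval yM B) := by
    intro σ B
    have h1 := MvPolynomial.eval₂_comp_left (σ : M →+* Ω) (algebraMap ℤ M) yM B
    refine Eq.trans ?_ h1.symm
    rw [MvPolynomial.aeval_def]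
    congr 1
    exact RingHom.ext_int _ _
  refine ⟨M →ₐ[L] Ω, inferInstance, fun σ k => σ (yM k), ?_, ?_, ?_⟩
  · have h1 := (split_form yM _ hgen hsep Ω).2
    rw [hφE, hφE'] at h1
    exact h1
  · intro σ B hB
    rw [hσ, hB, map_zero]
  · intro B b N hN
    rw [← hφE', ← hφE', hN, map_mul, map_pow, Algebra.norm_eq_prod_embeddings L Ω]
    have : ∏ σ : M →ₐ[L] Ω, MvPolynomial.aeval (fun k => σ (yM k)) B = ∏ σ : M →ₐ[L] Ω, σ (MvPolynomial.aeval yM B) :=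
      Finset.prod_congr rfl fun σ _ => hσ σ B
    rw [this]

theorem split_setup' {R D : Type} [CommRing R] [IsDomain R] [CharZero R] [CommRing D] [IsDomain D]
    (f0 : R →+* D) (hf0 : Function.Injective f0) (w0 : μ → D) (G : MvPolynomial (Option μ) R) (hG0 : G ≠ 0)
    (hG : ∀ Φ : MvPolynomial (Option μ) R, MvPolynomial.aeval (lin w0) (MvPolynomial.map f0 Φ) = 0 ↔ G ∣ Φ) :
    ∃ (L M : Type) (_ : Field L) (_ : Field M) (_ : Algebra R L) (_ : IsFractionRing R L) (_ : Algebra L M)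
      (_ : FiniteDimensional L M) (yM : μ → M), Sep L yM ∧ Gen (L := L) yM G ∧
      ∀ Q : MvPolynomial μ R, MvPolynomial.eval₂ ((algebraMap L M).comp (algebraMap R L)) yM Q = 0 ↔
        MvPolynomial.eval₂ f0 w0 Q = 0 := by
  obtain ⟨M, h1, h2, h3, h4⟩ := split_setup (L := FractionRing R) (E := FractionRing D) f0 hf0 w0 G hG0 hG
  exact ⟨FractionRing R, M, inferInstance, h1, inferInstance, inferInstance, h2, h3, h4⟩

theorem split_main {κ : Type} [Field κ] {ι : Type} [Finite ι] (F : PP μ (Option ι)) (y : μ → κ)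
    (hfree : Free ι y) (hF : IsChow F y) (hF0 : F ≠ 0) :
    lead F ≠ 0 ∧ ∃ Nm : MvPolynomial μ ℤ → ℕ → PP μ ι,
      (∀ (B : MvPolynomial μ ℤ) (b : ℕ), B.totalDegree ≤ b → MvPolynomial.aeval y B ≠ 0 → Nm B b ≠ 0 ∧
        ∀ S, Prime S → S ∣ Nm B b → ¬ S ∣ lead F → ∃ (κ' : Type) (_ : Field κ') (y' : μ → κ'),
          IsChow S y' ∧ MvPolynomial.aeval y' B = 0) ∧
      ∀ φ : PP μ ι →+* ℂ, Function.Injective φ → ∃ (J : Type) (_ : Fintype J) (Y : J → μ → ℂ),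
        MvPolynomial.map φ (spl ℤ ι (Option μ) F) = MvPolynomial.C (φ (lead F)) * ∏ j, lf (Y j) ∧
        (∀ j (B : MvPolynomial μ ℤ), MvPolynomial.aeval y B = 0 → MvPolynomial.aeval (Y j) B = 0) ∧
        ∀ (B : MvPolynomial μ ℤ) (b : ℕ), B.totalDegree ≤ b → φ (Nm B b) = φ (lead F) ^ b * ∏ j, MvPolynomial.aeval (Y j) B := by
  classical
  have hfree' : Function.Injective (sub ι y) := (injective_iff_map_eq_zero _).mpr hfree
  have hG0 : spl ℤ ι (Option μ) F ≠ 0 := by simpa using hF0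
  obtain ⟨L, M, _, _, _, _, _, _, yM, hsep, hgen, hQE⟩ := split_setup' (sub ι y) hfree' (fun k => MvPolynomial.C (y k))
    (spl ℤ ι (Option μ) F) hG0 (by
      intro Φ
      have := sub_eq_zero_iff y ((spl ℤ ι (Option μ)).symm Φ)
      rw [AlgEquiv.apply_symm_apply] at this
      rw [← this, hF, ← map_dvd_iff (spl ℤ ι (Option μ)), AlgEquiv.apply_symm_apply])
  have hL0 : CharZero L := charZero_of_injective_algebraMap (IsFractionRing.injective (PP μ ι) L)
  have hIntEv : ∀ {A : Type} [CommRing A] (g : ℤ →+* A) (v : μ → A) (B : MvPolynomial μ ℤ),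
      MvPolynomial.eval₂ g v B = MvPolynomial.aeval v B := by
    intro A _ g v B
    rw [MvPolynomial.aeval_def]
    congr 1
    exact RingHom.ext_int _ _
  have hBB : ∀ {A : Type} [CommRing A] (g : PP μ ι →+* A) (v : μ → A) (B : MvPolynomial μ ℤ),
      MvPolynomial.eval₂ g v (MvPolynomial.map (Int.castRingHom (PP μ ι)) B) =
      MvPolynomial.eval₂ (Int.castRingHom A) v B := by
    intro A _ g v B
    rw [MvPolynomial.eval₂_map, hIntEv, hIntEv]
  have hyC : ∀ B : MvPolynomial μ ℤ, MvPolynomial.eval₂ (Int.castRingHom _) (fun k => (MvPolynomial.C (y k) : MvPolynomial (ι × μ) κ)) B =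
      MvPolynomial.C (MvPolynomial.aeval y B) := by
    intro B
    have h2 := MvPolynomial.eval₂_comp_left (MvPolynomial.C : κ →+* MvPolynomial (ι × μ) κ) (algebraMap ℤ κ) y B
    refine Eq.trans ?_ h2.symm
    rw [hIntEv, hIntEv]; rfl
  have hyB0 : ∀ B : MvPolynomial μ ℤ, MvPolynomial.aeval yM B = 0 ↔ MvPolynomial.aeval y B = 0 := by
    intro B
    have := hQE (MvPolynomial.map (Int.castRingHom (PP μ ι)) B)
    rw [hBB, hBB, hIntEv, hyC, MvPolynomial.C_eq_zero] at this
    exact this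
  have hlead0 : lead F ≠ 0 := (split_form yM _ hgen hsep (AlgebraicClosure L)).1
  let Nm : MvPolynomial μ ℤ → ℕ → PP μ ι := fun B b =>
    if h : B.totalDegree ≤ b then (exists_normElt yM _ hgen hsep B b h).choose else 0
  have hNm : ∀ B b, B.totalDegree ≤ b → algebraMap (PP μ ι) L (Nm B b) = algebraMap (PP μ ι) L (lead F) ^ b *
      Algebra.norm L (MvPolynomial.aeval yM B) := by
    intro B b h
    simp only [Nm, dif_pos h]
    exact (exists_normElt yM _ hgen hsep B b h).choose_spec
  refine ⟨hlead0, Nm, ?_, ?_⟩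
  · intro B b hb hB
    have hBM : MvPolynomial.aeval yM B ≠ 0 := by rwa [Ne, hyB0]
    constructor
    · intro h0
      have := hNm B b hb
      rw [h0, map_zero] at this
      have h1 : algebraMap (PP μ ι) L (lead F) ^ b * Algebra.norm L (MvPolynomial.aeval yM B) ≠ 0 := by
        apply mul_ne_zero
        · apply pow_ne_zero
          simpa using hlead0
        · exact Algebra.norm_ne_zero_iff.mpr hBM
      exact h1 this.symm
    · intro S hS hSN hSa
      obtain ⟨κ', inst, π, y', hπ, hQ, hB'⟩ := exists_special yM _ hgen hsep B b (Nm B b) (hNm B b hb) S hS hSN hSa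
      refine ⟨κ', inst, y', ?_, hB'⟩
      have hQ' := fun Q h => hQ Q ((hQE Q).mpr h)
      -- the ideal of `y'` is contained in `(S)`
      have hsub : ∀ Φ : PP μ ι, sub ι y' Φ = 0 → S ∣ Φ := by
        intro Φ hΦ
        rw [← hπ]
        have hcomp : (MvPolynomial.eval (fun p : ι × μ => π (MvPolynomial.X (p.1, some p.2)))).comp (sub ι y') = π := by
          apply MvPolynomial.ringHom_ext
          · intro n; simp
          · rintro ⟨i, _ | k⟩
            · rw [RingHom.comp_apply, sub_none]
              let Q : MvPolynomial μ (PP μ ι) := MvPolynomial.C (MvPolynomial.X (i, none)) +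
                ∑ k, MvPolynomial.C (MvPolynomial.X (i, some k)) * MvPolynomial.X k
              have h1 : MvPolynomial.eval₂ (sub ι y) (fun k => MvPolynomial.C (y k)) Q = 0 := by
                simp only [Q, MvPolynomial.eval₂_add, MvPolynomial.eval₂_C, MvPolynomial.eval₂_sum,
                  MvPolynomial.eval₂_mul, MvPolynomial.eval₂_X, sub_none, sub_some]
                rw [neg_add_eq_zero]
                exact Finset.sum_congr rfl fun k _ => mul_comm _ _
              have h2 := hQ' Q h1
              simp only [Q, MvPolynomial.eval₂_add, MvPolynomial.eval₂_C, MvPolynomial.eval₂_sum,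
                  MvPolynomial.eval₂_mul, MvPolynomial.eval₂_X] at h2
              rw [eq_neg_of_add_eq_zero_left h2]
              simp [mul_comm]
            · rw [RingHom.comp_apply, sub_some]; simp
        rw [← hcomp, RingHom.comp_apply, hΦ, map_zero]
      -- it is nonzero
      have hne : ∃ c : PP μ ι, c ≠ 0 ∧ sub ι y' c = 0 := by
        obtain ⟨q, hq0, hq⟩ := exists_q (R := PP μ ι) (L := L) _ hBM
        refine ⟨q.coeff 0, hq0, ?_⟩
        let W : MvPolynomial (ι × μ) (MvPolynomial μ ℤ) := q.eval₂ (subU μ ι) (MvPolynomial.C B)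
        have hWgen : ∀ (κ₁ : Type) [Field κ₁] (z : μ → κ₁),
            MvPolynomial.map (MvPolynomial.aeval z : MvPolynomial μ ℤ →ₐ[ℤ] κ₁).toRingHom W =
            q.eval₂ (sub ι z) (MvPolynomial.C (MvPolynomial.aeval z B)) := by
          intro κ₁ _ z
          rw [Polynomial.hom_eval₂, MvPolynomial.map_C]
          rfl
        have h1 : MvPolynomial.map (MvPolynomial.aeval y : MvPolynomial μ ℤ →ₐ[ℤ] κ).toRingHom W = 0 := by
          rw [hWgen]
          have h3 : ∀ {A : Type} [CommRing A] (g : PP μ ι →+* A) (v : μ → A),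
              MvPolynomial.eval₂ g v (q.eval₂ MvPolynomial.C (MvPolynomial.map (Int.castRingHom (PP μ ι)) B)) =
              q.eval₂ g (MvPolynomial.eval₂ (Int.castRingHom A) v B) := by
            intro A _ g v
            rw [← hBB g v B]
            have := Polynomial.hom_eval₂ q MvPolynomial.C (MvPolynomial.eval₂Hom g v)
              (MvPolynomial.map (Int.castRingHom (PP μ ι)) B)
            refine this.trans ?_
            congr 1
            exact RingHom.ext fun x => by simp
          have h4 := (hQE (q.eval₂ MvPolynomial.C (MvPolynomial.map (Int.castRingHom (PP μ ι)) B))).mp (by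
            rw [h3, hIntEv]; exact hq)
          rw [h3, hyC] at h4
          exact h4
        have h2 : MvPolynomial.map (MvPolynomial.aeval y' : MvPolynomial μ ℤ →ₐ[ℤ] κ').toRingHom W = 0 := by
          ext m
          have h3 := congrArg (MvPolynomial.coeff m) h1
          rw [MvPolynomial.coeff_map, MvPolynomial.coeff_zero] at h3 ⊢
          have h4 : MvPolynomial.aeval y (MvPolynomial.coeff m W) = 0 := h3
          have h5 := hQ (MvPolynomial.map (Int.castRingHom (PP μ ι)) (MvPolynomial.coeff m W)) (by
            rw [hBB, hIntEv]; exact (hyB0 _).mpr h4)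
          rw [hBB, hIntEv] at h5
          exact h5
        rw [hWgen, hB', map_zero, Polynomial.eval₂_at_zero] at h2
        exact h2
      intro Φ
      refine ⟨hsub Φ, ?_⟩
      have hSmem : sub ι y' S = 0 := by
        obtain ⟨c, hc0, hc⟩ := hne
        obtain ⟨n, c', hnd, hcc⟩ := WfDvdMonoid.max_power_factor hc0 hS.irreducible
        rw [hcc, map_mul, map_pow, mul_eq_zero] at hc
        rcases hc with hc | hc
        · exact eq_zero_of_pow_eq_zero hc
        · exact absurd (hsub _ hc) hnd
      rintro ⟨G', rfl⟩
      rw [map_mul, hSmem, zero_mul]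
  · intro φ hφ
    obtain ⟨J, hJ, Y, h1, h2, h3⟩ := embed_part yM _ hgen hsep φ hφ
    exact ⟨J, hJ, Y, h1, fun j B hB => h2 j B ((hyB0 B).mpr hB), fun B b hb => h3 B b _ (hNm B b hb)⟩

end chow
end Nes

open Complex
namespace Nes
section gen
set_option linter.unusedSectionVars false

theorem dense_ne_zero {n : Type} [Fintype n] (P : MvPolynomial n ℂ) (hP : P ≠ 0) :
    Dense {z : n → ℂ | MvPolynomial.eval z P ≠ 0} := by
  obtain ⟨w, hw⟩ : ∃ w, MvPolynomial.eval w P ≠ 0 := by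
    by_contra h
    push Not at h
    exact hP (MvPolynomial.funext (fun z => by rw [h z, map_zero]))
  intro z
  rw [mem_closure_iff_nhds]
  intro U hU
  let q : Polynomial ℂ := MvPolynomial.aeval (fun k => Polynomial.C (z k) + Polynomial.C (w k - z k) * Polynomial.X) P
  have hq : ∀ t, q.eval t = MvPolynomial.eval (fun k => z k + (w k - z k) * t) P := by
    intro t
    have h1 := MvPolynomial.eval₂_comp_left (Polynomial.evalRingHom t) (algebraMap ℂ (Polynomial ℂ))
      (fun k => Polynomial.C (z k) + Polynomial.C (w k - z k) * Polynomial.X) P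
    refine h1.trans ?_
    have e1 : (Polynomial.evalRingHom t).comp (algebraMap ℂ (Polynomial ℂ)) = RingHom.id ℂ := by
      ext x; simp
    rw [e1, MvPolynomial.eval₂_id]
    congr 1
    congr 1
    funext j
    simp
  have hq0 : q ≠ 0 := by
    intro h
    have := hq 1
    rw [h] at this
    simp at this
    exact hw this.symm
  have hfin : {t | q.IsRoot t}.Finite := Polynomial.finite_setOfPred_isRoot hq0
  have hcont : Continuous (fun t : ℂ => fun k => z k + (w k - z k) * t) := by fun_prop
  have hU' : (fun t : ℂ => fun k => z k + (w k - z k) * t) ⁻¹' U ∈ nhds (0 : ℂ) := by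
    apply hcont.continuousAt
    simpa using hU
  have : ({t | q.IsRoot t}ᶜ : Set ℂ) ∩ ((fun t : ℂ => fun k => z k + (w k - z k) * t) ⁻¹' U) |>.Nonempty := by
    have h2 := (Set.Finite.countable hfin).dense_compl ℂ
    have h3 := (mem_closure_iff_nhds.mp (h2 0)) _ hU'
    rwa [Set.inter_comm] at h3
  obtain ⟨t, ht1, ht2⟩ := this
  refine ⟨_, ht2, ?_⟩
  simp only [Set.mem_ofPred_eq]
  rw [← hq]
  exact ht1

theorem dense_all {n : Type} [Fintype n] {I : Type} [Countable I] (P : I → MvPolynomial n ℂ) (hP : ∀ i, P i ≠ 0) :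
    Dense {z : n → ℂ | ∀ i, MvPolynomial.eval z (P i) ≠ 0} := by
  have := dense_iInter_of_isOpen (f := fun i => {z : n → ℂ | MvPolynomial.eval z (P i) ≠ 0})
    (fun i => isOpen_ne_fun (continuous_eval_mv _) continuous_const) (fun i => dense_ne_zero _ (hP i))
  refine this.mono ?_
  intro z hz
  simpa using hz

theorem exists_gen_gt {n : Type} [Fintype n] {s : Set (n → ℂ)} (hs : Dense s) {R : ℝ} (hR : 0 < R)
    (F : MvPolynomial n ℂ) (z : n → ℂ) (hz : ∀ k, ‖z k‖ ≤ R) (c : ℝ) (hc : c < ‖MvPolynomial.eval z F‖) :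
    ∃ w ∈ s, (∀ k, ‖w k‖ ≤ R) ∧ c < ‖MvPolynomial.eval w F‖ := by
  have hz' : z ∈ closure (Metric.ball (0 : n → ℂ) R) := by
    rw [closure_ball _ hR.ne', mem_closedBall_zero_iff]
    exact (pi_norm_le_iff_of_nonneg hR.le).mpr hz
  have hopen : IsOpen {w : n → ℂ | c < ‖MvPolynomial.eval w F‖} :=
    isOpen_lt continuous_const (continuous_eval_mv F).norm
  obtain ⟨x, hx1, hx2⟩ := mem_closure_iff.mp hz' _ hopen hc
  obtain ⟨w, hw1, hw2⟩ := hs.exists_mem_open (hopen.inter Metric.isOpen_ball) ⟨x, hx1, hx2⟩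
  refine ⟨w, hw1, fun k => (norm_le_pi_norm w k).trans ?_, hw2.1⟩
  have := hw2.2
  rw [mem_ball_zero_iff] at this
  exact this.le

theorem pn_le_gen {n : Type} [Fintype n] {s : Set (n → ℂ)} (hs : Dense s) {R : ℝ} (hR : 0 < R)
    (F : MvPolynomial n ℂ) {K : ℝ}
    (h : ∀ z ∈ s, (∀ k, ‖z k‖ ≤ R) → ‖MvPolynomial.eval z F‖ ≤ K) : pn R F ≤ K := by
  apply pn_le hR.le
  intro z hz
  by_contra hc
  push Not at hc
  obtain ⟨w, hw, hw1, hw2⟩ := exists_gen_gt hs hR F z hz K hc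
  linarith [h w hw hw1]

variable {μ : Type} [Fintype μ]

/-- extend a point by the coordinates which make it orthogonal to `(1, ω)` -/
noncomputable def orth {ι : Type} (ω : μ → ℂ) (u : ι × μ → ℂ) : ι × Option μ → ℂ :=
  fun p => p.2.elim (-∑ k, ω k * u (p.1, k)) (fun k => u (p.1, k))

theorem eval_sub {ι : Type} (ω : μ → ℂ) (u : ι × μ → ℂ) (F : PP μ ι) :
    MvPolynomial.eval u (sub ι ω F) = MvPolynomial.aeval (orth ω u) F := by
  induction F using MvPolynomial.induction_on with
  | C a => simp
  | add p q hp hq => simp only [map_add, hp, hq]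
  | mul_X p i hp =>
    have hX : MvPolynomial.eval u (sub ι ω (MvPolynomial.X i)) = MvPolynomial.aeval (orth ω u) (MvPolynomial.X i : PP μ ι) := by
      rcases i with ⟨i, _ | k⟩
      · simp [sub_none, orth]
      · simp [sub_some, orth]
    rw [map_mul, map_mul, hp, map_mul, hX]

instance {ι : Type} [Finite ι] : Countable (PP μ ι) := by
  have : Countable (ι × Option μ →₀ ℕ) := inferInstance
  have h2 : Countable ((ι × Option μ →₀ ℕ) →₀ ℤ) := inferInstance
  exact (AddMonoidAlgebra.coeff_injective (R := ℤ) (M := ι × Option μ →₀ ℕ)).countable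

theorem dense_gen (ι : Type) [Fintype ι] :
    Dense {u : ι × Option μ → ℂ | Function.Injective (MvPolynomial.aeval u : PP μ ι →ₐ[ℤ] ℂ)} := by
  have h := dense_all (n := ι × Option μ) (I := {Φ : PP μ ι // Φ ≠ 0}) (fun Φ => cx Φ.1) (fun Φ => by
    have : cx Φ.1 ≠ cx 0 := fun h => Φ.2 (MvPolynomial.map_injective _ Int.cast_injective h)
    simpa [cx] using this)
  refine h.mono ?_
  intro u hu
  rw [Set.mem_ofPred_eq, injective_iff_map_eq_zero]
  intro Φ hΦ
  by_contra h0
  have := hu ⟨Φ, h0⟩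
  rw [eval_cx] at this
  exact this hΦ

theorem dense_gen_orth (ι : Type) [Fintype ι] (ω : μ → ℂ) (hω : Free ι ω) :
    Dense {u : ι × μ → ℂ | Function.Injective (MvPolynomial.aeval (orth ω u) : PP μ ι →ₐ[ℤ] ℂ)} := by
  have h := dense_all (n := ι × μ) (I := {Φ : PP μ ι // Φ ≠ 0}) (fun Φ => sub ι ω Φ.1) (fun Φ h => Φ.2 (hω _ h))
  refine h.mono ?_
  intro u hu
  rw [Set.mem_ofPred_eq, injective_iff_map_eq_zero]
  intro Φ hΦ
  by_contra h0
  have := hu ⟨Φ, h0⟩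
  rw [eval_sub] at this
  exact this hΦ

theorem totalDegree_sub_le {ι : Type} (ω : μ → ℂ) (F : PP μ ι) : (sub ι ω F).totalDegree ≤ F.totalDegree := by
  classical
  rw [F.as_sum, map_sum]
  refine MvPolynomial.totalDegree_finsetSum_le fun m hm => ?_
  rw [MvPolynomial.monomial_eq, map_mul]
  refine (MvPolynomial.totalDegree_mul _ _).trans ?_
  have h1 : (sub ι ω (MvPolynomial.C (F.coeff m))).totalDegree = 0 := by
    have : (sub ι ω (MvPolynomial.C (F.coeff m))) = MvPolynomial.C ((F.coeff m : ℤ) : ℂ) := by simp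
    rw [this, MvPolynomial.totalDegree_C]
  rw [h1, zero_add, Finsupp.prod, map_prod]
  refine (MvPolynomial.totalDegree_finsetProd _ _).trans ?_
  rw [← F.as_sum]
  refine le_trans ?_ (MvPolynomial.le_totalDegree hm)
  rw [Finsupp.sum]
  refine Finset.sum_le_sum fun p _ => ?_
  rw [map_pow]
  refine (MvPolynomial.totalDegree_pow _ _).trans ?_
  have : (sub ι ω (MvPolynomial.X p)).totalDegree ≤ 1 := by
    rcases p with ⟨i, _ | k⟩
    · rw [sub_none, MvPolynomial.totalDegree_neg]
      refine MvPolynomial.totalDegree_finsetSum_le fun k _ => ?_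
      refine (MvPolynomial.totalDegree_mul _ _).trans ?_
      simp
    · rw [sub_some]; simp
  calc _ ≤ m p * 1 := Nat.mul_le_mul_left _ this
    _ = _ := mul_one _

/-- A divisor of `lead F` has restricted norm at least one. -/
theorem one_le_rs_of_dvd_lead {κ : Type} [CommRing κ] {ι : Type} [Fintype ι] (F : PP μ (Option ι)) (y : μ → κ)
    (hF : IsChow F y) (hF0 : F ≠ 0) (hl : lead F ≠ 0) (ω : μ → ℂ) (S : PP μ ι) (hS : S ∣ lead F) :
    1 ≤ pn 1 (sub ι ω S) := by
  classical
  have hinj : Function.Injective (cx : PP μ ι → _) := MvPolynomial.map_injective _ Int.cast_injective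
  let a := lead F
  let a0 : PP μ ι := MvPolynomial.bind₁ (fun p : ι × Option μ => p.2.elim 0 (fun k => MvPolynomial.X (p.1, some k))) a
  have ha : a = a0 := by
    apply hinj
    apply MvPolynomial.funext
    intro u
    rw [eval_cx, eval_cx]
    have h2 : MvPolynomial.aeval u a0 = MvPolynomial.aeval (fun p : ι × Option μ =>
      p.2.elim (0:ℂ) (fun k => u (p.1, some k))) a := by
      simp only [a0, MvPolynomial.aeval_bind₁]
      congr 2
      funext p
      rcases p with ⟨i, _ | k⟩ <;> simp
    rw [h2]
    exact lead_const F y hF hF0 _ _ (fun i k => rfl)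
  have hd : ∀ i, MvPolynomial.degreeOf (i, none) a = 0 := by
    intro i
    by_contra h
    rw [← ne_eq, ← MvPolynomial.mem_vars_iff_degreeOf_ne_zero, ha] at h
    obtain ⟨p, hp, hp'⟩ := MvPolynomial.mem_vars_bind₁ _ _ h
    rcases p with ⟨i', _ | k⟩
    · simp at hp'
    · simp [MvPolynomial.vars_X] at hp'
  obtain ⟨a', ha'⟩ := hS
  have hS0 : S ≠ 0 := by rintro rfl; rw [zero_mul] at ha'; exact hl ha'
  have ha'0 : a' ≠ 0 := by rintro rfl; rw [mul_zero] at ha'; exact hl ha'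
  have hdS : ∀ i, (i, none) ∉ S.vars := by
    intro i
    rw [MvPolynomial.mem_vars_iff_degreeOf_ne_zero, not_not]
    have := hd i
    change MvPolynomial.degreeOf _ (lead F) = 0 at this
    rw [ha', MvPolynomial.degreeOf_mul_eq hS0 ha'0] at this
    omega
  obtain ⟨z, hz, hz1⟩ := exists_one_le_norm S hS0
  have : MvPolynomial.aeval z S = MvPolynomial.aeval (orth ω (fun p => z (p.1, some p.2))) S := by
    rw [MvPolynomial.aeval_def, MvPolynomial.aeval_def]
    apply MvPolynomial.eval₂Hom_congr' rfl _ rfl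
    rintro ⟨i, _ | k⟩ h1 _
    · exact absurd h1 (hdS i)
    · rfl
  rw [this, ← eval_sub] at hz1
  exact hz1.trans (le_pn _ (fun p => hz _))

end gen
end Nes

open Complex
namespace Nes
section est
set_option linter.unusedSectionVars false

/-- sum of the absolute values of the coefficients -/
noncomputable def l1 {n : Type} (B : MvPolynomial n ℤ) : ℝ := ∑ m ∈ B.support, |((B.coeff m : ℤ) : ℝ)|

theorem l1_nonneg {n : Type} (B : MvPolynomial n ℤ) : 0 ≤ l1 B := Finset.sum_nonneg fun _ _ => abs_nonneg _

theorem aeval_sum {n : Type} [Fintype n] (B : MvPolynomial n ℤ) (y : n → ℂ) :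
    MvPolynomial.aeval y B = ∑ m ∈ B.support, ((B.coeff m : ℤ) : ℂ) * m.prod (fun k e => y k ^ e) := by
  rw [MvPolynomial.aeval_def, MvPolynomial.eval₂_eq]
  simp [Finsupp.prod]

theorem norm_mon_le {n : Type} [Fintype n] (y : n → ℂ) (r : ℝ) (hr : 1 ≤ r) (hy : ∀ k, ‖y k‖ ≤ r) (m : n →₀ ℕ) :
    ‖m.prod (fun k e => y k ^ e)‖ ≤ r ^ (m.sum fun _ e => e) := by
  rw [Finsupp.prod, Finsupp.sum, norm_prod, ← Finset.prod_pow_eq_pow_sum]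
  apply Finset.prod_le_prod (fun _ _ => norm_nonneg _)
  intro k _
  rw [norm_pow]
  exact pow_le_pow_left₀ (norm_nonneg _) (hy k) _

theorem norm_aeval_le {n : Type} [Fintype n] (B : MvPolynomial n ℤ) (y : n → ℂ) (r : ℝ) (hr : 1 ≤ r)
    (hy : ∀ k, ‖y k‖ ≤ r) (b : ℕ) (hb : B.totalDegree ≤ b) : ‖MvPolynomial.aeval y B‖ ≤ l1 B * r ^ b := by
  rw [aeval_sum, l1, Finset.sum_mul]
  refine (norm_sum_le _ _).trans (Finset.sum_le_sum fun m hm => ?_)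
  rw [norm_mul]
  have h1 : ‖((B.coeff m : ℤ) : ℂ)‖ = |((B.coeff m : ℤ) : ℝ)| := by simp [Complex.norm_intCast]
  rw [h1]
  refine mul_le_mul_of_nonneg_left ?_ (abs_nonneg _)
  exact (norm_mon_le y r hr hy m).trans (pow_le_pow_right₀ hr ((MvPolynomial.le_totalDegree hm).trans hb))

theorem mon_lip {n : Type} [Fintype n] (y w : n → ℂ) (r δ : ℝ) (hr : 1 ≤ r) (hy : ∀ k, ‖y k‖ ≤ r) (hw : ∀ k, ‖w k‖ ≤ r)
    (hδ : ∀ k, ‖y k - w k‖ ≤ δ) (m : n →₀ ℕ) : ‖m.prod (fun k e => y k ^ e) - m.prod (fun k e => w k ^ e)‖ ≤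
      (m.sum fun _ e => e : ℕ) * r ^ (m.sum fun _ e => e) * δ := by
  classical
  induction m using Finsupp.induction_linear with
  | zero => simp
  | add f g hf hg =>
    have e1 : ∀ v : n → ℂ, (f + g).prod (fun k e => v k ^ e) = f.prod (fun k e => v k ^ e) * g.prod (fun k e => v k ^ e) :=
      fun v => Finsupp.prod_add_index' (fun _ => pow_zero _) (fun _ _ _ => pow_add _ _ _)
    have e2 : (f + g).sum (fun _ e => e) = f.sum (fun _ e => e) + g.sum (fun _ e => e) :=
      Finsupp.sum_add_index' (fun _ => rfl) (fun _ _ _ => rfl)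
    rw [e1, e1, e2]
    have hfy := norm_mon_le y r hr hy f
    have hgw := norm_mon_le w r hr hw g
    set fy := f.prod (fun k e => y k ^ e)
    set fw := f.prod (fun k e => w k ^ e)
    set gy := g.prod (fun k e => y k ^ e)
    set gw := g.prod (fun k e => w k ^ e)
    set df := f.sum (fun _ e => e)
    set dg := g.sum (fun _ e => e)
    have : fy * gy - fw * gw = fy * (gy - gw) + (fy - fw) * gw := by ring
    rw [this]
    calc _ ≤ ‖fy‖ * ‖gy - gw‖ + ‖fy - fw‖ * ‖gw‖ := by
          refine (norm_add_le _ _).trans ?_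
          rw [norm_mul, norm_mul]
      _ ≤ r ^ df * (dg * r ^ dg * δ) + (df * r ^ df * δ) * r ^ dg := by
          have := hf.trans' (norm_nonneg _)
          gcongr
      _ = _ := by push_cast; ring
  | single k e =>
    rw [Finsupp.prod_single_index (h := fun k e => y k ^ e) (pow_zero _), Finsupp.prod_single_index (h := fun k e => w k ^ e) (pow_zero _), Finsupp.sum_single_index (h := fun _ e => e) rfl]
    induction e with
    | zero => simp
    | succ e ih =>
      have hδ0 := (norm_nonneg _).trans (hδ k)
      have : y k ^ (e + 1) - w k ^ (e + 1) = y k * (y k ^ e - w k ^ e) + (y k - w k) * w k ^ e := by ring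
      rw [this]
      calc _ ≤ ‖y k‖ * ‖y k ^ e - w k ^ e‖ + ‖y k - w k‖ * ‖w k‖ ^ e := by
            refine (norm_add_le _ _).trans ?_
            rw [norm_mul, norm_mul, norm_pow]
        _ ≤ r * (e * r ^ e * δ) + δ * r ^ e := by
            gcongr
            · exact hy k
            · exact hδ k
            · exact hw k
        _ ≤ r * (e * r ^ e * δ) + δ * r ^ (e + 1) := by
            gcongr
            omega
        _ = _ := by push_cast; ring

theorem aeval_lip {n : Type} [Fintype n] (B : MvPolynomial n ℤ) (y w : n → ℂ) (r δ : ℝ) (hr : 1 ≤ r)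
    (hy : ∀ k, ‖y k‖ ≤ r) (hw : ∀ k, ‖w k‖ ≤ r) (hδ0 : 0 ≤ δ)
    (hδ : ∀ k, ‖y k - w k‖ ≤ δ) (b : ℕ) (hb : B.totalDegree ≤ b) :
    ‖MvPolynomial.aeval y B - MvPolynomial.aeval w B‖ ≤ l1 B * (b * r ^ b * δ) := by
  rw [aeval_sum, aeval_sum, l1, Finset.sum_mul, ← Finset.sum_sub_distrib]
  refine (norm_sum_le _ _).trans (Finset.sum_le_sum fun m hm => ?_)
  rw [← mul_sub, norm_mul]
  have h1 : ‖((B.coeff m : ℤ) : ℂ)‖ = |((B.coeff m : ℤ) : ℝ)| := by simp [Complex.norm_intCast]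
  rw [h1]
  refine mul_le_mul_of_nonneg_left ?_ (abs_nonneg _)
  refine (mon_lip y w r δ hr hy hw hδ m).trans ?_
  have h2 := (MvPolynomial.le_totalDegree hm).trans hb
  gcongr

variable {μ : Type} [Fintype μ]

structure Good (ω : μ → ℂ) (R : ℝ) : Prop where
  sum : 1 + ∑ k, ‖ω k‖ ≤ R
  two : (2:ℝ) ^ Fintype.card (Option μ) ≤ R
  three : 3 ≤ R

theorem Good.norm {ω : μ → ℂ} {R : ℝ} (h : Good ω R) : 1 + ‖ω‖ ≤ R := by
  refine le_trans ?_ h.sum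
  gcongr
  rw [pi_norm_le_iff_of_nonneg (Finset.sum_nonneg fun _ _ => norm_nonneg _)]
  exact fun k => Finset.single_le_sum (f := fun k => ‖ω k‖) (fun _ _ => norm_nonneg _) (Finset.mem_univ k)

theorem point_bound {ω : μ → ℂ} {R : ℝ} (h : Good ω R) (B : MvPolynomial μ ℤ) (s : ℕ) (hs : 1 ≤ s)
    (hd : B.totalDegree ≤ s) (hl : l1 B ≤ Real.exp s) (β : ℝ) (hβ : ‖MvPolynomial.aeval ω B‖ ≤ β) (y : μ → ℂ) :
    ‖MvPolynomial.aeval y B‖ ≤ R ^ (4 * s) * max 1 ‖y‖ ^ s * max β (min 1 ‖y - ω‖) := by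
  have hR := h.three
  have hm : (1:ℝ) ≤ max 1 ‖y‖ := le_max_left _ _
  have hlR : l1 B ≤ R ^ s := by
    refine hl.trans ?_
    have : Real.exp s = Real.exp 1 ^ s := by rw [← Real.exp_nat_mul, mul_one]
    rw [this]
    gcongr
    linarith [Real.exp_one_lt_d9]
  rcases le_or_gt 1 ‖y - ω‖ with h1 | h1
  · rw [min_eq_left h1]
    have h2 := norm_aeval_le B y (max 1 ‖y‖) hm (fun k => (norm_le_pi_norm y k).trans (le_max_right _ _)) s hd
    calc _ ≤ l1 B * max 1 ‖y‖ ^ s := h2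
      _ ≤ R ^ (4 * s) * max 1 ‖y‖ ^ s := by
          gcongr
          refine hlR.trans (pow_le_pow_right₀ (by linarith) (by omega))
      _ ≤ _ := le_mul_of_one_le_right (by positivity) (le_max_right _ _)
  · rw [min_eq_right h1.le]
    have hy : ‖y‖ ≤ R := by
      calc ‖y‖ = ‖(y - ω) + ω‖ := by simp
        _ ≤ ‖y - ω‖ + ‖ω‖ := norm_add_le _ _
        _ ≤ R := by linarith [h.norm]
    have hw : ‖ω‖ ≤ R := by linarith [h.norm]
    have h2 := aeval_lip B y ω R ‖y - ω‖ (by linarith) (fun k => (norm_le_pi_norm y k).trans hy)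
      (fun k => (norm_le_pi_norm ω k).trans hw) (norm_nonneg _) (fun k => norm_le_pi_norm (y - ω) k) s hd
    set E := max β ‖y - ω‖ with hE
    have hβ' : ‖MvPolynomial.aeval ω B‖ ≤ E := hβ.trans (le_max_left _ _)
    have hE0 : 0 ≤ E := (norm_nonneg _).trans hβ'
    have hsR : (s : ℝ) ≤ R ^ s := by
      have : (s:ℝ) ≤ 2 ^ s := by exact_mod_cast Nat.lt_two_pow_self.le
      exact this.trans (pow_le_pow_left₀ (by norm_num) (by linarith) _)
    have hRs1 : 1 + R ^ (3 * s) ≤ R ^ (4 * s) := by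
      have e : R ^ (4 * s) = R ^ (3 * s) * R ^ s := by rw [← pow_add]; congr 1; omega
      have h3 : 2 ≤ R ^ s := by
        calc (2:ℝ) ≤ R ^ 1 := by linarith
          _ ≤ R ^ s := pow_le_pow_right₀ (by linarith) hs
      have h4 : 1 ≤ R ^ (3 * s) := one_le_pow₀ (by linarith)
      rw [e]; nlinarith
    calc ‖MvPolynomial.aeval y B‖ = ‖MvPolynomial.aeval ω B + (MvPolynomial.aeval y B - MvPolynomial.aeval ω B)‖ := by simp
      _ ≤ E + l1 B * (s * R ^ s * ‖y - ω‖) := (norm_add_le _ _).trans (add_le_add hβ' h2)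
      _ ≤ E + R ^ s * (R ^ s * R ^ s * E) := by
          gcongr
          exact le_max_right _ _
      _ = (1 + R ^ (3 * s)) * E := by ring
      _ ≤ R ^ (4 * s) * E := by gcongr
      _ ≤ _ := by
          refine mul_le_mul_of_nonneg_right ?_ hE0
          exact le_mul_of_one_le_right (by positivity) (one_le_pow₀ hm)

theorem pn_lf (w : μ → ℂ) : max 1 ‖w‖ ≤ pn 1 (lf w) := by
  classical
  apply max_le
  · have := le_pn (R := 1) (lf w) (z := e0) (by rintro (_ | k) <;> simp [e0])
    rw [eval_e0_lf] at this
    simpa using this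
  · rw [pi_norm_le_iff_of_nonneg (pn_nonneg zero_le_one _)]
    intro k
    have := le_pn (R := 1) (lf w) (z := fun o => if o = some k then 1 else 0) (by intro o; split_ifs <;> simp)
    simpa [lf] using this

variable {ι : Type} [Fintype ι]

theorem eval_map_spl (F : PP μ (Option ι)) (u : ι × Option μ → ℂ) (v : Option μ → ℂ) :
    MvPolynomial.eval v (MvPolynomial.map (MvPolynomial.aeval u : PP μ ι →ₐ[ℤ] ℂ).toRingHom (spl ℤ ι (Option μ) F)) =
      MvPolynomial.aeval (ext0 v u) F := by
  rw [aeval_ext0, MvPolynomial.eval_map]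

theorem totalDegree_lf_le (w : μ → ℂ) : (lf w).totalDegree ≤ 1 := by
  rw [lf]
  refine (MvPolynomial.totalDegree_add _ _).trans (max_le (by simp) ?_)
  refine MvPolynomial.totalDegree_finsetSum_le fun k _ => ?_
  refine (MvPolynomial.totalDegree_mul _ _).trans ?_
  simp

variable {J : Type} [Fintype J]

theorem core_A (F : PP μ (Option ι)) (u : ι × Option μ → ℂ) (a : ℂ) (Y : J → μ → ℂ) (R : ℝ) (hR : 1 ≤ R)
    (hu : ∀ p, ‖u p‖ ≤ R)
    (h : MvPolynomial.map (MvPolynomial.aeval u : PP μ ι →ₐ[ℤ] ℂ).toRingHom (spl ℤ ι (Option μ) F) =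
      MvPolynomial.C a * ∏ j, lf (Y j)) :
    ‖a‖ * ∏ j, max 1 ‖Y j‖ ≤ 2 ^ (Fintype.card (Option μ) * Fintype.card J) * pn R (cx F) := by
  have h1 : ∏ j, max 1 ‖Y j‖ ≤ ∏ j, pn 1 (lf (Y j)) :=
    Finset.prod_le_prod (fun _ _ => le_trans zero_le_one (le_max_left _ _)) (fun j _ => pn_lf (Y j))
  have h2 := prod_pn_le Finset.univ (fun j => lf (Y j)) (fun _ => 1) (fun j _ => totalDegree_lf_le _) 1 one_pos
  simp only [Finset.sum_const, Finset.card_univ, smul_eq_mul, mul_one] at h2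
  obtain ⟨z, hz, hz'⟩ := exists_pn (R := 1) zero_le_one (∏ j, lf (Y j))
  have h3 := eval_map_spl F u z
  rw [h, map_mul, MvPolynomial.eval_C, ← eval_cx] at h3
  have h4 : ‖a‖ * pn 1 (∏ j, lf (Y j)) ≤ pn R (cx F) := by
    rw [← hz', ← norm_mul, h3]
    apply le_pn
    rintro ⟨_ | i, o⟩
    · exact (hz o).trans hR
    · exact hu _
  calc _ ≤ ‖a‖ * (2 ^ (Fintype.card (Option μ) * Fintype.card J) * pn 1 (∏ j, lf (Y j))) := by
        gcongr; exact h1.trans h2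
    _ = 2 ^ (Fintype.card (Option μ) * Fintype.card J) * (‖a‖ * pn 1 (∏ j, lf (Y j))) := by ring
    _ ≤ _ := by gcongr

theorem core_g (F : PP μ (Option ι)) (u : ι × Option μ → ℂ) (a : ℂ) (ha : a ≠ 0) (Y : J → μ → ℂ)
    (h : MvPolynomial.map (MvPolynomial.aeval u : PP μ ι →ₐ[ℤ] ℂ).toRingHom (spl ℤ ι (Option μ) F) =
      MvPolynomial.C a * ∏ j, lf (Y j)) : Fintype.card J ≤ F.totalDegree := by
  by_contra hlt
  push Not at hlt
  let U := max 1 ‖u‖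
  have hU : 1 ≤ U := le_max_left _ _
  have ha' : 0 < ‖a‖ := norm_pos_iff.mpr ha
  let D := F.totalDegree
  have key : ∀ t : ℝ, 1 ≤ t → ‖a‖ * t ≤ l1 F * U ^ D := by
    intro t ht
    have h1 := eval_map_spl F u (fun o => t * e0 o)
    rw [h, map_mul, MvPolynomial.eval_C, map_prod] at h1
    have h2 : ∀ j, MvPolynomial.eval (fun o : Option μ => (t:ℂ) * e0 o) (lf (Y j)) = t := by
      intro j; simp [lf, e0]
    simp only [h2, Finset.prod_const, Finset.card_univ] at h1
    have h3 := norm_aeval_le F (ext0 (fun o => (t:ℂ) * e0 o) u) (t * U) (by nlinarith) (by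
      rintro ⟨_ | i, o⟩
      · rcases o with _ | k
        · simp only [ext0, e0, Option.elim]
          rw [mul_one, Complex.norm_real, Real.norm_of_nonneg (by linarith)]
          nlinarith
        · simp [ext0, e0]; positivity
      · simp only [ext0, Option.elim]
        have : ‖u (i, o)‖ ≤ U := (norm_le_pi_norm u _).trans (le_max_right _ _)
        nlinarith) D le_rfl
    rw [← h1, norm_mul, norm_pow, Complex.norm_real, Real.norm_of_nonneg (by linarith)] at h3
    have h4 : t ^ (D + 1) ≤ t ^ Fintype.card J := pow_le_pow_right₀ ht hlt
    have h5 : ‖a‖ * t * t ^ D ≤ (l1 F * U ^ D) * t ^ D := by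
      calc _ = ‖a‖ * t ^ (D + 1) := by ring
        _ ≤ ‖a‖ * t ^ Fintype.card J := by gcongr
        _ ≤ _ := h3
        _ = _ := by rw [mul_pow]; ring
    exact le_of_mul_le_mul_right h5 (by positivity)
  have hl := l1_nonneg F
  have h6 := key (1 + (l1 F * U ^ D) / ‖a‖) (by
    have : 0 ≤ (l1 F * U ^ D) / ‖a‖ := by positivity
    linarith)
  rw [mul_add, mul_div_cancel₀ _ ha'.ne'] at h6
  linarith

theorem norm_le_pn_linear (c : μ → ℂ) : ‖c‖ ≤ pn 1 (∑ k, MvPolynomial.C (c k) * MvPolynomial.X k : MvPolynomial μ ℂ) := by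
  classical
  rw [pi_norm_le_iff_of_nonneg (pn_nonneg zero_le_one _)]
  intro k
  have := le_pn (R := 1) (∑ k, MvPolynomial.C (c k) * MvPolynomial.X k : MvPolynomial μ ℂ)
    (z := fun o => if o = k then 1 else 0) (by intro o; split_ifs <;> simp)
  simpa using this

/-- joint orthogonal extension -/
theorem ext0_orth (ω : μ → ℂ) (v : μ → ℂ) (u : ι × μ → ℂ) :
    ext0 (fun o => o.elim (-∑ k, ω k * v k) v) (orth ω u) =
      orth ω (fun p : Option ι × μ => p.1.elim (v p.2) (fun i => u (i, p.2))) := by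
  funext p
  rcases p with ⟨_ | i, _ | k⟩ <;> simp [ext0, orth]

theorem core_eval (F : PP μ (Option ι)) (ω : μ → ℂ) (u : ι × μ → ℂ) (a : ℂ) (Y : J → μ → ℂ)
    (h : MvPolynomial.map (MvPolynomial.aeval (orth ω u) : PP μ ι →ₐ[ℤ] ℂ).toRingHom (spl ℤ ι (Option μ) F) =
      MvPolynomial.C a * ∏ j, lf (Y j)) (v : μ → ℂ) :
    a * MvPolynomial.eval v (∏ j, ∑ k, MvPolynomial.C (Y j k - ω k) * MvPolynomial.X k) =
      MvPolynomial.eval (fun p : Option ι × μ => p.1.elim (v p.2) (fun i => u (i, p.2))) (sub (Option ι) ω F) := by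
  rw [eval_sub, ← ext0_orth, ← eval_map_spl, h, map_mul, MvPolynomial.eval_C, map_prod, map_prod]
  congr 1
  refine Finset.prod_congr rfl fun j _ => ?_
  simp only [lf, map_sum, map_add, map_mul, MvPolynomial.eval_C, MvPolynomial.eval_X, Option.elim]
  rw [neg_add_eq_sub, ← Finset.sum_sub_distrib]
  exact Finset.sum_congr rfl fun k _ => by ring

theorem core_δ (F : PP μ (Option ι)) (ω : μ → ℂ) (u : ι × μ → ℂ) (hu : ∀ p, ‖u p‖ ≤ 1) (a : ℂ) (Y : J → μ → ℂ)
    (h : MvPolynomial.map (MvPolynomial.aeval (orth ω u) : PP μ ι →ₐ[ℤ] ℂ).toRingHom (spl ℤ ι (Option μ) F) =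
      MvPolynomial.C a * ∏ j, lf (Y j)) :
    ‖a‖ * ∏ j, ‖Y j - ω‖ ≤ 2 ^ (Fintype.card μ * Fintype.card J) * pn 1 (sub (Option ι) ω F) := by
  let f : J → MvPolynomial μ ℂ := fun j => ∑ k, MvPolynomial.C (Y j k - ω k) * MvPolynomial.X k
  have h1 : ∏ j, ‖Y j - ω‖ ≤ ∏ j, pn 1 (f j) :=
    Finset.prod_le_prod (fun _ _ => norm_nonneg _) (fun j _ => norm_le_pn_linear (Y j - ω))
  have hd : ∀ j, (f j).totalDegree ≤ 1 := by
    intro j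
    refine MvPolynomial.totalDegree_finsetSum_le fun k _ => ?_
    refine (MvPolynomial.totalDegree_mul _ _).trans ?_
    rw [MvPolynomial.totalDegree_C]
    simp
  have h2 := prod_pn_le Finset.univ f (fun _ => 1) (fun j _ => hd j) 1 one_pos
  simp only [Finset.sum_const, Finset.card_univ, smul_eq_mul, mul_one] at h2
  obtain ⟨z, hz, hz'⟩ := exists_pn (R := 1) zero_le_one (∏ j, f j)
  have h3 := core_eval F ω u a Y h z
  have h4 : ‖a‖ * pn 1 (∏ j, f j) ≤ pn 1 (sub (Option ι) ω F) := by
    rw [← hz', ← norm_mul, h3]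
    apply le_pn
    rintro ⟨_ | i, o⟩
    · exact hz o
    · exact hu _
  calc _ ≤ ‖a‖ * (2 ^ (Fintype.card μ * Fintype.card J) * pn 1 (∏ j, f j)) := by
        gcongr; exact h1.trans h2
    _ = 2 ^ (Fintype.card μ * Fintype.card J) * (‖a‖ * pn 1 (∏ j, f j)) := by ring
    _ ≤ _ := by gcongr

end est
end Nes

open Complex
namespace Nes
section stage
set_option linter.unusedSectionVars false
variable {μ : Type} [Fintype μ] {ι : Type} [Fintype ι]

theorem one_le_pn_cx {n : Type} [Fintype n] (F : MvPolynomial n ℤ) (hF : F ≠ 0) {R : ℝ} (hR : 3 ≤ R) :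
    1 ≤ pn R (cx F) :=
  (one_le_pow₀ (by linarith)).trans (pow_le_pn F hF R (by linarith))

theorem deg_le_log {n : Type} [Fintype n] (F : MvPolynomial n ℤ) (hF : F ≠ 0) {R : ℝ} (hR : 3 ≤ R) :
    (F.totalDegree : ℝ) ≤ Real.log (pn R (cx F)) := by
  have h := Real.log_le_log (by positivity) (pow_le_pn F hF R (by linarith))
  rw [Real.log_pow] at h
  have h1 : 1 ≤ Real.log R := by
    rw [Real.le_log_iff_exp_le (by linarith)]
    linarith [Real.exp_one_lt_d9]
  have : (0:ℝ) ≤ F.totalDegree := by positivity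
  nlinarith

theorem eq_C_of_deg {n : Type} (F : MvPolynomial n ℤ) (h : F.totalDegree = 0) : ∃ c, F = MvPolynomial.C c :=
  ⟨_, MvPolynomial.totalDegree_eq_zero_iff_eq_C.mp h⟩

theorem log_two_le {n : Type} [Fintype n] (F : MvPolynomial n ℤ) (hF : Prime F) {R : ℝ} (hR : 3 ≤ R) :
    Real.log 2 ≤ Real.log (pn R (cx F)) := by
  apply Real.log_le_log (by norm_num)
  rcases Nat.eq_zero_or_pos F.totalDegree with h | h
  · obtain ⟨c, rfl⟩ := eq_C_of_deg F h
    have h0 : c ≠ 0 := fun h => hF.ne_zero (by rw [h, map_zero])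
    have h1 : ¬ IsUnit c := fun h => hF.not_isUnit (h.map MvPolynomial.C)
    have h2 : 2 ≤ |c| := by
      rw [Int.isUnit_iff_abs_eq] at h1
      have := abs_pos.mpr h0
      omega
    have h3 := le_pn (R := R) (cx (MvPolynomial.C c : MvPolynomial n ℤ)) (z := 0) (by intro k; simp; linarith)
    rw [eval_cx] at h3
    refine le_trans ?_ h3
    rw [MvPolynomial.aeval_C, algebraMap_int_eq, eq_intCast, Complex.norm_intCast]
    exact_mod_cast h2
  · refine le_trans ?_ (pow_le_pn F hF.ne_zero R (by linarith))
    calc (2:ℝ) ≤ R ^ 1 := by linarith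
      _ ≤ R ^ F.totalDegree := pow_le_pow_right₀ (by linarith) h

theorem rs_C (ω : μ → ℂ) (c : ℤ) (hc : c ≠ 0) : 1 ≤ pn 1 (sub ι ω (MvPolynomial.C c)) := by
  have h3 := le_pn (R := 1) (sub ι ω (MvPolynomial.C c)) (z := 0) (by intro k; simp)
  rw [eval_sub] at h3
  refine le_trans ?_ h3
  rw [MvPolynomial.aeval_C, algebraMap_int_eq, eq_intCast, Complex.norm_intCast]
  exact_mod_cast Int.one_le_abs hc

theorem log_pos_prime {n : Type} [Fintype n] (F : MvPolynomial n ℤ) (hF : Prime F) {R : ℝ} (hR : 3 ≤ R) :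
    0 < Real.log (pn R (cx F)) := (Real.log_pos (by norm_num)).trans_le (log_two_le F hF hR)

theorem multiset_prod_exp_lt {α : Type*} (s : Multiset α) (f : α → ℝ) (t : α → ℝ) 
    (h : ∀ a ∈ s, Real.exp (t a) ≤ f a) : Real.exp ((s.map t).sum) ≤ (s.map f).prod := by
  induction s using Multiset.induction_on with
  | empty => simp
  | cons a s ih =>
    simp only [Multiset.map_cons, Multiset.sum_cons, Multiset.prod_cons]
    rw [Real.exp_add]
    have h1 := h a (by simp)
    exact mul_le_mul h1 (ih fun b hb => h b (by simp [hb])) (Real.exp_pos _).le ((Real.exp_pos _).le.trans h1)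

theorem totalDegree_prod_ne_zero {n : Type} {k : ℕ} (g : Fin k → MvPolynomial n ℤ) (hg : ∀ i, g i ≠ 0) :
    (∏ i, g i).totalDegree = ∑ i, (g i).totalDegree := by
  induction k with
  | zero => simp
  | succ k ih =>
    rw [Fin.prod_univ_succ, Fin.sum_univ_succ, MvPolynomial.totalDegree_mul_of_isDomain (hg 0)
      (Finset.prod_ne_zero_iff.mpr fun i _ => hg _), ih _ fun i => hg _]

theorem select {ω : μ → ℂ} {R : ℝ} (hR : 3 ≤ R) (N : PP μ ι) (hN : N ≠ 0) (τ ρ : ℝ) (hρ : 0 ≤ ρ)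
    (hτ : Real.log (pn R (cx N)) ≤ τ)
    (hr : pn 1 (sub ι ω N) < Real.exp (-((ρ * (Fintype.card (ι × Option μ) + 1) + Fintype.card (ι × Option μ)) * τ))) :
    ∃ S, Prime S ∧ S ∣ N ∧ pn 1 (sub ι ω S) ≤ Real.exp (-(ρ * Real.log (pn R (cx S)))) := by
  classical
  by_contra hcon
  push Not at hcon
  obtain ⟨f, hf, u, hu⟩ := UniqueFactorizationMonoid.exists_prime_factors N hN
  -- list the factors
  obtain ⟨l, rfl⟩ := Quotient.exists_rep f
  change (∀ b ∈ (↑l : Multiset (PP μ ι)), Prime b) at hf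
  change (↑l : Multiset (PP μ ι)).prod * u = N at hu
  set n : ℝ := ((Fintype.card (ι × Option μ) : ℕ) : ℝ) with hn
  let g : Fin l.length → PP μ ι := fun i => l.get i
  have hg : ∀ i, Prime (g i) := fun i => hf _ (by simp [g])
  have hgN : ∀ i, g i ∣ N := fun i => by
    rw [← hu]; exact Dvd.dvd.mul_right (Multiset.dvd_prod (by simp [g])) _
  have hprod : (∏ i, g i) * u = N := by
    rw [← hu]; congr 1
    simp only [g, Multiset.prod_coe]
    rw [← List.prod_ofFn, List.ofFn_get]
  obtain ⟨c, hc, hcu⟩ : ∃ c : ℤ, IsUnit c ∧ (u : PP μ ι) = MvPolynomial.C c := by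
    have := u.isUnit
    rw [MvPolynomial.isUnit_iff_eq_C_of_isReduced] at this
    obtain ⟨c, hc, h⟩ := this
    exact ⟨c, hc, h⟩
  have hcn : ‖(c:ℂ)‖ = 1 := by
    rw [Complex.norm_intCast]
    rcases Int.isUnit_iff.mp hc with rfl | rfl <;> simp
  have hprod' : N = (∏ i, g i) * MvPolynomial.C c := by rw [← hprod, hcu]
  have hP0 : (∏ i, g i) ≠ 0 := Finset.prod_ne_zero_iff.mpr fun i _ => (hg i).ne_zero
  have hdeg : ∑ i, (g i).totalDegree = N.totalDegree := by
    rw [hprod', MvPolynomial.totalDegree_mul_of_isDomain hP0 (by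
      simp only [ne_eq, MvPolynomial.C_eq_zero]; rintro rfl; simp at hc), MvPolynomial.totalDegree_C, add_zero]
    exact (totalDegree_prod_ne_zero g (fun i => (hg i).ne_zero)).symm
  have hD : (2:ℝ) ^ N.totalDegree ≤ pn R (cx N) :=
    (pow_le_pow_left₀ (by norm_num) (by linarith) _).trans (pow_le_pn N hN R (by linarith))
  have hnr1 := one_le_pn_cx N hN hR
  have hDN : ∀ k : ℕ, (k:ℝ) ≤ n → (2:ℝ) ^ (k * N.totalDegree) ≤ Real.exp (n * Real.log (pn R (cx N))) := by
    intro k hk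
    rw [mul_comm k, pow_mul]
    calc _ ≤ (pn R (cx N)) ^ k := pow_le_pow_left₀ (by positivity) hD _
      _ = Real.exp (k * Real.log (pn R (cx N))) := by
          rw [mul_comm, Real.exp_mul, Real.exp_log (by linarith), Real.rpow_natCast]
      _ ≤ _ := by
          have := Real.log_nonneg hnr1
          gcongr
  have hmulc : ∀ {m : Type} [Fintype m] (P : MvPolynomial m ℂ) (r : ℝ), 0 ≤ r →
      pn r P ≤ pn r (P * MvPolynomial.C (c:ℂ)) := by
    intro m _ P r hr
    obtain ⟨z, hz, hz'⟩ := exists_pn hr P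
    rw [← hz']
    refine le_trans ?_ (le_pn (P * MvPolynomial.C (c:ℂ)) hz)
    rw [map_mul, MvPolynomial.eval_C, norm_mul, hcn, mul_one]
  have h1 := prod_pn_le Finset.univ (fun i => cx (g i)) (fun i => (g i).totalDegree)
    (fun i _ => totalDegree_cx_le _) R (by linarith)
  have h2 := prod_pn_le Finset.univ (fun i => sub ι ω (g i)) (fun i => (g i).totalDegree)
    (fun i _ => totalDegree_sub_le _ _) 1 one_pos
  rw [hdeg] at h1 h2
  have e1 : pn R (∏ i, cx (g i)) ≤ pn R (cx N) := by
    have : cx N = (∏ i, cx (g i)) * MvPolynomial.C (c:ℂ) := by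
      rw [hprod']; simp [cx, map_prod]
    rw [this]; exact hmulc _ _ (by linarith)
  have e2 : pn 1 (∏ i, sub ι ω (g i)) ≤ pn 1 (sub ι ω N) := by
    have : sub ι ω N = (∏ i, sub ι ω (g i)) * MvPolynomial.C (c:ℂ) := by
      rw [hprod', map_mul, map_prod]; congr 1
      simp only [eq_intCast, map_intCast]
    rw [this]; exact hmulc _ _ zero_le_one
  have f1 : ∑ i, Real.log (pn R (cx (g i))) ≤ (n + 1) * Real.log (pn R (cx N)) := by
    have hpos : ∀ i, 0 < pn R (cx (g i)) := fun i => by linarith [one_le_pn_cx (g i) (hg i).ne_zero hR]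
    rw [← Real.log_prod (fun i _ => (hpos i).ne')]
    have : ∏ i, pn R (cx (g i)) ≤ Real.exp ((n + 1) * Real.log (pn R (cx N))) := by
      refine h1.trans ?_
      rw [add_mul, one_mul, Real.exp_add, Real.exp_log (by linarith : (0:ℝ) < pn R (cx N))]
      exact mul_le_mul (hDN _ le_rfl) e1 (pn_nonneg (by linarith) _) (Real.exp_pos _).le
    rw [Real.log_le_iff_le_exp (Finset.prod_pos fun i _ => hpos i)]
    exact this
  have f2 : Real.exp (∑ i, -(ρ * Real.log (pn R (cx (g i))))) ≤ ∏ i, pn 1 (sub ι ω (g i)) := by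
    rw [Real.exp_sum]
    exact Finset.prod_le_prod (fun _ _ => (Real.exp_pos _).le) (fun i _ => (hcon (g i) (hg i) (hgN i)).le)
  have f3 : ∏ i, pn 1 (sub ι ω (g i)) ≤ Real.exp (n * Real.log (pn R (cx N))) * pn 1 (sub ι ω N) := by
    refine h2.trans (mul_le_mul (hDN _ ?_) e2 (pn_nonneg zero_le_one _) (Real.exp_pos _).le)
    rw [hn]
    simp only [Fintype.card_prod, Fintype.card_option]
    exact_mod_cast Nat.mul_le_mul_left _ (Nat.le_succ _)
  have f4 := (f2.trans f3).trans_lt (mul_lt_mul_of_pos_left hr (Real.exp_pos _))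
  rw [← Real.exp_add, Real.exp_lt_exp, Finset.sum_neg_distrib, ← Finset.mul_sum] at f4
  have hn0 : 0 ≤ n := by positivity
  have hL := Real.log_nonneg hnr1
  have f5 := mul_le_mul_of_nonneg_left f1 hρ
  have f6 := mul_le_mul_of_nonneg_left hτ (mul_nonneg hρ (by linarith : 0 ≤ n + 1))
  have f7 := mul_le_mul_of_nonneg_left hτ hn0
  nlinarith

end stage
end Nes

open Complex
namespace Nes
section stage
set_option linter.unusedSectionVars false
variable {μ : Type} [Fintype μ] {ι : Type} [Fintype ι] {J : Type} [Fintype J]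

theorem Rpow_le {R : ℝ} (hR : 3 ≤ R) (F : PP μ (Option ι)) (hF0 : F ≠ 0) (g : ℕ) (hg : g ≤ F.totalDegree) :
    R ^ g ≤ pn R (cx F) :=
  (pow_le_pow_right₀ (by linarith) hg).trans (pow_le_pn F hF0 R (by linarith))

theorem A_le {ω : μ → ℂ} {R : ℝ} (hG : Good ω R) (F : PP μ (Option ι)) (hF0 : F ≠ 0) (u : ι × Option μ → ℂ)
    (hu : ∀ p, ‖u p‖ ≤ R) (a : ℂ) (ha : a ≠ 0) (Y : J → μ → ℂ)
    (h : MvPolynomial.map (MvPolynomial.aeval u : PP μ ι →ₐ[ℤ] ℂ).toRingHom (spl ℤ ι (Option μ) F) =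
      MvPolynomial.C a * ∏ j, lf (Y j)) : ‖a‖ * ∏ j, max 1 ‖Y j‖ ≤ pn R (cx F) ^ 2 := by
  have hR := hG.three
  have h1 := core_A F u a Y R (by linarith) hu h
  have h2 := Rpow_le hR F hF0 _ (core_g F u a ha Y h)
  have h3 := one_le_pn_cx F hF0 hR
  calc _ ≤ _ := h1
    _ = (2 ^ Fintype.card (Option μ)) ^ Fintype.card J * pn R (cx F) := by rw [pow_mul]
    _ ≤ R ^ Fintype.card J * pn R (cx F) := by
        gcongr
        exact hG.two
    _ ≤ pn R (cx F) * pn R (cx F) := by gcongr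
    _ = _ := by ring

theorem N_le {ω : μ → ℂ} {R : ℝ} (hG : Good ω R) (F : PP μ (Option ι)) (hF0 : F ≠ 0) (u : ι × Option μ → ℂ)
    (a : ℂ) (ha : a ≠ 0) (Y : J → μ → ℂ)
    (h : MvPolynomial.map (MvPolynomial.aeval u : PP μ ι →ₐ[ℤ] ℂ).toRingHom (spl ℤ ι (Option μ) F) =
      MvPolynomial.C a * ∏ j, lf (Y j)) (B : MvPolynomial μ ℤ) (s : ℕ) (hs : 1 ≤ s)
    (hd : B.totalDegree ≤ s) (hl : l1 B ≤ Real.exp s) (β : ℝ) (hβ : ‖MvPolynomial.aeval ω B‖ ≤ β) :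
    ‖a ^ s * ∏ j, MvPolynomial.aeval (Y j) B‖ ≤ (‖a‖ * ∏ j, max 1 ‖Y j‖) ^ s * pn R (cx F) ^ (4 * s) *
      ∏ j, max β (min 1 ‖Y j - ω‖) := by
  have hR := hG.three
  have h2 := Rpow_le hR F hF0 _ (core_g F u a ha Y h)
  have hm : ∀ j, 0 ≤ max β (min 1 ‖Y j - ω‖) := fun j => le_max_of_le_left ((norm_nonneg _).trans hβ)
  have h1 : ∏ j, ‖MvPolynomial.aeval (Y j) B‖ ≤ ∏ j, (R ^ (4 * s) * max 1 ‖Y j‖ ^ s * max β (min 1 ‖Y j - ω‖)) :=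
    Finset.prod_le_prod (fun _ _ => norm_nonneg _) fun j _ => point_bound hG B s hs hd hl β hβ (Y j)
  rw [Finset.prod_mul_distrib, Finset.prod_mul_distrib, Finset.prod_const, Finset.card_univ, Finset.prod_pow] at h1
  have hP : 0 ≤ ∏ j, max β (min 1 ‖Y j - ω‖) := Finset.prod_nonneg fun j _ => hm j
  have hQ : 0 ≤ ∏ j, max 1 ‖Y j‖ := Finset.prod_nonneg fun j _ => by positivity
  rw [norm_mul, norm_pow, norm_prod]
  calc _ ≤ ‖a‖ ^ s * ((R ^ (4 * s)) ^ Fintype.card J * (∏ j, max 1 ‖Y j‖) ^ s * ∏ j, max β (min 1 ‖Y j - ω‖)) := by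
        gcongr
    _ = (‖a‖ * ∏ j, max 1 ‖Y j‖) ^ s * (R ^ Fintype.card J) ^ (4 * s) * ∏ j, max β (min 1 ‖Y j - ω‖) := by
        rw [mul_pow, ← pow_mul, ← pow_mul, mul_comm (4 * s)]; ring
    _ ≤ _ := by gcongr

theorem δ_le {ω : μ → ℂ} {R : ℝ} (hG : Good ω R) (F : PP μ (Option ι)) (hF0 : F ≠ 0) (u : ι × μ → ℂ)
    (hu : ∀ p, ‖u p‖ ≤ 1) (a : ℂ) (ha : a ≠ 0) (Y : J → μ → ℂ)
    (h : MvPolynomial.map (MvPolynomial.aeval (orth ω u) : PP μ ι →ₐ[ℤ] ℂ).toRingHom (spl ℤ ι (Option μ) F) =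
      MvPolynomial.C a * ∏ j, lf (Y j)) :
    (‖a‖ * ∏ j, max 1 ‖Y j‖) * ∏ j, min 1 ‖Y j - ω‖ ≤ pn R (cx F) ^ 2 * pn 1 (sub (Option ι) ω F) := by
  have hR := hG.three
  have h2 := Rpow_le hR F hF0 _ (core_g F _ a ha Y h)
  have h3 := one_le_pn_cx F hF0 hR
  have hr0 := pn_nonneg zero_le_one (sub (Option ι) ω F)
  have h1 := core_δ F ω u hu a Y h
  have hj : ∀ j, max 1 ‖Y j‖ * min 1 ‖Y j - ω‖ ≤ R * ‖Y j - ω‖ := by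
    intro j
    have hn := hG.norm
    have h4 : ‖Y j‖ ≤ ‖Y j - ω‖ + ‖ω‖ := by
      simpa using norm_add_le (Y j - ω) ω
    have h5 := norm_nonneg (Y j - ω)
    have h6 := norm_nonneg ω
    rcases le_or_gt 1 ‖Y j - ω‖ with h7 | h7
    · rw [min_eq_left h7, mul_one]
      apply max_le <;> nlinarith
    · rw [min_eq_right h7.le]
      refine mul_le_mul_of_nonneg_right ?_ h5
      apply max_le <;> linarith
  calc _ = ‖a‖ * ∏ j, (max 1 ‖Y j‖ * min 1 ‖Y j - ω‖) := by rw [Finset.prod_mul_distrib]; ring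
    _ ≤ ‖a‖ * ∏ j, (R * ‖Y j - ω‖) := by
        refine mul_le_mul_of_nonneg_left (Finset.prod_le_prod (fun j _ => ?_) fun j _ => hj j) (norm_nonneg _)
        positivity
    _ = R ^ Fintype.card J * (‖a‖ * ∏ j, ‖Y j - ω‖) := by
        rw [Finset.prod_mul_distrib, Finset.prod_const, Finset.card_univ]; ring
    _ ≤ R ^ Fintype.card J * (2 ^ (Fintype.card μ * Fintype.card J) * pn 1 (sub (Option ι) ω F)) := by gcongr
    _ ≤ R ^ Fintype.card J * (R ^ Fintype.card J * pn 1 (sub (Option ι) ω F)) := by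
        gcongr
        rw [pow_mul]
        gcongr
        refine le_trans ?_ hG.two
        rw [Fintype.card_option]
        gcongr <;> norm_num
    _ ≤ pn R (cx F) * (pn R (cx F) * pn 1 (sub (Option ι) ω F)) := by gcongr
    _ = _ := by ring

theorem orth_bound {ω : μ → ℂ} {R : ℝ} (hG : Good ω R) (u : ι × μ → ℂ) (hu : ∀ p, ‖u p‖ ≤ 1) :
    ∀ p, ‖orth ω u p‖ ≤ R := by
  rintro ⟨i, _ | k⟩
  · simp only [orth, Option.elim]
    rw [norm_neg]
    refine (norm_sum_le _ _).trans (le_trans ?_ hG.sum)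
    have : ∑ k, ‖ω k * u (i, k)‖ ≤ ∑ k, ‖ω k‖ := by
      gcongr with k
      rw [norm_mul]
      exact mul_le_of_le_one_right (norm_nonneg _) (hu _)
    linarith
  · simp only [orth, Option.elim]
    linarith [hu (i, k), hG.three]

/-- a zero of `B` cannot be close to `ω` -/
theorem far {ω : μ → ℂ} {R : ℝ} (hG : Good ω R) (B : MvPolynomial μ ℤ) (s : ℕ) 
    (hd : B.totalDegree ≤ s) (hl : l1 B ≤ Real.exp s) (X : ℝ) (hX : Real.exp (-X) ≤ ‖MvPolynomial.aeval ω B‖)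
    (hX0 : 0 ≤ X)
    (y : μ → ℂ) (hy : MvPolynomial.aeval y B = 0) : Real.exp (-(X + 3 * s * Real.log R)) ≤ min 1 ‖y - ω‖ := by
  have hR := hG.three
  have hlog : 0 ≤ Real.log R := Real.log_nonneg (by linarith)
  apply le_min
  · rw [Real.exp_le_one_iff]
    have : 0 ≤ 3 * s * Real.log R := by positivity
    linarith
  rcases le_or_gt 1 ‖y - ω‖ with h1 | h1
  · refine le_trans ?_ h1
    rw [Real.exp_le_one_iff]
    have : 0 ≤ 3 * s * Real.log R := by positivity
    linarith
  have hlR : l1 B ≤ R ^ s := by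
    refine hl.trans ?_
    have : Real.exp s = Real.exp 1 ^ s := by rw [← Real.exp_nat_mul, mul_one]
    rw [this]
    gcongr
    linarith [Real.exp_one_lt_d9]
  have hy' : ‖y‖ ≤ R := by
    calc ‖y‖ = ‖(y - ω) + ω‖ := by simp
      _ ≤ ‖y - ω‖ + ‖ω‖ := norm_add_le _ _
      _ ≤ R := by linarith [hG.norm]
  have hw : ‖ω‖ ≤ R := by linarith [hG.norm]
  have h2 := aeval_lip B y ω R ‖y - ω‖ (by linarith) (fun k => (norm_le_pi_norm y k).trans hy')
    (fun k => (norm_le_pi_norm ω k).trans hw) (norm_nonneg _) (fun k => norm_le_pi_norm (y - ω) k) s hd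
  rw [hy, zero_sub, norm_neg] at h2
  have hsR : (s : ℝ) ≤ R ^ s := by
    have : (s:ℝ) ≤ 2 ^ s := by exact_mod_cast Nat.lt_two_pow_self.le
    exact this.trans (pow_le_pow_left₀ (by norm_num) (by linarith) _)
  have h3 : ‖MvPolynomial.aeval ω B‖ ≤ Real.exp (3 * s * Real.log R) * ‖y - ω‖ := by
    have e : Real.exp (3 * s * Real.log R) = R ^ s * (R ^ s * R ^ s) := by
      rw [mul_comm, Real.exp_mul, Real.exp_log (by linarith), ← pow_add, ← pow_add, ← Real.rpow_natCast]
      congr 1; push_cast; ring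
    rw [e]
    calc _ ≤ l1 B * (s * R ^ s * ‖y - ω‖) := h2
      _ ≤ R ^ s * (R ^ s * R ^ s * ‖y - ω‖) := by gcongr
      _ = _ := by ring
  rw [neg_add, Real.exp_add]
  have h4 := hX.trans h3
  rw [Real.exp_neg (3 * s * Real.log R), ← div_eq_mul_inv, div_le_iff₀ (Real.exp_pos _)]
  linarith

end stage
end Nes

open Complex
namespace Nes
section stage
set_option linter.unusedSectionVars false
variable {μ : Type} [Fintype μ] 

/-- the state of the elimination process -/
def State (ω : μ → ℂ) (R : ℝ) (ι : Type) [Fintype ι] (ρ X : ℝ) : Prop :=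
  ∃ (κ : Type) (_ : Field κ) (y : μ → κ) (F : PP μ ι), Prime F ∧ IsChow F y ∧
    pn 1 (sub ι ω F) ≤ Real.exp (-(ρ * Real.log (pn R (cx F)))) ∧
    ∃ (B : MvPolynomial μ ℤ) (s : ℕ), B.totalDegree ≤ s ∧ l1 B ≤ Real.exp s ∧
      MvPolynomial.aeval y B = 0 ∧ Real.exp (-X) ≤ ‖MvPolynomial.aeval ω B‖ ∧ (s:ℝ) ≤ X

variable {ω : μ → ℂ} {R : ℝ} {ι : Type} [Fintype ι]

theorem State.not_C {ρ : ℝ} (hρ : 0 < ρ) (hR : 3 ≤ R) (F : PP μ ι) (hF : Prime F)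
    (h : pn 1 (sub ι ω F) ≤ Real.exp (-(ρ * Real.log (pn R (cx F))))) : pn 1 (sub ι ω F) < 1 := by
  refine h.trans_lt ?_
  rw [Real.exp_lt_one_iff]
  have := mul_pos hρ (log_pos_prime F hF hR)
  linarith

theorem State.false_of_empty [IsEmpty ι] {ρ X : ℝ} (hρ : 0 < ρ) (hR : 3 ≤ R) (h : State ω R ι ρ X) : False := by
  obtain ⟨κ, _, y, F, hF, -, h, -⟩ := h
  have h1 := State.not_C hρ hR F hF h
  rw [MvPolynomial.eq_C_of_isEmpty F] at h1
  refine absurd (rs_C (ι := ι) ω _ ?_) (not_le.mpr h1)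
  intro h0
  apply hF.ne_zero
  rw [MvPolynomial.eq_C_of_isEmpty F, h0, map_zero]

/-- the common part of both kinds of stages -/
theorem stage_core (hG : Good ω R) (hω : Free ι ω) {κ : Type} [Field κ] (y : μ → κ) (F : PP μ (Option ι))
    (hfree : Free ι y) (hF : IsChow F y) (hP : Prime F)
    (B : MvPolynomial μ ℤ) (s : ℕ) (hs : 1 ≤ s)
    (hd : B.totalDegree ≤ s) (hl : l1 B ≤ Real.exp s) (hB : MvPolynomial.aeval y B ≠ 0) (X M V ρ' : ℝ) 
    (hX : Real.exp (-X) ≤ ‖MvPolynomial.aeval ω B‖) (hsX : s ≤ X) (hM0 : 0 ≤ M)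
    (hM : ‖MvPolynomial.aeval ω B‖ ≤ Real.exp (-M)) (hρ' : 0 < ρ')
    (hV : ((ρ' * (Fintype.card (ι × Option μ) + 1) + Fintype.card (ι × Option μ)) * (6 * s * Real.log (pn R (cx F)))) < V)
    (key : ∀ u : ι × μ → ℂ, Function.Injective (MvPolynomial.aeval (orth ω u) : PP μ ι →ₐ[ℤ] ℂ) → (∀ p, ‖u p‖ ≤ 1) →
      ∀ (J : Type) (_ : Fintype J) (Y : J → μ → ℂ), 
      MvPolynomial.map (MvPolynomial.aeval (orth ω u) : PP μ ι →ₐ[ℤ] ℂ).toRingHom (spl ℤ ι (Option μ) F) =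
        MvPolynomial.C (MvPolynomial.aeval (orth ω u) (lead F)) * ∏ j, lf (Y j) → 
      (∀ j (B : MvPolynomial μ ℤ), MvPolynomial.aeval y B = 0 → MvPolynomial.aeval (Y j) B = 0) →
      (‖MvPolynomial.aeval (orth ω u) (lead F)‖ * ∏ j, max 1 ‖Y j‖) ^ s * pn R (cx F) ^ (4 * s) *
      ∏ j, max (Real.exp (-M)) (min 1 ‖Y j - ω‖) ≤ Real.exp (-V)) : State ω R ι ρ' X := by
  have hR := hG.three
  obtain ⟨hlead, Nm, hNm, hsplit⟩ := split_main F y hfree hF hP.ne_zero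
  obtain ⟨hN0, hS⟩ := hNm B s hd hB
  have hnr := one_le_pn_cx F hP.ne_zero hR
  -- the trivial bound
  have ht : Real.log (pn R (cx (Nm B s))) ≤ 6 * s * Real.log (pn R (cx F)) := by
    have h1 : pn R (cx (Nm B s)) ≤ pn R (cx F) ^ (6 * s) := by
      refine pn_le_gen (dense_gen ι) (by linarith) _ ?_
      intro u hu huR
      obtain ⟨J, _, Y, hY, -, hN⟩ := hsplit (MvPolynomial.aeval u : PP μ ι →ₐ[ℤ] ℂ).toRingHom hu
      have ha : MvPolynomial.aeval u (lead F) ≠ 0 := fun h => hlead (hu (by rw [h, map_zero]))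
      have h2 := hN B s hd
      change MvPolynomial.aeval u (Nm B s) = (MvPolynomial.aeval u (lead F)) ^ s * _ at h2
      change _ = MvPolynomial.C (MvPolynomial.aeval u (lead F)) * _ at hY
      rw [eval_cx, h2]
      have h3 := A_le hG F hP.ne_zero u huR _ ha Y hY
      refine (N_le hG F hP.ne_zero u _ ha Y hY B s hs hd hl _ hM).trans ?_
      have h4 : ∏ j, max (Real.exp (-M)) (min 1 ‖Y j - ω‖) ≤ 1 := by
        apply Finset.prod_le_one
        · intro j _; positivity
        · intro j _
          exact max_le (by rw [Real.exp_le_one_iff]; linarith) (min_le_left _ _)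
      calc _ ≤ (‖MvPolynomial.aeval u (lead F)‖ * ∏ j, max 1 ‖Y j‖) ^ s * pn R (cx F) ^ (4 * s) * 1 := by
            gcongr
        _ ≤ (pn R (cx F) ^ 2) ^ s * pn R (cx F) ^ (4 * s) * 1 := by gcongr
        _ = _ := by ring
    have := one_le_pn_cx _ hN0 hR
    have := Real.log_le_log (by linarith) h1
    rw [Real.log_pow] at this
    push_cast at this
    exact this
  have hr : pn 1 (sub ι ω (Nm B s)) ≤ Real.exp (-V) := by
    refine pn_le_gen (dense_gen_orth ι ω hω) one_pos _ ?_
    intro u hu hu1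
    obtain ⟨J, _, Y, hY, hz, hN⟩ := hsplit (MvPolynomial.aeval (orth ω u) : PP μ ι →ₐ[ℤ] ℂ).toRingHom hu
    have ha : MvPolynomial.aeval (orth ω u) (lead F) ≠ 0 := fun h => hlead (hu (by rw [h, map_zero]))
    have h2 := hN B s hd
    change MvPolynomial.aeval (orth ω u) (Nm B s) = (MvPolynomial.aeval (orth ω u) (lead F)) ^ s * _ at h2
    change _ = MvPolynomial.C (MvPolynomial.aeval (orth ω u) (lead F)) * _ at hY
    rw [eval_sub, h2]
    exact (N_le hG F hP.ne_zero _ _ ha Y hY B s hs hd hl _ hM).trans (key u hu hu1 J _ Y hY hz)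
  obtain ⟨S, hSp, hSd, hSr⟩ := select (ω := ω) hR (Nm B s) hN0 _ ρ' hρ'.le ht
    (hr.trans_lt (by rw [Real.exp_lt_exp]; linarith))
  have hS1 := State.not_C hρ' hR S hSp hSr
  obtain ⟨κ', _, y', hy', hBy'⟩ := hS S hSp hSd (fun h =>
    absurd (one_le_rs_of_dvd_lead F y hF hP.ne_zero hlead ω S h) (not_le.mpr hS1))
  exact ⟨κ', _, y', S, hSp, hy', hSr, B, s, hd, hl, hBy', hX, hsX⟩

/-- first stage -/
theorem stage_first (hG : Good ω R) (hω : Free ι ω) (F : PP μ (Option ι)) (hF : IsChow F ω) (hP : Prime F)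
    (B : MvPolynomial μ ℤ) (s : ℕ) (hs : 1 ≤ s)
    (hd : B.totalDegree ≤ s) (hl : l1 B ≤ Real.exp s) (X M ρ' : ℝ) 
    (hX : Real.exp (-X) ≤ ‖MvPolynomial.aeval ω B‖) (hsX : s ≤ X) (hM0 : 0 ≤ M)
    (hM : ‖MvPolynomial.aeval ω B‖ ≤ Real.exp (-M)) (hρ' : 0 < ρ')
    (hV : ((ρ' * (Fintype.card (ι × Option μ) + 1) + Fintype.card (ι × Option μ)) * (6 * s * Real.log (pn R (cx F)))) +
      6 * s * Real.log (pn R (cx F)) < M) : State ω R ι ρ' X := by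
  have hR := hG.three
  have hnr := one_le_pn_cx F hP.ne_zero hR
  refine stage_core hG hω ω F hω hF hP B s hs hd hl ?_ X M (M - 6 * s * Real.log (pn R (cx F))) ρ' hX hsX hM0 hM hρ'
    (by linarith) ?_
  · intro h
    rw [h, norm_zero] at hX
    exact absurd hX (not_le.mpr (Real.exp_pos _))
  intro u hu hu1 J _ Y hY hz
  obtain ⟨hlead, -⟩ := split_main F ω hω hF hP.ne_zero
  have ha : MvPolynomial.aeval (orth ω u) (lead F) ≠ 0 := fun h => hlead (hu (by rw [h, map_zero]))
  have h3 := A_le hG F hP.ne_zero (orth ω u) (orth_bound hG u hu1) _ ha Y hY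
  -- some root equals ω
  have hsub : sub (Option ι) ω F = 0 := (hF F).mpr dvd_rfl
  have hz0 : (∏ j, ∑ k, MvPolynomial.C (Y j k - ω k) * MvPolynomial.X k : MvPolynomial μ ℂ) = 0 := by
    apply MvPolynomial.funext
    intro v
    have := core_eval F ω u _ Y hY v
    rw [hsub, map_zero] at this
    rw [map_zero]
    exact (mul_eq_zero.mp this).resolve_left ha
  obtain ⟨j, -, hj⟩ := Finset.prod_eq_zero_iff.mp hz0
  have hYj : Y j - ω = 0 := by
    have := norm_le_pn_linear (Y j - ω)
    have h0 : (∑ k, MvPolynomial.C ((Y j - ω) k) * MvPolynomial.X k : MvPolynomial μ ℂ) = 0 := hj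
    rw [h0] at this
    have h1 : pn 1 (0 : MvPolynomial μ ℂ) ≤ 0 := pn_le zero_le_one _ (fun z _ => by simp)
    exact norm_le_zero_iff.mp (this.trans h1)
  have h4 : ∏ j, max (Real.exp (-M)) (min 1 ‖Y j - ω‖) ≤ Real.exp (-M) := by
    classical
    rw [← Finset.mul_prod_erase _ _ (Finset.mem_univ j)]
    have e : max (Real.exp (-M)) (min 1 ‖Y j - ω‖) = Real.exp (-M) := by
      rw [hYj, norm_zero, min_eq_right zero_le_one, max_eq_left (Real.exp_pos _).le]
    rw [e]
    apply mul_le_of_le_one_right (Real.exp_pos _).le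
    apply Finset.prod_le_one
    · intro j _; positivity
    · intro j _
      exact max_le (by rw [Real.exp_le_one_iff]; linarith) (min_le_left _ _)
  calc _ ≤ (pn R (cx F) ^ 2) ^ s * pn R (cx F) ^ (4 * s) * Real.exp (-M) := by gcongr
    _ = pn R (cx F) ^ (6 * s) * Real.exp (-M) := by ring
    _ = Real.exp (6 * s * Real.log (pn R (cx F))) * Real.exp (-M) := by
        congr 1
        rw [mul_comm (6 * (s:ℝ)), Real.exp_mul, Real.exp_log (by linarith), ← Real.rpow_natCast]
        push_cast; rfl
    _ = _ := by rw [← Real.exp_add]; congr 1; ring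

theorem one_le_prod_real {J : Type} [Fintype J] (f : J → ℝ) (h : ∀ j, 1 ≤ f j) : 1 ≤ ∏ j, f j := by
  have := Finset.prod_le_prod (s := Finset.univ) (f := fun _ : J => (1:ℝ)) (g := f) (fun _ _ => zero_le_one) (fun j _ => h j)
  simpa using this

set_option maxHeartbeats 1000000 in
theorem stage_next (hG : Good ω R) (hω : Free ι ω) {ρ X : ℝ} (hρ : 3 < ρ) (hSt : State ω R (Option ι) ρ X) :
    ∃ d, ρ - 3 ≤ d ∧ d ≤ (1 + 3 * Real.log R) * X ∧ ∀ (B : MvPolynomial μ ℤ) (s : ℕ) (M X' : ℝ), 1 ≤ s →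
      B.totalDegree ≤ s → l1 B ≤ Real.exp s → Real.exp (-X') ≤ ‖MvPolynomial.aeval ω B‖ →
      ‖MvPolynomial.aeval ω B‖ ≤ Real.exp (-M) → s ≤ X' → 0 < M → X' + 3 * s * Real.log R ≤ d - 1 →
      (12 * Fintype.card (ι × Option μ) + 16) * s < ρ * (M / d) →
      State ω R ι (ρ * (M / d) / (12 * (Fintype.card (ι × Option μ) + 1) * s)) X' := by
  have hR := hG.three
  have hlogR : 0 ≤ Real.log R := Real.log_nonneg (by linarith)
  obtain ⟨κ, _, y, F, hP, hF, hrs, B0, s0, hd0, hl0, hB0, hX0, hsX0⟩ := hSt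
  have hF0 := hP.ne_zero
  have hrs1 := State.not_C (by linarith) hR F hP hrs
  have hfree : Free ι y := by
    apply free_of_chow F y hF
    rintro n rfl
    refine absurd (rs_C (ι := Option ι) ω n ?_) (not_le.mpr hrs1)
    rintro rfl
    exact hF0 (map_zero _)
  obtain ⟨hlead, Nm, hNm, hsplit⟩ := split_main F y hfree hF hP.ne_zero
  set T := Real.log (pn R (cx F)) with hT
  have hT2 : Real.log 2 ≤ T := log_two_le F hP hR
  have hlog2 : 0 < Real.log 2 := Real.log_pos (by norm_num)
  have hnr := one_le_pn_cx F hP.ne_zero hR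
  have hnrT : pn R (cx F) = Real.exp T := (Real.exp_log (by linarith)).symm
  -- the set of logarithmic distances
  let D : Set ℝ := {x | ∃ u : ι × μ → ℂ, Function.Injective (MvPolynomial.aeval (orth ω u) : PP μ ι →ₐ[ℤ] ℂ) ∧
      (∀ p, ‖u p‖ ≤ 1) ∧ ∃ (J : Type) (_ : Fintype J) (Y : J → μ → ℂ), 
      MvPolynomial.map (MvPolynomial.aeval (orth ω u) : PP μ ι →ₐ[ℤ] ℂ).toRingHom (spl ℤ ι (Option μ) F) =
        MvPolynomial.C (MvPolynomial.aeval (orth ω u) (lead F)) * ∏ j, lf (Y j) ∧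
      (∀ j (B : MvPolynomial μ ℤ), MvPolynomial.aeval y B = 0 → MvPolynomial.aeval (Y j) B = 0) ∧
      ∃ j, x = -Real.log (min 1 ‖Y j - ω‖)}
  have hfar : ∀ (B : MvPolynomial μ ℤ) (s : ℕ) (X' : ℝ), 
      B.totalDegree ≤ s → l1 B ≤ Real.exp s → Real.exp (-X') ≤ ‖MvPolynomial.aeval ω B‖ → s ≤ X' →
      MvPolynomial.aeval y B = 0 → ∀ x ∈ D, x ≤ X' + 3 * s * Real.log R := by
    rintro B s X' hd hl hX' hs' hB x ⟨u, -, -, J, _, Y, -, hz, j, rfl⟩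
    have := far hG B s hd hl X' hX' (le_trans (by positivity) hs') (Y j) (hz j B hB)
    have h1 := Real.log_le_log (Real.exp_pos _) this
    rw [Real.log_exp] at h1
    linarith
  have hpos : ∀ (Z : μ → ℂ), (∀ (B : MvPolynomial μ ℤ), MvPolynomial.aeval y B = 0 → MvPolynomial.aeval Z B = 0) →
      0 < min 1 ‖Z - ω‖ := fun Z hz =>
    (Real.exp_pos _).trans_le (far hG B0 s0 hd0 hl0 X hX0 (le_trans (by positivity) hsX0) Z (hz B0 hB0))
  have hbdd : BddAbove D := ⟨_, fun x hx => hfar B0 s0 X hd0 hl0 hX0 hsX0 hB0 x hx⟩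
  -- lower bound for the sup
  obtain ⟨u, hu, hu1, hua⟩ : ∃ u : ι × μ → ℂ, Function.Injective (MvPolynomial.aeval (orth ω u) : PP μ ι →ₐ[ℤ] ℂ) ∧
      (∀ p, ‖u p‖ ≤ 1) ∧ 1 / 2 < ‖MvPolynomial.aeval (orth ω u) (lead F)‖ := by
    have h1 := one_le_rs_of_dvd_lead F y hF hF0 hlead ω (lead F) dvd_rfl
    obtain ⟨z, hz, hz'⟩ := exists_pn zero_le_one (sub ι ω (lead F))
    obtain ⟨w, hw, hw1, hw2⟩ := exists_gen_gt (dense_gen_orth ι ω hω) one_pos (sub ι ω (lead F)) z hz (1/2)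
      (by rw [hz']; linarith)
    rw [eval_sub] at hw2
    exact ⟨w, hw, hw1, hw2⟩
  have hδlog : ∀ (u : ι × μ → ℂ) (J : Type) [Fintype J] (Y : J → μ → ℂ), (∀ p, ‖u p‖ ≤ 1) →
      MvPolynomial.aeval (orth ω u) (lead F) ≠ 0 →
      MvPolynomial.map (MvPolynomial.aeval (orth ω u) : PP μ ι →ₐ[ℤ] ℂ).toRingHom (spl ℤ ι (Option μ) F) =
        MvPolynomial.C (MvPolynomial.aeval (orth ω u) (lead F)) * ∏ j, lf (Y j) →
      (∀ j (B : MvPolynomial μ ℤ), MvPolynomial.aeval y B = 0 → MvPolynomial.aeval (Y j) B = 0) →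
      Real.log (‖MvPolynomial.aeval (orth ω u) (lead F)‖ * ∏ j, max 1 ‖Y j‖) + ∑ j, Real.log (min 1 ‖Y j - ω‖) ≤
        2 * T - ρ * T := by
    intro u J _ Y hu1 ha hY hz
    have h1 := δ_le hG F hF0 u hu1 _ ha Y hY
    have hA0 : 0 < ‖MvPolynomial.aeval (orth ω u) (lead F)‖ * ∏ j, max 1 ‖Y j‖ :=
      mul_pos (norm_pos_iff.mpr ha) (Finset.prod_pos fun j _ => by positivity)
    have hδ0 : ∀ j, 0 < min 1 ‖Y j - ω‖ := fun j => hpos (Y j) (hz j)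
    rw [← Real.log_prod (fun j _ => (hδ0 j).ne'), ← Real.log_mul hA0.ne' (Finset.prod_pos fun j _ => hδ0 j).ne']
    rw [Real.log_le_iff_le_exp (mul_pos hA0 (Finset.prod_pos fun j _ => hδ0 j))]
    refine h1.trans ?_
    calc _ ≤ pn R (cx F) ^ 2 * Real.exp (-(ρ * T)) := by gcongr
      _ = Real.exp T ^ 2 * Real.exp (-(ρ * T)) := by rw [hnrT]
      _ = _ := by rw [← Real.exp_nat_mul, ← Real.exp_add]; congr 1
  have hlow : D.Nonempty ∧ ρ - 3 ≤ sSup D := by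
    obtain ⟨J, _, Y, hY, hz, -⟩ := hsplit (MvPolynomial.aeval (orth ω u) : PP μ ι →ₐ[ℤ] ℂ).toRingHom hu
    have ha : MvPolynomial.aeval (orth ω u) (lead F) ≠ 0 := fun h => hlead (hu (by rw [h, map_zero]))
    have h1 := hδlog u J Y hu1 ha hY hz
    have hA : -Real.log 2 ≤ Real.log (‖MvPolynomial.aeval (orth ω u) (lead F)‖ * ∏ j, max 1 ‖Y j‖) := by
      rw [← Real.log_inv]
      apply Real.log_le_log (by norm_num)
      have : 1 ≤ ∏ j, max 1 ‖Y j‖ := one_le_prod_real _ fun j => le_max_left _ _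
      have := norm_nonneg (MvPolynomial.aeval (orth ω u) (lead F))
      nlinarith
    have hg := core_g F _ _ ha Y hY
    have hgT : (Fintype.card J : ℝ) ≤ T := le_trans (by exact_mod_cast hg) (deg_le_log F hF0 hR)
    have hmem : ∀ j, -Real.log (min 1 ‖Y j - ω‖) ∈ D := fun j => ⟨u, hu, hu1, J, _, Y, hY, hz, j, rfl⟩
    have hJ : Nonempty J := by
      by_contra hJ
      rw [not_nonempty_iff] at hJ
      rw [Fintype.sum_empty, add_zero] at h1
      nlinarith
    refine ⟨⟨_, hmem hJ.some⟩, ?_⟩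
    have h2 : ∑ j, -Real.log (min 1 ‖Y j - ω‖) ≤ ∑ _j : J, sSup D := Finset.sum_le_sum fun j _ => le_csSup hbdd (hmem j)
    rw [Finset.sum_neg_distrib, Finset.sum_const, Finset.card_univ, nsmul_eq_mul] at h2
    have hJ1 : (1:ℝ) ≤ Fintype.card J := by exact_mod_cast Fintype.card_pos
    have h3 : (ρ - 2) * Fintype.card J ≤ (ρ - 2) * T := by
      apply mul_le_mul_of_nonneg_left hgT; linarith
    have h4 : Real.log 2 ≤ Fintype.card J := by linarith [Real.log_two_lt_d9]
    by_contra hc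
    push Not at hc
    nlinarith
  obtain ⟨hne, hlow⟩ := hlow
  refine ⟨sSup D, hlow, ?_, ?_⟩
  · refine csSup_le hne fun x hx => (hfar B0 s0 X hd0 hl0 hX0 hsX0 hB0 x hx).trans ?_
    nlinarith
  set d := sSup D with hd'
  have hd0' : 0 < d := by linarith
  intro B s M X' hs hd hl hX' hM hsX' hM0 hXd hbig
  have hMX : M ≤ X' := by
    have := hX'.trans hM
    rw [Real.exp_le_exp] at this
    linarith
  have hs1 : (1:ℝ) ≤ s := by exact_mod_cast hs
  have hMd : M ≤ d := by
    have : 0 ≤ 3 * s * Real.log R := by positivity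
    linarith
  set θ := M / d with hθ
  have hθ0 : 0 < θ := by positivity
  have hθ1 : θ ≤ 1 := by rw [hθ, div_le_one hd0']; exact hMd
  have hT0 : 0 < T := by linarith
  have hρθ : 0 < ρ * θ := mul_pos (by linarith) hθ0
  refine stage_core hG hω y F hfree hF hP B s hs hd hl ?_ X' M ((θ * ρ - 8 * s) * T) _ hX' hsX' hM0.le hM (by positivity) ?_ ?_
  · intro hB
    obtain ⟨x, hx, hx'⟩ := exists_lt_of_lt_csSup hne (show d - 1 < sSup D by linarith)
    have := hfar B s X' hd hl hX' hsX' hB x hx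
    linarith
  · rw [← hT]
    set n : ℝ := ((Fintype.card (ι × Option μ) : ℕ) : ℝ) with hn
    have hn0 : 0 ≤ n := by positivity
    have e : (ρ * θ / (12 * (n + 1) * s) * (n + 1) + n) * (6 * s * T) = (ρ * θ / 2 + 6 * n * s) * T := by
      field_simp; ring
    rw [e]
    apply mul_lt_mul_of_pos_right _ hT0
    nlinarith
  · intro u hu hu1 J _ Y hY hz
    have ha : MvPolynomial.aeval (orth ω u) (lead F) ≠ 0 := fun h => hlead (hu (by rw [h, map_zero]))
    have h1 := hδlog u J Y hu1 ha hY hz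
    have h2 := A_le hG F hF0 (orth ω u) (orth_bound hG u hu1) _ ha Y hY
    have hA0 : 0 < ‖MvPolynomial.aeval (orth ω u) (lead F)‖ * ∏ j, max 1 ‖Y j‖ :=
      mul_pos (norm_pos_iff.mpr ha) (Finset.prod_pos fun j _ => by positivity)
    set A := ‖MvPolynomial.aeval (orth ω u) (lead F)‖ * ∏ j, max 1 ‖Y j‖ with hA
    have h3 : Real.log A ≤ 2 * T := by
      have := Real.log_le_log hA0 h2
      rw [Real.log_pow] at this
      exact_mod_cast this
    have hδ0 : ∀ j, 0 < min 1 ‖Y j - ω‖ := fun j => hpos (Y j) (hz j)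
    have h4 : ∏ j, max (Real.exp (-M)) (min 1 ‖Y j - ω‖) ≤ Real.exp (θ * ∑ j, Real.log (min 1 ‖Y j - ω‖)) := by
      rw [Finset.mul_sum, Real.exp_sum]
      refine Finset.prod_le_prod (fun j _ => by positivity) fun j _ => ?_
      have hdj : -Real.log (min 1 ‖Y j - ω‖) ≤ d := le_csSup hbdd ⟨u, hu, hu1, J, _, Y, hY, hz, j, rfl⟩
      have hj0 : Real.log (min 1 ‖Y j - ω‖) ≤ 0 := Real.log_nonpos (hδ0 j).le (min_le_left _ _)
      apply max_le
      · rw [Real.exp_le_exp]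
        have : M = θ * d := by rw [hθ]; field_simp
        nlinarith
      · conv_lhs => rw [← Real.exp_log (hδ0 j)]
        rw [Real.exp_le_exp]
        nlinarith
    have e1 : A ^ s = Real.exp (s * Real.log A) := by
      rw [mul_comm, Real.exp_mul, Real.exp_log hA0, Real.rpow_natCast]
    have e2 : pn R (cx F) ^ (4 * s) = Real.exp (4 * s * T) := by
      rw [hnrT, ← Real.exp_nat_mul]; push_cast; rfl
    calc _ ≤ Real.exp (s * Real.log A) * Real.exp (4 * s * T) * Real.exp (θ * ∑ j, Real.log (min 1 ‖Y j - ω‖)) := by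
          rw [e1, e2]; gcongr
      _ = Real.exp (s * Real.log A + 4 * s * T + θ * ∑ j, Real.log (min 1 ‖Y j - ω‖)) := by
          rw [Real.exp_add, Real.exp_add]
      _ ≤ _ := by
          rw [Real.exp_le_exp]
          have h5 := mul_le_mul_of_nonneg_left h1 hθ0.le
          have h6 := mul_le_mul_of_nonneg_left h3 (by linarith : 0 ≤ (s:ℝ) - θ)
          have : 0 < s * T := by positivity
          nlinarith

end stage
end Nes

open Complex
namespace Nes
section chain
set_option linter.unusedSectionVars false
variable {μ : Type} [Fintype μ] {ω : μ → ℂ} {R : ℝ} {ι : Type} [Fintype ι]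

/-- the analytic input -/
def Hyp (ω : μ → ℂ) : Prop := ∃ K : ℝ, 1 ≤ K ∧ ∃ N0 : ℕ, 1 ≤ N0 ∧ ∀ N ≥ N0, ∃ (B : MvPolynomial μ ℤ) (s : ℕ) (M : ℝ),
  1 ≤ s ∧ 0 < M ∧ B.totalDegree ≤ s ∧ l1 B ≤ Real.exp s ∧ Real.exp (-(K * M)) ≤ ‖MvPolynomial.aeval ω B‖ ∧
  ‖MvPolynomial.aeval ω B‖ ≤ Real.exp (-M) ∧ Real.log s ≤ 1.01 * Real.log N ∧
  3.99 * Real.log N ≤ Real.log M ∧ Real.log M ≤ 5.01 * Real.log N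

theorem State.mono {ρ ρ' X : ℝ} (hR : 3 ≤ R) (h : State ω R ι ρ X) (hρ : ρ' ≤ ρ) : State ω R ι ρ' X := by
  obtain ⟨κ, _, y, F, hP, hF, hrs, h⟩ := h
  refine ⟨κ, _, y, F, hP, hF, hrs.trans ?_, h⟩
  rw [Real.exp_le_exp]
  have := log_pos_prime F hP hR
  nlinarith

theorem pickN (x : ℝ) (hx : 0 ≤ x) : ∃ N : ℕ, 1 ≤ N ∧ 5.01 * Real.log N ≤ x ∧ x ≤ 5.01 * Real.log N + 5.01 * Real.log 2 := by
  set y := Real.exp (x / 5.01) with hy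
  have hy1 : 1 ≤ y := Real.one_le_exp (by positivity)
  have hly : Real.log y = x / 5.01 := Real.log_exp _
  have hf1 : 1 ≤ ⌊y⌋₊ := Nat.le_floor (by simpa using hy1)
  have hf1' : (1:ℝ) ≤ ⌊y⌋₊ := by exact_mod_cast hf1
  refine ⟨⌊y⌋₊, hf1, ?_, ?_⟩
  · have := Real.log_le_log (by linarith) (Nat.floor_le (by linarith : 0 ≤ y))
    rw [hly] at this
    rw [le_div_iff₀ (by norm_num)] at this
    linarith
  · have h1 : y ≤ ⌊y⌋₊ * 2 := by linarith [Nat.lt_floor_add_one y]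
    have := Real.log_le_log (by linarith) h1
    rw [hly, Real.log_mul (by linarith) (by norm_num), div_le_iff₀ (by norm_num)] at this
    linarith

set_option maxHeartbeats 1000000 in
theorem step (hG : Good ω R) (hω : Free ι ω) (H : Hyp ω) : ∃ C : ℝ, 0 ≤ C ∧ ∀ r x, C ≤ r → 
    State ω R (Option ι) (Real.exp r) (Real.exp x) → ∃ ld n lM ls : ℝ, r - C ≤ ld ∧ ld ≤ x + C ∧ 5.01 * n ≤ ld ∧
      ld ≤ 5.01 * n + C ∧ 3.99 * n ≤ lM ∧ lM ≤ 5.01 * n ∧ ls ≤ 1.01 * n ∧ 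
      (C ≤ r + lM - ld - ls → State ω R ι (Real.exp (r + lM - ld - ls - C)) (Real.exp (lM + C))) := by
  obtain ⟨K, hK, N0, hN0, H⟩ := H
  have hR := hG.three
  have hlogR : 0 ≤ Real.log R := Real.log_nonneg (by linarith)
  set cN : ℝ := ((Fintype.card (ι × Option μ) : ℕ) : ℝ) with hcN
  have hcN0 : 0 ≤ cN := by positivity
  set L := Real.log R with hL
  set c1 := Real.log (1 + 3 * L) with hc1
  set c2 := Real.log (2 * (K + 3 * L)) with hc2
  set c3 := Real.log (12 * cN + 16) with hc3
  set c4 := Real.log K with hc4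
  set c5 := Real.log N0 with hc5
  have h2 : 0 < Real.log 2 := Real.log_pos (by norm_num)
  have hc1' : 0 ≤ c1 := Real.log_nonneg (by linarith)
  have hc2' : 0 ≤ c2 := Real.log_nonneg (by linarith)
  have hc3' : 0 ≤ c3 := Real.log_nonneg (by linarith)
  have hc4' : 0 ≤ c4 := Real.log_nonneg (by linarith)
  have hc5' : 0 ≤ c5 := Real.log_nonneg (by exact_mod_cast hN0)
  set C := c1 + c2 + c3 + c4 + 6 * c5 + 20 * Real.log 2 + 4 with hC
  refine ⟨C, by positivity, ?_⟩
  intro r x hr hSt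
  have hl2 := Real.log_two_gt_d9
  have hexp4 : (8:ℝ) < Real.exp r := by
    have : (8:ℝ) = Real.exp (3 * Real.log 2) := by
      rw [mul_comm, Real.exp_mul, Real.exp_log (by norm_num)]; norm_num
    rw [this, Real.exp_lt_exp]; linarith
  obtain ⟨d, hd1, hd2, hst⟩ := stage_next hG hω (by linarith) hSt
  have hdr : Real.exp r / 2 ≤ d := by linarith
  have hd0 : 0 < d := by linarith
  have hld1 : r - Real.log 2 ≤ Real.log d := by
    have := Real.log_le_log (by positivity) hdr
    rwa [Real.log_div (by positivity) (by norm_num), Real.log_exp] at this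
  have hld2 : Real.log d ≤ c1 + x := by
    have := Real.log_le_log hd0 hd2
    rwa [Real.log_mul (by positivity) (by positivity), Real.log_exp] at this
  obtain ⟨N, hN1, hNa, hNb⟩ := pickN (Real.log d - c2) (by linarith)
  have hN : N0 ≤ N := by
    have h1 : c5 ≤ Real.log N := by linarith
    have := (Real.log_le_log_iff (by exact_mod_cast hN0) (by exact_mod_cast hN1)).mp h1
    exact_mod_cast this
  obtain ⟨B, s, M, hs, hM0, hdeg, hl1, hlow, hup, hls, hlM1, hlM2⟩ := H N hN
  have hn0 : 0 ≤ Real.log N := Real.log_nonneg (by exact_mod_cast hN1)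
  have hs0 : (0:ℝ) < s := by exact_mod_cast hs
  have hsM : (s:ℝ) ≤ M := by
    rw [← Real.log_le_log_iff hs0 hM0]; linarith
  refine ⟨Real.log d, Real.log N, Real.log M, Real.log s, by linarith, by linarith, by linarith, by linarith,
    hlM1, hlM2, hls, ?_⟩
  intro hbig
  have e1 : K * M + 3 * s * L ≤ d - 1 := by
    have h1 : M ≤ d / (2 * (K + 3 * L)) := by
      rw [← Real.log_le_log_iff hM0 (by positivity), Real.log_div hd0.ne' (by positivity)]
      linarith
    rw [le_div_iff₀ (by positivity)] at h1
    have : s * L ≤ M * L := by gcongr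
    nlinarith
  have e2 : (12 * cN + 16) * s < Real.exp r * (M / d) := by
    rw [← Real.log_lt_log_iff (by positivity) (by positivity), Real.log_mul (by positivity) (by positivity),
      Real.log_mul (by positivity) (by positivity), Real.log_div (by positivity) (by positivity), Real.log_exp]
    linarith
  have hfin := hst B s M (K * M) hs hdeg hl1 hlow hup (by nlinarith) hM0 e1 e2
  have e3 : State ω R ι (Real.exp (r + Real.log M - Real.log d - Real.log s - C)) (K * M) := by
    refine hfin.mono hR ?_
    rw [← Real.le_log_iff_exp_le (by positivity), Real.log_div (by positivity) (by positivity), 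
      Real.log_mul (by positivity) (by positivity), Real.log_div (by positivity) (by positivity), Real.log_exp,
      Real.log_mul (by positivity) (by positivity)]
    have : Real.log (12 * (cN + 1)) ≤ c3 := Real.log_le_log (by positivity) (by linarith)
    linarith
  obtain ⟨κ, i, y, F, hP, hF, hrs, B', s', h1, h2, h3, h4, h5⟩ := e3
  have hKM : K * M ≤ Real.exp (Real.log M + C) := by
    rw [← Real.log_le_iff_le_exp (by positivity), Real.log_mul (by positivity) (by positivity)]
    linarith
  exact ⟨κ, i, y, F, hP, hF, hrs, B', s', h1, h2, h3, le_trans (by rw [Real.exp_le_exp]; linarith) h4, h5.trans hKM⟩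

theorem step_first (hG : Good ω R) (hω : Free ι ω) (hω1 : ¬ Free (Option ι) ω) (H : Hyp ω) : ∃ C : ℝ, 0 ≤ C ∧ 
    ∃ N0 : ℕ, 1 ≤ N0 ∧ ∀ N ≥ N0, ∃ lM ls : ℝ, 3.99 * Real.log N ≤ lM ∧ lM ≤ 5.01 * Real.log N ∧ ls ≤ 1.01 * Real.log N ∧ 
      (C ≤ lM - ls → State ω R ι (Real.exp (lM - ls - C)) (Real.exp (lM + C))) := by
  obtain ⟨K, hK, N0, hN0, H⟩ := H
  obtain ⟨F, hP, hF⟩ := exists_chow ω hω hω1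
  have hR := hG.three
  set cN : ℝ := ((Fintype.card (ι × Option μ) : ℕ) : ℝ) with hcN
  have hcN0 : 0 ≤ cN := by positivity
  set T := Real.log (pn R (cx F)) with hT
  have hT0 : 0 < T := log_pos_prime F hP hR
  set c3 := Real.log (12 * (cN + 1) * T) with hc3
  set c4 := Real.log K with hc4
  have hc4' : 0 ≤ c4 := Real.log_nonneg (by linarith)
  have hc3' := abs_nonneg c3
  have hc3'' := le_abs_self c3
  set C := |c3| + c4 + 1 with hC
  refine ⟨C, by positivity, N0, hN0, ?_⟩
  intro N hN
  obtain ⟨B, s, M, hs, hM0, hdeg, hl1, hlow, hup, hls, hlM1, hlM2⟩ := H N hN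
  have hn0 : 0 ≤ Real.log N := Real.log_nonneg (by exact_mod_cast hN0.trans hN)
  have hs0 : (0:ℝ) < s := by exact_mod_cast hs
  have hsM : (s:ℝ) ≤ M := by
    rw [← Real.log_le_log_iff hs0 hM0]; linarith
  refine ⟨Real.log M, Real.log s, hlM1, hlM2, hls, ?_⟩
  intro hbig
  have hV : 12 * (cN + 1) * T * s < M := by
    rw [← Real.log_lt_log_iff (by positivity) (by positivity), Real.log_mul (by positivity) (by positivity)]
    linarith
  have hfin : State ω R ι (M / (12 * (cN + 1) * T * s)) (K * M) := by
    refine stage_first hG hω F hF hP B s hs hdeg hl1 (K * M) M _ hlow (by nlinarith) hM0.le hup (by positivity) ?_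
    rw [← hT, ← hcN]
    have e : (M / (12 * (cN + 1) * T * s) * (cN + 1) + cN) * (6 * s * T) + 6 * s * T = M / 2 + 6 * (cN + 1) * T * s := by
      field_simp; ring
    rw [e]; linarith
  have e3 : State ω R ι (Real.exp (Real.log M - Real.log s - C)) (K * M) := by
    refine hfin.mono hR ?_
    rw [← Real.le_log_iff_exp_le (by positivity), Real.log_div (by positivity) (by positivity), 
      Real.log_mul (by positivity) (by positivity)]
    linarith
  obtain ⟨κ, i, y, F, hP, hF, hrs, B', s', h1, h2, h3, h4, h5⟩ := e3
  have hKM : K * M ≤ Real.exp (Real.log M + C) := by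
    rw [← Real.log_le_iff_le_exp (by positivity), Real.log_mul (by positivity) (by positivity)]
    linarith
  exact ⟨κ, i, y, F, hP, hF, hrs, B', s', h1, h2, h3, le_trans (by rw [Real.exp_le_exp]; linarith) h4, h5.trans hKM⟩

theorem exists_log_ge (N0 : ℕ) (c : ℝ) : ∃ N ≥ N0, c ≤ Real.log N := by
  obtain ⟨N, h1, h2⟩ := ((Filter.tendsto_atTop.mp (Real.tendsto_log_atTop.comp tendsto_natCast_atTop_atTop) c).and
    (Filter.eventually_ge_atTop N0)).exists
  exact ⟨N, h2, h1⟩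

/-- the criterion: the point `ω` is free in dimension 3 -/
theorem criterion (hG : Good ω R) (H : Hyp ω) : Free (Option (Option (Option Empty))) ω := by
  have hR := hG.three
  have hF0 : Free Empty ω := by
    intro Φ hΦ
    rw [MvPolynomial.eq_C_of_isEmpty Φ] at hΦ ⊢
    have : ((MvPolynomial.coeff 0 Φ : ℤ) : MvPolynomial (Empty × μ) ℂ) = 0 := by
      rw [← hΦ]; simp only [eq_intCast, map_intCast]
    rw [Int.cast_eq_zero] at this
    rw [this, map_zero]
  have hF1 : Free (Option Empty) ω := by
    by_contra h1
    obtain ⟨C, hC, N0, hN0, h⟩ := step_first hG hF0 h1 H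
    obtain ⟨N, hN, hlog⟩ := exists_log_ge N0 (C + 1)
    obtain ⟨lM, ls, a1, a2, a3, hS⟩ := h N hN
    exact State.false_of_empty (Real.exp_pos _) hR (hS (by linarith))
  have hF2 : Free (Option (Option Empty)) ω := by
    by_contra h1
    obtain ⟨C, hC, N0, hN0, h⟩ := step_first hG hF1 h1 H
    obtain ⟨C', hC', h'⟩ := step hG hF0 H
    obtain ⟨N, hN, hlog⟩ := exists_log_ge N0 (100 * (C + C' + 1))
    obtain ⟨lM, ls, a1, a2, a3, hS⟩ := h N hN
    obtain ⟨ld, n, lM2, ls2, b1, b2, b3, b4, b5, b6, b7, hS2⟩ := h' _ _ (by linarith) (hS (by linarith))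
    exact State.false_of_empty (Real.exp_pos _) hR (hS2 (by linarith))
  by_contra h1
  obtain ⟨C, hC, N0, hN0, h⟩ := step_first hG hF2 h1 H
  obtain ⟨C', hC', h'⟩ := step hG hF1 H
  obtain ⟨C'', hC'', h''⟩ := step hG hF0 H
  obtain ⟨N, hN, hlog⟩ := exists_log_ge N0 (1000 * (C + C' + C'' + 1))
  obtain ⟨lM, ls, a1, a2, a3, hS⟩ := h N hN
  obtain ⟨ld, n, lM2, ls2, b1, b2, b3, b4, b5, b6, b7, hS2⟩ := h' _ _ (by linarith) (hS (by linarith))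
  obtain ⟨ld2, n3, lM3, ls3, c1, c2, c3, c4, c5, c6, c7, hS3⟩ := h'' _ _ (by linarith) (hS2 (by linarith))
  exact State.false_of_empty (Real.exp_pos _) hR (hS3 (by linarith))

end chain
end Nes

open Complex
namespace Nes

section glue

open MvPolynomial

theorem alg_card : Fintype.card (Option (Option (Option Empty))) = 3 := by simp

theorem trdeg_ge (ω : Fin 4 → ℂ) (h : Free (Option (Option (Option Empty))) ω) :
    (3 : Cardinal) ≤ Algebra.trdeg ℤ (Algebra.adjoin ℤ (Set.range ω)) := by
  set A := Algebra.adjoin ℤ (Set.range ω) with hA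
  let w : Fin 4 → A := fun k => ⟨ω k, Algebra.subset_adjoin ⟨k, rfl⟩⟩
  let T := Option (Option (Option Empty))
  let g : T × Option (Fin 4) → MvPolynomial (T × Fin 4) A := fun p =>
    match p with
    | (i, none) => -∑ k, C (w k) * X (i, k)
    | (i, some k) => X (i, k)
  have hg : AlgebraicIndependent ℤ g := by
    rw [algebraicIndependent_iff]
    intro Φ hΦ
    apply h Φ
    have e : (sub T ω : PP (Fin 4) T →+* MvPolynomial (T × Fin 4) ℂ)
        = (MvPolynomial.map (algebraMap A ℂ)).comp (aeval g : _ →ₐ[ℤ] _).toRingHom := by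
      apply MvPolynomial.ringHom_ext
      · intro r; simp
      · rintro ⟨i, _ | k⟩
        · rw [sub_none]
          simp [g, w]
        · rw [sub_some]; simp [g]
    change sub T ω Φ = 0
    rw [e]
    simp [hΦ]
  have h1 := hg.cardinalMk_le_trdeg
  have h2 : Algebra.trdeg ℤ A + Algebra.trdeg A (MvPolynomial (T × Fin 4) A) = Algebra.trdeg ℤ (MvPolynomial (T × Fin 4) A) :=
    _root_.trdeg_add_eq ℤ A
  rw [MvPolynomial.trdeg_of_isDomain] at h2
  rw [← h2] at h1
  have c1 : Cardinal.mk (T × Option (Fin 4)) = 15 := by simp [T]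
  have c2 : Cardinal.mk (T × Fin 4) = 12 := by simp [T]
  rw [c1, c2] at h1
  simp only [Cardinal.lift_ofNat] at h1
  by_contra! h3
  obtain ⟨n, hn⟩ := Cardinal.lt_aleph0.mp (h3.trans (by exact_mod_cast Cardinal.natCast_lt_aleph0 (n := 3)))
  rw [hn] at h1 h3
  norm_cast at h1 h3
  omega

theorem exists_indep (ω : Fin 4 → ℂ) (h : Free (Option (Option (Option Empty))) ω) :
    ∃ s : Finset (Fin 4), s.card = 3 ∧ AlgebraicIndependent ℚ (fun i : s => ω i) := by
  have h3 := trdeg_ge ω h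
  set A := Algebra.adjoin ℤ (Set.range ω) with hA
  let w : Fin 4 → A := fun k => ⟨ω k, Algebra.subset_adjoin ⟨k, rfl⟩⟩
  have htop : Algebra.adjoin ℤ (Set.range w) = ⊤ := by
    have := Algebra.adjoin_adjoin_coe_preimage (R := ℤ) (s := Set.range ω)
    convert this using 2
    ext x; constructor
    · rintro ⟨k, rfl⟩; exact ⟨k, rfl⟩
    · rintro ⟨k, hk⟩; exact ⟨k, Subtype.ext hk⟩
  have hal : Algebra.IsAlgebraic (Algebra.adjoin ℤ (Set.range w)) A := by
    constructor; intro x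
    have hx : x ∈ Algebra.adjoin ℤ (Set.range w) := by rw [htop]; trivial
    exact isAlgebraic_algebraMap (⟨x, hx⟩ : Algebra.adjoin ℤ (Set.range w))
  obtain ⟨t, ht, hb⟩ := exists_isTranscendenceBasis_subset (R := ℤ) (Set.range w)
  have hc := hb.cardinalMk_eq_trdeg
  rw [← hc] at h3
  obtain ⟨u, hut, huc⟩ := Cardinal.le_mk_iff_exists_subset.mp h3
  have hu : AlgebraicIndependent ℤ ((↑) : u → A) := hb.1.mono hut
  have hur : ∀ x : u, ∃ k, w k = x := fun x => ht (hut x.2)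
  choose f hf using hur
  have hfi : Function.Injective f := fun x y hxy => by
    apply Subtype.ext; rw [← hf, ← hf, hxy]
  have : Fintype u := by
    have : Finite u := Cardinal.lt_aleph0_iff_finite.mp (by rw [huc]; exact by exact_mod_cast Cardinal.natCast_lt_aleph0 (n := 3))
    exact Fintype.ofFinite _
  have hcard : Fintype.card u = 3 := by
    have : ((Fintype.card u : ℕ) : Cardinal) = (3:ℕ) := by rw [← Cardinal.mk_fintype, huc]; rfl
    exact_mod_cast this
  refine ⟨Finset.univ.image f, by rw [Finset.card_image_of_injective _ hfi, Finset.card_univ, hcard], ?_⟩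
  have hZ : AlgebraicIndependent ℤ (fun x : u => ω (f x)) := by
    have := hu.map' (f := A.val) Subtype.val_injective
    convert this using 1
    funext x
    simp [← hf x, w]
  have hQ : AlgebraicIndependent ℚ (fun x : u => ω (f x)) := by
    have : Algebra.IsAlgebraic ℤ ℚ := IsFractionRing.comap_isAlgebraic_iff (A := ℤ) (K := ℚ) (C := ℚ) |>.mpr inferInstance
    exact hZ.extendScalars ℚ
  let e : u ≃ (Finset.univ.image f : Finset (Fin 4)) :=
    Equiv.ofBijective (fun x => ⟨f x, by simp⟩)
      ⟨fun x y hxy => hfi (by simpa using hxy), fun ⟨y, hy⟩ => by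
        obtain ⟨x, -, hx⟩ := Finset.mem_image.mp hy
        exact ⟨x, Subtype.ext hx⟩⟩
  rw [← algebraicIndependent_equiv e]
  exact hQ

end glue
end Nes

open Complex
namespace Nes

/-! ### Weighted norms of integer power series -/

section weighted

open PowerSeries

/-- `∑ |cₙ| rⁿ` converges and is at most `b`. -/
def Wt (S : PowerSeries ℤ) (r b : ℝ) : Prop :=
  Summable (fun n => |((coeff n S : ℤ) : ℝ)| * r ^ n) ∧ ∑' n, |((coeff n S : ℤ) : ℝ)| * r ^ n ≤ b

/-- Evaluation of an integer power series. -/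
noncomputable def ev (S : PowerSeries ℤ) (q : ℂ) : ℂ := ∑' n, ((coeff n S : ℤ) : ℂ) * q ^ n

variable {S T : PowerSeries ℤ} {r b b' : ℝ} {q : ℂ}

theorem Wt.mono (h : Wt S r b) (hb : b ≤ b') : Wt S r b' := ⟨h.1, h.2.trans hb⟩

theorem Wt.norm_summable (h : Wt S r b) (hq : ‖q‖ ≤ r) :
    Summable (fun n => ‖((coeff n S : ℤ) : ℂ) * q ^ n‖) := by
  refine Summable.of_nonneg_of_le (fun _ => norm_nonneg _) (fun n => ?_) h.1
  rw [norm_mul, norm_pow, Complex.norm_intCast]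
  gcongr

theorem Wt.hasSum (h : Wt S r b) (hq : ‖q‖ ≤ r) :
    HasSum (fun n => ((coeff n S : ℤ) : ℂ) * q ^ n) (ev S q) :=
  (h.norm_summable hq).of_norm.hasSum

theorem wt_zero (hb : 0 ≤ b) : Wt 0 r b := by
  constructor
  · simp [summable_zero]
  · simpa using hb

theorem wt_C (c : ℤ) : Wt (C c) r |(c : ℝ)| := by
  have h : HasSum (fun n => |((coeff n (C c) : ℤ) : ℝ)| * r ^ n) |(c : ℝ)| := by
    convert hasSum_ite_eq 0 (|(c:ℝ)|) using 1
    funext n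
    rw [coeff_C]
    split_ifs with h0
    · simp [h0]
    · simp
  exact ⟨h.summable, h.tsum_eq.le⟩

theorem ev_C (c : ℤ) : ev (C c) q = c := by
  have h : HasSum (fun n => ((coeff n (C c) : ℤ) : ℂ) * q ^ n) (c : ℂ) := by
    convert hasSum_ite_eq 0 (c:ℂ) using 1
    funext n
    rw [coeff_C]
    split_ifs with h0
    · simp [h0]
    · simp
  exact h.tsum_eq

theorem Wt.add (hr : 0 ≤ r) (h : Wt S r b) (h' : Wt T r b') : Wt (S + T) r (b + b') := by
  have hle : ∀ n, |((coeff n (S + T) : ℤ) : ℝ)| * r ^ n ≤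
      |((coeff n S : ℤ) : ℝ)| * r ^ n + |((coeff n T : ℤ) : ℝ)| * r ^ n := fun n => by
    rw [map_add, Int.cast_add, ← add_mul]
    gcongr; exact abs_add_le _ _
  have hs := h.1.add h'.1
  have hs' : Summable (fun n => |((coeff n (S + T) : ℤ) : ℝ)| * r ^ n) :=
    Summable.of_nonneg_of_le (fun _ => by positivity) hle hs
  refine ⟨hs', (hs'.tsum_le_tsum hle hs).trans ?_⟩
  rw [h.1.tsum_add h'.1]
  exact add_le_add h.2 h'.2

theorem ev_add (h : Wt S r b) (h' : Wt T r b') (hq : ‖q‖ ≤ r) : ev (S + T) q = ev S q + ev T q := by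
  have := (h.hasSum hq).add (h'.hasSum hq)
  rw [ev, ← this.tsum_eq]
  congr 1; funext n; rw [map_add]; push_cast; ring

theorem Wt.mul (hr : 0 ≤ r) (h : Wt S r b) (h' : Wt T r b') (hb : 0 ≤ b) : Wt (S * T) r (b * b') := by
  have hn : ∀ U : PowerSeries ℤ, ∀ n, ‖|((coeff n U : ℤ) : ℝ)| * r ^ n‖ = |((coeff n U : ℤ) : ℝ)| * r ^ n :=
    fun U n => Real.norm_of_nonneg (by positivity)
  have s1 : Summable (fun n => ‖|((coeff n S : ℤ) : ℝ)| * r ^ n‖) := by simpa only [hn] using h.1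
  have s2 : Summable (fun n => ‖|((coeff n T : ℤ) : ℝ)| * r ^ n‖) := by simpa only [hn] using h'.1
  have hs := (summable_norm_sum_mul_antidiagonal_of_summable_norm s1 s2).of_norm
  have hle : ∀ n, |((coeff n (S * T) : ℤ) : ℝ)| * r ^ n ≤ ∑ kl ∈ Finset.HasAntidiagonal.antidiagonal n,
      |((coeff kl.1 S : ℤ) : ℝ)| * r ^ kl.1 * (|((coeff kl.2 T : ℤ) : ℝ)| * r ^ kl.2) := fun n => by
    rw [coeff_mul, Int.cast_sum]
    refine (mul_le_mul_of_nonneg_right (Finset.abs_sum_le_sum_abs _ _) (by positivity)).trans ?_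
    rw [Finset.sum_mul]
    refine Finset.sum_le_sum fun kl hkl => ?_
    rw [← Finset.HasAntidiagonal.mem_antidiagonal.mp hkl, pow_add, Int.cast_mul, abs_mul]
    exact le_of_eq (by ring)
  have hs' : Summable (fun n => |((coeff n (S * T) : ℤ) : ℝ)| * r ^ n) :=
    Summable.of_nonneg_of_le (fun _ => by positivity) hle hs
  refine ⟨hs', (hs'.tsum_le_tsum hle hs).trans ?_⟩
  rw [← tsum_mul_tsum_eq_tsum_sum_antidiagonal_of_summable_norm s1 s2]
  exact mul_le_mul h.2 h'.2 (tsum_nonneg fun _ => by positivity) hb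

theorem ev_mul (h : Wt S r b) (h' : Wt T r b') (hq : ‖q‖ ≤ r) : ev (S * T) q = ev S q * ev T q := by
  rw [ev, ev, ev, tsum_mul_tsum_eq_tsum_sum_antidiagonal_of_summable_norm (h.norm_summable hq)
    (h'.norm_summable hq)]
  congr 1; funext n
  rw [coeff_mul, Int.cast_sum, Finset.sum_mul]
  refine Finset.sum_congr rfl fun kl hkl => ?_
  rw [← Finset.HasAntidiagonal.mem_antidiagonal.mp hkl, pow_add]
  push_cast; ring

theorem Wt.pow (hr : 0 ≤ r) (h : Wt S r b) (hb : 0 ≤ b) (n : ℕ) : Wt (S ^ n) r (b ^ n) := by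
  induction n with
  | zero => simpa using wt_C (r := r) 1
  | succ n ih => rw [pow_succ, pow_succ]; exact ih.mul hr h (by positivity)

theorem Wt.sum {ι : Type*} (s : Finset ι) (f : ι → PowerSeries ℤ) (B : ι → ℝ) (hr : 0 ≤ r)
    (h : ∀ i ∈ s, Wt (f i) r (B i)) : Wt (∑ i ∈ s, f i) r (∑ i ∈ s, B i) := by
  classical
  induction s using Finset.induction_on with
  | empty => simpa using wt_zero le_rfl
  | insert a s ha ih =>
    rw [Finset.sum_insert ha, Finset.sum_insert ha]
    exact (h a (Finset.mem_insert_self _ _)).add hr (ih fun i hi => h i (Finset.mem_insert_of_mem hi))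

theorem wt_mon {n : Type} [Fintype n] (Sv : n → PowerSeries ℤ) (hr : 0 ≤ r) (hb : 1 ≤ b)
    (h : ∀ i, Wt (Sv i) r b) (m : n →₀ ℕ) :
    Wt (m.prod fun k e => Sv k ^ e) r (b ^ (m.sum fun _ e => e)) := by
  classical
  induction m using Finsupp.induction_linear with
  | zero => simpa using wt_C (r := r) 1
  | add f g hf hg =>
    rw [Finsupp.prod_add_index' (fun _ => pow_zero _) (fun _ _ _ => pow_add _ _ _),
      Finsupp.sum_add_index' (fun _ => rfl) (fun _ _ _ => rfl), pow_add]
    exact hf.mul hr hg (by positivity)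
  | single a c =>
    rw [Finsupp.prod_single_index (h := fun k e => Sv k ^ e) (pow_zero _), Finsupp.sum_single_index rfl]
    exact (h a).pow hr (by linarith) c

theorem wt_aeval {n : Type} [Fintype n] (A : MvPolynomial n ℤ) (Sv : n → PowerSeries ℤ) (hr : 0 ≤ r) (hb : 1 ≤ b)
    (h : ∀ i, Wt (Sv i) r b) (D : ℕ) (hD : A.totalDegree ≤ D) :
    Wt (MvPolynomial.aeval Sv A) r (l1 A * b ^ D) := by
  rw [MvPolynomial.aeval_def, MvPolynomial.eval₂_eq', l1, Finset.sum_mul]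
  refine Wt.sum _ _ _ hr fun m hm => ?_
  have h1 := wt_mon Sv hr hb h m
  rw [Finsupp.prod_fintype _ _ (fun _ => pow_zero _)] at h1
  have h2 := (wt_C (r := r) (A.coeff m)).mul hr h1 (abs_nonneg _)
  refine Wt.mono ?_ (mul_le_mul_of_nonneg_left (pow_le_pow_right₀ hb ((MvPolynomial.le_totalDegree hm).trans hD)) (abs_nonneg _))
  exact h2

theorem ev_aeval {n : Type} [Fintype n] (A : MvPolynomial n ℤ) (Sv : n → PowerSeries ℤ) (hr : 0 ≤ r) (hb : 1 ≤ b)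
    (h : ∀ i, Wt (Sv i) r b) (hq : ‖q‖ ≤ r) :
    ev (MvPolynomial.aeval Sv A) q = MvPolynomial.aeval (fun i => ev (Sv i) q) A := by
  have hw := fun A : MvPolynomial n ℤ => wt_aeval A Sv hr hb h _ le_rfl
  induction A using MvPolynomial.induction_on with
  | C a => simp only [MvPolynomial.aeval_C]; exact ev_C a
  | add p s hp hs => rw [map_add, map_add, ev_add (hw p) (hw s) hq, hp, hs]
  | mul_X p i hp => rw [map_mul, map_mul, ev_mul (hw p) (hw _) hq, hp, MvPolynomial.aeval_X, MvPolynomial.aeval_X]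

theorem Wt.coeff_le (h : Wt S r b) (hr : 0 ≤ r) (n : ℕ) : |((coeff n S : ℤ) : ℝ)| * r ^ n ≤ b :=
  (h.1.le_tsum n (fun _ _ => by positivity)).trans h.2

/-- the Schwarz lemma -/
theorem Wt.schwarz (h : Wt S r b) (hr : 0 < r) (M : ℕ) (hM : ∀ n < M, coeff n S = 0) (hq : ‖q‖ ≤ r) :
    ‖ev S q‖ ≤ (‖q‖ / r) ^ M * b := by
  have h1 : ‖ev S q‖ ≤ ∑' n, ‖((coeff n S : ℤ) : ℂ) * q ^ n‖ := norm_tsum_le_tsum_norm (h.norm_summable hq)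
  have h2 : ∀ n, ‖((coeff n S : ℤ) : ℂ) * q ^ n‖ ≤ (‖q‖ / r) ^ M * (|((coeff n S : ℤ) : ℝ)| * r ^ n) := fun n => by
    rcases lt_or_ge n M with hn | hn
    · simp [hM n hn]
    · rw [norm_mul, norm_pow, Complex.norm_intCast]
      have h3 : ‖q‖ ^ n ≤ (‖q‖ / r) ^ M * r ^ n := by
        have e : ‖q‖ ^ n = (‖q‖ / r) ^ n * r ^ n := by rw [← mul_pow]; congr 1; field_simp
        rw [e]
        refine mul_le_mul_of_nonneg_right ?_ (by positivity)
        exact pow_le_pow_of_le_one (by positivity) ((div_le_one hr).mpr hq) hn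
      calc _ ≤ |((coeff n S : ℤ) : ℝ)| * ((‖q‖ / r) ^ M * r ^ n) := by gcongr
        _ = _ := by ring
  refine h1.trans (((h.norm_summable hq).tsum_le_tsum h2 (h.1.mul_left _)).trans ?_)
  rw [tsum_mul_left]
  exact mul_le_mul_of_nonneg_left h.2 (by positivity)

end weighted
end Nes

open Complex
namespace Nes

/-! ### The series P, Q, R -/

section series

open PowerSeries

/-- Eisenstein-type series with constant `a` and power `k`. -/
noncomputable def eser (a : ℤ) (k : ℕ) : PowerSeries ℤ :=
  PowerSeries.mk fun n => if n = 0 then 1 else a * ∑ d ∈ n.divisors, (d : ℤ) ^ k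

/-- The four series `q, P, Q, R`. -/
noncomputable def Sv : Fin 4 → PowerSeries ℤ :=
  ![X, eser (-24) 1, eser 240 3, eser (-504) 5]

theorem divsum_le (n k : ℕ) (hk : k ≤ 5) : |((∑ d ∈ n.divisors, (d : ℤ) ^ k : ℤ) : ℝ)| ≤ (n + 1) ^ 6 := by
  push_cast
  rw [abs_of_nonneg (Finset.sum_nonneg fun _ _ => by positivity)]
  have h1 : ∀ d ∈ n.divisors, (d : ℝ) ^ k ≤ (n + 1) ^ 5 := fun d hd => by
    have hd' : (d : ℝ) ≤ n := by exact_mod_cast Nat.divisor_le hd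
    calc (d:ℝ) ^ k ≤ (n + 1) ^ k := by gcongr; linarith
      _ ≤ _ := pow_le_pow_right₀ (by linarith [(Nat.cast_nonneg n : (0:ℝ) ≤ n)]) hk
  refine (Finset.sum_le_card_nsmul _ _ _ h1).trans ?_
  rw [nsmul_eq_mul]
  have : ((n.divisors.card : ℕ) : ℝ) ≤ n + 1 := by
    exact_mod_cast (Nat.card_divisors_le_self n).trans (Nat.le_succ n)
  calc _ ≤ ((n:ℝ) + 1) * (n + 1) ^ 5 := by gcongr
    _ = _ := by ring

theorem pow_le_choose (n : ℕ) : ((n : ℝ) + 1) ^ 6 ≤ 720 * ((n + 6).choose 6 : ℕ) := by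
  have h := Nat.pow_succ_le_ascFactorial (n + 1) 6
  have h2 := Nat.ascFactorial_eq_factorial_mul_choose n 6
  rw [h2] at h
  have : Nat.factorial 6 = 720 := by decide
  rw [this] at h
  have h3 : ((n:ℝ) + 1) ^ 6 = (((n + 1) ^ 6 : ℕ) : ℝ) := by push_cast; rfl
  rw [h3]
  exact_mod_cast h

theorem wt_of_coeff_le {S : PowerSeries ℤ} {c r : ℝ} (hr : 0 ≤ r) (hr1 : r < 1)
    (h : ∀ n, |((coeff n S : ℤ) : ℝ)| ≤ c * (n + 1) ^ 6) (hc : 0 ≤ c) : Wt S r (c * 720 / (1 - r) ^ 7) := by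
  have hs := hasSum_choose_mul_geometric_of_norm_lt_one 6 (r := r) (by rwa [Real.norm_of_nonneg hr])
  have hs2 := hs.mul_left (c * 720)
  have hle : ∀ n, |((coeff n S : ℤ) : ℝ)| * r ^ n ≤ c * 720 * (((n + 6).choose 6 : ℕ) * r ^ n) := fun n => by
    have h1 := pow_le_choose n
    calc _ ≤ (c * (n + 1) ^ 6) * r ^ n := by gcongr; exact h n
      _ ≤ (c * (720 * ((n + 6).choose 6 : ℕ))) * r ^ n := by gcongr
      _ = _ := by ring
  have hs' := Summable.of_nonneg_of_le (fun _ => by positivity) hle hs2.summable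
  refine ⟨hs', (hs'.tsum_le_tsum hle hs2.summable).trans ?_⟩
  rw [hs2.tsum_eq]
  exact le_of_eq (by ring)

/-- the constant `504 * 720` -/
noncomputable def c0 : ℝ := 504 * 720

theorem coeff_eser_le (a : ℤ) (k : ℕ) (hk : k ≤ 5) (ha : |(a : ℝ)| ≤ 504) (n : ℕ) :
    |((coeff n (eser a k) : ℤ) : ℝ)| ≤ 504 * (n + 1) ^ 6 := by
  rw [eser, coeff_mk]
  split_ifs with h
  · rw [h]; norm_num
  · rw [Int.cast_mul, abs_mul]
    exact mul_le_mul ha (divsum_le n k hk) (abs_nonneg _) (by norm_num)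

theorem coeff_Sv_le (i : Fin 4) (n : ℕ) : |((coeff n (Sv i) : ℤ) : ℝ)| ≤ 504 * (n + 1) ^ 6 := by
  fin_cases i
  · change |((coeff n X : ℤ) : ℝ)| ≤ _
    rw [coeff_X]
    split_ifs with h
    · rw [h]; norm_num
    · simp only [Int.cast_zero, abs_zero]; positivity
  · exact coeff_eser_le _ _ (by norm_num) (by norm_num) n
  · exact coeff_eser_le _ _ (by norm_num) (by norm_num) n
  · exact coeff_eser_le _ _ (by norm_num) (by norm_num) n

theorem wt_Sv {r : ℝ} (hr : 0 ≤ r) (hr1 : r < 1) (i : Fin 4) : Wt (Sv i) r (c0 / (1 - r) ^ 7) :=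
  wt_of_coeff_le hr hr1 (coeff_Sv_le i) (by norm_num)

theorem one_le_c0 {r : ℝ} (hr : 0 ≤ r) (hr1 : r < 1) : 1 ≤ c0 / (1 - r) ^ 7 := by
  rw [one_le_div (by have : 0 < 1 - r := by linarith
                     positivity)]
  have : (1 - r) ^ 7 ≤ 1 := pow_le_one₀ (by linarith) (by linarith)
  unfold c0; linarith

/-- The point `(q, P(q), Q(q), R(q))`. -/
noncomputable def pt (q : ℂ) : Fin 4 → ℂ := fun i => ev (Sv i) q

theorem pt_zero (q : ℂ) : pt q 0 = q := by
  change ev X q = q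
  have h : HasSum (fun n => ((coeff n (X : PowerSeries ℤ) : ℤ) : ℂ) * q ^ n) q := by
    convert hasSum_ite_eq 1 q using 1
    funext n
    rw [coeff_X]
    split_ifs with h0
    · simp [h0]
    · simp
  exact h.tsum_eq

theorem ev_eser {q : ℂ} (hq : ‖q‖ < 1) (a : ℤ) (k : ℕ) (hk : k ≤ 5) (ha : |(a : ℝ)| ≤ 504) :
    ev (eser a k) q = 1 + a * ∑' n : ℕ, (∑ d ∈ Nat.divisors (n + 1), (d : ℂ) ^ k) * q ^ (n + 1) := by
  have hw := wt_of_coeff_le (norm_nonneg q) hq (coeff_eser_le a k hk ha) (by norm_num)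
  have hs := hw.hasSum le_rfl
  rw [ev, hs.summable.tsum_eq_zero_add, ← tsum_mul_left]
  congr 1
  · simp [eser]
  · congr 1; funext n
    simp only [eser, coeff_mk]
    rw [if_neg (Nat.succ_ne_zero n)]
    push_cast; ring

theorem pt_one {q : ℂ} (hq : ‖q‖ < 1) : pt q 1 = 1 - 24 * ∑' n : ℕ, (∑ d ∈ Nat.divisors (n + 1), (d : ℂ) ^ 1) * q ^ (n + 1) := by
  change ev (eser (-24) 1) q = _
  rw [ev_eser hq _ _ (by norm_num) (by norm_num)]; push_cast; ring
theorem pt_two {q : ℂ} (hq : ‖q‖ < 1) : pt q 2 = 1 + 240 * ∑' n : ℕ, (∑ d ∈ Nat.divisors (n + 1), (d : ℂ) ^ 3) * q ^ (n + 1) := by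
  change ev (eser 240 3) q = _
  rw [ev_eser hq _ _ (by norm_num) (by norm_num)]; push_cast; ring
theorem pt_three {q : ℂ} (hq : ‖q‖ < 1) : pt q 3 = 1 - 504 * ∑' n : ℕ, (∑ d ∈ Nat.divisors (n + 1), (d : ℂ) ^ 5) * q ^ (n + 1) := by
  change ev (eser (-504) 5) q = _
  rw [ev_eser hq _ _ (by norm_num) (by norm_num)]; push_cast; ring

/-- The power series of a polynomial in `q, P, Q, R`. -/
noncomputable def FS (A : MvPolynomial (Fin 4) ℤ) : PowerSeries ℤ := MvPolynomial.aeval Sv A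

theorem wt_FS (A : MvPolynomial (Fin 4) ℤ) (D : ℕ) (hD : A.totalDegree ≤ D) {r : ℝ} (hr : 0 ≤ r) (hr1 : r < 1) :
    Wt (FS A) r (l1 A * (c0 / (1 - r) ^ 7) ^ D) :=
  wt_aeval A Sv hr (one_le_c0 hr hr1) (wt_Sv hr hr1) D hD

theorem ev_FS (A : MvPolynomial (Fin 4) ℤ) {q : ℂ} (hq : ‖q‖ < 1) : ev (FS A) q = MvPolynomial.aeval (pt q) A :=
  ev_aeval A Sv (norm_nonneg q) (one_le_c0 (norm_nonneg q) hq) (wt_Sv (norm_nonneg q) hq) le_rfl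

end series
end Nes

open Complex
namespace Nes

/-! ### Relation with modular forms -/

section modular

open UpperHalfPlane EisensteinSeries ModularForm

/-- `e^{2πiτ}`. -/
noncomputable def qq (z : ℂ) : ℂ := Complex.exp (2 * Real.pi * Complex.I * z)

theorem norm_qq (z : ℂ) : ‖qq z‖ = Real.exp (-2 * Real.pi * z.im) := by
  rw [qq, Complex.norm_exp]
  congr 1
  simp

theorem norm_qq_lt {z : ℂ} (hz : 0 < z.im) : ‖qq z‖ < 1 := by
  rw [norm_qq, Real.exp_lt_one_iff]
  have := Real.pi_pos
  nlinarith

theorem qq_lt (τ : ℍ) : ‖qq τ‖ < 1 := norm_qq_lt τ.im_pos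

theorem pt_E2 (τ : ℍ) : pt (qq τ) 1 = E2 τ := by
  rw [pt_one (qq_lt τ), E2_eq_tsum_cexp, tsum_pnat_eq_tsum_succ (f := fun n => (ArithmeticFunction.sigma 1 n : ℂ) * _ ^ n)]
  congr 3; funext n
  rw [ArithmeticFunction.sigma_apply]
  push_cast
  rfl

theorem pt_E4 (τ : ℍ) : pt (qq τ) 2 = E₄ τ := by
  rw [pt_two (qq_lt τ), q_expansion_bernoulli _ ⟨2, rfl⟩,
    show bernoulli 4 = -1 / 30 by decide +kernel]
  have := tsum_pnat_eq_tsum_succ (f := fun n => (ArithmeticFunction.sigma (4 - 1) n : ℂ) * cexp (2 * Real.pi * Complex.I * τ) ^ (n:ℤ))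
  rw [this]
  have e : ∀ n : ℕ, (ArithmeticFunction.sigma (4 - 1) (n + 1) : ℂ) * cexp (2 * Real.pi * Complex.I * τ) ^ ((n + 1 : ℕ) : ℤ) =
      (∑ d ∈ Nat.divisors (n + 1), (d : ℂ) ^ 3) * qq τ ^ (n + 1) := fun n => by
    rw [ArithmeticFunction.sigma_apply, zpow_natCast]
    push_cast
    rfl
  simp_rw [e]
  push_cast; norm_num

theorem pt_E6 (τ : ℍ) : pt (qq τ) 3 = E₆ τ := by
  rw [pt_three (qq_lt τ), q_expansion_bernoulli _ ⟨3, rfl⟩,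
    show bernoulli 6 = 1 / 42 by decide +kernel]
  have := tsum_pnat_eq_tsum_succ (f := fun n => (ArithmeticFunction.sigma (6 - 1) n : ℂ) * cexp (2 * Real.pi * Complex.I * τ) ^ (n:ℤ))
  rw [this]
  have e : ∀ n : ℕ, (ArithmeticFunction.sigma (6 - 1) (n + 1) : ℂ) * cexp (2 * Real.pi * Complex.I * τ) ^ ((n + 1 : ℕ) : ℤ) =
      (∑ d ∈ Nat.divisors (n + 1), (d : ℂ) ^ 5) * qq τ ^ (n + 1) := fun n => by
    rw [ArithmeticFunction.sigma_apply, zpow_natCast]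
    push_cast
    rfl
  simp_rw [e]
  push_cast; norm_num

open PowerSeries in
/-- Absolutely convergent on the open unit disc. -/
def AW (S : PowerSeries ℤ) : Prop := ∀ r : ℝ, 0 ≤ r → r < 1 → ∃ b, Wt S r b

theorem aw_FS (A : MvPolynomial (Fin 4) ℤ) : AW (FS A) := fun _ h0 h1 => ⟨_, wt_FS A _ le_rfl h0 h1⟩

/-- The derivation `X d/dX`. -/
noncomputable def th : Derivation ℤ (PowerSeries ℤ) (PowerSeries ℤ) :=
  (PowerSeries.X : PowerSeries ℤ) • PowerSeries.derivative ℤ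

theorem coeff_th (S : PowerSeries ℤ) (n : ℕ) : PowerSeries.coeff n (th S) = n * PowerSeries.coeff n S := by
  change PowerSeries.coeff n (PowerSeries.X * PowerSeries.derivative ℤ S) = _
  cases n with
  | zero => simp
  | succ n => rw [PowerSeries.coeff_succ_X_mul, PowerSeries.coeff_derivative]; push_cast; ring

theorem AW.summable_mul {S : PowerSeries ℤ} (h : AW S) {r : ℝ} (h0 : 0 ≤ r) (h1 : r < 1) :
    Summable (fun n : ℕ => (n:ℝ) * (|((PowerSeries.coeff n S : ℤ) : ℝ)| * r ^ n)) := by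
  set r1 := (1 + r) / 2 with hr1
  have hr1' : 0 < r1 := by rw [hr1]; linarith
  obtain ⟨b, hb⟩ := h r1 hr1'.le (by rw [hr1]; linarith)
  have ht := tendsto_self_mul_const_pow_of_lt_one (r := r / r1) (by positivity) (by
    rw [div_lt_one hr1', hr1]; linarith)
  obtain ⟨c, hc⟩ := ht.bddAbove_range
  have hc' : ∀ n : ℕ, (n:ℝ) * (r / r1) ^ n ≤ c := fun n => hc ⟨n, rfl⟩
  refine Summable.of_nonneg_of_le (fun _ => by positivity) (fun n => ?_) (hb.1.mul_left c)
  have e : (n:ℝ) * (|((PowerSeries.coeff n S : ℤ) : ℝ)| * r ^ n) =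
      ((n:ℝ) * (r / r1) ^ n) * (|((PowerSeries.coeff n S : ℤ) : ℝ)| * r1 ^ n) := by
    rw [div_pow]; field_simp
  rw [e]
  exact mul_le_mul_of_nonneg_right (hc' n) (by positivity)

theorem AW.th {S : PowerSeries ℤ} (h : AW S) : AW (th S) := fun r h0 h1 => by
  refine ⟨_, ?_, le_rfl⟩
  convert h.summable_mul h0 h1 using 2 with n
  rw [coeff_th]
  push_cast
  rw [abs_mul, abs_of_nonneg (by positivity : (0:ℝ) ≤ n)]; ring

theorem AW.hasDerivAt {S : PowerSeries ℤ} (h : AW S) {q : ℂ} (hq : ‖q‖ < 1) :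
    ∃ d, HasDerivAt (ev S) d q ∧ q * d = ev (Nes.th S) q := by
  obtain ⟨r, hr, hr1⟩ := exists_between hq
  have hr0 : 0 < r := (norm_nonneg q).trans_lt hr
  have hs := (h.summable_mul hr0.le hr1).mul_right r⁻¹
  have key := hasDerivAt_tsum_of_isPreconnected (g := fun n y => ((PowerSeries.coeff n S : ℤ) : ℂ) * y ^ n)
    (g' := fun n y => ((PowerSeries.coeff n S : ℤ) : ℂ) * (n * y ^ (n - 1))) (t := Metric.ball 0 r)
    (y₀ := q) (y := q) hs Metric.isOpen_ball (convex_ball _ _).isPreconnected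
    (fun n y _ => (hasDerivAt_pow n y).const_mul _)
    (fun n y hy => by
      have hy' : ‖y‖ < r := by simpa using hy
      rw [norm_mul, norm_mul, norm_pow, Complex.norm_intCast, Complex.norm_natCast]
      rcases n with _ | n
      · simp
      · rw [Nat.add_sub_cancel, pow_succ]
        calc _ ≤ |((PowerSeries.coeff (n+1) S : ℤ) : ℝ)| * (((n + 1 : ℕ) : ℝ) * r ^ n) := by gcongr
          _ = _ := by field_simp)
    (by simpa using hr) (by
      obtain ⟨b, hb⟩ := h r hr0.le hr1
      exact (hb.hasSum hr.le).summable) (by simpa using hr)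
  refine ⟨_, key, ?_⟩
  rw [ev, ← tsum_mul_left]
  congr 1; funext n
  rw [coeff_th]
  rcases n with _ | n
  · simp
  · rw [Nat.add_sub_cancel]; push_cast; ring

end modular
end Nes

open Complex
namespace Nes

/-! ### Ramanujan's differential equations -/

section ramanujan

open UpperHalfPlane EisensteinSeries ModularForm MatrixGroups

theorem AW.add {S T : PowerSeries ℤ} (h : AW S) (h' : AW T) : AW (S + T) := fun r h0 h1 => by
  obtain ⟨b, hb⟩ := h r h0 h1
  obtain ⟨b', hb'⟩ := h' r h0 h1
  exact ⟨_, hb.add h0 hb'⟩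

theorem AW.cmul {S : PowerSeries ℤ} (h : AW S) (m : ℤ) : AW (PowerSeries.C m * S) := fun r h0 h1 => by
  obtain ⟨b, hb⟩ := h r h0 h1
  exact ⟨_, (wt_C m).mul h0 hb (abs_nonneg _)⟩

theorem AW.ev_add {S T : PowerSeries ℤ} (h : AW S) (h' : AW T) {q : ℂ} (hq : ‖q‖ < 1) :
    ev (S + T) q = ev S q + ev T q := by
  obtain ⟨b, hb⟩ := h ‖q‖ (norm_nonneg _) hq
  obtain ⟨b', hb'⟩ := h' ‖q‖ (norm_nonneg _) hq
  exact Nes.ev_add hb hb' le_rfl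

theorem AW.ev_cmul {S : PowerSeries ℤ} (h : AW S) (m : ℤ) {q : ℂ} (hq : ‖q‖ < 1) :
    ev (PowerSeries.C m * S) q = m * ev S q := by
  obtain ⟨b, hb⟩ := h ‖q‖ (norm_nonneg _) hq
  rw [ev_mul (wt_C m) hb le_rfl, ev_C]

theorem aw_Sv (i : Fin 4) : AW (Sv i) := fun _ h0 h1 => ⟨_, wt_Sv h0 h1 i⟩

theorem vanish (S : PowerSeries ℤ) (hS : AW S) (k : ℕ) (hk : k < 12)
    (h0 : PowerSeries.coeff 0 S = 0)
    (hinv : ∀ (γ : SL(2, ℤ)) (τ : ℍ), ev S (qq ↑(γ • τ)) = denom γ τ ^ k * ev S (qq τ)) : S = 0 := by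
  have hsum : ∀ τ : ℍ, HasSum (fun m : ℕ => ((PowerSeries.coeff m S : ℤ) : ℂ) • Function.Periodic.qParam 1 τ ^ m) (ev S (qq τ)) := by
    intro τ
    obtain ⟨b, hb⟩ := hS ‖qq τ‖ (norm_nonneg _) (qq_lt τ)
    have := hb.hasSum le_rfl
    simpa only [Function.Periodic.qParam, ofReal_one, div_one, smul_eq_mul, qq] using this
  have hsl : ∀ γ : SL(2, ℤ), (fun τ : ℍ => ev S (qq τ)) ∣[(k : ℤ)] γ = fun τ : ℍ => ev S (qq τ) := by
    intro γ
    funext τ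
    rw [ModularForm.SL_slash_apply, hinv, zpow_neg, zpow_natCast]
    have := denom_ne_zero γ τ
    field_simp
  let f : ModularForm 𝒮ℒ (k : ℤ) :=
    { toFun := fun τ => ev S (qq τ)
      slash_action_eq' := by
        rintro _ ⟨γ, rfl⟩
        exact hsl γ
      holo' := by
        rw [UpperHalfPlane.mdifferentiable_iff]
        have : DifferentiableOn ℂ (fun z => ev S (qq z)) upperHalfPlaneSet := by
          intro z hz
          obtain ⟨d, hd, -⟩ := hS.hasDerivAt (norm_qq_lt hz)
          refine (hd.differentiableAt.comp z ?_).differentiableWithinAt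
          unfold qq
          fun_prop
        refine this.congr fun z hz => ?_
        simp [Function.comp_apply, ofComplex_apply_of_im_pos hz]
      bdd_at_cusps' := by
        intro c hc
        rw [OnePoint.isBoundedAt_iff_forall_SL2Z hc]
        intro γ _
        change IsBoundedAtImInfty ((fun τ : ℍ => ev S (qq τ)) ∣[(k : ℤ)] γ)
        rw [hsl]
        exact isBoundedAtImInfty_of_hasSum_qExpansion one_pos hsum }
  have hc := ModularFormClass.qExpansion_coeff_unique (f := f) one_pos one_mem_strictPeriods_SL hsum
  have hf : f = 0 := by
    apply sturm_bound_levelOne_nat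
    rw [Nat.div_eq_of_lt hk]
    refine lt_of_lt_of_le (by norm_num : ((0:ℕ):ℕ∞) < ((1:ℕ):ℕ∞)) (PowerSeries.nat_le_order _ _ fun i hi => ?_)
    have : i = 0 := by omega
    subst this
    rw [← hc, h0]; simp
  ext n
  have h1 := hc n
  rw [hf] at h1
  have h2 : qExpansion 1 ((0 : ModularForm 𝒮ℒ (k : ℤ)) : ℍ → ℂ) = 0 := by
    exact qExpansion_zero 1
  rw [h2] at h1
  simpa using h1

theorem hasDerivAt_evqq {S : PowerSeries ℤ} (hS : AW S) {z : ℂ} (hz : 0 < z.im) :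
    HasDerivAt (fun z => ev S (qq z)) (2 * Real.pi * Complex.I * ev (th S) (qq z)) z := by
  obtain ⟨d, hd, hd'⟩ := hS.hasDerivAt (norm_qq_lt hz)
  have h1 : HasDerivAt qq (qq z * (2 * Real.pi * Complex.I)) z := by
    have := ((hasDerivAt_id z).const_mul (2 * Real.pi * Complex.I)).cexp
    simp only [id, mul_one] at this
    exact this
  have := hd.comp z h1
  have e : 2 * Real.pi * Complex.I * ev (th S) (qq z) = d * (qq z * (2 * Real.pi * Complex.I)) := by
    rw [← hd']; ring
  rw [e]; exact this

theorem coe_smul_eq (γ : SL(2, ℤ)) (τ : ℍ) :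
    ((γ • τ : ℍ) : ℂ) = ((γ 0 0 : ℤ) * τ + (γ 0 1 : ℤ)) / ((γ 1 0 : ℤ) * τ + (γ 1 1 : ℤ)) := by
  rw [UpperHalfPlane.specialLinearGroup_apply]
  simp

theorem denom_eq (γ : SL(2, ℤ)) (τ : ℍ) : denom γ τ = (γ 1 0 : ℤ) * τ + (γ 1 1 : ℤ) := by
  simp [denom]

theorem transf_th {S : PowerSeries ℤ} (hS : AW S) (m : ℕ) (e : ℂ) (γ : SL(2, ℤ))
    (h : ∀ τ : ℍ, ev S (qq ↑(γ • τ)) = denom γ τ ^ (m + 1) * ev S (qq τ) + e * (γ 1 0 : ℤ) * denom γ τ ^ m)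
    (τ : ℍ) :
    2 * Real.pi * Complex.I * ev (th S) (qq ↑(γ • τ)) =
      denom γ τ ^ (m + 3) * (2 * Real.pi * Complex.I * ev (th S) (qq τ)) +
      (m + 1) * (γ 1 0 : ℤ) * denom γ τ ^ (m + 2) * ev S (qq τ) +
      m * e * (γ 1 0 : ℤ) ^ 2 * denom γ τ ^ (m + 1) := by
  set c : ℂ := ((γ 1 0 : ℤ) : ℂ) with hc
  set d : ℂ := ((γ 1 1 : ℤ) : ℂ) with hd
  set a : ℂ := ((γ 0 0 : ℤ) : ℂ) with ha
  set b : ℂ := ((γ 0 1 : ℤ) : ℂ) with hb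
  have hdet : a * d - b * c = 1 := by
    have := γ.det_coe
    rw [Matrix.det_fin_two] at this
    rw [ha, hb, hc, hd]
    exact_mod_cast this
  have hu : c * τ + d ≠ 0 := by
    have := denom_ne_zero γ τ
    rwa [denom_eq] at this
  have hD : HasDerivAt (fun z : ℂ => c * z + d) c (τ : ℂ) := by
    simpa using ((hasDerivAt_id (τ:ℂ)).const_mul c).add_const d
  have hN : HasDerivAt (fun z : ℂ => a * z + b) a (τ : ℂ) := by
    simpa using ((hasDerivAt_id (τ:ℂ)).const_mul a).add_const b
  have hg := hN.div hD hu
  have e1 : (a * (c * τ + d) - (a * τ + b) * c) = 1 := by linear_combination hdet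
  have hz' := hasDerivAt_evqq hS (γ • τ).im_pos
  change HasDerivAt _ _ (((γ • τ : ℍ) : ℂ)) at hz'
  rw [coe_smul_eq γ τ, ← ha, ← hb, ← hc, ← hd] at hz'
  have hL := HasDerivAt.comp (τ : ℂ) (h₂ := fun z => ev S (qq z)) hz' hg
  have hR := ((hD.pow (m + 1)).mul (hasDerivAt_evqq hS τ.im_pos)).add ((hD.pow m).const_mul (e * c))
  have hev : (fun z : ℂ => (c * z + d) ^ (m + 1) * ev S (qq z) + e * c * (c * z + d) ^ m) =ᶠ[nhds (τ : ℂ)]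
      (fun z => ev S (qq z)) ∘ (fun z => (a * z + b) / (c * z + d)) := by
    filter_upwards [isOpen_upperHalfPlaneSet.mem_nhds τ.im_pos] with w hw
    have := h ⟨w, hw⟩
    rw [coe_smul_eq, denom_eq] at this
    exact this.symm
  have key := (hL.congr_of_eventuallyEq hev).unique hR
  rw [e1] at key
  rw [coe_smul_eq γ τ, denom_eq, ← ha, ← hb, ← hc, ← hd]
  have key2 : 2 * Real.pi * Complex.I * ev (th S) (qq ((a * τ + b) / (c * τ + d))) =
      (c * τ + d) ^ 2 * (2 * Real.pi * Complex.I * ev (th S) (qq ((a * τ + b) / (c * τ + d))) * (1 / (c * τ + d) ^ 2)) := by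
    generalize 2 * Real.pi * Complex.I * ev (th S) (qq ((a * τ + b) / (c * τ + d))) = t
    field_simp
  rw [key2, key]
  simp only [Nat.add_sub_cancel, Pi.pow_apply, UpperHalfPlane.coe_mk]
  rcases m with _ | m
  · simp; ring
  · simp only [Nat.add_sub_cancel]; push_cast; ring

theorem transf_E2 (γ : SL(2, ℤ)) (τ : ℍ) : ev (Sv 1) (qq ↑(γ • τ)) =
    denom γ τ ^ (1 + 1) * ev (Sv 1) (qq τ) + 6 / (Real.pi * Complex.I) * (γ 1 0 : ℤ) * denom γ τ ^ 1 := by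
  change pt _ 1 = _ * pt _ 1 + _
  rw [pt_E2, pt_E2]
  have h1 := congrFun (E2_slash_action γ) τ
  rw [ModularForm.SL_slash_apply] at h1
  simp only [Pi.sub_apply, Pi.smul_apply, smul_eq_mul, D2, riemannZeta_two] at h1
  have hu := denom_ne_zero γ τ
  have hpi : (Real.pi : ℂ) ≠ 0 := by exact_mod_cast Real.pi_ne_zero
  have hI := Complex.I_ne_zero
  rw [zpow_neg, show (2:ℤ) = ((2:ℕ):ℤ) from rfl, zpow_natCast] at h1
  field_simp at h1 ⊢
  rw [h1]
  linear_combination (-6 * (γ 1 0 : ℤ) * denom γ τ) * Complex.I_sq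

theorem transf_E4 (γ : SL(2, ℤ)) (τ : ℍ) : ev (Sv 2) (qq ↑(γ • τ)) =
    denom γ τ ^ 4 * ev (Sv 2) (qq τ) := by
  change pt _ 2 = _ * pt _ 2
  rw [pt_E4, pt_E4]
  exact_mod_cast SlashInvariantForm.slash_action_eqn'' E₄ (γ := (γ : GL (Fin 2) ℝ)) (Γ := 𝒮ℒ) ⟨γ, rfl⟩ τ

theorem transf_E6 (γ : SL(2, ℤ)) (τ : ℍ) : ev (Sv 3) (qq ↑(γ • τ)) =
    denom γ τ ^ 6 * ev (Sv 3) (qq τ) := by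
  change pt _ 3 = _ * pt _ 3
  rw [pt_E6, pt_E6]
  exact_mod_cast SlashInvariantForm.slash_action_eqn'' E₆ (γ := (γ : GL (Fin 2) ℝ)) (Γ := 𝒮ℒ) ⟨γ, rfl⟩ τ

theorem coeff_zero_Sv (i : Fin 4) : PowerSeries.coeff 0 (Sv i) = if i = 0 then 0 else 1 := by
  fin_cases i <;> simp [Sv, eser]

theorem th_zero (S : PowerSeries ℤ) : PowerSeries.coeff 0 (th S) = 0 := by rw [coeff_th]; simp

theorem ram_aux (i : Fin 4) (m : ℤ) (B : MvPolynomial (Fin 4) ℤ) (k : ℕ) (hk : k < 12)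
    (hB : PowerSeries.coeff 0 (FS B) = 0)
    (hinv : ∀ (γ : SL(2, ℤ)) (τ : ℍ), m * ev (th (Sv i)) (qq ↑(γ • τ)) - MvPolynomial.aeval (pt (qq ↑(γ • τ))) B
      = denom γ τ ^ k * (m * ev (th (Sv i)) (qq τ) - MvPolynomial.aeval (pt (qq ↑τ)) B)) :
    PowerSeries.C m * th (Sv i) = FS B := by
  have hA : AW (PowerSeries.C m * th (Sv i)) := (aw_Sv i).th.cmul m
  have key : PowerSeries.C m * th (Sv i) + FS (-B) = 0 := by
    refine vanish _ (hA.add (aw_FS _)) k hk ?_ fun γ τ => ?_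
    · rw [map_add, PowerSeries.coeff_C_mul, th_zero, FS, map_neg, map_neg]
      rw [FS] at hB; rw [hB]; simp
    · rw [hA.ev_add (aw_FS _) (qq_lt _), hA.ev_add (aw_FS _) (qq_lt _), (aw_Sv i).th.ev_cmul m (qq_lt _),
        (aw_Sv i).th.ev_cmul m (qq_lt _), ev_FS _ (qq_lt _), ev_FS _ (qq_lt _), map_neg, map_neg,
        ← sub_eq_add_neg, ← sub_eq_add_neg]
      exact hinv γ τ
  rw [FS, map_neg, ← sub_eq_add_neg, sub_eq_zero] at key
  exact key

open MvPolynomial in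
theorem ram_P : PowerSeries.C 12 * th (Sv 1) = FS (X 1 ^ 2 - X 2) := by
  refine ram_aux 1 12 _ 4 (by norm_num) ?_ fun γ τ => ?_
  · have := coeff_zero_Sv; simp only [PowerSeries.coeff_zero_eq_constantCoeff] at this; simp [FS, this]
  · have h := transf_th (aw_Sv 1) 1 _ γ (transf_E2 γ) τ
    have h2 := transf_E2 γ τ
    have h4 := transf_E4 γ τ
    simp only [map_sub, map_pow, aeval_X]
    change _ - (ev (Sv 1) _ ^ 2 - ev (Sv 2) _) = _ * (_ - (ev (Sv 1) _ ^ 2 - ev (Sv 2) _))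
    rw [h2, h4]
    have hpi : (Real.pi : ℂ) ≠ 0 := by exact_mod_cast Real.pi_ne_zero
    have hI := Complex.I_ne_zero
    have e : ev (th (Sv 1)) (qq ↑(γ • τ)) = (2 * Real.pi * Complex.I)⁻¹ * (2 * Real.pi * Complex.I * ev (th (Sv 1)) (qq ↑(γ • τ))) := by
      field_simp
    rw [e, h]
    push_cast
    field_simp
    ring

open MvPolynomial in
theorem ram_Q : PowerSeries.C 3 * th (Sv 2) = FS (X 1 * X 2 - X 3) := by
  refine ram_aux 2 3 _ 6 (by norm_num) ?_ fun γ τ => ?_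
  · have := coeff_zero_Sv; simp only [PowerSeries.coeff_zero_eq_constantCoeff] at this; simp [FS, this]
  · have h := transf_th (aw_Sv 2) 3 0 γ (fun τ => by rw [transf_E4]; ring) τ
    have h2 := transf_E2 γ τ
    have h4 := transf_E4 γ τ
    have h6 := transf_E6 γ τ
    simp only [map_sub, map_mul, aeval_X]
    change _ - (ev (Sv 1) _ * ev (Sv 2) _ - ev (Sv 3) _) = _ * (_ - (ev (Sv 1) _ * ev (Sv 2) _ - ev (Sv 3) _))
    rw [h2, h4, h6]
    have hpi : (Real.pi : ℂ) ≠ 0 := by exact_mod_cast Real.pi_ne_zero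
    have hI := Complex.I_ne_zero
    have e : ev (th (Sv 2)) (qq ↑(γ • τ)) = (2 * Real.pi * Complex.I)⁻¹ * (2 * Real.pi * Complex.I * ev (th (Sv 2)) (qq ↑(γ • τ))) := by
      field_simp
    rw [e, h]
    push_cast
    field_simp
    ring

open MvPolynomial in
theorem ram_R : PowerSeries.C 2 * th (Sv 3) = FS (X 1 * X 3 - X 2 ^ 2) := by
  refine ram_aux 3 2 _ 8 (by norm_num) ?_ fun γ τ => ?_
  · have := coeff_zero_Sv; simp only [PowerSeries.coeff_zero_eq_constantCoeff] at this; simp [FS, this]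
  · have h := transf_th (aw_Sv 3) 5 0 γ (fun τ => by rw [transf_E6]; ring) τ
    have h2 := transf_E2 γ τ
    have h4 := transf_E4 γ τ
    have h6 := transf_E6 γ τ
    simp only [map_sub, map_mul, map_pow, aeval_X]
    change _ - (ev (Sv 1) _ * ev (Sv 3) _ - ev (Sv 2) _ ^ 2) = _ * (_ - (ev (Sv 1) _ * ev (Sv 3) _ - ev (Sv 2) _ ^ 2))
    rw [h2, h4, h6]
    have hpi : (Real.pi : ℂ) ≠ 0 := by exact_mod_cast Real.pi_ne_zero
    have hI := Complex.I_ne_zero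
    have e : ev (th (Sv 3)) (qq ↑(γ • τ)) = (2 * Real.pi * Complex.I)⁻¹ * (2 * Real.pi * Complex.I * ev (th (Sv 3)) (qq ↑(γ • τ))) := by
      field_simp
    rw [e, h]
    push_cast
    field_simp
    ring

end ramanujan
end Nes

open Complex
namespace Nes

/-! ### The derivation on polynomials -/

section derivation
open MvPolynomial

variable {n : Type}

theorem l1_eq_sum (B : MvPolynomial n ℤ) (s : Finset (n →₀ ℕ)) (hs : B.support ⊆ s) :
    l1 B = ∑ m ∈ s, |((B.coeff m : ℤ) : ℝ)| :=
  Finset.sum_subset hs fun m _ hm => by rw [notMem_support_iff.mp hm]; simp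

theorem l1_add_le (B C : MvPolynomial n ℤ) : l1 (B + C) ≤ l1 B + l1 C := by
  classical
  rw [l1_eq_sum (B + C) (B.support ∪ C.support) support_add,
    l1_eq_sum B (B.support ∪ C.support) Finset.subset_union_left,
    l1_eq_sum C (B.support ∪ C.support) Finset.subset_union_right, ← Finset.sum_add_distrib]
  refine Finset.sum_le_sum fun m _ => ?_
  rw [coeff_add]; push_cast
  exact abs_add_le _ _

theorem l1_neg (B : MvPolynomial n ℤ) : l1 (-B) = l1 B := by
  rw [l1, l1, support_neg]
  refine Finset.sum_congr rfl fun m _ => ?_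
  rw [coeff_neg]; push_cast; exact abs_neg _

theorem l1_sub_le (B C : MvPolynomial n ℤ) : l1 (B - C) ≤ l1 B + l1 C := by
  rw [sub_eq_add_neg, ← l1_neg C]; exact l1_add_le _ _

theorem l1_zero : l1 (0 : MvPolynomial n ℤ) = 0 := by simp [l1]

theorem l1_monomial (m : n →₀ ℕ) (a : ℤ) : l1 (monomial m a) = |(a : ℝ)| := by
  classical
  rw [l1_eq_sum _ {m} (support_monomial_subset)]
  simp

theorem l1_sum_le {ι : Type*} (s : Finset ι) (f : ι → MvPolynomial n ℤ) :
    l1 (∑ i ∈ s, f i) ≤ ∑ i ∈ s, l1 (f i) := by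
  classical
  induction s using Finset.induction_on with
  | empty => simp [l1_zero]
  | insert a s ha ih =>
    rw [Finset.sum_insert ha, Finset.sum_insert ha]
    exact (l1_add_le _ _).trans (by gcongr)

theorem l1_mul_le (B C : MvPolynomial n ℤ) : l1 (B * C) ≤ l1 B * l1 C := by
  have e : B * C = ∑ m ∈ B.support, ∑ k ∈ C.support, monomial (m + k) (B.coeff m * C.coeff k) := by
    conv_lhs => rw [B.as_sum, C.as_sum, Finset.sum_mul_sum]
    simp_rw [monomial_mul]
  rw [e]
  refine (l1_sum_le _ _).trans ?_
  rw [l1, Finset.sum_mul]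
  refine Finset.sum_le_sum fun m _ => (l1_sum_le _ _).trans ?_
  rw [l1, Finset.mul_sum]
  refine Finset.sum_le_sum fun k _ => ?_
  rw [l1_monomial]; push_cast; rw [abs_mul]

theorem l1_X (i : n) : l1 (X i : MvPolynomial n ℤ) = 1 := by
  rw [X, l1_monomial]; simp

theorem l1_C (a : ℤ) : l1 (C a : MvPolynomial n ℤ) = |(a:ℝ)| := l1_monomial 0 a

/-- images of the variables -/
noncomputable def dv : Fin 4 → MvPolynomial (Fin 4) ℤ :=
  ![C 12 * X 0, X 1 ^ 2 - X 2, C 4 * (X 1 * X 2 - X 3), C 6 * (X 1 * X 3 - X 2 ^ 2)]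

/-- Ramanujan derivation -/
noncomputable def dl : Derivation ℤ (MvPolynomial (Fin 4) ℤ) (MvPolynomial (Fin 4) ℤ) :=
  mkDerivation ℤ dv

theorem l1_dv (i : Fin 4) : l1 (dv i) ≤ 12 := by
  have h2 : ∀ i j : Fin 4, l1 (X i * X j : MvPolynomial (Fin 4) ℤ) ≤ 1 := fun i j => by
    refine (l1_mul_le _ _).trans ?_
    rw [l1_X, l1_X]; norm_num
  have h3 : ∀ i j k l : Fin 4, l1 (X i * X j - X k * X l : MvPolynomial (Fin 4) ℤ) ≤ 2 := fun i j k l => by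
    refine (l1_sub_le _ _).trans ?_
    linarith [h2 i j, h2 k l]
  have h4 : ∀ i j k : Fin 4, l1 (X i * X j - X k : MvPolynomial (Fin 4) ℤ) ≤ 2 := fun i j k => by
    refine (l1_sub_le _ _).trans ?_
    linarith [h2 i j, l1_X k]
  fin_cases i
  · change l1 (C 12 * X 0) ≤ _
    refine (l1_mul_le _ _).trans ?_
    rw [l1_C, l1_X]; norm_num
  · change l1 (X 1 ^ 2 - X 2) ≤ _
    rw [sq]; linarith [h4 1 1 2]
  · change l1 (C 4 * (X 1 * X 2 - X 3)) ≤ _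
    refine (l1_mul_le _ _).trans ?_
    rw [l1_C]; norm_num; linarith [h4 1 2 3]
  · change l1 (C 6 * (X 1 * X 3 - X 2 ^ 2)) ≤ _
    refine (l1_mul_le _ _).trans ?_
    rw [l1_C, sq]; norm_num; linarith [h3 1 3 2 2]

theorem deg_dv (i : Fin 4) : (dv i).totalDegree ≤ 2 := by
  have h1 : ∀ i : Fin 4, (X i : MvPolynomial (Fin 4) ℤ).totalDegree ≤ 1 := fun i => (totalDegree_X i).le
  have h2 : ∀ i j : Fin 4, (X i * X j : MvPolynomial (Fin 4) ℤ).totalDegree ≤ 2 := fun i j =>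
    (totalDegree_mul _ _).trans (by linarith [h1 i, h1 j])
  have h3 : ∀ i j k l : Fin 4, (X i * X j - X k * X l : MvPolynomial (Fin 4) ℤ).totalDegree ≤ 2 := fun i j k l =>
    (totalDegree_sub _ _).trans (max_le (h2 _ _) (h2 _ _))
  have h4 : ∀ i j k : Fin 4, (X i * X j - X k : MvPolynomial (Fin 4) ℤ).totalDegree ≤ 2 := fun i j k =>
    (totalDegree_sub _ _).trans (max_le (h2 _ _) ((h1 _).trans (by norm_num)))
  have hC : ∀ (a : ℤ) (p : MvPolynomial (Fin 4) ℤ), p.totalDegree ≤ 2 → (C a * p).totalDegree ≤ 2 := fun a p hp =>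
    (totalDegree_mul _ _).trans (by rw [totalDegree_C]; omega)
  fin_cases i
  · exact hC _ _ ((h1 0).trans (by norm_num))
  · change (X 1 ^ 2 - X 2 : MvPolynomial (Fin 4) ℤ).totalDegree ≤ _
    rw [sq]; exact h4 1 1 2
  · exact hC _ _ (h4 1 2 3)
  · change (C 6 * (X 1 * X 3 - X 2 ^ 2) : MvPolynomial (Fin 4) ℤ).totalDegree ≤ _
    rw [sq]; exact hC _ _ (h3 1 3 2 2)

theorem dl_eq (A : MvPolynomial (Fin 4) ℤ) : dl A = ∑ m ∈ A.support,
    A.coeff m • m.sum fun i k => monomial (m - Finsupp.single i 1) (k : ℤ) • dv i := by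
  conv_lhs => rw [A.as_sum, map_sum]
  refine Finset.sum_congr rfl fun m _ => ?_
  rw [dl, mkDerivation_monomial]

theorem l1_smul (a : ℤ) (B : MvPolynomial n ℤ) : l1 (a • B) ≤ |(a:ℝ)| * l1 B := by
  rw [smul_eq_C_mul, ← l1_C (n := n)]; exact l1_mul_le _ _

theorem l1_dl (A : MvPolynomial (Fin 4) ℤ) : l1 (dl A) ≤ 12 * A.totalDegree * l1 A := by
  rw [dl_eq]
  refine (l1_sum_le _ _).trans ?_
  rw [l1, Finset.mul_sum]
  refine Finset.sum_le_sum fun m hm => (l1_smul _ _).trans ?_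
  rw [mul_comm]
  refine mul_le_mul_of_nonneg_right ?_ (abs_nonneg _)
  rw [Finsupp.sum]
  refine (l1_sum_le _ _).trans ?_
  calc _ ≤ ∑ i ∈ m.support, (m i : ℝ) * 12 := by
        refine Finset.sum_le_sum fun i _ => (l1_mul_le _ _).trans ?_
        rw [l1_monomial]
        have : |((m i : ℤ) : ℝ)| = (m i : ℝ) := by simp
        rw [this]
        exact mul_le_mul_of_nonneg_left (l1_dv i) (by positivity)
    _ = 12 * ((m.sum fun _ e => e : ℕ) : ℝ) := by
        rw [← Finset.sum_mul, Finsupp.sum]; push_cast; ring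
    _ ≤ _ := by
        gcongr; exact le_totalDegree hm

theorem deg_dl (A : MvPolynomial (Fin 4) ℤ) : (dl A).totalDegree ≤ A.totalDegree + 1 := by
  classical
  rw [dl_eq]
  refine totalDegree_finsetSum_le fun m hm => (totalDegree_smul_le _ _).trans ?_
  rw [Finsupp.sum]
  refine totalDegree_finsetSum_le fun i hi => (totalDegree_mul _ _).trans ?_
  have h1 : (monomial (m - Finsupp.single i 1) ((m i : ℕ) : ℤ)).totalDegree ≤ A.totalDegree - 1 := by
    refine (totalDegree_monomial_le _ _).trans ?_
    have h2 := le_totalDegree hm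
    have h3 : m - Finsupp.single i 1 + Finsupp.single i 1 = m :=
      tsub_add_cancel_of_le (Finsupp.single_le_iff.mpr (Nat.one_le_iff_ne_zero.mpr (Finsupp.mem_support_iff.mp hi)))
    have h4 : ((m - Finsupp.single i 1).sum fun _ e => e) + 1 = m.sum fun _ e => e := by
      conv_rhs => rw [← h3]
      rw [Finsupp.sum_add_index' (fun _ => rfl) (fun _ _ _ => rfl), Finsupp.sum_single_index rfl]
    have h5 : ((m - Finsupp.single i 1).sum fun _ => id) = ((m - Finsupp.single i 1).sum fun _ e => e) := rfl
    omega
  have h6 := deg_dv i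
  have h7 : 1 ≤ A.totalDegree := by
    refine le_trans ?_ (le_totalDegree hm)
    refine le_trans (Nat.one_le_iff_ne_zero.mpr (Finsupp.mem_support_iff.mp hi)) ?_
    exact Finset.single_le_sum (f := fun i => m i) (fun _ _ => Nat.zero_le _) hi
  omega

theorem FS_X (i : Fin 4) : FS (X i) = Sv i := by simp [FS]

theorem FS_dv (i : Fin 4) : FS (dv i) = PowerSeries.C 12 * th (Sv i) := by
  have hC : ∀ (a : ℤ) B, FS (C a * B) = PowerSeries.C a * FS B := fun a B => by
    rw [FS, map_mul, aeval_C]; rfl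
  fin_cases i
  · change FS (C 12 * X 0) = PowerSeries.C 12 * th (Sv 0)
    rw [hC, FS_X]
    congr 1
    ext n
    rw [coeff_th]
    change PowerSeries.coeff n (PowerSeries.X : PowerSeries ℤ) = (n:ℤ) * PowerSeries.coeff n (PowerSeries.X : PowerSeries ℤ)
    rw [PowerSeries.coeff_X]
    split_ifs with h <;> simp [h]
  · exact ram_P.symm
  · change FS (C 4 * (X 1 * X 2 - X 3)) = PowerSeries.C 12 * th (Sv 2)
    rw [hC, ← ram_Q, ← mul_assoc, ← map_mul]; norm_num
  · change FS (C 6 * (X 1 * X 3 - X 2 ^ 2)) = PowerSeries.C 12 * th (Sv 3)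
    rw [hC, ← ram_R, ← mul_assoc, ← map_mul]; norm_num

theorem FS_dl (A : MvPolynomial (Fin 4) ℤ) : FS (dl A) = PowerSeries.C 12 * th (FS A) := by
  induction A using MvPolynomial.induction_on with
  | C a =>
    have h1 : FS (C a) = algebraMap ℤ (PowerSeries ℤ) a := by rw [FS, aeval_C]
    have h2 : dl (C a) = 0 := dl.map_algebraMap a
    rw [h1, h2, Derivation.map_algebraMap, FS, map_zero, mul_zero]
  | add p s hp hs =>
    rw [FS] at hp hs ⊢
    rw [map_add, map_add, hp, hs, FS, FS, FS, map_add, map_add, mul_add]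
  | mul_X p i hp =>
    have h1 : FS (p * X i) = FS p * Sv i := by rw [FS, map_mul, aeval_X]; rfl
    have h2 : dl (p * X i) = p * dv i + X i * dl p := by
      rw [Derivation.leibniz, dl, mkDerivation_X]; rfl
    have h3 : FS (p * dv i + X i * dl p) = FS p * FS (dv i) + Sv i * FS (dl p) := by
      rw [FS, map_add, map_mul, map_mul, aeval_X]; rfl
    rw [h1, h2, h3, FS_dv, hp, Derivation.leibniz]
    simp only [smul_eq_mul]
    ring

/-- iterates -/
noncomputable def dit (T : ℕ) (A : MvPolynomial (Fin 4) ℤ) : MvPolynomial (Fin 4) ℤ := (fun B => dl B)^[T] A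

theorem dit_succ (T : ℕ) (A : MvPolynomial (Fin 4) ℤ) : dit (T + 1) A = dl (dit T A) :=
  Function.iterate_succ_apply' _ _ _

theorem deg_dit (T : ℕ) (A : MvPolynomial (Fin 4) ℤ) : (dit T A).totalDegree ≤ A.totalDegree + T := by
  induction T with
  | zero => exact le_rfl
  | succ T ih => rw [dit_succ]; exact (deg_dl _).trans (by omega)

theorem l1_dit (T : ℕ) (A : MvPolynomial (Fin 4) ℤ) (D : ℕ) (hD : A.totalDegree + T ≤ D) :
    l1 (dit T A) ≤ (12 * D) ^ T * l1 A := by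
  induction T with
  | zero => rw [pow_zero, one_mul]; exact le_rfl
  | succ T ih =>
    rw [dit_succ, pow_succ]
    refine (l1_dl _).trans ?_
    have h := ih (by omega)
    have h2 : ((dit T A).totalDegree : ℝ) ≤ D := by
      have := deg_dit T A
      exact_mod_cast (by omega : (dit T A).totalDegree ≤ D)
    calc _ ≤ 12 * (D:ℝ) * ((12 * D) ^ T * l1 A) := by
          gcongr
          exact l1_nonneg _
      _ = _ := by ring

theorem coeff_FS_dit (T : ℕ) (A : MvPolynomial (Fin 4) ℤ) (k : ℕ) :
    PowerSeries.coeff k (FS (dit T A)) = 12 ^ T * k ^ T * PowerSeries.coeff k (FS A) := by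
  induction T with
  | zero => simp [dit]
  | succ T ih =>
    rw [dit_succ, FS_dl, PowerSeries.coeff_C_mul, coeff_th, ih]; ring

end derivation
end Nes

open Complex
namespace Nes

/-! ### The kernel functional -/

section kernel

theorem cauchy_coeff (c : ℕ → ℂ) (h : ℂ → ℂ) (hs : ∀ v : ℂ, ‖v‖ < 1 → HasSum (fun n => c n * v ^ n) (h v))
    {r B : ℝ} (hr : 0 < r) (hr1 : r < 1) (hB : ∀ v : ℂ, ‖v‖ = r → ‖h v‖ ≤ B) (n : ℕ) : ‖c n‖ * r ^ n ≤ B := by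
  have H : HasFPowerSeriesOnBall h (.ofScalars ℂ c) 0 1 := by
    constructor
    · refine le_of_forall_lt_imp_le_of_dense fun r hr ↦ ?_
      lift r to NNReal using hr.ne_top
      apply FormalMultilinearSeries.le_radius_of_summable
      simpa [smul_eq_mul, norm_mul, mul_comm, mul_left_comm, mul_assoc] using
        (hs (r : ℂ) (by simpa using hr)).summable.norm
    · simp
    · intro y hy
      rw [← ENNReal.coe_one, Metric.eball_coe, NNReal.coe_one, mem_ball_zero_iff] at hy
      simpa [mul_comm] using hs y hy
  have h1 := H.hasFPowerSeriesAt.eq_formalMultilinearSeries H.analyticAt.hasFPowerSeriesAt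
  have h2 := congr_arg (FormalMultilinearSeries.coeff · n) h1
  simp only [FormalMultilinearSeries.coeff_ofScalars] at h2
  have hd : DifferentiableOn ℂ h (Metric.ball 0 1) := by
    have := H.differentiableOn
    rwa [← ENNReal.coe_one, Metric.eball_coe, NNReal.coe_one] at this
  have h3 := Complex.norm_iteratedDeriv_le_of_forall_mem_sphere_norm_le n hr (f := h) (c := 0) (C := B)
    (DifferentiableOn.diffContOnCl_ball (U := Metric.ball 0 1) hd (by
      intro z hz
      simp only [Metric.mem_closedBall, dist_zero_right, Metric.mem_ball] at hz ⊢
      linarith)) (fun z hz => hB z (by simpa using hz))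
  rw [h2, norm_div, Complex.norm_natCast]
  have hf : (0:ℝ) < n.factorial := by exact_mod_cast n.factorial_pos
  rw [le_div_iff₀ (by positivity)] at h3
  rw [div_mul_eq_mul_div, div_le_iff₀ hf]
  linarith

/-- kernel polynomial -/
noncomputable def kerP (T0 : ℕ) (ρ : ℝ) (m : ℕ) : ℝ :=
  ∑ j ∈ Finset.range T0, (T0.choose (j + 1) : ℝ) * (-(1 - ρ)) ^ (j + 1) * ((m + j).choose j : ℝ)

theorem kerP_zero (T0 : ℕ) (ρ : ℝ) : kerP T0 ρ 0 = ρ ^ T0 - 1 := by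
  have h := add_pow (-(1 - ρ)) 1 T0
  rw [Finset.sum_range_succ'] at h
  rw [show -(1 - ρ) + 1 = ρ by ring] at h
  rw [h, kerP]
  simp only [zero_add, Nat.choose_self, one_pow, mul_one, pow_zero, Nat.choose_zero_right, Nat.cast_one]
  rw [add_sub_cancel_right]
  exact Finset.sum_congr rfl fun j _ => by ring

theorem kerP_hasSum (T0 : ℕ) (ρ : ℝ) (v : ℂ) (hv : ‖v‖ < 1) :
    HasSum (fun m => (((kerP T0 ρ m : ℝ) : ℂ) + if m = 0 then 1 else 0) * v ^ m) (((ρ - v) / (1 - v)) ^ T0) := by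
  have hv1 : (1 - v) ≠ 0 := by
    intro h
    rw [sub_eq_zero] at h
    rw [← h] at hv; simp at hv
  have h1 : HasSum (fun m => ((kerP T0 ρ m : ℝ) : ℂ) * v ^ m)
      (∑ j ∈ Finset.range T0, (T0.choose (j + 1) : ℂ) * (-(1 - ρ)) ^ (j + 1) * (1 / (1 - v) ^ (j + 1))) := by
    have := hasSum_sum (s := Finset.range T0) fun j _ =>
      (hasSum_choose_mul_geometric_of_norm_lt_one j hv).mul_left ((T0.choose (j + 1) : ℂ) * (-(1 - (ρ:ℂ))) ^ (j + 1))
    have e : (fun m => ((kerP T0 ρ m : ℝ) : ℂ) * v ^ m) = fun m : ℕ => ∑ j ∈ Finset.range T0,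
        (T0.choose (j + 1) : ℂ) * (-(1 - (ρ:ℂ))) ^ (j + 1) * (((m + j).choose j : ℂ) * v ^ m) := by
      funext m
      rw [kerP]
      push_cast
      rw [Finset.sum_mul]
      exact Finset.sum_congr rfl fun j _ => by ring
    rw [e]; exact this
  have h2 : HasSum (fun m : ℕ => (if m = 0 then (1:ℂ) else 0) * v ^ m) 1 := by
    convert hasSum_ite_eq 0 (1:ℂ) using 1
    funext m
    split_ifs with h <;> simp [h]
  have h3 := h1.add h2
  convert h3 using 1
  · funext m; ring
  · have h := add_pow (-(1 - (ρ:ℂ)) / (1 - v)) 1 T0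
    rw [Finset.sum_range_succ'] at h
    rw [show (ρ - v) / (1 - v) = -(1 - (ρ:ℂ)) / (1 - v) + 1 by field_simp; ring, h]
    congr 1
    · refine Finset.sum_congr rfl fun j _ => ?_
      rw [div_pow]; simp; ring
    · simp

theorem blaschke (r : ℝ) (hr : 0 < r) (hr1 : r < 1) (v : ℂ) (hv : ‖v‖ = r) :
    ‖(((r ^ 2 : ℝ) : ℂ) - v) / (1 - v)‖ = r := by
  have hv1 : (1 - v) ≠ 0 := by
    intro h
    rw [sub_eq_zero] at h
    rw [← h] at hv; simp at hv; linarith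
  rw [norm_div, div_eq_iff (norm_ne_zero_iff.mpr hv1), ← sq_eq_sq₀ (norm_nonneg _) (by positivity), mul_pow,
    ← Complex.normSq_eq_norm_sq, ← Complex.normSq_eq_norm_sq]
  have h2 : v.re * v.re + v.im * v.im = r ^ 2 := by
    rw [← hv, ← Complex.normSq_eq_norm_sq, Complex.normSq_apply]
  rw [Complex.normSq_apply, Complex.normSq_apply]
  simp only [sub_re, ofReal_re, sub_im, ofReal_im, one_re, one_im, zero_sub]
  nlinarith [h2]

theorem kerP_le (T0 : ℕ) (r : ℝ) (hr : 0 < r) (hr1 : r < 1) (m : ℕ) (hm : m ≠ 0) :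
    |kerP T0 (r ^ 2) m| * r ^ m ≤ r ^ T0 := by
  have := cauchy_coeff _ _ (kerP_hasSum T0 (r ^ 2)) hr hr1 (B := r ^ T0) (fun v hv => by
    rw [norm_pow, blaschke r hr hr1 v hv]) m
  simpa [hm] using this

theorem choose_rec (m j : ℕ) : (((m + (j + 1)).choose (j + 1) : ℕ) : ℝ) =
    (((m + j).choose j : ℕ) : ℝ) * (m + j + 1) / (j + 1) := by
  have h := Nat.add_one_mul_choose_eq (m + j) j
  have h' : (((m + j + 1 : ℕ) : ℝ)) * (((m + j).choose j : ℕ) : ℝ) = (((m + j + 1).choose (j + 1) : ℕ) : ℝ) * ((j + 1 : ℕ) : ℝ) := by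
    exact_mod_cast h
  rw [eq_div_iff (by positivity), ← add_assoc]
  push_cast at h' ⊢
  linarith

theorem ker_summable (a : ℕ → ℂ) (M : ℕ) (H : ∀ t : ℕ, Summable fun m : ℕ => ((M:ℝ) + m) ^ t * ‖a m‖)
    (j t : ℕ) : Summable fun m : ℕ => ((M:ℝ) + m) ^ t * ((m + j).choose j : ℝ) * ‖a m‖ := by
  induction j generalizing t with
  | zero => simpa using H t
  | succ j ih =>
    have h1 := ih (t + 1)
    have h2 := (ih t).mul_left ((j + 1 : ℝ))
    refine Summable.of_nonneg_of_le (fun _ => by positivity) (fun m => ?_) (h1.add h2)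
    rw [choose_rec]
    have : (((m + j).choose j : ℕ) : ℝ) * (m + j + 1) / (j + 1) ≤ ((m + j).choose j : ℕ) * ((M + m) + (j + 1)) := by
      rw [div_le_iff₀ (by positivity), mul_assoc]
      refine mul_le_mul_of_nonneg_left ?_ (by positivity)
      have : (0:ℝ) ≤ M := by positivity
      have : (0:ℝ) ≤ m := by positivity
      have : (0:ℝ) ≤ j := by positivity
      nlinarith [mul_nonneg ‹(0:ℝ) ≤ M› ‹(0:ℝ) ≤ j›, mul_nonneg ‹(0:ℝ) ≤ m› ‹(0:ℝ) ≤ j›]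
    calc _ ≤ ((M:ℝ) + m) ^ t * (((m + j).choose j : ℕ) * ((M + m) + (j + 1))) * ‖a m‖ := by gcongr
      _ = _ := by ring

theorem ker_summable' (a : ℕ → ℂ) (M : ℕ) (H : ∀ t : ℕ, Summable fun m : ℕ => ((M:ℝ) + m) ^ t * ‖a m‖)
    (j t : ℕ) : Summable fun m : ℕ => ((M:ℂ) + m) ^ t * ((m + j).choose j : ℂ) * a m := by
  refine Summable.of_norm ?_
  convert ker_summable a M H j t using 2 with m
  rw [norm_mul, norm_mul, norm_pow, Complex.norm_natCast]
  norm_cast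

theorem ker_bound (a : ℕ → ℂ) (M T0 : ℕ) (H : ∀ t : ℕ, Summable fun m : ℕ => ((M:ℝ) + m) ^ t * ‖a m‖)
    (ε : ℝ) (hε : ∀ t < T0, ‖∑' m : ℕ, ((M:ℂ) + m) ^ t * a m‖ ≤ ε)
    (hε0 : 0 ≤ ε) (j t : ℕ) (hjt : t + j < T0) :
    ‖∑' m : ℕ, ((M:ℂ) + m) ^ t * ((m + j).choose j : ℂ) * a m‖ ≤ (M + T0 + 1) ^ j * ε := by
  induction j generalizing t with
  | zero => simpa using hε t (by omega)
  | succ j ih =>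
    have h1 := ih (t + 1) (by omega)
    have h2 := ih t (by omega)
    have s1 := ker_summable' a M H j (t + 1)
    have s2 := ker_summable' a M H j t
    have e : ∀ m : ℕ, ((M:ℂ) + m) ^ t * ((m + (j + 1)).choose (j + 1) : ℂ) * a m =
        ((j:ℂ) + 1)⁻¹ * (((M:ℂ) + m) ^ (t + 1) * ((m + j).choose j : ℂ) * a m +
        (j + 1 - M) * (((M:ℂ) + m) ^ t * ((m + j).choose j : ℂ) * a m)) := fun m => by
      have := congrArg (fun x : ℝ => (x : ℂ)) (choose_rec m j)
      push_cast at this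
      rw [this]
      have : (j:ℂ) + 1 ≠ 0 := by exact_mod_cast Nat.succ_ne_zero j
      field_simp
      ring
    simp_rw [e]
    rw [tsum_mul_left, s1.tsum_add (s2.mul_left _), tsum_mul_left, norm_mul]
    have n1 : ‖((j:ℂ) + 1)⁻¹‖ ≤ 1 := by
      rw [norm_inv]
      refine inv_le_one_of_one_le₀ ?_
      rw [show (j:ℂ) + 1 = ((j + 1 : ℕ) : ℂ) by push_cast; ring, Complex.norm_natCast]
      exact_mod_cast Nat.succ_le_succ (Nat.zero_le j)
    have n2 : ‖(j:ℂ) + 1 - M‖ ≤ M + T0 := by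
      have : ‖(j:ℂ) + 1 - M‖ = |(j:ℝ) + 1 - M| := by
        rw [← Real.norm_eq_abs, ← Complex.norm_real]; push_cast; rfl
      rw [this, abs_le]
      have h1 : ((j:ℝ) + 1) ≤ T0 := by exact_mod_cast (by omega : j + 1 ≤ T0)
      have : (0:ℝ) ≤ M := by positivity
      have : (0:ℝ) ≤ j := by positivity
      constructor <;> linarith
    calc _ ≤ 1 * ((M + T0 + 1) ^ j * ε + (M + T0) * ((M + T0 + 1) ^ j * ε)) := by
          refine mul_le_mul n1 ((norm_add_le _ _).trans (add_le_add h1 ?_)) (norm_nonneg _) zero_le_one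
          rw [norm_mul]
          exact mul_le_mul n2 h2 (norm_nonneg _) (by positivity)
      _ = _ := by ring

theorem ker_main (a : ℕ → ℂ) (M T0 : ℕ) (H : ∀ t : ℕ, Summable fun m : ℕ => ((M:ℝ) + m) ^ t * ‖a m‖)
    (ε : ℝ) (hε : ∀ t < T0, ‖∑' m : ℕ, ((M:ℂ) + m) ^ t * a m‖ ≤ ε)
    (hε0 : 0 ≤ ε) (hT : 1 ≤ T0) (r : ℝ) (hr : 0 < r) (hr1 : r < 1)
    (W : ℝ) (hW : Summable fun m => ‖a m‖ / r ^ m) (hW' : ∑' m, ‖a m‖ / r ^ m ≤ W) :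
    (1 - r ^ 2) * ‖a 0‖ ≤ (2 * (M + T0 + 1)) ^ T0 * ε + r ^ T0 * W := by
  have hk : ∀ m, ((kerP T0 (r ^ 2) m : ℝ) : ℂ) * a m = ∑ j ∈ Finset.range T0,
      ((T0.choose (j + 1) : ℂ) * (-(1 - (r:ℂ) ^ 2)) ^ (j + 1)) * (((M:ℂ) + m) ^ 0 * ((m + j).choose j : ℂ) * a m) := fun m => by
    rw [kerP]; push_cast; rw [Finset.sum_mul]
    exact Finset.sum_congr rfl fun j _ => by ring
  have hs : Summable fun m => ((kerP T0 (r ^ 2) m : ℝ) : ℂ) * a m := by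
    simp_rw [hk]
    exact summable_sum fun j _ => (ker_summable' a M H j 0).mul_left _
  have h1 : ‖∑' m, ((kerP T0 (r ^ 2) m : ℝ) : ℂ) * a m‖ ≤ (2 * (M + T0 + 1)) ^ T0 * ε := by
    simp_rw [hk]
    rw [Summable.tsum_finsetSum fun j _ => (ker_summable' a M H j 0).mul_left _]
    refine (norm_sum_le _ _).trans ?_
    calc _ ≤ ∑ j ∈ Finset.range T0, (T0.choose (j + 1) : ℝ) * ((M + T0 + 1) ^ T0 * ε) := by
          refine Finset.sum_le_sum fun j hj => ?_
          have hj' := Finset.mem_range.mp hj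
          rw [tsum_mul_left, norm_mul, norm_mul, Complex.norm_natCast, mul_assoc]
          refine mul_le_mul_of_nonneg_left ?_ (by positivity)
          have n1 : ‖(-(1 - (r:ℂ) ^ 2)) ^ (j + 1)‖ ≤ 1 := by
            rw [norm_pow, norm_neg]
            refine pow_le_one₀ (norm_nonneg _) ?_
            rw [show 1 - (r:ℂ) ^ 2 = ((1 - r ^ 2 : ℝ) : ℂ) by push_cast; ring, Complex.norm_real, Real.norm_eq_abs, abs_le]
            constructor <;> nlinarith
          have n2 := ker_bound a M T0 H ε hε hε0 j 0 (by omega)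
          have n3 : ((M:ℝ) + T0 + 1) ^ j ≤ (M + T0 + 1) ^ T0 :=
            pow_le_pow_right₀ (by linarith [(Nat.cast_nonneg M : (0:ℝ) ≤ M), (Nat.cast_nonneg T0 : (0:ℝ) ≤ T0)]) hj'.le
          calc _ ≤ 1 * ((M + T0 + 1) ^ j * ε) := mul_le_mul n1 n2 (norm_nonneg _) zero_le_one
            _ ≤ _ := by rw [one_mul]; gcongr
      _ ≤ 2 ^ T0 * ((M + T0 + 1) ^ T0 * ε) := by
          rw [← Finset.sum_mul]
          refine mul_le_mul_of_nonneg_right ?_ (by positivity)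
          have := Nat.sum_range_choose T0
          rw [Finset.sum_range_succ'] at this
          have h2 : ∑ j ∈ Finset.range T0, T0.choose (j + 1) ≤ 2 ^ T0 := by omega
          exact_mod_cast h2
      _ = _ := by rw [mul_pow]; ring
  have h2 : ‖∑' m, ((kerP T0 (r ^ 2) (m + 1) : ℝ) : ℂ) * a (m + 1)‖ ≤ r ^ T0 * W := by
    have hb : ∀ m, ‖((kerP T0 (r ^ 2) (m + 1) : ℝ) : ℂ) * a (m + 1)‖ ≤ r ^ T0 * (‖a (m + 1)‖ / r ^ (m + 1)) := fun m => by
      rw [norm_mul, Complex.norm_real, Real.norm_eq_abs]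
      have := kerP_le T0 r hr hr1 (m + 1) (Nat.succ_ne_zero m)
      rw [← le_div_iff₀ (by positivity)] at this
      calc _ ≤ r ^ T0 / r ^ (m + 1) * ‖a (m + 1)‖ := by gcongr
        _ = _ := by ring
    have hs' := ((summable_nat_add_iff 1).mpr hW)
    refine (tsum_of_norm_bounded (hs'.mul_left (r ^ T0)).hasSum hb).trans ?_
    rw [tsum_mul_left]
    refine mul_le_mul_of_nonneg_left (le_trans ?_ hW') (by positivity)
    rw [hW.tsum_eq_zero_add]
    have : 0 ≤ ‖a 0‖ / r ^ 0 := by positivity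
    linarith
  have h3 := hs.tsum_eq_zero_add
  have h4 : ((kerP T0 (r ^ 2) 0 : ℝ) : ℂ) * a 0 = ∑' m, ((kerP T0 (r ^ 2) m : ℝ) : ℂ) * a m - ∑' m, ((kerP T0 (r ^ 2) (m + 1) : ℝ) : ℂ) * a (m + 1) := by
    rw [h3]; ring
  have h5 : ‖((kerP T0 (r ^ 2) 0 : ℝ) : ℂ) * a 0‖ ≤ (2 * (M + T0 + 1)) ^ T0 * ε + r ^ T0 * W := by
    rw [h4]; exact (norm_sub_le _ _).trans (add_le_add h1 h2)
  refine le_trans ?_ h5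
  rw [norm_mul, Complex.norm_real, kerP_zero]
  refine mul_le_mul_of_nonneg_right ?_ (norm_nonneg _)
  rw [Real.norm_eq_abs, abs_sub_comm]
  refine le_trans ?_ (le_abs_self _)
  have : (r ^ 2) ^ T0 ≤ (r ^ 2) ^ 1 := pow_le_pow_of_le_one (by positivity) (by nlinarith) hT
  linarith

end kernel
end Nes

open Complex
namespace Nes

section derivs

theorem dit_hasSum (A : MvPolynomial (Fin 4) ℤ) (T : ℕ) {q : ℂ} (hq : ‖q‖ < 1) :
    HasSum (fun n : ℕ => (12:ℂ) ^ T * ((n:ℂ) ^ T * (((PowerSeries.coeff n (FS A) : ℤ) : ℂ) * q ^ n)))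
      (MvPolynomial.aeval (pt q) (dit T A)) := by
  obtain ⟨b, hb⟩ := aw_FS (dit T A) ‖q‖ (norm_nonneg _) hq
  have h := hb.hasSum le_rfl
  rw [ev_FS _ hq] at h
  have e : (fun n : ℕ => (12:ℂ) ^ T * ((n:ℂ) ^ T * (((PowerSeries.coeff n (FS A) : ℤ) : ℂ) * q ^ n)))
      = fun n => ((PowerSeries.coeff n (FS (dit T A)) : ℤ) : ℂ) * q ^ n := by
    funext n
    rw [coeff_FS_dit]
    push_cast
    ring
  rw [e]
  exact h

theorem dit_summable (A : MvPolynomial (Fin 4) ℤ) (T : ℕ) {q : ℂ} (hq : ‖q‖ < 1) :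
    Summable (fun n : ℕ => (n:ℝ) ^ T * ‖((PowerSeries.coeff n (FS A) : ℤ) : ℂ) * q ^ n‖) := by
  obtain ⟨b, hb⟩ := aw_FS (dit T A) ‖q‖ (norm_nonneg _) hq
  have h := (hb.norm_summable (q := q) le_rfl).mul_left ((12:ℝ) ^ T)⁻¹
  refine h.congr fun n => ?_
  rw [coeff_FS_dit]
  push_cast
  simp only [norm_mul, norm_pow, Complex.norm_natCast]
  norm_num
  field_simp

theorem deriv_lower (A : MvPolynomial (Fin 4) ℤ) (q : ℂ) (ρ : ℝ) (hρ : 0 < ρ) (hρ1 : ρ < 1) (hq : ‖q‖ = ρ ^ 2)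
    (M : ℕ) (hM : ∀ n < M, PowerSeries.coeff n (FS A) = 0) (hM' : PowerSeries.coeff M (FS A) ≠ 0)
    (T0 : ℕ) (hT : 1 ≤ T0) (rr : ℝ) (hrr : ρ ≤ rr) (hrr1 : rr < 1) (b : ℝ) (hb : Wt (FS A) rr b)
    (h : ρ ^ T0 * (b / rr ^ M) ≤ (1 - ρ ^ 2) / 2) :
    ∃ T < T0, (1 - ρ ^ 2) / 4 * ρ ^ (2 * M) / (2 * (M + T0 + 1)) ^ T0 ≤ ‖MvPolynomial.aeval (pt q) (dit T A)‖ := by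
  by_contra hcon
  push Not at hcon
  have hq1 : ‖q‖ < 1 := by rw [hq]; nlinarith
  set ε := (1 - ρ ^ 2) / 4 * ρ ^ (2 * M) / (2 * (M + T0 + 1)) ^ T0 with hε
  have h1ρ : 0 < 1 - ρ ^ 2 := by nlinarith
  have hε0 : 0 ≤ ε := by positivity
  have hrr0 : 0 < rr := hρ.trans_le hrr
  set f : ℕ → ℂ := fun n => ((PowerSeries.coeff n (FS A) : ℤ) : ℂ) * q ^ n with hf
  have hf0 : ∀ n < M, f n = 0 := fun n hn => by rw [hf]; simp [hM n hn]
  have hH : ∀ t, Summable fun m : ℕ => ((M:ℝ) + m) ^ t * ‖f (M + m)‖ := fun t => by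
    have := (summable_nat_add_iff M).mpr (dit_summable A t hq1)
    refine this.congr fun m => ?_
    simp only [hf]
    rw [add_comm m M]; push_cast; rfl
  have hε' : ∀ t < T0, ‖∑' m : ℕ, ((M:ℂ) + m) ^ t * f (M + m)‖ ≤ ε := fun t ht => by
    have hs := dit_hasSum A t hq1
    have h1 := hs.tsum_eq
    rw [tsum_mul_left] at h1
    have h2 : ∑' n : ℕ, (n:ℂ) ^ t * f n = ∑' m : ℕ, ((M:ℂ) + m) ^ t * f (M + m) := by
      have hs' : Summable fun n : ℕ => (n:ℂ) ^ t * f n := by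
        refine Summable.of_norm ((dit_summable A t hq1).congr fun n => ?_)
        rw [norm_mul ((n:ℂ) ^ t), norm_pow (n:ℂ), Complex.norm_natCast]
      rw [← hs'.sum_add_tsum_nat_add M, Finset.sum_eq_zero, zero_add]
      · refine tsum_congr fun m => ?_
        rw [add_comm m M]; push_cast; rfl
      · intro n hn
        rw [hf0 n (Finset.mem_range.mp hn), mul_zero]
    rw [← h2]
    refine le_trans ?_ (hcon t ht).le
    rw [← h1, norm_mul, norm_pow]
    refine le_mul_of_one_le_left (norm_nonneg _) (one_le_pow₀ (by norm_num))
  have hWle : ∀ m, ‖f (M + m)‖ / ρ ^ m ≤ ρ ^ (2 * M) * (rr ^ M)⁻¹ * (|((PowerSeries.coeff (m + M) (FS A) : ℤ) : ℝ)| * rr ^ (m + M)) := fun m => by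
    simp only [hf]
    rw [norm_mul, norm_pow, Complex.norm_intCast, hq, add_comm M m]
    have e1 : |((PowerSeries.coeff (m + M) (FS A) : ℤ) : ℝ)| * (ρ ^ 2) ^ (m + M) / ρ ^ m
      = ρ ^ (2 * M) * |((PowerSeries.coeff (m + M) (FS A) : ℤ) : ℝ)| * ρ ^ m := by
      rw [div_eq_iff (by positivity), ← pow_mul, mul_add, pow_add, two_mul m, pow_add]; ring
    have e2 : ρ ^ (2 * M) * (rr ^ M)⁻¹ * (|((PowerSeries.coeff (m + M) (FS A) : ℤ) : ℝ)| * rr ^ (m + M))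
      = ρ ^ (2 * M) * |((PowerSeries.coeff (m + M) (FS A) : ℤ) : ℝ)| * rr ^ m := by
      rw [pow_add]; field_simp
    rw [e1, e2]
    gcongr
  have hs0 := (summable_nat_add_iff M).mpr hb.1
  have hW : Summable fun m : ℕ => ‖f (M + m)‖ / ρ ^ m :=
    Summable.of_nonneg_of_le (fun m => by positivity) hWle (hs0.mul_left _)
  have hW' : ∑' m : ℕ, ‖f (M + m)‖ / ρ ^ m ≤ ρ ^ (2 * M) * (b / rr ^ M) := by
    refine (hW.tsum_le_tsum hWle (hs0.mul_left _)).trans ?_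
    rw [tsum_mul_left, div_eq_mul_inv, mul_assoc, mul_comm b]
    have : ∑' m : ℕ, |((PowerSeries.coeff (m + M) (FS A) : ℤ) : ℝ)| * rr ^ (m + M) ≤ b := by
      refine le_trans ?_ hb.2
      rw [← hb.1.sum_add_tsum_nat_add M]
      exact le_add_of_nonneg_left (Finset.sum_nonneg fun _ _ => by positivity)
    gcongr
  have key := ker_main (fun m => f (M + m)) M T0 hH ε hε' hε0 hT ρ hρ hρ1 _ hW hW'
  have hP : (0:ℝ) < (2 * (M + T0 + 1)) ^ T0 := by positivity
  have k1 : (2 * ((M:ℝ) + T0 + 1)) ^ T0 * ε = (1 - ρ ^ 2) / 4 * ρ ^ (2 * M) := by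
    rw [hε]; field_simp
  have k2 : ρ ^ T0 * (ρ ^ (2 * M) * (b / rr ^ M)) ≤ ρ ^ (2 * M) * ((1 - ρ ^ 2) / 2) := by
    calc _ = ρ ^ (2 * M) * (ρ ^ T0 * (b / rr ^ M)) := by ring
      _ ≤ _ := by gcongr
  have k3 : ρ ^ (2 * M) ≤ ‖f (M + 0)‖ := by
    simp only [hf, add_zero]
    rw [norm_mul, norm_pow, Complex.norm_intCast, hq, ← pow_mul]
    refine le_mul_of_one_le_left (by positivity) ?_
    exact_mod_cast Int.one_le_abs hM'
  have k4 : 0 < ρ ^ (2 * M) := by positivity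
  rw [k1] at key
  have k5 := mul_le_mul_of_nonneg_left k3 h1ρ.le
  have k6 : 0 < (1 - ρ ^ 2) * ρ ^ (2 * M) := by positivity
  nlinarith

theorem deriv_upper (A : MvPolynomial (Fin 4) ℤ) (q : ℂ) (ρ : ℝ) (hρ : 0 < ρ) (hρ1 : ρ < 1) (hq : ‖q‖ = ρ ^ 2)
    (M : ℕ) (hM : ∀ n < M, PowerSeries.coeff n (FS A) = 0) (T : ℕ) (κ : ℝ) (hκ : ∀ n : ℕ, M ≤ n → (n:ℝ) ^ T * ρ ^ n ≤ κ)
    (b : ℝ) (hb : Wt (FS A) ρ b) : ‖MvPolynomial.aeval (pt q) (dit T A)‖ ≤ 12 ^ T * (κ * b) := by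
  have hq1 : ‖q‖ < 1 := by rw [hq]; nlinarith
  have hκ0 : 0 ≤ κ := le_trans (by positivity) (hκ M le_rfl)
  rw [← (dit_hasSum A T hq1).tsum_eq, tsum_mul_left, norm_mul, norm_pow]
  have : ‖(12:ℂ)‖ = 12 := by norm_num
  rw [this]
  refine mul_le_mul_of_nonneg_left ?_ (by positivity)
  refine (tsum_of_norm_bounded (hb.1.mul_left κ).hasSum fun n => ?_).trans ?_
  · rw [norm_mul, norm_mul, norm_pow, norm_pow, Complex.norm_natCast, Complex.norm_intCast, hq]
    by_cases hn : n < M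
    · rw [hM n hn]; simp
    · calc _ = ((n:ℝ) ^ T * ρ ^ n) * (|((PowerSeries.coeff n (FS A) : ℤ) : ℝ)| * ρ ^ n) := by ring
        _ ≤ _ := by gcongr; exact hκ n (not_lt.mp hn)
  · rw [tsum_mul_left]
    exact mul_le_mul_of_nonneg_left hb.2 hκ0

end derivs
end Nes

open Complex
namespace Nes

section siegel
open MvPolynomial
attribute [local instance] Matrix.seminormedAddCommGroup

/-- exponent vector attached to a box index -/
noncomputable def bx {N : ℕ} (e : Fin 4 → Fin (N + 1)) : Fin 4 →₀ ℕ :=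
  Finsupp.equivFunOnFinite.symm (fun i => (e i : ℕ))

theorem bx_apply {N : ℕ} (e : Fin 4 → Fin (N + 1)) (i : Fin 4) : bx e i = e i := rfl

theorem bx_inj {N : ℕ} {e e' : Fin 4 → Fin (N + 1)} (h : bx e = bx e') : e = e' := by
  funext i
  have := DFunLike.congr_fun h i
  exact Fin.ext this

theorem deg_bx {N : ℕ} (e : Fin 4 → Fin (N + 1)) : (bx e).degree ≤ 4 * N := by
  rw [Finsupp.degree_eq_sum]
  calc _ ≤ ∑ i : Fin 4, N := Finset.sum_le_sum fun i _ => by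
        rw [bx_apply]; omega
    _ = 4 * N := by simp

/-- the entries are not too large -/
theorem entry_le (N n : ℕ) (hn : 1 ≤ n) (e : Fin 4 → Fin (N + 1)) (k : ℕ) (hk : k ≤ n) :
    |((PowerSeries.coeff k (FS (monomial (bx e) 1)) : ℤ) : ℝ)| ≤ 2 * (c0 * (2 * n) ^ 7) ^ (4 * N) := by
  have hn' : (1:ℝ) ≤ n := by exact_mod_cast hn
  set r : ℝ := 1 - 1 / (2 * n) with hr
  have h1 : 1 / (2 * (n:ℝ)) ≤ 1 / 2 := by
    apply one_div_le_one_div_of_le (by norm_num); linarith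
  have hr0 : 0 < r := by rw [hr]; linarith
  have hr1 : r < 1 := by
    have : 0 < 1 / (2 * (n:ℝ)) := by positivity
    linarith
  have hw := wt_FS (monomial (bx e) 1) (4 * N) ((totalDegree_monomial_le _ _).trans (deg_bx e)) hr0.le hr1
  have hc := hw.coeff_le hr0.le k
  have hb : 1 + (k:ℝ) * (-(1 / (2 * n))) ≤ r ^ k := by
    have := one_add_mul_le_pow (a := -(1 / (2 * (n:ℝ)))) (by linarith) k
    rw [hr, sub_eq_add_neg]; exact this
  have hk' : (k:ℝ) ≤ n := by exact_mod_cast hk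
  have hb2 : 1 / 2 ≤ r ^ k := by
    refine le_trans ?_ hb
    have : (k:ℝ) * (1 / (2 * n)) ≤ 1 / 2 := by
      rw [mul_one_div, div_le_div_iff₀ (by positivity) (by norm_num)]; linarith
    linarith
  rw [l1_monomial] at hc
  have e1 : c0 / (1 - r) ^ 7 = c0 * (2 * n) ^ 7 := by
    rw [hr, sub_sub_cancel]; field_simp
  rw [e1] at hc
  simp only [Int.cast_one, abs_one, one_mul] at hc
  have := mul_le_mul_of_nonneg_left hb2 (abs_nonneg ((PowerSeries.coeff k (FS (monomial (bx e) 1)) : ℤ) : ℝ))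
  linarith

theorem siegel (N : ℕ) (hN : 1 ≤ N) : ∃ A : MvPolynomial (Fin 4) ℤ, A ≠ 0 ∧ (∀ i, A.degreeOf i ≤ N) ∧
    (∀ k < (N + 1) ^ 4 / 2, PowerSeries.coeff k (FS A) = 0) ∧
    l1 A ≤ (((N + 1) ^ 4 : ℕ) : ℝ) ^ 2 * (2 * (c0 * (2 * ((N + 1) ^ 4 : ℕ)) ^ 7) ^ (4 * N)) := by
  classical
  set n := (N + 1) ^ 4 with hn
  have hn16 : 16 ≤ n := by
    calc 16 = 2 ^ 4 := by norm_num
      _ ≤ (N + 1) ^ 4 := Nat.pow_le_pow_left (by omega) 4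
  set Mx : Matrix (Fin (n / 2)) (Fin 4 → Fin (N + 1)) ℤ :=
    Matrix.of fun k e => PowerSeries.coeff k (FS (monomial (bx e) 1)) with hMx
  have hcard : Fintype.card (Fin 4 → Fin (N + 1)) = n := by simp [hn]
  obtain ⟨t, ht0, ht, htn⟩ := Int.Matrix.exists_ne_zero_int_vec_norm_le Mx (by
    rw [hcard, Fintype.card_fin]; omega) (by rw [Fintype.card_fin]; omega)
  set E : ℝ := 2 * (c0 * (2 * n) ^ 7) ^ (4 * N) with hE
  have hE1 : 1 ≤ E := by
    have : (1:ℝ) ≤ c0 * (2 * n) ^ 7 := by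
      have h1 : (1:ℝ) ≤ c0 := by rw [c0]; norm_num
      have h2 : (1:ℝ) ≤ 2 * n := by
        have : (16:ℝ) ≤ n := by exact_mod_cast hn16
        linarith
      exact one_le_mul_of_one_le_of_one_le h1 (one_le_pow₀ h2)
    have := one_le_pow₀ this (n := 4 * N)
    rw [hE]; linarith
  have hnorm : max 1 ‖Mx‖ ≤ E := by
    refine max_le hE1 ?_
    rw [Matrix.norm_le_iff (by linarith)]
    intro k e
    rw [Int.norm_eq_abs]
    refine entry_le N n (by omega) e k ?_
    have := k.2; omega
  have htE : ∀ e, |((t e : ℤ) : ℝ)| ≤ n * E := fun e => by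
    have h1 : |((t e : ℤ) : ℝ)| ≤ ‖t‖ := by rw [← Int.norm_eq_abs]; exact norm_le_pi_norm t e
    refine h1.trans (htn.trans ?_)
    rw [hcard, Fintype.card_fin]
    have hn1 : (1:ℝ) ≤ n := by exact_mod_cast (by omega : 1 ≤ n)
    have hb : (1:ℝ) ≤ n * max 1 ‖Mx‖ := one_le_mul_of_one_le_of_one_le hn1 (le_max_left _ _)
    have hx : ((n / 2 : ℕ) : ℝ) / ((n:ℝ) - ((n / 2 : ℕ) : ℝ)) ≤ 1 := by
      have h2 : 2 * ((n / 2 : ℕ) : ℝ) ≤ n := by exact_mod_cast (by omega : 2 * (n / 2) ≤ n)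
      have h3 : (0:ℝ) < n := by linarith
      rw [div_le_one (by linarith)]; linarith
    calc _ ≤ (n * max 1 ‖Mx‖) ^ (1:ℝ) := Real.rpow_le_rpow_of_exponent_le hb hx
      _ = n * max 1 ‖Mx‖ := Real.rpow_one _
      _ ≤ n * E := by gcongr
  set A : MvPolynomial (Fin 4) ℤ := ∑ e, monomial (bx e) (t e) with hA
  have hcoef : ∀ e, coeff (bx e) A = t e := fun e => by
    rw [hA, coeff_sum, Finset.sum_eq_single e]
    · rw [coeff_monomial, if_pos rfl]
    · intro e' _ he'
      rw [coeff_monomial, if_neg (fun h => he' (bx_inj h))]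
    · intro h; exact absurd (Finset.mem_univ _) h
  refine ⟨A, ?_, ?_, ?_, ?_⟩
  · obtain ⟨e, he⟩ := Function.ne_iff.mp ht0
    intro h0
    apply he
    rw [← hcoef e, h0]; simp
  · intro i
    rw [hA]
    refine (degreeOf_sum_le i _ _).trans (Finset.sup_le fun e _ => ?_)
    by_cases h0 : t e = 0
    · rw [h0, monomial_zero, degreeOf_zero]; omega
    · rw [degreeOf_monomial_eq _ _ h0, bx_apply]; omega
  · intro k hk
    have h := congrFun ht ⟨k, hk⟩
    rw [Matrix.mulVec, dotProduct] at h
    have e1 : FS A = ∑ e, PowerSeries.C (t e) * FS (monomial (bx e) 1) := by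
      rw [hA]
      unfold FS
      rw [map_sum]
      refine Finset.sum_congr rfl fun e _ => ?_
      rw [aeval_monomial, aeval_monomial]
      simp
    rw [e1, map_sum]
    refine Eq.trans (Finset.sum_congr rfl fun e _ => ?_) h
    rw [PowerSeries.coeff_C_mul, hMx, Matrix.of_apply, mul_comm]
  · rw [hA]
    refine (l1_sum_le _ _).trans ?_
    calc _ ≤ ∑ e : Fin 4 → Fin (N + 1), (n * E : ℝ) := Finset.sum_le_sum fun e _ => by
          rw [l1_monomial]; exact htE e
      _ = n ^ 2 * E := by
          rw [Finset.sum_const, Finset.card_univ, hcard, nsmul_eq_mul]; ring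

end siegel
end Nes

open Complex
namespace Nes

section interp

theorem interp (K : ℕ) : ∀ (g : ℂ → ℂ) (p : ℕ → ℂ) (δ ε B : ℝ), Differentiable ℂ g → 0 < δ → δ ≤ 1 →
    (∀ k < K, ‖p k‖ ≤ 1) → (∀ k < K, ∀ l < K, k ≠ l → δ ≤ ‖p k - p l‖) → (∀ k < K, ‖g (p k)‖ ≤ ε) → 0 ≤ ε →
    (∀ z, ‖z‖ ≤ 9 → ‖g z‖ ≤ B) → ∀ z, ‖z‖ ≤ 1 → ‖g z‖ ≤ B / 2 ^ K + ε * (8 / δ) ^ K := by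
  induction K with
  | zero =>
    intro g p δ ε B hg hδ hδ1 hp hs hε hε0 hB z hz
    have := hB z (by linarith)
    simp; linarith
  | succ K ih =>
    intro g p δ ε B hg hδ hδ1 hp hs hε hε0 hB z hz
    set a := p K with ha
    have ha1 : ‖a‖ ≤ 1 := hp K (Nat.lt_succ_self K)
    have hga : ‖g a‖ ≤ ε := hε K (Nat.lt_succ_self K)
    set g1 := dslope g a with hg1
    have hd1 : Differentiable ℂ g1 := by
      have := (Complex.differentiableOn_dslope (s := Set.univ) (f := g) (c := a) Filter.univ_mem).mpr hg.differentiableOn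
      exact differentiableOn_univ.mp this
    have hid : ∀ w, (w - a) * g1 w = g w - g a := fun w => by
      have := sub_smul_dslope g a w
      simpa using this
    have hB0 : 0 ≤ B := (norm_nonneg _).trans (hB 0 (by simp))
    have hb9 : ∀ w, ‖w‖ = 9 → ‖g1 w‖ ≤ (B + ε) / 8 := fun w hw => by
      have h1 : 8 ≤ ‖w - a‖ := by
        have := norm_sub_norm_le w a
        linarith
      have h2 : ‖w - a‖ * ‖g1 w‖ ≤ B + ε := by
        rw [← norm_mul, hid]
        exact (norm_sub_le _ _).trans (add_le_add (hB w hw.le) hga)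
      rw [le_div_iff₀ (by norm_num)]
      nlinarith [norm_nonneg (g1 w)]
    have hb : ∀ w, ‖w‖ ≤ 9 → ‖g1 w‖ ≤ (B + ε) / 8 := fun w hw => by
      refine Complex.norm_le_of_forall_mem_frontier_norm_le (U := Metric.ball 0 9) Metric.isBounded_ball
        hd1.diffContOnCl (fun v hv => ?_) ?_
      · rw [frontier_ball _ (by norm_num)] at hv
        exact hb9 v (by simpa using hv)
      · rw [closure_ball _ (by norm_num)]; simpa using hw
    have hpt : ∀ k < K, ‖g1 (p k)‖ ≤ 2 * ε / δ := fun k hk => by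
      have h1 := hs k (hk.trans (Nat.lt_succ_self K)) K (Nat.lt_succ_self K) hk.ne
      have h2 : ‖p k - a‖ * ‖g1 (p k)‖ ≤ ε + ε := by
        rw [← norm_mul, hid]
        exact (norm_sub_le _ _).trans (add_le_add (hε k (hk.trans (Nat.lt_succ_self K))) hga)
      rw [le_div_iff₀ hδ]
      nlinarith [norm_nonneg (g1 (p k))]
    have key := ih g1 p δ (2 * ε / δ) ((B + ε) / 8) hd1 hδ hδ1 (fun k hk => hp k (by omega))
      (fun k hk l hl => hs k (by omega) l (by omega)) hpt (by positivity) hb z hz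
    have h1 : ‖g z‖ ≤ ε + 2 * ‖g1 z‖ := by
      have : g z = g a + (z - a) * g1 z := by rw [hid]; ring
      rw [this]
      refine (norm_add_le _ _).trans (add_le_add hga ?_)
      rw [norm_mul]
      gcongr
      refine (norm_sub_le _ _).trans ?_
      linarith
    have h8 : 8 ≤ 8 / δ := by rw [le_div_iff₀ hδ]; linarith
    have hpow : 1 ≤ (8 / δ) ^ K := one_le_pow₀ (by linarith)
    have h2 : (B + ε) / 8 / 2 ^ K ≤ B / 8 / 2 ^ K + ε / 8 := by
      have : ε / 8 / 2 ^ K ≤ ε / 8 := div_le_self (by positivity) (one_le_pow₀ (by norm_num))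
      rw [add_div, add_div]; linarith
    have h3 : 2 * ε / δ * (8 / δ) ^ K = ε * (8 / δ) ^ (K + 1) / 4 := by
      rw [pow_succ]; ring
    have h4 : 8 * ε ≤ ε * (8 / δ) ^ (K + 1) := by
      rw [pow_succ]
      nlinarith [mul_le_mul hpow h8 (by norm_num) (by positivity)]
    have h5 : B / 8 / 2 ^ K = B / 2 ^ (K + 1) / 4 := by rw [pow_succ]; field_simp; ring
    have h6 : 0 ≤ B / 2 ^ (K + 1) := by positivity
    rw [h3] at key
    linarith

open Polynomial in
theorem newton (n : ℕ) : ∀ (P : Polynomial ℂ) (x : ℕ → ℂ) (R s ε : ℝ), P.natDegree ≤ n → 0 < s → s ≤ 1 → 0 ≤ R →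
    0 ≤ ε → (∀ k ≤ n, ‖x k‖ ≤ R) → (∀ k ≤ n, ∀ l ≤ n, k ≠ l → s ≤ ‖x k - x l‖) → (∀ k ≤ n, ‖P.eval (x k)‖ ≤ ε) →
    ∀ i, ‖P.coeff i‖ ≤ ε * (4 * (1 + R) / s) ^ n := by
  induction n with
  | zero =>
    intro P x R s ε hP hs hs1 hR hε0 hx hsp hε i
    rw [Polynomial.eq_C_of_natDegree_le_zero hP, coeff_C]
    have := hε 0 le_rfl
    rw [Polynomial.eq_C_of_natDegree_le_zero hP] at this
    simp at this
    split_ifs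
    · simpa using this
    · simpa using hε0
  | succ n ih =>
    intro P x R s ε hP hs hs1 hR hε0 hx hsp hε i
    set a := x (n + 1) with ha
    have hPa := hε (n + 1) le_rfl
    rw [← ha] at hPa
    set Q := (P - C (P.eval a)) /ₘ (X - C a) with hQ
    have hid : (X - C a) * Q = P - C (P.eval a) := by
      rw [hQ, mul_divByMonic_eq_iff_isRoot]
      simp [IsRoot]
    have hid' : ∀ w, (w - a) * Q.eval w = P.eval w - P.eval a := fun w => by
      have := congrArg (eval w) hid
      simpa using this
    have hQd : Q.natDegree ≤ n := by
      rw [hQ, natDegree_divByMonic _ (monic_X_sub_C a), natDegree_X_sub_C, natDegree_sub_C]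
      omega
    set C0 := 4 * (1 + R) / s with hC0
    have hC4 : 4 ≤ C0 := by rw [hC0, le_div_iff₀ hs]; nlinarith
    have hQx : ∀ k ≤ n, ‖Q.eval (x k)‖ ≤ 2 * ε / s := fun k hk => by
      have h1 := hsp k (by omega) (n + 1) le_rfl (by omega)
      have h2 : ‖x k - a‖ * ‖Q.eval (x k)‖ ≤ ε + ε := by
        rw [← norm_mul, hid']
        exact (norm_sub_le _ _).trans (add_le_add (hε k (by omega)) hPa)
      rw [le_div_iff₀ hs]
      nlinarith [norm_nonneg (Q.eval (x k))]
    have key := ih Q x R s (2 * ε / s) hQd hs hs1 hR (by positivity) (fun k hk => hx k (by omega))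
      (fun k hk l hl => hsp k (by omega) l (by omega)) hQx
    have ha1 : ‖a‖ ≤ R := hx _ le_rfl
    set D := 2 * ε / s * C0 ^ n with hD
    have hD0 : 0 ≤ D := by positivity
    have hc1 : ‖((X - C a) * Q).coeff i‖ ≤ (1 + R) * D := by
      have h2 : ‖a * Q.coeff i‖ ≤ R * D := by
        rw [norm_mul]; exact mul_le_mul ha1 (key i) (norm_nonneg _) hR
      rw [sub_mul, coeff_sub, coeff_C_mul]
      refine (norm_sub_le _ _).trans ?_
      have h1 : ‖(X * Q).coeff i‖ ≤ D := by
        cases i with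
        | zero => simpa using hD0
        | succ i => rw [coeff_X_mul]; exact key i
      linarith
    have hc2 : ‖(C (P.eval a)).coeff i‖ ≤ ε := by
      rw [coeff_C]
      split_ifs
      · exact hPa
      · simpa using hε0
    have : P.coeff i = ((X - C a) * Q).coeff i + (C (P.eval a)).coeff i := by
      rw [hid, coeff_sub]; ring
    rw [this]
    refine (norm_add_le _ _).trans ((add_le_add hc1 hc2).trans ?_)
    have e1 : (1 + R) * D = ε * C0 ^ (n + 1) / 2 := by
      have h1 : 1 + R = C0 * s / 4 := by rw [hC0]; field_simp
      have h2 : 2 * ε / s * s = 2 * ε := by field_simp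
      rw [hD, pow_succ, h1]
      calc C0 * s / 4 * (2 * ε / s * C0 ^ n) = (2 * ε / s * s) * (C0 ^ n * C0) / 4 := by ring
        _ = _ := by rw [h2]; ring
    have e2 : 4 * ε ≤ ε * C0 ^ (n + 1) := by
      have h1 : 1 ≤ C0 ^ n := one_le_pow₀ (by linarith)
      rw [pow_succ]
      nlinarith [mul_le_mul h1 hC4 (by norm_num) (by positivity)]
    rw [e1]; linarith

/-- Newton's bound for sums -/
theorem newton_sum {N : ℕ} (b : Fin (N + 1) → ℂ) (x : ℕ → ℂ) (R s ε : ℝ) (hs : 0 < s) (hs1 : s ≤ 1) (hR : 0 ≤ R)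
    (hε : 0 ≤ ε) (hx : ∀ k ≤ N, ‖x k‖ ≤ R) (hsp : ∀ k ≤ N, ∀ l ≤ N, k ≠ l → s ≤ ‖x k - x l‖)
    (h : ∀ k ≤ N, ‖∑ i, b i * x k ^ (i : ℕ)‖ ≤ ε) (i : Fin (N + 1)) : ‖b i‖ ≤ ε * (4 * (1 + R) / s) ^ N := by
  have key := newton N (∑ i : Fin (N + 1), Polynomial.monomial (i : ℕ) (b i)) x R s ε ?_ hs hs1 hR hε hx hsp ?_ i
  · rw [Polynomial.finsetSum_coeff, Finset.sum_eq_single i] at key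
    · rwa [Polynomial.coeff_monomial, if_pos rfl] at key
    · intro j _ hj
      rw [Polynomial.coeff_monomial, if_neg]
      exact fun h => hj (Fin.ext h)
    · intro h; exact absurd (Finset.mem_univ _) h
  · refine Polynomial.natDegree_sum_le_of_forall_le _ _ fun j _ => ?_
    refine (Polynomial.natDegree_monomial_le _).trans ?_
    omega
  · intro k hk
    rw [Polynomial.eval_finsetSum]
    simpa only [Polynomial.eval_monomial] using h k hk

/-- the four coordinates of a box index -/
def qd (N : ℕ) : (Fin 4 → Fin (N + 1)) ≃ Fin (N + 1) × Fin (N + 1) × Fin (N + 1) × Fin (N + 1) where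
  toFun e := (e 0, e 1, e 3, e 2)
  invFun p := ![p.1, p.2.1, p.2.2.2, p.2.2.1]
  left_inv e := by
    funext i
    fin_cases i <;> rfl
  right_inv p := rfl

theorem eq_sum_bx {N : ℕ} (A : MvPolynomial (Fin 4) ℤ) (hA : ∀ i, A.degreeOf i ≤ N) :
    A = ∑ e : Fin 4 → Fin (N + 1), MvPolynomial.monomial (bx e) (A.coeff (bx e)) := by
  classical
  ext m
  rw [MvPolynomial.coeff_sum]
  by_cases hm : ∀ i, m i ≤ N
  · have : m = bx (fun i => (⟨m i, by have := hm i; omega⟩ : Fin (N + 1))) := by ext i; rfl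
    rw [Finset.sum_eq_single (fun i => (⟨m i, by have := hm i; omega⟩ : Fin (N + 1)))]
    · rw [← this, MvPolynomial.coeff_monomial, if_pos rfl]
    · intro e _ he
      rw [MvPolynomial.coeff_monomial, if_neg]
      intro h
      rw [this] at h
      exact he (bx_inj h)
    · intro h; exact absurd (Finset.mem_univ _) h
  · rw [Finset.sum_eq_zero]
    · by_contra h0
      apply hm
      intro i
      exact (MvPolynomial.monomial_le_degreeOf i (MvPolynomial.mem_support_iff.mpr h0)).trans (hA i)
    · intro e _
      rw [MvPolynomial.coeff_monomial, if_neg]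
      intro h
      apply hm
      intro i
      rw [← h, bx_apply]; omega

theorem aeval_bx {N : ℕ} (A : MvPolynomial (Fin 4) ℤ) (hA : ∀ i, A.degreeOf i ≤ N) (x : Fin 4 → ℂ) :
    MvPolynomial.aeval x A = ∑ e : Fin 4 → Fin (N + 1), ((A.coeff (bx e) : ℤ) : ℂ) *
      (x 0 ^ (e 0 : ℕ) * x 1 ^ (e 1 : ℕ) * x 2 ^ (e 2 : ℕ) * x 3 ^ (e 3 : ℕ)) := by
  conv_lhs => rw [eq_sum_bx A hA]
  rw [map_sum]
  refine Finset.sum_congr rfl fun e _ => ?_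
  rw [MvPolynomial.aeval_monomial, Finsupp.prod_fintype _ _ (fun i => pow_zero _), Fin.prod_univ_four]
  simp [bx_apply]

/-- Fibered elimination: a polynomial small on a fibered grid has small coefficients. -/
theorem grid {N : ℕ} (A : MvPolynomial (Fin 4) ℤ) (hA : ∀ i, A.degreeOf i ≤ N)
    (x2 : ℕ → ℂ) (x3 : ℕ → ℕ → ℂ) (x1 : ℕ → ℕ → ℕ → ℂ) (x0 : ℕ → ℕ → ℕ → ℕ → ℂ) (R s ε : ℝ) (hs : 0 < s) (hs1 : s ≤ 1)
    (hR : 0 ≤ R) (hε : 0 ≤ ε)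
    (h2 : ∀ k ≤ N, ‖x2 k‖ ≤ R) (h2s : ∀ k ≤ N, ∀ l ≤ N, k ≠ l → s ≤ ‖x2 k - x2 l‖)
    (h3 : ∀ i ≤ N, ∀ k ≤ N, ‖x3 i k‖ ≤ R) (h3s : ∀ i ≤ N, ∀ k ≤ N, ∀ l ≤ N, k ≠ l → s ≤ ‖x3 i k - x3 i l‖)
    (h1 : ∀ i ≤ N, ∀ j ≤ N, ∀ k ≤ N, ‖x1 i j k‖ ≤ R)
    (h1s : ∀ i ≤ N, ∀ j ≤ N, ∀ k ≤ N, ∀ l ≤ N, k ≠ l → s ≤ ‖x1 i j k - x1 i j l‖)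
    (h0 : ∀ i ≤ N, ∀ j ≤ N, ∀ m ≤ N, ∀ k ≤ N, ‖x0 i j m k‖ ≤ R)
    (h0s : ∀ i ≤ N, ∀ j ≤ N, ∀ m ≤ N, ∀ k ≤ N, ∀ l ≤ N, k ≠ l → s ≤ ‖x0 i j m k - x0 i j m l‖)
    (h : ∀ i ≤ N, ∀ j ≤ N, ∀ m ≤ N, ∀ k ≤ N,
      ‖MvPolynomial.aeval ![x0 i j m k, x1 i j m, x2 i, x3 i j] A‖ ≤ ε) (e : Fin 4 → Fin (N + 1)) :
    |((A.coeff (bx e) : ℤ) : ℝ)| ≤ ε * (4 * (1 + R) / s) ^ (4 * N) := by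
  set C0 := 4 * (1 + R) / s with hC0
  have hC : 0 ≤ C0 := by positivity
  set b : Fin (N + 1) → Fin (N + 1) → Fin (N + 1) → Fin (N + 1) → ℂ := fun e0 e1 e3 e2 =>
    ((A.coeff (bx ((qd N).symm (e0, e1, e3, e2))) : ℤ) : ℂ) with hb
  have hev : ∀ y0 y1 y2 y3 : ℂ, MvPolynomial.aeval ![y0, y1, y2, y3] A =
      ∑ e0, (∑ e1, (∑ e3, (∑ e2, b e0 e1 e3 e2 * y2 ^ (e2 : ℕ)) * y3 ^ (e3 : ℕ)) * y1 ^ (e1 : ℕ)) * y0 ^ (e0 : ℕ) := by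
    intro y0 y1 y2 y3
    rw [aeval_bx A hA, ← (qd N).symm.sum_comp, Fintype.sum_prod_type]
    refine Finset.sum_congr rfl fun e0 _ => ?_
    rw [Fintype.sum_prod_type, Finset.sum_mul]
    refine Finset.sum_congr rfl fun e1 _ => ?_
    rw [Fintype.sum_prod_type, Finset.sum_mul, Finset.sum_mul]
    refine Finset.sum_congr rfl fun e3 _ => ?_
    rw [Finset.sum_mul, Finset.sum_mul, Finset.sum_mul]
    refine Finset.sum_congr rfl fun e2 _ => ?_
    simp only [hb]
    have t0 : (qd N).symm (e0, e1, e3, e2) 0 = e0 := rfl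
    have t1 : (qd N).symm (e0, e1, e3, e2) 1 = e1 := rfl
    have t2 : (qd N).symm (e0, e1, e3, e2) 2 = e2 := rfl
    have t3 : (qd N).symm (e0, e1, e3, e2) 3 = e3 := rfl
    rw [t0, t1, t2, t3]
    simp only [Matrix.cons_val]
    ring
  have s1 : ∀ i ≤ N, ∀ j ≤ N, ∀ m ≤ N, ∀ e0,
      ‖∑ e1, (∑ e3, (∑ e2, b e0 e1 e3 e2 * x2 i ^ (e2 : ℕ)) * x3 i j ^ (e3 : ℕ)) * x1 i j m ^ (e1 : ℕ)‖ ≤ ε * C0 ^ N := by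
    intro i hi j hj m hm e0
    refine newton_sum (fun e0 => ∑ e1, (∑ e3, (∑ e2, b e0 e1 e3 e2 * x2 i ^ (e2 : ℕ)) * x3 i j ^ (e3 : ℕ)) * x1 i j m ^ (e1 : ℕ))
      (x0 i j m) R s ε hs hs1 hR hε (h0 i hi j hj m hm) (h0s i hi j hj m hm) (fun k hk => ?_) e0
    have := h i hi j hj m hm k hk
    rwa [hev] at this
  have s2 : ∀ i ≤ N, ∀ j ≤ N, ∀ e0 e1,
      ‖∑ e3, (∑ e2, b e0 e1 e3 e2 * x2 i ^ (e2 : ℕ)) * x3 i j ^ (e3 : ℕ)‖ ≤ ε * C0 ^ N * C0 ^ N := by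
    intro i hi j hj e0 e1
    exact newton_sum (fun e1 => ∑ e3, (∑ e2, b e0 e1 e3 e2 * x2 i ^ (e2 : ℕ)) * x3 i j ^ (e3 : ℕ))
      (x1 i j) R s _ hs hs1 hR (by positivity) (h1 i hi j hj) (h1s i hi j hj) (fun k hk => s1 i hi j hj k hk e0) e1
  have s3 : ∀ i ≤ N, ∀ e0 e1 e3,
      ‖∑ e2, b e0 e1 e3 e2 * x2 i ^ (e2 : ℕ)‖ ≤ ε * C0 ^ N * C0 ^ N * C0 ^ N := by
    intro i hi e0 e1 e3
    exact newton_sum (fun e3 => ∑ e2, b e0 e1 e3 e2 * x2 i ^ (e2 : ℕ))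
      (x3 i) R s _ hs hs1 hR (by positivity) (h3 i hi) (h3s i hi) (fun k hk => s2 i hi k hk e0 e1) e3
  have s4 : ∀ e0 e1 e3 e2, ‖b e0 e1 e3 e2‖ ≤ ε * C0 ^ N * C0 ^ N * C0 ^ N * C0 ^ N := by
    intro e0 e1 e3 e2
    exact newton_sum (fun e2 => b e0 e1 e3 e2)
      x2 R s _ hs hs1 hR (by positivity) h2 h2s (fun k hk => s3 k hk e0 e1 e3) e2
  have := s4 (e 0) (e 1) (e 3) (e 2)
  have hq : (qd N).symm (e 0, e 1, e 3, e 2) = e := (qd N).left_inv e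
  simp only [hb, hq] at this
  rw [Complex.norm_intCast] at this
  refine this.trans (le_of_eq ?_)
  ring

end interp
end Nes

open Complex
namespace Nes

section curve

theorem sum_bx_l1 {N : ℕ} (A : MvPolynomial (Fin 4) ℤ) (hA : ∀ i, A.degreeOf i ≤ N) :
    ∑ e : Fin 4 → Fin (N + 1), |((A.coeff (bx e) : ℤ) : ℝ)| = l1 A := by
  classical
  rw [l1_eq_sum A (Finset.univ.image (bx (N := N))), Finset.sum_image fun _ _ _ _ h => bx_inj h]
  intro m hm
  have hm' : ∀ i, m i ≤ N := fun i => (MvPolynomial.monomial_le_degreeOf i hm).trans (hA i)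
  rw [Finset.mem_image]
  refine ⟨fun i => ⟨m i, by have := hm' i; omega⟩, Finset.mem_univ _, ?_⟩
  ext i; rfl

/-- the auxiliary entire function -/
noncomputable def Gf (N : ℕ) (A : MvPolynomial (Fin 4) ℤ) (ζ c E2 κ E4 E6 p : ℂ) : ℂ :=
  ∑ e : Fin 4 → Fin (N + 1), ((A.coeff (bx e) : ℤ) : ℂ) * ((ζ * exp (-(2 * Real.pi * I * p / c))) ^ (e 0 : ℕ) *
    (E2 + κ * p) ^ (e 1 : ℕ) * E4 ^ (e 2 : ℕ) * E6 ^ (e 3 : ℕ) * p ^ (12 * N - 2 * (e 1 : ℕ) - 4 * (e 2 : ℕ) - 6 * (e 3 : ℕ)))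

variable {N : ℕ} {A : MvPolynomial (Fin 4) ℤ}

theorem Gf_diff (ζ c E2 κ E4 E6 : ℂ) : Differentiable ℂ (Gf N A ζ c E2 κ E4 E6) := by
  unfold Gf
  fun_prop

theorem Gf_eq (hA : ∀ i, A.degreeOf i ≤ N) (ζ c E2 κ E4 E6 p : ℂ) (hp : p ≠ 0) : Gf N A ζ c E2 κ E4 E6 p =
    p ^ (12 * N) * MvPolynomial.aeval ![ζ * exp (-(2 * Real.pi * I * p / c)), p⁻¹ ^ 2 * E2 + κ * p⁻¹,
      p⁻¹ ^ 4 * E4, p⁻¹ ^ 6 * E6] A := by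
  rw [aeval_bx A hA, Gf, Finset.mul_sum]
  refine Finset.sum_congr rfl fun e _ => ?_
  simp only [Matrix.cons_val]
  have h1 : p⁻¹ ^ 2 * E2 + κ * p⁻¹ = p⁻¹ ^ 2 * (E2 + κ * p) := by field_simp
  have h0 : p ^ (12 * N - 2 * (e 1 : ℕ) - 4 * (e 2 : ℕ) - 6 * (e 3 : ℕ)) =
      p ^ (12 * N) * (p⁻¹ ^ 2) ^ (e 1 : ℕ) * (p⁻¹ ^ 4) ^ (e 2 : ℕ) * (p⁻¹ ^ 6) ^ (e 3 : ℕ) := by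
    have i1 := (e 1).2
    have i2 := (e 2).2
    have i3 := (e 3).2
    have : 12 * N = (12 * N - 2 * (e 1 : ℕ) - 4 * (e 2 : ℕ) - 6 * (e 3 : ℕ)) + 2 * (e 1 : ℕ) + 4 * (e 2 : ℕ) + 6 * (e 3 : ℕ) := by omega
    conv_rhs => rw [this]
    rw [pow_add, pow_add, pow_add, ← pow_mul, ← pow_mul, ← pow_mul, inv_pow, inv_pow, inv_pow]
    field_simp
  rw [h1, h0]
  simp only [mul_pow]
  ring

theorem Gf_bound (hA : ∀ i, A.degreeOf i ≤ N) (ζ E2 κ E4 E6 : ℂ) (c : ℕ) (hc : N ≤ c) (hc1 : 1 ≤ c) (hζ : ‖ζ‖ = 1) (Q : ℝ) (hQ : 1 ≤ Q)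
    (h2 : ‖E2‖ ≤ Q) (hκ : ‖κ‖ ≤ 2 * c) (h4 : ‖E4‖ ≤ Q) (h6 : ‖E6‖ ≤ Q) (p : ℂ) (hp : ‖p‖ ≤ 9) :
    ‖Gf N A ζ c E2 κ E4 E6 p‖ ≤ l1 A * (Real.exp 57 * (Q + 18 * c) ^ N * Q ^ N * Q ^ N * 9 ^ (12 * N)) := by
  rw [Gf, ← sum_bx_l1 A hA, Finset.sum_mul]
  refine (norm_sum_le _ _).trans (Finset.sum_le_sum fun e _ => ?_)
  have i0 := (e 0).2
  have i1 := (e 1).2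
  have i2 := (e 2).2
  have i3 := (e 3).2
  have hc1' : (1:ℝ) ≤ c := by exact_mod_cast hc1
  rw [norm_mul, Complex.norm_intCast]
  refine mul_le_mul_of_nonneg_left ?_ (abs_nonneg _)
  simp only [norm_mul, norm_pow]
  have b0 : (‖ζ‖ * ‖exp (-(2 * Real.pi * I * p / c))‖) ^ (e 0 : ℕ) ≤ Real.exp 57 := by
    rw [hζ, one_mul]
    have h1 : ‖exp (-(2 * Real.pi * I * p / c))‖ ≤ Real.exp (57 / c) := by
      refine (Complex.norm_exp_le_exp_norm _).trans (Real.exp_le_exp.mpr ?_)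
      rw [norm_neg, norm_div, Complex.norm_natCast]
      refine div_le_div_of_nonneg_right ?_ (by positivity)
      simp only [norm_mul, Complex.norm_I, Complex.norm_real, Real.norm_eq_abs, abs_of_pos Real.pi_pos]
      have := Real.pi_lt_d2
      have : ‖(2:ℂ)‖ = 2 := by norm_num
      rw [this]
      nlinarith [norm_nonneg p, Real.pi_pos]
    calc _ ≤ Real.exp (57 / c) ^ (e 0 : ℕ) := by gcongr
      _ = Real.exp ((e 0 : ℕ) * (57 / c)) := by rw [← Real.exp_nat_mul]
      _ ≤ Real.exp 57 := by
        apply Real.exp_le_exp.mpr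
        have : ((e 0 : ℕ) : ℝ) ≤ c := by exact_mod_cast (by omega : (e 0 : ℕ) ≤ c)
        rw [mul_div_assoc', div_le_iff₀ (by linarith)]
        linarith
  have b1 : ‖E2 + κ * p‖ ^ (e 1 : ℕ) ≤ (Q + 18 * c) ^ N := by
    have h1 : ‖E2 + κ * p‖ ≤ Q + 18 * c := by
      refine (norm_add_le _ _).trans (add_le_add h2 ?_)
      rw [norm_mul]
      calc _ ≤ (2 * c : ℝ) * 9 := by gcongr
        _ = _ := by ring
    calc _ ≤ (Q + 18 * c) ^ (e 1 : ℕ) := by gcongr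
      _ ≤ _ := pow_le_pow_right₀ (by linarith) (by omega)
  have b2 : ‖E4‖ ^ (e 2 : ℕ) ≤ Q ^ N :=
    (pow_le_pow_left₀ (norm_nonneg _) h4 _).trans (pow_le_pow_right₀ hQ (by omega))
  have b3 : ‖E6‖ ^ (e 3 : ℕ) ≤ Q ^ N :=
    (pow_le_pow_left₀ (norm_nonneg _) h6 _).trans (pow_le_pow_right₀ hQ (by omega))
  have b4 : ‖p‖ ^ (12 * N - 2 * (e 1 : ℕ) - 4 * (e 2 : ℕ) - 6 * (e 3 : ℕ)) ≤ 9 ^ (12 * N) :=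
    (pow_le_pow_left₀ (norm_nonneg _) hp _).trans (pow_le_pow_right₀ (by norm_num) (by omega))
  gcongr

open UpperHalfPlane ModularForm MatrixGroups in
/-- the value at a modular translate -/
theorem Gf_translate (hA : ∀ i, A.degreeOf i ≤ N) (M : ℕ) (hM : ∀ n < M, PowerSeries.coeff n (FS A) = 0)
    (γ : SL(2, ℤ)) (τ : ℍ) (hc : γ 1 0 ≠ 0) (Z : ℝ) (hZ : ‖denom γ τ‖ ≤ Z) (hτ : 1 ≤ τ.im) (h1 : 1 ≤ ‖denom γ τ‖) :
    ‖Gf N A (Complex.exp (2 * Real.pi * Complex.I * ((γ 0 0 : ℤ) : ℂ) / ((γ 1 0 : ℤ) : ℂ))) ((γ 1 0 : ℤ) : ℂ)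
      (ev (Sv 1) (qq τ)) (6 / (Real.pi * Complex.I) * ((γ 1 0 : ℤ) : ℂ)) (ev (Sv 2) (qq τ)) (ev (Sv 3) (qq τ)) (denom γ τ)⁻¹‖
      ≤ Real.exp (-(M / Z ^ 2)) * (l1 A * (c0 * (2 * Z ^ 2) ^ 7) ^ (4 * N)) := by
  have hd0 : denom γ τ ≠ 0 := by
    intro h; rw [h] at h1; simp at h1; linarith
  have hZ1 : 1 ≤ Z := h1.trans hZ
  rw [Gf_eq hA _ _ _ _ _ _ _ (inv_ne_zero hd0)]
  set q := qq ↑(γ • τ) with hq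
  have hcC : ((γ 1 0 : ℤ) : ℂ) ≠ 0 := by exact_mod_cast hc
  have hvec : ![Complex.exp (2 * Real.pi * Complex.I * ((γ 0 0 : ℤ) : ℂ) / ((γ 1 0 : ℤ) : ℂ)) *
      Complex.exp (-(2 * Real.pi * Complex.I * (denom γ τ)⁻¹ / ((γ 1 0 : ℤ) : ℂ))),
      (denom γ τ)⁻¹⁻¹ ^ 2 * ev (Sv 1) (qq τ) + 6 / (Real.pi * Complex.I) * ((γ 1 0 : ℤ) : ℂ) * (denom γ τ)⁻¹⁻¹,
      (denom γ τ)⁻¹⁻¹ ^ 4 * ev (Sv 2) (qq τ), (denom γ τ)⁻¹⁻¹ ^ 6 * ev (Sv 3) (qq τ)] = pt q := by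
    rw [inv_inv]
    funext i
    fin_cases i
    · change _ = pt q 0
      rw [pt_zero, hq, qq, coe_smul_eq]
      simp only [Fin.zero_eta, Matrix.cons_val_zero]
      rw [← Complex.exp_add]
      congr 1
      rw [← denom_eq]
      have hdet : ((γ 0 0 : ℤ) : ℂ) * ((γ 1 1 : ℤ) : ℂ) - ((γ 0 1 : ℤ) : ℂ) * ((γ 1 0 : ℤ) : ℂ) = 1 := by
        have := γ.2
        rw [Matrix.det_fin_two] at this
        exact_mod_cast this
      have hden := denom_eq γ τ
      field_simp
      rw [hden]
      linear_combination hdet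
    · change _ = ev (Sv 1) q
      rw [hq, transf_E2]
      simp
    · change _ = ev (Sv 2) q
      rw [hq, transf_E4]
      simp
    · change _ = ev (Sv 3) q
      rw [hq, transf_E6]
      simp
  rw [hvec]
  have hq1 : ‖q‖ < 1 := qq_lt _
  rw [← ev_FS A hq1, norm_mul, norm_pow]
  have hp1 : ‖(denom γ τ)⁻¹‖ ^ (12 * N) ≤ 1 := pow_le_one₀ (norm_nonneg _) (by rw [norm_inv]; exact inv_le_one_of_one_le₀ h1)
  have hdeg : A.totalDegree ≤ 4 * N := by
    refine Finset.sup_le fun m hm => ?_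
    calc _ = ∑ i, m i := by rw [Finsupp.sum_fintype]; intro i; rfl
      _ ≤ ∑ i : Fin 4, N := Finset.sum_le_sum fun i _ => (MvPolynomial.monomial_le_degreeOf i hm).trans (hA i)
      _ = 4 * N := by simp
  set et : ℝ := 1 / Z ^ 2 with het
  have het0 : 0 < et := by positivity
  have het1 : et ≤ 1 := by rw [het, div_le_one (by positivity)]; exact one_le_pow₀ hZ1
  have hr0 : 0 < 1 / (1 + et) := by positivity
  have hr1 : 1 / (1 + et) < 1 := by rw [div_lt_one (by positivity)]; linarith
  have him : et ≤ (γ • τ).im := by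
    rw [ModularGroup.im_smul_eq_div_normSq, Complex.normSq_eq_norm_sq, het]
    have : 0 < ‖denom γ τ‖ := by linarith
    apply div_le_div₀ (by linarith) hτ (by positivity)
    gcongr
  have hqn : ‖q‖ ≤ Real.exp (-2 * Real.pi * et) := by
    rw [hq, norm_qq]
    apply Real.exp_le_exp.mpr
    have h5 : (↑(γ • τ) : ℂ).im = (γ • τ).im := rfl
    rw [h5]
    nlinarith [Real.pi_pos]
  have hqr : ‖q‖ / (1 / (1 + et)) ≤ Real.exp (-et) := by
    rw [div_div_eq_mul_div, div_one]
    calc _ ≤ Real.exp (-2 * Real.pi * et) * Real.exp et := by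
          gcongr
          have := Real.add_one_le_exp et
          linarith
      _ = Real.exp (-2 * Real.pi * et + et) := by rw [Real.exp_add]
      _ ≤ _ := by
          apply Real.exp_le_exp.mpr
          nlinarith [Real.pi_gt_three]
  have hqr' : ‖q‖ ≤ 1 / (1 + et) := by
    have : ‖q‖ / (1 / (1 + et)) ≤ 1 := hqr.trans (by rw [Real.exp_le_one_iff]; linarith)
    rwa [div_le_one hr0] at this
  have hw := wt_FS A (4 * N) hdeg hr0.le hr1
  have hs := hw.schwarz hr0 M hM hqr'
  have hl := l1_nonneg A
  have hc00 : (0:ℝ) ≤ c0 := by rw [c0]; norm_num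
  calc _ ≤ 1 * ‖ev (FS A) q‖ := by gcongr
    _ = ‖ev (FS A) q‖ := one_mul _
    _ ≤ _ := hs
    _ ≤ _ := by
      have e1 : (‖q‖ / (1 / (1 + et))) ^ M ≤ Real.exp (-(M / Z ^ 2)) := by
        calc _ ≤ Real.exp (-et) ^ M := by gcongr
          _ = Real.exp (M * (-et)) := by rw [← Real.exp_nat_mul]
          _ = _ := by rw [het]; congr 1; ring
      have e2 : c0 / (1 - 1 / (1 + et)) ^ 7 ≤ c0 * (2 * Z ^ 2) ^ 7 := by
        have : 1 - 1 / (1 + et) = et / (1 + et) := by field_simp; ring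
        rw [this, div_eq_mul_inv, ← inv_pow, inv_div]
        gcongr
        rw [het]
        rw [div_le_iff₀ (by positivity)]
        have : 2 * Z ^ 2 * (1 / Z ^ 2) = 2 := by field_simp
        rw [this]
        linarith
      have e3 : 0 ≤ c0 / (1 - 1 / (1 + et)) ^ 7 := (zero_le_one.trans (one_le_c0 hr0.le hr1))
      gcongr

end curve
end Nes

open Complex
namespace Nes

section curve2
variable {N : ℕ} {A : MvPolynomial (Fin 4) ℤ}
open UpperHalfPlane ModularForm MatrixGroups

theorem exists_gammas (a c : ℕ) (hc : 1 ≤ c) (h : Nat.Coprime a c) : ∃ (γ : ℕ → SL(2, ℤ)) (d0 : ℤ), 0 ≤ d0 ∧ d0 < c ∧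
    ∀ k, γ k 0 0 = a ∧ γ k 1 0 = c ∧ γ k 1 1 = d0 + k * c := by
  obtain ⟨x, y, hxy⟩ := (Nat.isCoprime_iff_coprime).mpr h
  have hc0 : (0:ℤ) < c := by exact_mod_cast hc
  have hm := Int.emod_add_mul_ediv x c
  refine ⟨fun k => ⟨!![(a:ℤ), -(y + a * (x / c)) + k * a; (c:ℤ), x % c + k * c], ?_⟩, x % c,
    Int.emod_nonneg _ hc0.ne', Int.emod_lt_of_pos _ hc0, fun k => ⟨?_, ?_, ?_⟩⟩
  · rw [Matrix.det_fin_two_of]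
    linear_combination hxy + a * hm
  · simp
  · simp
  · simp

theorem curve_bound (hA : ∀ i, A.degreeOf i ≤ N) (M : ℕ) (hM : ∀ n < M, PowerSeries.coeff n (FS A) = 0)
    (a c : ℕ) (hcN : N ≤ c) (hc : 1 ≤ c) (hac : Nat.Coprime a c) (τ : ℍ) (hτ1 : 1 ≤ τ.im) (Q : ℝ) (hQ : 1 ≤ Q)
    (hτQ : ‖(τ : ℂ)‖ ≤ Q) (h2 : ‖ev (Sv 1) (qq τ)‖ ≤ Q) (h4 : ‖ev (Sv 2) (qq τ)‖ ≤ Q) (h6 : ‖ev (Sv 3) (qq τ)‖ ≤ Q)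
    (K : ℕ) (Z : ℝ) (hZ : c * (Q + K) ≤ Z) (p : ℂ) (hp : ‖p‖ ≤ 1) :
    ‖Gf N A (Complex.exp (2 * Real.pi * Complex.I * a / c)) c
      (ev (Sv 1) (qq τ)) (6 / (Real.pi * Complex.I) * c) (ev (Sv 2) (qq τ)) (ev (Sv 3) (qq τ)) p‖
      ≤ l1 A * (Real.exp 57 * (Q + 18 * c) ^ N * Q ^ N * Q ^ N * 9 ^ (12 * N)) / 2 ^ K +
        Real.exp (-(M / Z ^ 2)) * (l1 A * (c0 * (2 * Z ^ 2) ^ 7) ^ (4 * N)) * (8 * Z ^ 2) ^ K := by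
  obtain ⟨γ, d0, hd0, hd1, hγ⟩ := exists_gammas a c hc hac
  have hc' : (1:ℝ) ≤ c := by exact_mod_cast hc
  have hK0 : (0:ℝ) ≤ K := by positivity
  have hZ1 : 1 ≤ Z := by nlinarith
  have hden : ∀ k, denom (γ k) τ = (c:ℂ) * τ + ((d0:ℂ) + k * c) := fun k => by
    rw [denom_eq, (hγ k).2.1, (hγ k).2.2]; push_cast; ring
  have hlow : ∀ k, 1 ≤ ‖denom (γ k) τ‖ := fun k => by
    refine le_trans ?_ (Complex.abs_im_le_norm _)
    rw [hden]
    refine le_trans ?_ (le_abs_self _)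
    simp
    nlinarith
  have hup : ∀ k < K, ‖denom (γ k) τ‖ ≤ Z := fun k hk => by
    rw [hden]
    refine le_trans ((norm_add_le _ _).trans ?_) hZ
    rw [norm_mul, Complex.norm_natCast, mul_add]
    have : ‖((d0:ℂ) + k * c)‖ ≤ c * K := by
      have e : ((d0:ℂ) + k * c) = ((d0 + k * c : ℤ) : ℂ) := by push_cast; ring
      rw [e, Complex.norm_intCast, abs_of_nonneg (by exact_mod_cast (by positivity))]
      have h1 : d0 + k * c ≤ (c:ℤ) * K := by
        have : (k:ℤ) + 1 ≤ K := by exact_mod_cast hk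
        nlinarith
      exact_mod_cast h1
    gcongr
  refine interp K _ (fun k => (denom (γ k) τ)⁻¹) (1 / Z ^ 2)
    (Real.exp (-(M / Z ^ 2)) * (l1 A * (c0 * (2 * Z ^ 2) ^ 7) ^ (4 * N)))
    (l1 A * (Real.exp 57 * (Q + 18 * c) ^ N * Q ^ N * Q ^ N * 9 ^ (12 * N))) (Gf_diff _ _ _ _ _ _) (by positivity) ?_ ?_ ?_ ?_ ?_ ?_ p hp |>.trans (le_of_eq ?_)
  · rw [div_le_one (by positivity)]; exact one_le_pow₀ hZ1
  · intro k hk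
    rw [norm_inv]; exact inv_le_one_of_one_le₀ (hlow k)
  · intro k hk l hl hkl
    have hk0 : denom (γ k) τ ≠ 0 := fun h => by have := hlow k; rw [h, norm_zero] at this; linarith
    have hl0 : denom (γ l) τ ≠ 0 := fun h => by have := hlow l; rw [h, norm_zero] at this; linarith
    rw [inv_sub_inv hk0 hl0, norm_div, norm_mul]
    have : 1 ≤ ‖denom (γ l) τ - denom (γ k) τ‖ := by
      rw [hden, hden]
      have e : (c:ℂ) * τ + ((d0:ℂ) + l * c) - ((c:ℂ) * τ + ((d0:ℂ) + k * c)) = (((l:ℤ) - k) * c : ℤ) := by push_cast; ring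
      rw [e, Complex.norm_intCast]
      have h1 : ((l:ℤ) - k) * c ≠ 0 := mul_ne_zero (by omega) (by omega)
      exact_mod_cast Int.one_le_abs h1
    have := hlow k
    have := hlow l
    have := hup k hk
    have := hup l hl
    apply div_le_div₀ (by positivity) ‹1 ≤ ‖denom (γ l) τ - denom (γ k) τ‖› (by positivity)
    rw [pow_two]
    gcongr
  · intro k hk
    have := Gf_translate hA M hM (γ k) τ (by rw [(hγ k).2.1]; omega) Z (hup k hk) hτ1 (hlow k)
    rw [(hγ k).1, (hγ k).2.1] at this
    push_cast at this
    exact this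
  · have := l1_nonneg A
    have : (0:ℝ) ≤ c0 := by rw [c0]; norm_num
    positivity
  · intro z hz
    refine Gf_bound hA _ _ _ _ _ c hcN hc ?_ Q hQ h2 ?_ h4 h6 z hz
    · have : (2 * Real.pi * Complex.I * a / c : ℂ) = ((2 * Real.pi * a / c : ℝ) : ℂ) * Complex.I := by push_cast; ring
      rw [this, Complex.norm_exp_ofReal_mul_I]
    · rw [norm_mul, norm_div, norm_mul, Complex.norm_I, Complex.norm_real, Complex.norm_natCast, Real.norm_eq_abs, abs_of_pos Real.pi_pos]
      gcongr
      have : ‖(6:ℂ)‖ = 6 := by norm_num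
      rw [this, mul_one, div_le_iff₀ Real.pi_pos]
      linarith [Real.pi_gt_three]
  · congr 2
    rw [div_div_eq_mul_div, div_one]

end curve2
end Nes

open Complex
namespace Nes

section choosey
open UpperHalfPlane ModularForm MatrixGroups

/-- real evaluation -/
noncomputable def evR (S : PowerSeries ℤ) (x : ℝ) : ℝ := ∑' n, ((PowerSeries.coeff n S : ℤ) : ℝ) * x ^ n

theorem ev_ofReal (S : PowerSeries ℤ) (x : ℝ) : ev S (x : ℂ) = (evR S x : ℂ) := by
  rw [ev, evR, Complex.ofReal_tsum]
  push_cast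
  rfl

theorem evR_cont (i : Fin 4) : ContinuousOn (evR (Sv i)) (Set.Icc 0 (1 / 2)) := by
  have hw := wt_Sv (r := 1 / 2) (by norm_num) (by norm_num) i
  refine continuousOn_tsum (fun n => by fun_prop) hw.1 (fun n x hx => ?_)
  rw [norm_mul, norm_pow, Real.norm_eq_abs, Real.norm_eq_abs, abs_of_nonneg hx.1]
  have := hx.1
  gcongr
  exact hx.2

theorem ev_Sv_le (i : Fin 4) (q : ℂ) (hq : ‖q‖ ≤ 1 / 2) : ‖ev (Sv i) q‖ ≤ c0 * 128 := by
  have hw := wt_Sv (r := 1 / 2) (by norm_num) (by norm_num) i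
  have hs := hw.schwarz (by norm_num) 0 (fun n hn => by omega) hq
  rw [pow_zero, one_mul] at hs
  refine hs.trans (le_of_eq ?_)
  norm_num
  ring

theorem evR_zero (i : Fin 4) (hi : i ≠ 0) : evR (Sv i) 0 = 1 := by
  rw [evR, tsum_eq_single 0]
  · rw [coeff_zero_Sv, if_neg hi]; simp
  · intro n hn; simp [hn]

theorem one_le_evR2 (x : ℝ) (hx : 0 ≤ x) (hx2 : x ≤ 1 / 2) : 1 ≤ evR (Sv 2) x := by
  have hw := wt_Sv (r := 1 / 2) (by norm_num) (by norm_num) 2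
  have hnn : ∀ n, 0 ≤ ((PowerSeries.coeff n (Sv 2) : ℤ) : ℝ) := fun n => by
    simp only [Sv, Matrix.cons_val, eser, PowerSeries.coeff_mk]
    split_ifs
    · simp
    · push_cast; positivity
  have hs : Summable fun n => ((PowerSeries.coeff n (Sv 2) : ℤ) : ℝ) * x ^ n := by
    refine Summable.of_nonneg_of_le (fun n => mul_nonneg (hnn n) (by positivity)) (fun n => ?_) hw.1
    rw [abs_of_nonneg (hnn n)]
    have := hnn n
    gcongr
  have := hs.le_tsum 0 (fun n _ => mul_nonneg (hnn n) (by positivity))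
  rw [coeff_zero_Sv] at this
  rw [evR]
  simpa using this

theorem qq_I (y : ℝ) : qq (y * Complex.I) = (Real.exp (-2 * Real.pi * y) : ℝ) := by
  rw [qq]
  push_cast
  congr 1
  linear_combination (2 * Real.pi * y) * Complex.I_mul_I

theorem evR3_root : evR (Sv 3) (Real.exp (-2 * Real.pi)) = 0 := by
  have h := transf_E6 ModularGroup.S UpperHalfPlane.I
  have hSI : ModularGroup.S • UpperHalfPlane.I = UpperHalfPlane.I := by
    apply UpperHalfPlane.ext
    rw [coe_smul_eq]
    simp [ModularGroup.S, UpperHalfPlane.coe_I]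
  have hq : qq (UpperHalfPlane.I : ℂ) = (Real.exp (-2 * Real.pi) : ℝ) := by
    have := qq_I 1
    simpa [UpperHalfPlane.coe_I] using this
  rw [hSI, denom_eq, hq, ev_ofReal] at h
  have hd : (((ModularGroup.S 1 0 : ℤ) : ℂ) * (UpperHalfPlane.I : ℂ) + ((ModularGroup.S 1 1 : ℤ) : ℂ)) ^ 6 = -1 := by
    simp only [ModularGroup.S, UpperHalfPlane.coe_I]
    simp
  rw [hd] at h
  have h' : ((evR (Sv 3) (Real.exp (-2 * Real.pi)) : ℝ) : ℂ) = 0 := by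
    linear_combination h / 2
  exact_mod_cast h'

theorem x1_le : Real.exp (-2 * Real.pi) ≤ 1 / 2 := by
  have h1 : Real.exp (-2 * Real.pi) ≤ Real.exp (-1) := Real.exp_le_exp.mpr (by linarith [Real.pi_gt_three])
  have h2 : Real.exp (-1) ≤ 1 / 2 := by
    rw [Real.exp_neg, one_div]
    apply inv_anti₀ (by norm_num)
    have := Real.add_one_le_exp 1
    linarith
  linarith

theorem exists_y : ∃ Q : ℝ, 1 ≤ Q ∧ ∀ v : ℝ, 0 ≤ v → v ≤ 1 / 2 → ∃ (τ : ℍ) (e : ℝ), 1 ≤ τ.im ∧ ‖(τ:ℂ)‖ ≤ Q ∧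
    ‖ev (Sv 1) (qq τ)‖ ≤ Q ∧ ‖ev (Sv 2) (qq τ)‖ ≤ Q ∧ ‖ev (Sv 3) (qq τ)‖ ≤ Q ∧ 1 ≤ e ∧ e ≤ Q ∧
    ev (Sv 2) (qq τ) = (e:ℂ) ^ 2 ∧ ev (Sv 3) (qq τ) = v * (e:ℂ) ^ 3 := by
  set x1 := Real.exp (-2 * Real.pi) with hx1
  have hx10 : 0 < x1 := Real.exp_pos _
  have hx12 : x1 ≤ 1 / 2 := x1_le
  set h : ℝ → ℝ := fun x => evR (Sv 3) x / Real.sqrt (evR (Sv 2) x) ^ 3 with hh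
  have hcont : ContinuousOn h (Set.Icc 0 (1 / 2)) := by
    refine ContinuousOn.div (evR_cont 3) ((Real.continuous_sqrt.comp_continuousOn (evR_cont 2)).pow 3) fun x hx => ?_
    have := one_le_evR2 x hx.1 hx.2
    positivity
  have h0 : h 0 = 1 := by
    simp only [hh]
    rw [evR_zero 3 (by decide), evR_zero 2 (by decide)]; simp
  have h1 : h x1 = 0 := by simp only [hh]; rw [hx1, evR3_root, zero_div]
  obtain ⟨xY, hxY, hxYv⟩ : (1 / 2 : ℝ) ∈ h '' Set.Icc 0 x1 := by
    refine intermediate_value_Icc' hx10.le (hcont.mono (Set.Icc_subset_Icc_right hx12)) ?_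
    rw [h0, h1]; constructor <;> norm_num
  have hxY0 : 0 < xY := by
    rcases hxY.1.eq_or_lt with he | hl
    · rw [← he, h0] at hxYv; norm_num at hxYv
    · exact hl
  have hlog : ∀ x, 0 < x → x ≤ x1 → 1 ≤ - Real.log x / (2 * Real.pi) := fun x hx hx' => by
    rw [le_div_iff₀ (by positivity)]
    have := Real.log_le_log hx hx'
    rw [hx1, Real.log_exp] at this
    linarith
  refine ⟨c0 * 128 + -Real.log xY / (2 * Real.pi), ?_, fun v hv0 hv1 => ?_⟩
  · have := hlog xY hxY0 hxY.2
    have : (0:ℝ) ≤ c0 := by rw [c0]; norm_num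
    linarith
  obtain ⟨x, hx, hxv⟩ : v ∈ h '' Set.Icc xY x1 := by
    refine intermediate_value_Icc' hxY.2 (hcont.mono (Set.Icc_subset_Icc hxY.1 hx12)) ?_
    rw [hxYv, h1]; exact ⟨hv0, hv1⟩
  have hx0 : 0 < x := hxY0.trans_le hx.1
  have hx2 : x ≤ 1 / 2 := hx.2.trans hx12
  set y := - Real.log x / (2 * Real.pi) with hy
  have hy1 : 1 ≤ y := hlog x hx0 hx.2
  have hyY : y ≤ -Real.log xY / (2 * Real.pi) := by
    rw [hy]
    have := Real.log_le_log hxY0 hx.1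
    have := Real.pi_pos
    gcongr
  have hc00 : (0:ℝ) ≤ c0 := by rw [c0]; norm_num
  have hY1 := hlog xY hxY0 hxY.2
  let τ : ℍ := ⟨y * Complex.I, by simp; linarith⟩
  have hτ : (τ : ℂ) = y * Complex.I := rfl
  have hqτ : qq (τ:ℂ) = (x : ℂ) := by
    rw [hτ, qq_I]
    congr 1
    have : -2 * Real.pi * y = Real.log x := by rw [hy]; field_simp
    rw [this, Real.exp_log hx0]
  have hqn : ‖qq (τ:ℂ)‖ ≤ 1 / 2 := by
    rw [hqτ, Complex.norm_real, Real.norm_eq_abs, abs_of_pos hx0]; exact hx2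
  have he1 := one_le_evR2 x hx0.le hx2
  refine ⟨τ, Real.sqrt (evR (Sv 2) x), ?_, ?_, ?_, ?_, ?_, ?_, ?_, ?_, ?_⟩
  · have : τ.im = y := by change (y * Complex.I : ℂ).im = y; simp
    rw [this]; exact hy1
  · rw [hτ, norm_mul, Complex.norm_I, Complex.norm_real, Real.norm_eq_abs, abs_of_pos (by linarith)]
    nlinarith
  · exact (ev_Sv_le 1 _ hqn).trans (by linarith)
  · exact (ev_Sv_le 2 _ hqn).trans (by linarith)
  · exact (ev_Sv_le 3 _ hqn).trans (by linarith)
  · rw [Real.one_le_sqrt]; exact he1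
  · have h3 := ev_Sv_le 2 _ hqn
    rw [hqτ, ev_ofReal, Complex.norm_real, Real.norm_eq_abs, abs_of_pos (by linarith)] at h3
    have : Real.sqrt (evR (Sv 2) x) ≤ evR (Sv 2) x := by
      rw [Real.sqrt_le_left (by linarith)]; nlinarith
    linarith
  · rw [hqτ, ev_ofReal, ← Complex.ofReal_pow, Real.sq_sqrt (by linarith)]
  · rw [hqτ, ev_ofReal, ← hxv]
    simp only [hh]
    rw [← Complex.ofReal_pow, ← Complex.ofReal_mul, div_mul_cancel₀]
    positivity

end choosey
end Nes

open Complex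
namespace Nes

section zeroest
open UpperHalfPlane ModularForm MatrixGroups

theorem chord (c a b : ℕ) (hc : 0 < c) (hab : a < b) (hbc : 2 * (b - a) ≤ c) :
    1 / (c:ℝ) ≤ ‖Complex.exp (2 * Real.pi * Complex.I * a / c) - Complex.exp (2 * Real.pi * Complex.I * b / c)‖ := by
  have hc' : (0:ℝ) < c := by exact_mod_cast hc
  set j := b - a with hj
  have hb : b = a + j := by omega
  have hj1 : (1:ℝ) ≤ j := by exact_mod_cast (by omega : 1 ≤ j)
  have hjc : 2 * (j:ℝ) ≤ c := by exact_mod_cast hbc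
  have e1 : Complex.exp (2 * Real.pi * Complex.I * a / c) - Complex.exp (2 * Real.pi * Complex.I * b / c) =
      -(Complex.exp ((2 * Real.pi * a / c : ℝ) * Complex.I) * (Complex.exp (Complex.I * (2 * Real.pi * j / c : ℝ)) - 1)) := by
    rw [mul_sub, ← Complex.exp_add, mul_one, neg_sub, hb]
    congr 1
    · congr 1; push_cast; ring
    · congr 1; push_cast; ring
  rw [e1, norm_neg, norm_mul, Complex.norm_exp_ofReal_mul_I, one_mul, Complex.norm_exp_I_mul_ofReal_sub_one]
  have hx : 2 * Real.pi * j / c / 2 = Real.pi * (j / c) := by ring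
  have hjc2 : (j:ℝ) / c ≤ 1 / 2 := by rw [div_le_div_iff₀ hc' (by norm_num)]; linarith
  have hs := Real.mul_le_sin (x := Real.pi * (j / c)) (by positivity) (by nlinarith [Real.pi_pos])
  have h3 : 2 / Real.pi * (Real.pi * (j / c)) = 2 * (j / c) := by field_simp
  rw [h3] at hs
  rw [hx, Real.norm_eq_abs]
  refine le_trans ?_ (le_abs_self _)
  have : 1 / (c:ℝ) ≤ j / c := by gcongr
  have : 0 ≤ 1 / (c:ℝ) := by positivity
  linarith

variable {N : ℕ} {A : MvPolynomial (Fin 4) ℤ}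

theorem exists_primes (N Cm : ℕ) (h : 3 * N + 3 ≤ Nat.primeCounting Cm) : ∃ c : ℕ → ℕ, Function.Injective c ∧
    ∀ k ≤ N, (c k).Prime ∧ 2 * N + 2 ≤ c k ∧ c k ≤ Cm := by
  refine ⟨fun k => Nat.nth Nat.Prime (2 * N + 2 + k), fun k l hkl => ?_, fun k hk => ⟨?_, ?_, ?_⟩⟩
  · have := Nat.nth_injective Nat.infinite_setOfPred_prime hkl
    omega
  · exact Nat.prime_nth_prime _
  · have := Nat.add_two_le_nth_prime (2 * N + 2 + k)
    change 2 * N + 2 ≤ Nat.nth Nat.Prime (2 * N + 2 + k)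
    omega
  · have h1 : 2 * N + 2 + k < Nat.primeCounting Cm := by omega
    rw [Nat.primeCounting, Nat.primeCounting'] at h1
    have := Nat.nth_lt_of_lt_count h1
    change Nat.nth Nat.Prime (2 * N + 2 + k) ≤ Cm
    omega

set_option maxHeartbeats 1600000 in
theorem zero_est (Q : ℝ) (hQ1 : 1 ≤ Q) (hQ : ∀ v : ℝ, 0 ≤ v → v ≤ 1 / 2 → ∃ (τ : ℍ) (e : ℝ), 1 ≤ τ.im ∧ ‖(τ:ℂ)‖ ≤ Q ∧
    ‖ev (Sv 1) (qq τ)‖ ≤ Q ∧ ‖ev (Sv 2) (qq τ)‖ ≤ Q ∧ ‖ev (Sv 3) (qq τ)‖ ≤ Q ∧ 1 ≤ e ∧ e ≤ Q ∧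
    ev (Sv 2) (qq τ) = (e:ℂ) ^ 2 ∧ ev (Sv 3) (qq τ) = v * (e:ℂ) ^ 3)
    (hA : ∀ i, A.degreeOf i ≤ N) (M : ℕ) (hM : ∀ n < M, PowerSeries.coeff n (FS A) = 0)
    (Cm K : ℕ) (hCm : 3 * N + 3 ≤ Nat.primeCounting Cm) (Z : ℝ) (hZ : Cm * (Q + K) ≤ Z)
    (h : (l1 A * (Real.exp 57 * (Q + 18 * Cm) ^ N * Q ^ N * Q ^ N * 9 ^ (12 * N)) / 2 ^ K +
        Real.exp (-(M / Z ^ 2)) * (l1 A * (c0 * (2 * Z ^ 2) ^ 7) ^ (4 * N)) * (8 * Z ^ 2) ^ K) * (Q + N) ^ (6 * N) *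
        (4 * (1 + 3 * Cm * (Q + N) ^ 3) / (1 / (2 * Cm))) ^ (4 * N) < 1) : A = 0 := by
  obtain ⟨c, hcinj, hc⟩ := exists_primes N Cm hCm
  choose! τ e hτ1 hτQ h2 h4 h6 he1 heQ hE4 hE6 using hQ
  set v : ℕ → ℝ := fun j => j / (2 * (N + 1)) with hv
  have hv0 : ∀ j, 0 ≤ v j := fun j => by simp only [hv]; positivity
  have hv1 : ∀ j ≤ N, v j ≤ 1 / 2 := fun j hj => by
    simp only [hv]
    have : (j:ℝ) ≤ N := by exact_mod_cast hj
    rw [div_le_div_iff₀ (by positivity) (by norm_num)]; linarith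
  set ε2 := l1 A * (Real.exp 57 * (Q + 18 * Cm) ^ N * Q ^ N * Q ^ N * 9 ^ (12 * N)) / 2 ^ K +
        Real.exp (-(M / Z ^ 2)) * (l1 A * (c0 * (2 * Z ^ 2) ^ 7) ^ (4 * N)) * (8 * Z ^ 2) ^ K with hε2
  have hl1 := l1_nonneg A
  have hc00 : (0:ℝ) ≤ c0 := by rw [c0]; norm_num
  have hQ0 : 0 ≤ Q := by linarith
  have hε20 : 0 ≤ ε2 := by positivity
  have hCmN : 2 * N + 2 ≤ Cm := (hc 0 (Nat.zero_le _)).2.1.trans (hc 0 (Nat.zero_le _)).2.2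
  have hCmR : 2 * (N:ℝ) + 2 ≤ Cm := by exact_mod_cast hCmN
  have hN0 : (0:ℝ) ≤ N := by positivity
  set P := Q + (N:ℝ) with hP
  have hP1 : 1 ≤ P := by linarith
  have hP3 : P ≤ P ^ 3 := le_self_pow₀ hP1 (by norm_num)
  have hP23 : P ^ 2 ≤ P ^ 3 := pow_le_pow_right₀ hP1 (by norm_num)
  set X : ℕ → ℝ := fun i => Q + i with hX
  have hXQ : ∀ i, Q ≤ X i := fun i => by simp only [hX]; linarith [(Nat.cast_nonneg i : (0:ℝ) ≤ i)]
  have hXP : ∀ i ≤ N, X i ≤ P := fun i hi => by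
    have : (i:ℝ) ≤ N := by exact_mod_cast hi
    simp only [hX, hP]; linarith
  set u : ℕ → ℕ → ℝ := fun i j => Real.sqrt (X i / e (v j)) with hu
  have hu2 : ∀ i, ∀ j ≤ N, u i j ^ 2 = X i / e (v j) := fun i j hj => by
    have := he1 (v j) (hv0 j) (hv1 j hj)
    have := hXQ i
    simp only [hu]; rw [Real.sq_sqrt]
    apply div_nonneg <;> linarith
  have hu1 : ∀ i, ∀ j ≤ N, 1 ≤ u i j := fun i j hj => by
    have h1 := he1 (v j) (hv0 j) (hv1 j hj)
    have h2 := hXQ i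
    have h3 := heQ (v j) (hv0 j) (hv1 j hj)
    simp only [hu]
    rw [Real.one_le_sqrt, one_le_div (by linarith)]; linarith
  have huP : ∀ i ≤ N, ∀ j ≤ N, u i j ^ 2 ≤ P := fun i hi j hj => by
    have h1 := he1 (v j) (hv0 j) (hv1 j hj)
    have h2 := hXQ i
    rw [hu2 i j hj]
    exact (div_le_self (by linarith) h1).trans (hXP i hi)
  have huP' : ∀ i ≤ N, ∀ j ≤ N, u i j ≤ P := fun i hi j hj => by
    have := hu1 i j hj
    have := huP i hi j hj
    nlinarith
  have hs0 : (0:ℝ) < 1 / (2 * Cm) := by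
    have : (0:ℝ) < Cm := by linarith
    positivity
  have hs1 : 1 / (2 * (Cm:ℝ)) ≤ 1 / 2 := by
    apply one_div_le_one_div_of_le (by norm_num); linarith
  have hR0 : 0 ≤ 3 * (Cm:ℝ) * P ^ 3 := by positivity
  have hRP : P ^ 3 ≤ 3 * (Cm:ℝ) * P ^ 3 := le_mul_of_one_le_left (by positivity) (by linarith)
  have key := grid A hA (fun i => ((X i : ℝ) : ℂ) ^ 2) (fun i j => ((v j * X i ^ 3 : ℝ) : ℂ))
    (fun i j m => ((u i j : ℝ) : ℂ) ^ 2 * ev (Sv 1) (qq (τ (v j))) + 6 / (Real.pi * Complex.I) * c m * ((u i j : ℝ) : ℂ))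
    (fun i j m k => Complex.exp (2 * Real.pi * Complex.I * (k + 1 : ℕ) / c m) * Complex.exp (-(2 * Real.pi * Complex.I * ((u i j : ℝ) : ℂ)⁻¹ / c m)))
    (3 * Cm * P ^ 3) (1 / (2 * Cm)) (ε2 * P ^ (6 * N)) hs0 (by linarith) hR0 (by positivity)
    ?_ ?_ ?_ ?_ ?_ ?_ ?_ ?_ ?_
  · rw [eq_sum_bx A hA]
    refine Finset.sum_eq_zero fun e _ => ?_
    have h1 := (key e).trans_lt h
    have h2 : |A.coeff (bx e)| < 1 := by exact_mod_cast h1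
    rw [Int.abs_lt_one_iff] at h2
    rw [h2, MvPolynomial.monomial_zero]
  · intro i hi
    rw [norm_pow, Complex.norm_real, Real.norm_eq_abs, abs_of_nonneg (by linarith [hXQ i])]
    have : X i ^ 2 ≤ P ^ 2 := pow_le_pow_left₀ (by linarith [hXQ i]) (hXP i hi) 2
    linarith
  · intro i hi l hl hil
    have e1 : ((X i : ℝ) : ℂ) ^ 2 - ((X l : ℝ) : ℂ) ^ 2 = (((i:ℤ) - l : ℤ) : ℂ) * ((X i + X l : ℝ) : ℂ) := by
      simp only [hX]; push_cast; ring
    rw [e1, norm_mul, Complex.norm_intCast, Complex.norm_real, Real.norm_eq_abs, abs_of_nonneg (a := X i + X l) (by linarith [hXQ i, hXQ l])]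
    have h0 : (i:ℤ) - l ≠ 0 := by omega
    have h1 : (1:ℝ) ≤ |(((i:ℤ) - l : ℤ) : ℝ)| := by exact_mod_cast Int.one_le_abs h0
    nlinarith [hXQ i, hXQ l]
  · intro i hi j hj
    rw [Complex.norm_real, Real.norm_eq_abs, abs_of_nonneg (mul_nonneg (hv0 j) (pow_nonneg (by linarith [hXQ i]) 3))]
    have h1 : X i ^ 3 ≤ P ^ 3 := pow_le_pow_left₀ (by linarith [hXQ i]) (hXP i hi) 3
    have h2 : 0 ≤ X i ^ 3 := pow_nonneg (by linarith [hXQ i]) 3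
    nlinarith [hv1 j hj, hv0 j]
  · intro i hi j hj l hl hjl
    have e1 : ((v j * X i ^ 3 : ℝ) : ℂ) - ((v l * X i ^ 3 : ℝ) : ℂ) = ((((j:ℤ) - l : ℤ) : ℝ) * (1 / (2 * (N + 1)) * X i ^ 3) : ℝ) := by
      simp only [hv]; push_cast; ring
    have hXi : 1 ≤ X i ^ 3 := one_le_pow₀ (by linarith [hXQ i])
    rw [e1, Complex.norm_real, norm_mul, Real.norm_eq_abs, Real.norm_eq_abs, abs_of_nonneg (a := 1 / (2 * ((N:ℝ) + 1)) * X i ^ 3) (by positivity)]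
    have h0 : (j:ℤ) - l ≠ 0 := by omega
    have h1 : (1:ℝ) ≤ |(((j:ℤ) - l : ℤ) : ℝ)| := by exact_mod_cast Int.one_le_abs h0
    have h2 : 1 / (2 * (Cm:ℝ)) ≤ 1 / (2 * ((N:ℝ) + 1)) := by
      apply one_div_le_one_div_of_le (by positivity); linarith
    have h3 : 1 / (2 * ((N:ℝ) + 1)) ≤ 1 / (2 * ((N:ℝ) + 1)) * X i ^ 3 := le_mul_of_one_le_right (by positivity) hXi
    have h4 : 1 / (2 * ((N:ℝ) + 1)) * X i ^ 3 ≤ |(((j:ℤ) - l : ℤ) : ℝ)| * (1 / (2 * ((N:ℝ) + 1)) * X i ^ 3) :=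
      le_mul_of_one_le_left (by positivity) h1
    linarith
  · intro i hi j hj m hm
    have hcm : (c m : ℝ) ≤ Cm := by exact_mod_cast (hc m hm).2.2
    refine (norm_add_le _ _).trans ?_
    have t1 : ‖((u i j : ℝ) : ℂ) ^ 2 * ev (Sv 1) (qq (τ (v j)))‖ ≤ P * P := by
      rw [norm_mul, norm_pow, Complex.norm_real, Real.norm_eq_abs, sq_abs]
      have := huP i hi j hj
      have := h2 (v j) (hv0 j) (hv1 j hj)
      gcongr
      linarith
    have t2 : ‖6 / (Real.pi * Complex.I) * c m * ((u i j : ℝ) : ℂ)‖ ≤ 2 * Cm * P := by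
      rw [norm_mul, norm_mul, norm_div, norm_mul, Complex.norm_I, Complex.norm_real, Complex.norm_real, Complex.norm_natCast,
        Real.norm_eq_abs, abs_of_pos Real.pi_pos, Real.norm_eq_abs, abs_of_nonneg (by linarith [hu1 i j hj])]
      have t3 : ‖(6:ℂ)‖ / (Real.pi * 1) ≤ 2 := by
        have : ‖(6:ℂ)‖ = 6 := by norm_num
        rw [this, mul_one, div_le_iff₀ Real.pi_pos]
        linarith [Real.pi_gt_three]
      have := huP' i hi j hj
      have := hu1 i j hj
      gcongr
    have t4 : P * P ≤ Cm * P ^ 3 := by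
      have : P * P = P ^ 2 := by ring
      nlinarith
    have t5 : 2 * (Cm:ℝ) * P ≤ 2 * Cm * P ^ 3 := by gcongr
    linarith
  · intro i hi j hj m hm l hl hml
    have e1 : ∀ (x E κ : ℂ), x ^ 2 * E + κ * c m * x - (x ^ 2 * E + κ * c l * x) = κ * (((c m : ℤ) - c l : ℤ) : ℂ) * x := by
      intro x E κ; push_cast; ring
    rw [e1, norm_mul, norm_mul, norm_div, norm_mul, Complex.norm_I, Complex.norm_real, Complex.norm_real, Complex.norm_intCast,
        Real.norm_eq_abs, abs_of_pos Real.pi_pos, Real.norm_eq_abs, abs_of_nonneg (a := u i j) (by linarith [hu1 i j hj])]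
    have t3 : 1 ≤ ‖(6:ℂ)‖ / (Real.pi * 1) := by
      have : ‖(6:ℂ)‖ = 6 := by norm_num
      rw [this, mul_one, le_div_iff₀ Real.pi_pos]
      linarith [Real.pi_lt_four]
    have t4 : (1:ℝ) ≤ |(((c m : ℤ) - c l : ℤ) : ℝ)| := by
      have : (c m : ℤ) - c l ≠ 0 := fun h => hml (hcinj (by omega))
      exact_mod_cast Int.one_le_abs this
    have t5 := hu1 i j hj
    have t6 : (1:ℝ) ≤ ‖(6:ℂ)‖ / (Real.pi * 1) * |(((c m : ℤ) - c l : ℤ) : ℝ)| * u i j :=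
      one_le_mul_of_one_le_of_one_le (one_le_mul_of_one_le_of_one_le t3 t4) t5
    linarith
  · intro i hi j hj m hm k hk
    have n1 : ‖Complex.exp (2 * Real.pi * Complex.I * (k + 1 : ℕ) / c m)‖ = 1 := by
      have : (2 * Real.pi * Complex.I * (k + 1 : ℕ) / c m : ℂ) = ((2 * Real.pi * (k + 1 : ℕ) / c m : ℝ) : ℂ) * Complex.I := by push_cast; ring
      rw [this, Complex.norm_exp_ofReal_mul_I]
    have n2 : ‖Complex.exp (-(2 * Real.pi * Complex.I * ((u i j : ℝ) : ℂ)⁻¹ / c m))‖ = 1 := by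
      have : (-(2 * Real.pi * Complex.I * ((u i j : ℝ) : ℂ)⁻¹ / c m) : ℂ) = ((-(2 * Real.pi * (u i j)⁻¹ / c m) : ℝ) : ℂ) * Complex.I := by push_cast; ring
      rw [this, Complex.norm_exp_ofReal_mul_I]
    rw [norm_mul, n1, n2]
    linarith
  · intro i hi j hj m hm k hk l hl hkl
    have n2 : ‖Complex.exp (-(2 * Real.pi * Complex.I * ((u i j : ℝ) : ℂ)⁻¹ / c m))‖ = 1 := by
      have : (-(2 * Real.pi * Complex.I * ((u i j : ℝ) : ℂ)⁻¹ / c m) : ℂ) = ((-(2 * Real.pi * (u i j)⁻¹ / c m) : ℝ) : ℂ) * Complex.I := by push_cast; ring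
      rw [this, Complex.norm_exp_ofReal_mul_I]
    rw [← sub_mul, norm_mul, n2, mul_one]
    have hcm := hc m hm
    have hcpos : 0 < c m := hcm.1.pos
    have b1 : 1 / (2 * (Cm:ℝ)) ≤ 1 / (c m : ℝ) := by
      have : (c m : ℝ) ≤ Cm := by exact_mod_cast hcm.2.2
      apply one_div_le_one_div_of_le (by exact_mod_cast hcpos)
      linarith
    refine b1.trans ?_
    rcases lt_or_gt_of_ne hkl with hlt | hlt
    · exact chord (c m) (k + 1) (l + 1) hcpos (by omega) (by omega)
    · rw [norm_sub_rev]
      exact chord (c m) (l + 1) (k + 1) hcpos (by omega) (by omega)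
  · intro i hi j hj m hm k hk
    have hcm := hc m hm
    have hu1' := hu1 i j hj
    have hu0 : ((u i j : ℝ) : ℂ) ≠ 0 := by
      have : u i j ≠ 0 := by linarith
      exact_mod_cast this
    have hcop : Nat.Coprime (k + 1) (c m) := (Nat.coprime_of_lt_prime (by omega) (by omega) hcm.1).symm
    have hcmR : (c m : ℝ) ≤ Cm := by exact_mod_cast hcm.2.2
    have hK0 : (0:ℝ) ≤ K := by positivity
    have hb := curve_bound hA M hM (k + 1) (c m) (by omega) hcm.1.pos hcop (τ (v j)) (hτ1 _ (hv0 j) (hv1 j hj)) Q hQ1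
      (hτQ _ (hv0 j) (hv1 j hj)) (h2 _ (hv0 j) (hv1 j hj)) (h4 _ (hv0 j) (hv1 j hj)) (h6 _ (hv0 j) (hv1 j hj))
      K Z (le_trans (by gcongr) hZ) ((u i j : ℝ) : ℂ)⁻¹ (by
        rw [norm_inv, Complex.norm_real, Real.norm_eq_abs, abs_of_nonneg (by linarith)]
        exact inv_le_one_of_one_le₀ hu1')
    rw [Gf_eq hA _ _ _ _ _ _ _ (inv_ne_zero hu0), inv_inv, hE4 _ (hv0 j) (hv1 j hj), hE6 _ (hv0 j) (hv1 j hj), norm_mul, norm_pow, norm_inv,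
      Complex.norm_real, Real.norm_eq_abs, abs_of_nonneg (a := u i j) (by linarith)] at hb
    have he0 : e (v j) ≠ 0 := by have := he1 (v j) (hv0 j) (hv1 j hj); linarith
    have k1 : u i j ^ 2 * e (v j) = X i := by rw [hu2 i j hj]; field_simp
    have k4 : ((u i j : ℝ) : ℂ) ^ 4 * ((e (v j) : ℝ) : ℂ) ^ 2 = ((X i : ℝ) : ℂ) ^ 2 := by
      rw [← k1]; push_cast; ring
    have k6 : ((u i j : ℝ) : ℂ) ^ 6 * (((v j : ℝ) : ℂ) * ((e (v j) : ℝ) : ℂ) ^ 3) = ((v j * X i ^ 3 : ℝ) : ℂ) := by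
      rw [← k1]; push_cast; ring
    rw [k4, k6] at hb
    have hb2 := hb.trans (b := _) (c := ε2) (by
      rw [hε2]
      gcongr)
    rw [inv_pow, inv_mul_le_iff₀ (by positivity)] at hb2
    refine hb2.trans ?_
    rw [mul_comm]
    refine mul_le_mul_of_nonneg_left ?_ hε20
    calc u i j ^ (12 * N) = (u i j ^ 2) ^ (6 * N) := by rw [← pow_mul]; congr 1; ring
      _ ≤ P ^ (6 * N) := pow_le_pow_left₀ (by positivity) (huP i hi j hj) _

end zeroest
end Nes

open Complex
namespace Nes

section params

/-- Parameters: `N` large with respect to the constant `C`, and `w = N ^ 0.0005`. -/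
structure Big (C : ℝ) (N : ℕ) (w L : ℝ) : Prop where
  hC : (10:ℝ) ^ 12 ≤ C
  hN : C ≤ N
  hL : Real.exp L = N
  hw : C * (L + 1) ≤ w
  hw2 : w ^ 20 ≤ N
  hlw : Real.log w = 0.0005 * L

theorem exists_big (C : ℝ) (hC : (10:ℝ) ^ 12 ≤ C) : ∃ N0 : ℕ, 1 ≤ N0 ∧ ∀ N ≥ N0, ∃ w L, Big C N w L := by
  have h1 : ∀ᶠ N : ℕ in Filter.atTop, C * (Real.log N + 1) ≤ (N:ℝ) ^ (0.0005:ℝ) := by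
    have h2 : (fun x : ℝ => C * (Real.log x + 1)) =o[Filter.atTop] fun x : ℝ => x ^ (0.0005:ℝ) := by
      apply Asymptotics.IsLittleO.const_mul_left
      apply (isLittleO_log_rpow_atTop (by norm_num)).add
      apply Asymptotics.isLittleO_const_left.2
      right
      exact tendsto_norm_atTop_atTop.comp (tendsto_rpow_atTop (by norm_num))
    have h3 := (h2.bound (c := 1) one_pos)
    have h4 := tendsto_natCast_atTop_atTop (R := ℝ) |>.eventually h3
    filter_upwards [h4] with N hN
    rw [one_mul, Real.norm_eq_abs, Real.norm_eq_abs, abs_of_nonneg (a := (N:ℝ) ^ (0.0005:ℝ)) (by positivity)] at hN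
    exact (le_abs_self _).trans hN
  have h5 : ∀ᶠ N : ℕ in Filter.atTop, C ≤ N := tendsto_natCast_atTop_atTop.eventually_ge_atTop C
  obtain ⟨N0, h0⟩ := Filter.eventually_atTop.1 (h1.and h5)
  refine ⟨N0 + 1, by omega, fun N hN => ⟨(N:ℝ) ^ (0.0005:ℝ), Real.log N, ?_⟩⟩
  obtain ⟨h1, h5⟩ := h0 N (by omega)
  have hN1 : (1:ℝ) ≤ N := by exact_mod_cast (by omega : 1 ≤ N)
  refine ⟨hC, h5, Real.exp_log (by linarith), h1, ?_, Real.log_rpow (by linarith) _⟩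
  rw [← Real.rpow_natCast, ← Real.rpow_mul (by linarith)]
  calc (N:ℝ) ^ ((0.0005:ℝ) * (20:ℕ)) ≤ (N:ℝ) ^ (1:ℝ) := Real.rpow_le_rpow_of_exponent_le hN1 (by norm_num)
    _ = N := Real.rpow_one _

namespace Big
variable {C : ℝ} {N : ℕ} {w L : ℝ}

theorem N1 (H : Big C N w L) : (10:ℝ) ^ 12 ≤ N := H.hC.trans H.hN
theorem L0 (H : Big C N w L) : 1 ≤ L := by
  have h := H.N1
  rw [← H.hL] at h
  by_contra hL
  have h2 : Real.exp L ≤ Real.exp 1 := Real.exp_le_exp.2 (by linarith)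
  have := Real.exp_one_lt_d9
  norm_num at h
  linarith
theorem w1 (H : Big C N w L) : C ≤ w := by
  have := H.hw
  have := H.L0
  have := H.hC
  norm_num at this
  nlinarith
theorem wL (H : Big C N w L) : C * L ≤ w := by
  have := H.hw
  have := H.hC
  norm_num at this
  nlinarith
theorem w0 (H : Big C N w L) : (10:ℝ) ^ 12 ≤ w := H.hC.trans H.w1
theorem pw (H : Big C N w L) (k : ℕ) (hk : k ≤ 20) : w ^ k ≤ N := by
  refine le_trans (pow_le_pow_right₀ ?_ hk) H.hw2
  have := H.w0
  norm_num at this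
  linarith
theorem nexp (H : Big C N w L) (k : ℕ) : (N:ℝ) ^ k = Real.exp (k * L) := by
  rw [← H.hL, ← Real.exp_nat_mul]
theorem wexp (H : Big C N w L) : w = Real.exp (0.0005 * L) := by
  rw [← H.hlw, Real.exp_log]
  have := H.w0
  norm_num at this
  linarith

end Big

theorem siegel_bound {C : ℝ} {N : ℕ} {w L : ℝ} (H : Big C N w L) {x : ℝ}
    (hx : x ≤ (((N+1)^4:ℕ):ℝ)^2 * (2*(c0*(2*((N+1)^4:ℕ))^7)^(4*N))) : x ≤ (N:ℝ) ^ (273 * N) := by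
  have h1 := H.N1
  have hc0 : (c0:ℝ) ≤ N := by refine le_trans ?_ h1; rw [c0]; norm_num
  have hc00 : (0:ℝ) ≤ c0 := by rw [c0]; norm_num
  have h2 : (2:ℝ) ≤ N := by refine le_trans ?_ h1; norm_num
  have hN1 : 1 ≤ N := by
    have : (1:ℝ) ≤ N := by linarith
    exact_mod_cast this
  have h3 : (((N+1)^4:ℕ):ℝ) ≤ (N:ℝ) ^ 8 := by
    push_cast
    calc ((N:ℝ) + 1) ^ 4 ≤ ((N:ℝ) ^ 2) ^ 4 := by gcongr; nlinarith
      _ = (N:ℝ) ^ 8 := by ring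
  refine hx.trans ?_
  calc (((N+1)^4:ℕ):ℝ)^2 * (2*(c0*(2*((N+1)^4:ℕ))^7)^(4*N)) ≤ ((N:ℝ) ^ 8) ^ 2 * (N * (N * (N * (N:ℝ)^8)^7) ^ (4 * N)) := by gcongr
    _ = (N:ℝ) ^ (17 + 64 * (4 * N)) := by rw [pow_add, pow_mul]; ring
    _ ≤ (N:ℝ) ^ (273 * N) := pow_le_pow_right₀ (by linarith) (by omega)

end params
end Nes

open Complex
namespace Nes

section mult
open UpperHalfPlane ModularForm MatrixGroups
variable {C : ℝ} {N : ℕ} {w L : ℝ}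

theorem prime_ok (H : Big C N w L) (Cm : ℕ) (h1 : N * w ≤ Cm) (h2 : (Cm:ℝ) ≤ 2 * N * w) :
    3 * N + 3 ≤ Nat.primeCounting Cm := by
  have hN1 := H.N1
  have hL0 := H.L0
  have hwL := H.wL
  have hw0 := H.w0
  have hC := H.hC
  have hw2 : w ^ 2 ≤ N := H.pw 2 (by norm_num)
  have e12 : (10:ℝ) ^ 12 = 1000000000000 := by norm_num
  rw [e12] at hN1 hw0 hC
  have hCm0 : (1:ℝ) < Cm := by nlinarith
  have hCm2 : (Cm:ℝ) ≤ (N:ℝ) ^ 2 := by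
    refine h2.trans ?_
    have : 2 * w ≤ N := by nlinarith
    nlinarith
  have l1' : Real.log Cm ≤ 2 * L := by
    rw [Real.log_le_iff_le_exp (by linarith)]
    have := H.nexp 2
    push_cast at this
    linarith
  have l2 : Real.log (Cm + 1) ≤ 3 * L := by
    rw [Real.log_le_iff_le_exp (by linarith)]
    have := H.nexp 3
    push_cast at this
    rw [← this]
    nlinarith [sq_nonneg (N:ℝ)]
  have h3 := Chebyshev.pi_ge Cm
  have l0 : 0 < Real.log Cm := Real.log_pos hCm0
  have hlog2 := Real.log_two_gt_d9
  have h4 : (3 * (N:ℝ) + 3) * Real.log Cm ≤ Cm * Real.log 2 - Real.log (Cm + 1) := by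
    have a1 : 1000 * L ≤ w := by nlinarith
    have a2 : 1000 * (N * L) ≤ Cm := by nlinarith
    have a3 : (3 * (N:ℝ) + 3) * Real.log Cm ≤ (4 * N) * (2 * L) := by
      apply mul_le_mul (by linarith) l1' l0.le (by linarith)
    have a4 : 3 * L ≤ N * L := by nlinarith
    nlinarith
  have h5 : 3 * (N:ℝ) + 3 ≤ (Cm * Real.log 2 - Real.log (Cm + 1)) / Real.log Cm := by
    rwa [le_div_iff₀ l0]
  have h6 := h5.trans h3
  exact_mod_cast h6

set_option maxHeartbeats 1600000 in
theorem mult_bound (H : Big C N w L) (hC57 : Real.exp 57 ≤ C) (Q : ℝ) (hQC : Q ≤ C) (hQ1 : 1 ≤ Q)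
    (hQ : ∀ v : ℝ, 0 ≤ v → v ≤ 1 / 2 → ∃ (τ : ℍ) (e : ℝ), 1 ≤ τ.im ∧ ‖(τ:ℂ)‖ ≤ Q ∧
    ‖ev (Sv 1) (qq τ)‖ ≤ Q ∧ ‖ev (Sv 2) (qq τ)‖ ≤ Q ∧ ‖ev (Sv 3) (qq τ)‖ ≤ Q ∧ 1 ≤ e ∧ e ≤ Q ∧
    ev (Sv 2) (qq τ) = (e:ℂ) ^ 2 ∧ ev (Sv 3) (qq τ) = v * (e:ℂ) ^ 3)
    (A : MvPolynomial (Fin 4) ℤ) (hA : ∀ i, A.degreeOf i ≤ N) (hA0 : A ≠ 0) (hl : l1 A ≤ (N:ℝ) ^ (273 * N)) :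
    ∃ n : ℕ, (n:ℝ) < N ^ 5 * w ^ 10 ∧ PowerSeries.coeff n (FS A) ≠ 0 := by
  by_contra hcon
  push Not at hcon
  apply hA0
  have hN1 := H.N1
  have hL0 := H.L0
  have hwL := H.wL
  have hw0 := H.w0
  have hC := H.hC
  have hCN := H.hN
  have hw2 : w ^ 2 ≤ N := H.pw 2 (by norm_num)
  have e12 : (10:ℝ) ^ 12 = 1000000000000 := by norm_num
  rw [e12] at hN1 hw0 hC
  have hN0 : (0:ℝ) ≤ N := by linarith
  set Cm := ⌈(N:ℝ) * w⌉₊ with hCm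
  have c1 : N * w ≤ Cm := Nat.le_ceil _
  have c2 : (Cm:ℝ) ≤ 2 * N * w := by
    have := Nat.ceil_lt_add_one (a := (N:ℝ) * w) (by positivity)
    nlinarith
  have hCm2 : (Cm:ℝ) ≤ (N:ℝ) ^ 2 := by
    refine c2.trans ?_
    have : 2 * w ≤ N := by nlinarith
    nlinarith
  have hCm0 : (1:ℝ) ≤ Cm := by nlinarith
  have hQw : Q ≤ Cm := by nlinarith [H.w1]
  set Z : ℝ := Cm * (Q + Cm) with hZ
  have hZ1 : 0 < Z := by positivity
  have hZ2 : Z ≤ (N:ℝ) ^ 5 := by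
    calc Z ≤ (N:ℝ) ^ 2 * ((N:ℝ) ^ 2 + (N:ℝ) ^ 2) := by rw [hZ]; gcongr; linarith
      _ = 2 * (N:ℝ) ^ 4 := by ring
      _ ≤ N * (N:ℝ) ^ 4 := by gcongr; linarith
      _ = (N:ℝ) ^ 5 := by ring
  have hZ3 : Z ≤ 8 * (N * w) ^ 2 := by
    calc Z ≤ (2 * N * w) * (2 * N * w + 2 * N * w) := by rw [hZ]; gcongr; linarith
      _ = _ := by ring
  set M := ⌈(N:ℝ) ^ 5 * w ^ 10⌉₊ with hM
  have hMle : (N:ℝ) ^ 5 * w ^ 10 ≤ M := Nat.le_ceil _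
  have hl0 := l1_nonneg A
  have hc0 : (c0:ℝ) ≤ N := by refine le_trans ?_ hN1; rw [c0]; norm_num
  have hc00 : (0:ℝ) ≤ c0 := by rw [c0]; norm_num
  have h57 : Real.exp 57 ≤ N := hC57.trans hCN
  have hQN : Q ≤ N := hQC.trans hCN
  have hNn : 1 ≤ N := by
    have : (1:ℝ) ≤ N := by linarith
    exact_mod_cast this
  refine zero_est Q hQ1 hQ hA M (fun n hn => hcon n (Nat.lt_ceil.1 hn)) Cm Cm (prime_ok H Cm c1 c2) Z le_rfl ?_
  have p1 : l1 A * (Real.exp 57 * (Q + 18 * Cm) ^ N * Q ^ N * Q ^ N * 9 ^ (12 * N)) ≤ (N:ℝ) ^ (281 * N) := by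
    calc l1 A * (Real.exp 57 * (Q + 18 * Cm) ^ N * Q ^ N * Q ^ N * 9 ^ (12 * N))
        ≤ (N:ℝ) ^ (273 * N) * ((N:ℝ) ^ N * ((N:ℝ)^4) ^ N * (N:ℝ) ^ N * (N:ℝ) ^ N * (N:ℝ) ^ N) := by
          rw [pow_mul (9:ℝ)]
          have b1 : Q + 18 * (Cm:ℝ) ≤ (N:ℝ) ^ 4 := by nlinarith
          have b2 : (N:ℝ) ≤ (N:ℝ) ^ N := le_self_pow₀ (by linarith) (by omega)
          have b3 : Real.exp 57 ≤ (N:ℝ) ^ N := h57.trans b2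
          have b4 : (9:ℝ) ^ 12 ≤ N := by refine le_trans ?_ hN1; norm_num
          gcongr
      _ = (N:ℝ) ^ (281 * N) := by ring
  have p2 : l1 A * (c0 * (2 * Z ^ 2) ^ 7) ^ (4 * N) ≤ (N:ℝ) ^ (585 * N) := by
    calc l1 A * (c0 * (2 * Z ^ 2) ^ 7) ^ (4 * N) ≤ (N:ℝ) ^ (273 * N) * (N * (N * ((N:ℝ) ^ 5) ^ 2) ^ 7) ^ (4 * N) := by
          gcongr; linarith
      _ = (N:ℝ) ^ (273 * N) * ((N:ℝ) ^ 78) ^ (4 * N) := by congr 2; ring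
      _ = (N:ℝ) ^ (585 * N) := by rw [← pow_mul, ← pow_add]; congr 1; ring
  have p3 : (8 * Z ^ 2) ^ Cm ≤ (N:ℝ) ^ (11 * Cm) := by
    calc (8 * Z ^ 2) ^ Cm ≤ (N * ((N:ℝ) ^ 5) ^ 2) ^ Cm := by gcongr; linarith
      _ = (N:ℝ) ^ (11 * Cm) := by rw [pow_mul]; congr 1; ring
  have p4 : (Q + N) ^ (6 * N) ≤ (N:ℝ) ^ (12 * N) := by
    calc (Q + N) ^ (6 * N) ≤ ((N:ℝ) ^ 2) ^ (6 * N) := by gcongr; nlinarith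
      _ = (N:ℝ) ^ (12 * N) := by rw [← pow_mul]; congr 1; ring
  have p5 : (4 * (1 + 3 * Cm * (Q + N) ^ 3) / (1 / (2 * Cm))) ^ (4 * N) ≤ (N:ℝ) ^ (48 * N) := by
    have d1 : 4 * (1 + 3 * Cm * (Q + N) ^ 3) / (1 / (2 * (Cm:ℝ))) = 8 * Cm * (1 + 3 * Cm * (Q + N) ^ 3) := by
      field_simp; ring
    have d2 : (1:ℝ) ≤ (N:ℝ) ^ 8 := one_le_pow₀ (by linarith)
    rw [d1]
    calc (8 * Cm * (1 + 3 * Cm * (Q + N) ^ 3)) ^ (4 * N) ≤ (8 * (N:ℝ) ^ 2 * (1 * (N:ℝ) ^ 8 + 3 * (N:ℝ) ^ 2 * ((N:ℝ) ^ 2) ^ 3)) ^ (4 * N) := by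
          gcongr
          · linarith
          · nlinarith
      _ = (32 * (N:ℝ) ^ 10) ^ (4 * N) := by congr 1; ring
      _ ≤ ((N:ℝ) ^ 2 * (N:ℝ) ^ 10) ^ (4 * N) := by
          have d3 : (32:ℝ) ≤ (N:ℝ) ^ 2 := by nlinarith
          exact pow_le_pow_left₀ (by positivity) (mul_le_mul_of_nonneg_right d3 (by positivity)) _
      _ = (N:ℝ) ^ (48 * N) := by rw [← pow_add, ← pow_mul]; congr 1; ring
  have q1 : (N:ℝ) ^ (281 * N) * (N:ℝ) ^ (12 * N) * (N:ℝ) ^ (48 * N) ≤ 2 ^ Cm / 4 := by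
    rw [← pow_add, ← pow_add, H.nexp, ← Real.exp_log (show (0:ℝ) < 2 ^ Cm / 4 by positivity), Real.exp_le_exp,
      Real.log_div (by positivity) (by norm_num), Real.log_pow, show (4:ℝ) = 2 ^ 2 by norm_num, Real.log_pow]
    push_cast
    have g1 := Real.log_two_gt_d9
    have g2 := Real.log_two_lt_d9
    have a1 : 1000 * L ≤ w := by nlinarith
    have a2 : 1000 * (N * L) ≤ Cm := by nlinarith
    have a3 : 1000 ≤ N * L := by nlinarith
    nlinarith
  have q2 : Real.exp (-(M / Z ^ 2)) * (N:ℝ) ^ (585 * N) * (N:ℝ) ^ (11 * Cm) * (N:ℝ) ^ (12 * N) * (N:ℝ) ^ (48 * N) ≤ 1 / 4 := by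
    rw [H.nexp, H.nexp, H.nexp, H.nexp, ← Real.exp_add, ← Real.exp_add, ← Real.exp_add, ← Real.exp_add]
    have f1 : Real.exp (-2) ≤ 1 / 4 := by
      rw [Real.exp_neg, inv_le_comm₀ (Real.exp_pos _) (by norm_num)]
      have := Real.exp_one_gt_d9
      have e2 : Real.exp 2 = Real.exp 1 * Real.exp 1 := by rw [← Real.exp_add]; norm_num
      rw [e2]; norm_num; nlinarith
    refine le_trans (Real.exp_le_exp.2 ?_) f1
    have f2 : N * w * w ≤ M / Z ^ 2 := by
      rw [le_div_iff₀ (by positivity)]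
      refine le_trans ?_ hMle
      calc N * w * w * Z ^ 2 ≤ N * w * w * (8 * (N * w) ^ 2) ^ 2 := by gcongr
        _ = 64 * ((N:ℝ) ^ 5 * w ^ 6) := by ring
        _ ≤ w * ((N:ℝ) ^ 5 * w ^ 6) := by gcongr; linarith
        _ = (N:ℝ) ^ 5 * w ^ 7 := by ring
        _ ≤ (N:ℝ) ^ 5 * w ^ 10 := by gcongr; linarith; norm_num
    have a1 : 10000 * L ≤ w := by nlinarith
    have a2 : (N * w) * (10000 * L) ≤ (N * w) * w := by gcongr
    have a3 : (Cm:ℝ) * L ≤ (2 * N * w) * L := by gcongr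
    have a4 : (N:ℝ) * L ≤ (N * w) * L := by
      gcongr; nlinarith
    have a5 : 1000 ≤ N * L := by nlinarith
    push_cast
    nlinarith
  set PP := (Q + N) ^ (6 * N) * (4 * (1 + 3 * Cm * (Q + N) ^ 3) / (1 / (2 * (Cm:ℝ)))) ^ (4 * N) with hPP
  have hPP1 : PP ≤ (N:ℝ) ^ (12 * N) * (N:ℝ) ^ (48 * N) := by
    rw [hPP]; gcongr
  have hPP0 : 0 ≤ PP := by positivity
  rw [mul_assoc, ← hPP, add_mul]
  have r1 : l1 A * (Real.exp 57 * (Q + 18 * Cm) ^ N * Q ^ N * Q ^ N * 9 ^ (12 * N)) / 2 ^ Cm * PP ≤ 1 / 4 := by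
    rw [div_mul_eq_mul_div, div_le_iff₀ (by positivity)]
    calc _ ≤ (N:ℝ) ^ (281 * N) * ((N:ℝ) ^ (12 * N) * (N:ℝ) ^ (48 * N)) := by gcongr
      _ ≤ 2 ^ Cm / 4 := by rw [← mul_assoc]; exact q1
      _ = _ := by ring
  have r2 : Real.exp (-(M / Z ^ 2)) * (l1 A * (c0 * (2 * Z ^ 2) ^ 7) ^ (4 * N)) * (8 * Z ^ 2) ^ Cm * PP ≤ 1 / 4 := by
    calc _ ≤ Real.exp (-(M / Z ^ 2)) * (N:ℝ) ^ (585 * N) * (N:ℝ) ^ (11 * Cm) * ((N:ℝ) ^ (12 * N) * (N:ℝ) ^ (48 * N)) := by gcongr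
      _ ≤ 1 / 4 := by rw [← mul_assoc]; exact q2
  linarith

end mult
end Nes

open Complex
namespace Nes

section final
open UpperHalfPlane ModularForm MatrixGroups
variable {C : ℝ} {N : ℕ} {w L : ℝ}

set_option maxHeartbeats 1600000 in
/-- The lower bound for a derivative. -/
theorem fin_lower (H : Big C N w L) (ρ la : ℝ) (hla : 0 < la) (hρ : ρ = Real.exp (-la))
    (hC1 : 1000 / la ≤ C) (hC2 : 4 / (1 - ρ ^ 2) ≤ C) (hC3 : 1 / (1 - ρ) ≤ C)
    (A : MvPolynomial (Fin 4) ℤ) (hD : A.totalDegree ≤ 4 * N) (hl : l1 A ≤ (N:ℝ) ^ (273 * N))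
    (q : ℂ) (hq : ‖q‖ = ρ ^ 2) (M : ℕ) (hM1 : (N:ℝ) ^ 4 / 2 ≤ M) (hM2 : (M:ℝ) ≤ N ^ 5 * w ^ 10)
    (hM : ∀ n < M, PowerSeries.coeff n (FS A) = 0) (hM' : PowerSeries.coeff M (FS A) ≠ 0)
    (T0 : ℕ) (t1 : N * w ≤ T0) (t2 : (T0:ℝ) ≤ 2 * N * w) :
    ∃ T < T0, Real.exp (-(3 * la * M)) ≤ ‖MvPolynomial.aeval (pt q) (dit T A)‖ := by
  have hN1 := H.N1
  have hL0 := H.L0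
  have hwL := H.wL
  have hw0 := H.w0
  have hC := H.hC
  have hCN := H.hN
  have e12 : (10:ℝ) ^ 12 = 1000000000000 := by norm_num
  rw [e12] at hN1 hw0 hC
  have hN0 : (0:ℝ) ≤ N := by linarith
  have hw00 : (0:ℝ) ≤ w := by linarith
  have hw2 : w ^ 2 ≤ N := H.pw 2 (by norm_num)
  have hw10 : w ^ 10 ≤ N := H.pw 10 (by norm_num)
  have hρ0 : 0 < ρ := by rw [hρ]; exact Real.exp_pos _
  have hρ1 : ρ < 1 := by rw [hρ, ← Real.exp_zero]; exact Real.exp_lt_exp.2 (by linarith)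
  have hρ2 : 0 < 1 - ρ ^ 2 := by nlinarith
  have h1ρ : 0 < 1 - ρ := by linarith
  have hc0 : (c0:ℝ) ≤ N := by refine le_trans ?_ hN1; rw [c0]; norm_num
  have hc00 : (0:ℝ) ≤ c0 := by rw [c0]; norm_num
  have hl0 := l1_nonneg A
  have hNn : 1 ≤ N := by
    have : (1:ℝ) ≤ N := by linarith
    exact_mod_cast this
  have hM6 : (M:ℝ) ≤ (N:ℝ) ^ 6 := by
    calc (M:ℝ) ≤ N ^ 5 * w ^ 10 := hM2
      _ ≤ (N:ℝ) ^ 5 * N := by gcongr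
      _ = (N:ℝ) ^ 6 := by ring
  have hNM : (N:ℝ) ≤ M := by
    refine le_trans ?_ hM1
    have : (2:ℝ) ≤ (N:ℝ) ^ 3 := le_trans (by linarith) (le_self_pow₀ (by linarith : (1:ℝ) ≤ N) (by norm_num : 3 ≠ 0))
    have e4 : (N:ℝ) ^ 4 = N * (N:ℝ) ^ 3 := by ring
    rw [e4]; nlinarith
  have hT2 : (T0:ℝ) ≤ (N:ℝ) ^ 2 := by
    refine t2.trans ?_
    have : 2 * w ≤ N := le_trans (by rw [sq]; gcongr; linarith) hw2
    calc 2 * N * w = N * (2 * w) := by ring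
      _ ≤ N * N := by gcongr
      _ = (N:ℝ) ^ 2 := by ring
  have hT1 : 1 ≤ T0 := by
    have : (1:ℝ) ≤ T0 := by nlinarith
    exact_mod_cast this
  have hlaw : 1000 * L ≤ la * w := by
    rw [div_le_iff₀ hla] at hC1
    calc 1000 * L ≤ (C * la) * L := by gcongr
      _ = la * (C * L) := by ring
      _ ≤ la * w := by gcongr
  have hinv : 1 / (N:ℝ) ≤ (1 - ρ ^ 2) / 4 := by
    rw [div_le_iff₀ hρ2] at hC2
    rw [div_le_div_iff₀ (by linarith) (by norm_num)]
    nlinarith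
  set rr : ℝ := 1 - 1 / (2 * (M + 1)) with hrr
  have hMM : (0:ℝ) < 2 * (M + 1) := by linarith
  have hrr1 : rr < 1 := by
    have : 0 < 1 / (2 * ((M:ℝ) + 1)) := by positivity
    linarith
  have hrr0 : ρ ≤ rr := by
    have : 1 / (2 * ((M:ℝ) + 1)) ≤ 1 - ρ := by
      rw [div_le_iff₀ hMM]
      rw [div_le_iff₀ h1ρ] at hC3
      nlinarith
    linarith
  have hrrM : 1 / 2 ≤ rr ^ M := by
    have h1 := one_add_mul_le_pow (a := -(1 / (2 * ((M:ℝ) + 1)))) (by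
      have : 1 / (2 * ((M:ℝ) + 1)) ≤ 1 := by rw [div_le_one hMM]; linarith
      linarith) M
    have e1 : 1 + -(1 / (2 * ((M:ℝ) + 1))) = rr := by rw [hrr]; ring
    rw [e1] at h1
    refine le_trans ?_ h1
    have : (M:ℝ) * (1 / (2 * ((M:ℝ) + 1))) ≤ 1 / 2 := by
      rw [mul_one_div, div_le_div_iff₀ hMM (by norm_num)]; linarith
    linarith
  have hb := wt_FS A (4 * N) hD (hρ0.le.trans hrr0) hrr1
  set b := l1 A * (c0 / (1 - rr) ^ 7) ^ (4 * N) with hbdef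
  have hbN : b ≤ (N:ℝ) ^ (473 * N) := by
    have e1 : c0 / (1 - rr) ^ 7 = c0 * (2 * ((M:ℝ) + 1)) ^ 7 := by
      rw [hrr, sub_sub_cancel, div_pow, one_pow, div_div_eq_mul_div, div_one]
    have h7 : 2 * ((M:ℝ) + 1) ≤ (N:ℝ) ^ 7 := by
      have : 1 ≤ (N:ℝ) ^ 6 := one_le_pow₀ (by linarith)
      calc 2 * ((M:ℝ) + 1) ≤ 2 * ((N:ℝ) ^ 6 + (N:ℝ) ^ 6) := by gcongr
        _ = 4 * (N:ℝ) ^ 6 := by ring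
        _ ≤ N * (N:ℝ) ^ 6 := by gcongr; linarith
        _ = (N:ℝ) ^ 7 := by ring
    rw [hbdef, e1]
    calc _ ≤ (N:ℝ) ^ (273 * N) * (N * ((N:ℝ) ^ 7) ^ 7) ^ (4 * N) := by gcongr
      _ = (N:ℝ) ^ (273 * N) * ((N:ℝ) ^ 50) ^ (4 * N) := by congr 2; ring
      _ = (N:ℝ) ^ (473 * N) := by rw [← pow_mul, ← pow_add]; congr 1; ring
  have hb0 : 0 ≤ b := by
    have : 0 < 1 - rr := by linarith
    positivity
  have main : ρ ^ T0 * (b / rr ^ M) ≤ (1 - ρ ^ 2) / 2 := by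
    have h1 : b / rr ^ M ≤ N * (N:ℝ) ^ (473 * N) := by
      rw [div_le_iff₀ (by linarith)]
      have : b ≤ (N * (N:ℝ) ^ (473 * N)) * (1 / 2) := by
        calc b ≤ 1 * (N:ℝ) ^ (473 * N) := by linarith
          _ ≤ (N * (1 / 2)) * (N:ℝ) ^ (473 * N) := by gcongr; linarith
          _ = _ := by ring
      refine this.trans ?_
      gcongr
    calc ρ ^ T0 * (b / rr ^ M) ≤ ρ ^ T0 * (N * (N:ℝ) ^ (473 * N)) := by gcongr
      _ ≤ 1 / N := by
        rw [le_div_iff₀ (by linarith)]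
        have e1 : (N:ℝ) * (N:ℝ) ^ (473 * N) = (N:ℝ) ^ (473 * N + 1) := by ring
        rw [mul_assoc, e1, ← pow_succ, H.nexp, hρ, ← Real.exp_nat_mul, ← Real.exp_add, Real.exp_le_one_iff]
        push_cast
        have s1 : N * (1000 * L) ≤ la * T0 := by
          calc N * (1000 * L) ≤ N * (la * w) := by gcongr
            _ = la * (N * w) := by ring
            _ ≤ la * T0 := by gcongr
        have s2 : 2 * L ≤ N * L := by gcongr; linarith
        have s3 : 0 ≤ (N:ℝ) * L := by positivity
        linarith
      _ ≤ (1 - ρ ^ 2) / 2 := by linarith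
  obtain ⟨T, hT, hlow⟩ := deriv_lower A q ρ hρ0 hρ1 hq M hM hM' T0 hT1 rr hrr0 hrr1 b hb main
  refine ⟨T, hT, le_trans ?_ hlow⟩
  have h8 : 2 * ((M:ℝ) + T0 + 1) ≤ (N:ℝ) ^ 7 := by
    have : 1 ≤ (N:ℝ) ^ 6 := one_le_pow₀ (by linarith)
    have h26 : (N:ℝ) ^ 2 ≤ (N:ℝ) ^ 6 := pow_le_pow_right₀ (by linarith) (by norm_num)
    calc 2 * ((M:ℝ) + T0 + 1) ≤ 2 * ((N:ℝ) ^ 6 + (N:ℝ) ^ 6 + (N:ℝ) ^ 6) := by gcongr; linarith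
      _ = 6 * (N:ℝ) ^ 6 := by ring
      _ ≤ N * (N:ℝ) ^ 6 := by gcongr; linarith
      _ = (N:ℝ) ^ 7 := by ring
  rw [le_div_iff₀ (by positivity)]
  calc Real.exp (-(3 * la * M)) * (2 * ((M:ℝ) + T0 + 1)) ^ T0 ≤ Real.exp (-(3 * la * M)) * ((N:ℝ) ^ 7) ^ T0 := by gcongr
    _ ≤ 1 / N * ρ ^ (2 * M) := by
      rw [← pow_mul, H.nexp, hρ, ← Real.exp_nat_mul, ← H.hL, one_div, ← Real.exp_neg, ← Real.exp_add, ← Real.exp_add, Real.exp_le_exp]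
      push_cast
      have u1 : (T0:ℝ) * L ≤ N * (N:ℝ) := by
        calc (T0:ℝ) * L ≤ 2 * N * w * L := by gcongr
          _ = N * (2 * L * w) := by ring
          _ ≤ N * (w * w) := by
            have : 2 * L ≤ w := le_trans (by gcongr; linarith) hwL
            gcongr
          _ ≤ N * (N:ℝ) := by gcongr; linarith
      have u2 : L ≤ (N:ℝ) * N := by
        have : L ≤ w := le_trans (le_mul_of_one_le_left (by linarith) (by linarith)) hwL
        nlinarith
      have u3 : 8 * ((N:ℝ) * N) ≤ la * M := by
        have v1 : 1000 ≤ la * N := by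
          rw [div_le_iff₀ hla] at hC1
          nlinarith
        have v2 : (N:ℝ) * N ≤ (N:ℝ) ^ 3 := by
          have : (N:ℝ) ^ 3 = N * (N * N) := by ring
          rw [this]; exact le_mul_of_one_le_left (by positivity) (by linarith)
        have v3 : 0 ≤ (N:ℝ) * N := by positivity
        calc 8 * ((N:ℝ) * N) ≤ 1000 * ((N:ℝ) ^ 3 / 2) := by linarith
          _ ≤ (la * N) * ((N:ℝ) ^ 3 / 2) := by gcongr
          _ = la * ((N:ℝ) ^ 4 / 2) := by ring
          _ ≤ la * M := by gcongr
      linarith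
    _ ≤ (1 - ρ ^ 2) / 4 * ρ ^ (2 * M) := by gcongr

set_option maxHeartbeats 1600000 in
/-- The upper bound for a derivative. -/
theorem fin_upper (H : Big C N w L) (ρ la : ℝ) (hla : 0 < la) (hρ : ρ = Real.exp (-la))
    (hC1 : 1000 / la ≤ C) (hC2 : c0 / (1 - ρ) ^ 7 ≤ C)
    (A : MvPolynomial (Fin 4) ℤ) (hD : A.totalDegree ≤ 4 * N) (hl : l1 A ≤ (N:ℝ) ^ (273 * N))
    (q : ℂ) (hq : ‖q‖ = ρ ^ 2) (M : ℕ) (hM1 : (N:ℝ) ^ 4 / 2 ≤ M)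
    (hM : ∀ n < M, PowerSeries.coeff n (FS A) = 0)
    (T : ℕ) (t2 : (T:ℝ) ≤ 2 * N * w) :
    ‖MvPolynomial.aeval (pt q) (dit T A)‖ ≤ Real.exp (-(la * M / 4)) := by
  have hN1 := H.N1
  have hL0 := H.L0
  have hwL := H.wL
  have hw0 := H.w0
  have hC := H.hC
  have hCN := H.hN
  have e12 : (10:ℝ) ^ 12 = 1000000000000 := by norm_num
  rw [e12] at hN1 hw0 hC
  have hN0 : (0:ℝ) ≤ N := by linarith
  have hw00 : (0:ℝ) ≤ w := by linarith
  have hw2 : w ^ 2 ≤ N := H.pw 2 (by norm_num)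
  have hρ0 : 0 < ρ := by rw [hρ]; exact Real.exp_pos _
  have hρ1 : ρ < 1 := by rw [hρ, ← Real.exp_zero]; exact Real.exp_lt_exp.2 (by linarith)
  have h1ρ : 0 < 1 - ρ := by linarith
  have hc00 : (0:ℝ) ≤ c0 := by rw [c0]; norm_num
  have hl0 := l1_nonneg A
  rw [div_le_iff₀ hla] at hC1
  have v1 : 1000 ≤ la * N := by nlinarith
  have v1w : 1000 ≤ la * w := by nlinarith [H.w1]
  have hb := wt_FS A (4 * N) hD hρ0.le hρ1
  have hκ : ∀ n : ℕ, M ≤ n → (n:ℝ) ^ T * ρ ^ n ≤ Real.exp (-(la * M / 2)) := by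
    intro n hn
    have hn' : (M:ℝ) ≤ n := by exact_mod_cast hn
    have hn4 : (N:ℝ) ^ 4 / 4 ≤ n := by
      have : 0 ≤ (N:ℝ) ^ 4 := by positivity
      linarith
    have hn0 : (0:ℝ) < n := by
      refine lt_of_lt_of_le ?_ hn4
      have : (0:ℝ) < N := by linarith
      positivity
    set r := Real.sqrt n with hr
    have hr2 : r ^ 2 = n := Real.sq_sqrt hn0.le
    have hr0 : 0 < r := Real.sqrt_pos.2 hn0
    have hrN : (N:ℝ) ^ 2 / 2 ≤ r := by
      apply Real.le_sqrt_of_sq_le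
      refine le_trans (le_of_eq ?_) hn4
      ring
    have hlog : Real.log n ≤ 2 * r := by
      rw [← hr2, Real.log_pow]
      have := Real.log_le_sub_one_of_pos hr0
      push_cast; linarith
    have hTr : (T:ℝ) * Real.log n ≤ la * n / 2 := by
      calc (T:ℝ) * Real.log n ≤ (2 * N * w) * (2 * r) := by
            apply mul_le_mul t2 hlog _ (by positivity)
            apply Real.log_nonneg
            refine le_trans ?_ hn4
            have : (1:ℝ) ≤ (N:ℝ) ^ 3 := one_le_pow₀ (by linarith)
            have e4 : (N:ℝ) ^ 4 = N * (N:ℝ) ^ 3 := by ring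
            rw [e4]; nlinarith
        _ = (16 * w) * (N * r / 4) := by ring
        _ ≤ (la * w * w) * (N * r / 4) := by gcongr; nlinarith
        _ ≤ (la * N) * (N * r / 4) := by
            have : la * w * w ≤ la * N := by
              rw [mul_assoc, ← sq]; gcongr
            gcongr
        _ = la * ((N:ℝ) ^ 2 / 2 * r) / 2 := by ring
        _ ≤ la * (r * r) / 2 := by gcongr
        _ = la * n / 2 := by rw [← sq, hr2]
    rw [← Real.exp_log hn0, ← Real.exp_nat_mul, hρ, ← Real.exp_nat_mul, ← Real.exp_add, Real.exp_le_exp]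
    have : la * M ≤ la * n := by gcongr
    linarith
  have hup := deriv_upper A q ρ hρ0 hρ1 hq M hM T _ hκ _ hb
  refine hup.trans ?_
  calc (12:ℝ) ^ T * (Real.exp (-(la * M / 2)) * (l1 A * (c0 / (1 - ρ) ^ 7) ^ (4 * N)))
      ≤ (N:ℝ) ^ T * (Real.exp (-(la * M / 2)) * ((N:ℝ) ^ (273 * N) * (N:ℝ) ^ (4 * N))) := by
        have h12 : (12:ℝ) ≤ N := by linarith
        have hcc : c0 / (1 - ρ) ^ 7 ≤ N := hC2.trans hCN
        gcongr
    _ ≤ Real.exp (-(la * M / 4)) := by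
      rw [← pow_add, H.nexp, H.nexp, ← Real.exp_add, ← Real.exp_add, Real.exp_le_exp]
      push_cast
      have u1 : (T:ℝ) * L ≤ N * (N:ℝ) := by
        calc (T:ℝ) * L ≤ 2 * N * w * L := by gcongr
          _ = N * (2 * L * w) := by ring
          _ ≤ N * (w * w) := by
            have : 2 * L ≤ w := le_trans (by gcongr; linarith) hwL
            gcongr
          _ ≤ N * (N:ℝ) := by gcongr; linarith
      have u2 : (N:ℝ) * L ≤ (N:ℝ) * N := by
        have : L ≤ w := le_trans (le_mul_of_one_le_left (by linarith) (by linarith)) hwL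
        gcongr
        nlinarith
      have v3 : 0 ≤ (N:ℝ) * N := by positivity
      have u3 : 2000 * ((N:ℝ) * N) ≤ la * M := by
        have v2 : 1000 * ((N:ℝ) * N) ≤ (N:ℝ) ^ 3 := by
          have : (N:ℝ) ^ 3 = N * (N * N) := by ring
          rw [this]; gcongr; linarith
        calc 2000 * ((N:ℝ) * N) ≤ 1000 * ((N:ℝ) ^ 3 / 2) := by linarith
          _ ≤ (la * N) * ((N:ℝ) ^ 3 / 2) := by gcongr
          _ = la * ((N:ℝ) ^ 4 / 2) := by ring
          _ ≤ la * M := by gcongr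
      linarith

end final
end Nes

open Complex
namespace Nes

section hyp
open UpperHalfPlane ModularForm MatrixGroups

theorem tot_le {N : ℕ} {A : MvPolynomial (Fin 4) ℤ} (hA : ∀ i, A.degreeOf i ≤ N) : A.totalDegree ≤ 4 * N :=
  Finset.sup_le fun m hm => calc
    _ = ∑ i, m i := by rw [Finsupp.sum_fintype]; intro i; rfl
    _ ≤ ∑ i : Fin 4, N := Finset.sum_le_sum fun i _ => (MvPolynomial.monomial_le_degreeOf i hm).trans (hA i)
    _ = 4 * N := by simp

theorem dit_bound {C : ℝ} {N : ℕ} {w L : ℝ} (H : Big C N w L) (A : MvPolynomial (Fin 4) ℤ)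
    (hD : A.totalDegree ≤ 4 * N) (hl : l1 A ≤ (N:ℝ) ^ (273 * N)) (T : ℕ) (t2 : (T:ℝ) ≤ 2 * N * w)
    (s : ℕ) (hs : N * w ^ 2 ≤ s) : (dit T A).totalDegree ≤ s ∧ l1 (dit T A) ≤ Real.exp s := by
  have hN1 := H.N1
  have hL0 := H.L0
  have hwL := H.wL
  have hw0 := H.w0
  have hC := H.hC
  have e12 : (10:ℝ) ^ 12 = 1000000000000 := by norm_num
  rw [e12] at hN1 hw0 hC
  have hN0 : (0:ℝ) ≤ N := by linarith
  have hw00 : (0:ℝ) ≤ w := by linarith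
  have hw2 : w ^ 2 ≤ N := H.pw 2 (by norm_num)
  have hww : 1000 * w ≤ w ^ 2 := by rw [sq]; gcongr; linarith
  have hww' : 1000 * (N * w) ≤ N * w ^ 2 := by
    calc 1000 * (N * w) = N * (1000 * w) := by ring
      _ ≤ _ := by gcongr
  have hNw : (N:ℝ) ≤ N * w := le_mul_of_one_le_right hN0 (by linarith)
  have hdeg : ((4 * N + T : ℕ) : ℝ) ≤ N * w ^ 2 := by
    push_cast
    linarith
  constructor
  · refine (deg_dit T A).trans ((Nat.add_le_add_right hD T).trans ?_)
    exact_mod_cast hdeg.trans hs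
  · refine (l1_dit T A (4 * N + T) (Nat.add_le_add_right hD T)).trans ?_
    have h12 : 12 * ((4 * N + T : ℕ) : ℝ) ≤ (N:ℝ) ^ 3 := by
      calc 12 * ((4 * N + T : ℕ) : ℝ) ≤ N * (N * N) := by gcongr; linarith; exact hdeg.trans (by gcongr)
        _ = (N:ℝ) ^ 3 := by ring
    calc (12 * ((4 * N + T : ℕ) : ℝ)) ^ T * l1 A ≤ ((N:ℝ) ^ 3) ^ T * (N:ℝ) ^ (273 * N) := by
          have := l1_nonneg A
          gcongr
      _ ≤ Real.exp s := by
        rw [← pow_mul, ← pow_add, H.nexp, Real.exp_le_exp]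
        push_cast
        have a1 : 1000 * L ≤ w := le_trans (by gcongr; linarith) hwL
        have a2 : (T:ℝ) * L ≤ 2 * N * w * L := by gcongr
        have a3 : (N:ℝ) * L ≤ N * w * L := by gcongr
        have a4 : N * w * (1000 * L) ≤ N * w * w := by gcongr
        have a5 : N * w * w = N * w ^ 2 := by ring
        linarith

theorem hyp_pt (q : ℂ) (hq0 : q ≠ 0) (hq1 : ‖q‖ < 1) : Hyp (pt q) := by
  obtain ⟨Q, hQ1, hQ⟩ := exists_y
  set ρ := Real.sqrt ‖q‖ with hρ
  have hqpos : 0 < ‖q‖ := norm_pos_iff.2 hq0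
  have hρ0 : 0 < ρ := Real.sqrt_pos.2 hqpos
  have hqρ : ‖q‖ = ρ ^ 2 := (Real.sq_sqrt hqpos.le).symm
  have hρ1 : ρ < 1 := by
    rw [hρ, Real.sqrt_lt' one_pos]; linarith
  set la := -Real.log ρ with hla
  have hla0 : 0 < la := by
    have := Real.log_neg hρ0 hρ1
    linarith
  have hρe : ρ = Real.exp (-la) := by rw [hla, neg_neg, Real.exp_log hρ0]
  set C : ℝ := (10:ℝ) ^ 12 + Real.exp 57 + Q + 1000 / la + 4 / (1 - ρ ^ 2) + 1 / (1 - ρ) + c0 / (1 - ρ) ^ 7 + la with hC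
  have z1 : 0 < Real.exp 57 := Real.exp_pos _
  have z2 : 0 < 1000 / la := by positivity
  have z3 : 0 < 4 / (1 - ρ ^ 2) := by
    have : 0 < 1 - ρ ^ 2 := by rw [← hqρ]; linarith
    positivity
  have h1ρ : 0 < 1 - ρ := by linarith
  have z4 : 0 < 1 / (1 - ρ) := by positivity
  have hc00 : (0:ℝ) ≤ c0 := by rw [c0]; norm_num
  have z5 : 0 ≤ c0 / (1 - ρ) ^ 7 := by positivity
  have z6 : (0:ℝ) < 10 ^ 12 := by positivity
  obtain ⟨N0, hN0, hbig⟩ := exists_big C (by linarith)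
  refine ⟨12, by norm_num, N0, hN0, fun N hN => ?_⟩
  obtain ⟨w, L, H⟩ := hbig N hN
  have hN1 : 1 ≤ N := hN0.trans hN
  obtain ⟨A, hA0, hA, hAk, hAl⟩ := siegel N hN1
  have hl := siegel_bound H hAl
  have hD := tot_le hA
  obtain ⟨n, hn, hn'⟩ := mult_bound H (by linarith) Q (by linarith) hQ1 hQ A hA hA0 hl
  classical
  have hex : ∃ n, PowerSeries.coeff n (FS A) ≠ 0 := ⟨n, hn'⟩
  set M := Nat.find hex with hMdef
  have hM' : PowerSeries.coeff M (FS A) ≠ 0 := Nat.find_spec hex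
  have hM : ∀ m < M, PowerSeries.coeff m (FS A) = 0 := fun m hm => by
    by_contra hne
    exact Nat.find_min hex hm hne
  have hM2 : (M:ℝ) ≤ N ^ 5 * w ^ 10 := by
    have : M ≤ n := Nat.find_min' hex hn'
    have : (M:ℝ) ≤ n := by exact_mod_cast this
    linarith
  have hM1 : (N:ℝ) ^ 4 / 2 ≤ M := by
    have h1 : (N + 1) ^ 4 / 2 ≤ M := by
      by_contra hlt
      exact hM' (hAk M (not_le.1 hlt))
    have h2 : N ^ 4 + 1 ≤ (N + 1) ^ 4 := by
      have : (N + 1) ^ 4 = N ^ 4 + 1 + (4 * N ^ 3 + 6 * N ^ 2 + 4 * N) := by ring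
      omega
    have h3 : N ^ 4 ≤ 2 * M := by omega
    have h4 : (N:ℝ) ^ 4 ≤ 2 * M := by exact_mod_cast h3
    linarith
  have hNb := H.N1
  have hw0 := H.w0
  have hL0 := H.L0
  have hlw := H.hlw
  have e12 : (10:ℝ) ^ 12 = 1000000000000 := by norm_num
  rw [e12] at hNb hw0
  have hw1 := H.w1
  have hNpos : (0:ℝ) < N := by linarith
  have hwpos : (0:ℝ) < w := by linarith
  have hlN : Real.log N = L := by rw [← H.hL, Real.log_exp]
  set T0 := ⌈(N:ℝ) * w⌉₊ with hT0
  have t1 : N * w ≤ T0 := Nat.le_ceil _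
  have hNw : 1 ≤ (N:ℝ) * w := one_le_mul_of_one_le_of_one_le (by linarith) (by linarith)
  have t2 : (T0:ℝ) ≤ 2 * N * w := by
    have := Nat.ceil_lt_add_one (a := (N:ℝ) * w) (by positivity)
    linarith
  obtain ⟨T, hT, hlow⟩ := fin_lower H ρ la hla0 hρe (by linarith) (by linarith) (by linarith) A hD hl q hqρ M hM1 hM2 hM hM' T0 t1 t2
  have hTR : (T:ℝ) ≤ 2 * N * w := le_trans (by exact_mod_cast hT.le) t2
  have hup := fin_upper H ρ la hla0 hρe (by linarith) (by linarith) A hD hl q hqρ M hM1 hM T hTR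
  set s := ⌈(N:ℝ) * w ^ 2⌉₊ with hs
  have hNw2 : 1 ≤ (N:ℝ) * w ^ 2 := one_le_mul_of_one_le_of_one_le (by linarith) (one_le_pow₀ (by linarith))
  have s1 : N * w ^ 2 ≤ s := Nat.le_ceil _
  have s2 : (s:ℝ) ≤ N * w ^ 3 := by
    have := Nat.ceil_lt_add_one (a := (N:ℝ) * w ^ 2) (by positivity)
    calc (s:ℝ) ≤ 2 * (N * w ^ 2) := by linarith
      _ ≤ w * (N * w ^ 2) := by gcongr; linarith
      _ = N * w ^ 3 := by ring
  obtain ⟨b1, b2⟩ := dit_bound H A hD hl T hTR s s1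
  have hspos : (0:ℝ) < s := by linarith
  have hMpos : (0:ℝ) < M := lt_of_lt_of_le (by positivity) hM1
  refine ⟨dit T A, s, la * M / 4, by exact_mod_cast hspos, by positivity, b1, b2, ?_, hup, ?_, ?_, ?_⟩
  · refine le_trans (le_of_eq ?_) hlow
    congr 1; ring
  · rw [hlN]
    calc Real.log s ≤ Real.log (N * w ^ 3) := Real.log_le_log hspos s2
      _ = L + 3 * (0.0005 * L) := by
        rw [Real.log_mul hNpos.ne' (by positivity), Real.log_pow, hlN, hlw]; push_cast; ring
      _ ≤ 1.01 * L := by linarith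
  · rw [hlN]
    have hlaw : 1000 ≤ la * w := by
      have : 1000 / la ≤ w := by linarith
      rw [div_le_iff₀ hla0] at this; linarith
    have h1 : (N:ℝ) ^ 4 ≤ w * (la * M / 4) := by
      calc (N:ℝ) ^ 4 ≤ 1000 * ((N:ℝ) ^ 4 / 2 / 4) := by
            have : 0 ≤ (N:ℝ) ^ 4 := by positivity
            linarith
        _ ≤ (la * w) * (M / 4) := by gcongr
        _ = w * (la * M / 4) := by ring
    have h2 := Real.log_le_log (by positivity) h1
    rw [Real.log_mul hwpos.ne' (by positivity), Real.log_pow, hlN, hlw] at h2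
    push_cast at h2
    linarith
  · rw [hlN]
    have h1 : la * M / 4 ≤ (N:ℝ) ^ 5 * w ^ 11 := by
      calc la * M / 4 ≤ la * M := by
            have : 0 < la * M := by positivity
            linarith
        _ ≤ w * (N ^ 5 * w ^ 10) := by gcongr; linarith
        _ = (N:ℝ) ^ 5 * w ^ 11 := by ring
    have h2 := Real.log_le_log (by positivity) h1
    rw [Real.log_mul (by positivity) (by positivity), Real.log_pow, Real.log_pow, hlN, hlw] at h2
    push_cast at h2
    linarith

theorem main_pt (q : ℂ) (hq0 : q ≠ 0) (hq1 : ‖q‖ < 1) :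
    ∃ s : Finset (Fin 4), s.card = 3 ∧ AlgebraicIndependent ℚ (fun i : s => pt q i) := by
  have hG : Good (pt q) (1 + ∑ k, ‖pt q k‖ + 2 ^ Fintype.card (Option (Fin 4)) + 3) := by
    have h1 : 0 ≤ ∑ k, ‖pt q k‖ := Finset.sum_nonneg fun _ _ => norm_nonneg _
    have h2 : (0:ℝ) ≤ 2 ^ Fintype.card (Option (Fin 4)) := by positivity
    exact ⟨by linarith, by linarith, by linarith⟩
  exact exists_indep _ (criterion hG (hyp_pt q hq0 hq1))

end hyp
end Nes

/-- **Nesterenko's theorem.** For every complex `z` with `Im z > 0`, at least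
three of the four numbers `e^{2πiz}, E₂(z), E₄(z), E₆(z)` are algebraically
independent over `ℚ`. -/
theorem stmt_12 (z : ℂ) (hz : 0 < z.im) :
    ∃ s : Finset (Fin 4), s.card = 3 ∧
      AlgebraicIndependent ℚ
        (fun i : s => ![Complex.exp (2 * Real.pi * I * z), eisE2 z, eisE4 z, eisE6 z] i) := by
  have hq : ‖Complex.exp (2 * Real.pi * I * z)‖ < 1 := Nes.norm_qq_lt hz
  have h := Nes.main_pt _ (Complex.exp_ne_zero (2 * Real.pi * I * z)) hq
  have e : Nes.pt (Complex.exp (2 * Real.pi * I * z)) =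
      ![Complex.exp (2 * Real.pi * I * z), eisE2 z, eisE4 z, eisE6 z] := by
    funext i
    fin_cases i
    · exact Nes.pt_zero _
    · exact Nes.pt_one hq
    · exact Nes.pt_two hq
    · exact Nes.pt_three hq
  rw [e] at h
  exact h
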